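/- Let G be a connected reductive algebraic group over an algebraically closed field, and let P, Q be parabolic subgroups of G. Then P^Q := (P ∩ Q)·U_P is a parabolic subgroup of G, and its unipotent radical is U_{P^Q} = U_P·(P ∩ U_Q), where U_H denotes the unipotent radical of an algebraic group H. -/

import Mathlib

/-!
Statement 17 (Lusztig 1.1): if `P, Q` are parabolic subgroups of a connected
reductive algebraic group `G` over an algebraically closed field, then
`P^Q := (P ∩ Q) · U_P` is a parabolic subgroup of `G` and its unipotent
radical is `U_{P^Q} = U_P · (P ∩ U_Q)`.

We realize linear algebraic groups as Zariski-closed subgroups of `GL_n(k)`.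
-/

namespace Stmt17

open scoped Pointwise

open Matrix

variable {k : Type} [Field k] [IsAlgClosed k] {n : ℕ}

abbrev GLn (n : ℕ) (k : Type) [Field k] := Matrix.GeneralLinearGroup (Fin n) k

/-- The regular functions on `GL_n`: polynomials in the matrix entries of `g`
(variables with last component `true`) and of `g⁻¹` (last component `false`). -/
noncomputable def evalAt (g : GLn n k) :
    MvPolynomial (Fin n × Fin n × Bool) k → k :=
  MvPolynomial.eval fun i =>
    if i.2.2 then (g : Matrix (Fin n) (Fin n) k) i.1 i.2.1
    else ((g⁻¹ : GLn n k) : Matrix (Fin n) (Fin n) k) i.1 i.2.1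

/-- Zariski-closed subsets of `GL_n(k)`. -/
def ZClosed (Z : Set (GLn n k)) : Prop :=
  ∃ S : Set (MvPolynomial (Fin n × Fin n × Bool) k),
    Z = {g | ∀ p ∈ S, evalAt g p = 0}

/-- Irreducibility for the Zariski topology (for an algebraic group this is
the same as connectedness of the identity component being everything). -/
def ZConnected (Z : Set (GLn n k)) : Prop :=
  Z.Nonempty ∧ ∀ C₁ C₂ : Set (GLn n k), ZClosed C₁ → ZClosed C₂ →
    Z ⊆ C₁ ∪ C₂ → Z ⊆ C₁ ∨ Z ⊆ C₂

/-- A unipotent element of `GL_n(k)`. -/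
def IsUnip (g : GLn n k) : Prop :=
  IsNilpotent ((g : Matrix (Fin n) (Fin n) k) - 1)

/-- A (Zariski-closed) algebraic subgroup. -/
def IsAlgSubgroup (H : Subgroup (GLn n k)) : Prop := ZClosed (H : Set (GLn n k))

/-- `B` is a Borel subgroup of `G`: a maximal closed connected solvable
subgroup of `G`. -/
def IsBorel (G B : Subgroup (GLn n k)) : Prop :=
  B ≤ G ∧ IsAlgSubgroup B ∧ ZConnected (B : Set (GLn n k)) ∧ IsSolvable B ∧
    ∀ B' : Subgroup (GLn n k), B' ≤ G → IsAlgSubgroup B' →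
      ZConnected (B' : Set (GLn n k)) → IsSolvable B' → B ≤ B' → B' = B

/-- `P` is a parabolic subgroup of `G`: a closed subgroup containing a Borel
subgroup of `G`. -/
def IsParabolic (G P : Subgroup (GLn n k)) : Prop :=
  P ≤ G ∧ IsAlgSubgroup P ∧ ∃ B : Subgroup (GLn n k), IsBorel G B ∧ B ≤ P

/-- `U` is the unipotent radical of `H`: the greatest closed connected normal
subgroup of `H` all of whose elements are unipotent. -/
def IsUnipotentRadical (H U : Subgroup (GLn n k)) : Prop :=
  U ≤ H ∧ IsAlgSubgroup U ∧ ZConnected (U : Set (GLn n k)) ∧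
    (∀ g ∈ U, IsUnip g) ∧
    (∀ h ∈ H, ∀ g ∈ U, h * g * h⁻¹ ∈ U) ∧
    ∀ V : Subgroup (GLn n k), V ≤ H → IsAlgSubgroup V →
      ZConnected (V : Set (GLn n k)) → (∀ g ∈ V, IsUnip g) →
      (∀ h ∈ H, ∀ g ∈ V, h * g * h⁻¹ ∈ V) → V ≤ U

/-- `G` is connected reductive: closed, connected, and its unipotent radical
is trivial. -/
def IsConnectedReductive (G : Subgroup (GLn n k)) : Prop :=
  IsAlgSubgroup G ∧ ZConnected (G : Set (GLn n k)) ∧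
    ∀ U : Subgroup (GLn n k), IsUnipotentRadical G U → U = ⊥

end Stmt17

namespace Stmt17

open scoped Pointwise
open Topology
set_option linter.unusedSectionVars false
set_option linter.style.haveILetI false
variable {k : Type} [Field k] [IsAlgClosed k] {n : ℕ}

/-! ### Affine algebraic sets, presented by their algebra of regular functions -/

/-- A set with a finitely generated algebra of `k`-valued functions all of whose `k`-points come
from elements of the set. -/
class Aff (k : Type) [Field k] (X : Type) where
  algebra : Subalgebra k (X → k)
  fg : algebra.FG
  exists_point : ∀ φ : algebra →ₐ[k] k, ∃ x, ∀ f : algebra, φ f = f.1 x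
  separated : ∀ x y, (∀ f ∈ algebra, f x = f y) → x = y

/-- The algebra of regular functions. -/
abbrev reg (k : Type) [Field k] (X : Type) [Aff k X] : Subalgebra k (X → k) := Aff.algebra

/-- A character of an algebra of functions is evaluation at a point as soon as it is so on
generators. -/
lemma eq_eval_of_le {X : Type} {A : Subalgebra k (X → k)} {φ : A →ₐ[k] k} {x : X} (h : A ≤
    (AlgHom.equalizer φ ((Pi.evalAlgHom k (fun _ : X => k) x).comp A.val)).map A.val) (f : A) :
    φ f = f.1 x := by
  obtain ⟨g, hg, hgf⟩ := h f.2
  rwa [← (Subtype.ext hgf : g = f)]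

section General
variable {X Y Z : Type} [Aff k X] [Aff k Y] [Aff k Z]

instance : IsNoetherianRing (reg k X) := by
  have : Algebra.FiniteType k (reg k X) :=
    (Subalgebra.fg_iff_finiteType _).1 Aff.fg
  exact Algebra.FiniteType.isNoetherianRing k _

/-- The Zariski topology. -/
@[reducible] def zar (k : Type) [Field k] (X : Type) [Aff k X] : TopologicalSpace X :=
  TopologicalSpace.induced (fun x => (⟨RingHom.ker ((Pi.evalRingHom (fun _ : X => k) x).comp
    (reg k X).val.toRingHom), RingHom.ker_isPrime _⟩ :
      PrimeSpectrum (reg k X))) inferInstance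

/-- Zariski-closed sets. -/
abbrev Clo (k : Type) [Field k] {X : Type} [Aff k X] (C : Set X) : Prop := IsClosed[zar k X] C

/-- Irreducible sets. -/
abbrev Irr (k : Type) [Field k] {X : Type} [Aff k X] (C : Set X) : Prop :=
  @IsIrreducible X (zar k X) C

lemma clo_iff {C : Set X} : Clo k C ↔
    ∃ S : Set (X → k), S ⊆ (reg k X : Set (X → k)) ∧ C = {x | ∀ f ∈ S, f x = 0} := by
  rw [Clo, zar, isClosed_induced_iff]
  constructor
  · rintro ⟨t, ht, rfl⟩
    obtain ⟨s, rfl⟩ := (PrimeSpectrum.isClosed_iff_zeroLocus t).1 ht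
    refine ⟨Subtype.val '' s, by rintro _ ⟨f, _, rfl⟩; exact f.2, ?_⟩
    ext x
    simp only [Set.mem_preimage, PrimeSpectrum.mem_zeroLocus, Set.mem_ofPred_eq,
      Set.forall_mem_image]
    rfl
  · rintro ⟨S, hS, rfl⟩
    refine ⟨PrimeSpectrum.zeroLocus (Subtype.val ⁻¹' S), PrimeSpectrum.isClosed_zeroLocus _, ?_⟩
    ext x
    simp only [Set.mem_preimage, PrimeSpectrum.mem_zeroLocus, Set.mem_ofPred_eq]
    exact ⟨fun h f hf => h (show (⟨f, hS hf⟩ : reg k X) ∈ _ from hf), fun h f hf => h f.1 hf⟩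

lemma clo_zero {f : X → k} (hf : f ∈ reg k X) : Clo k {x | f x = 0} :=
  clo_iff.2 ⟨{f}, by simpa using hf, by simp⟩

lemma mem_closure {C : Set X} {x : X} : x ∈ closure[zar k X] C ↔
    ∀ f ∈ reg k X, (∀ y ∈ C, f y = 0) → f x = 0 := by
  letI := zar k X
  constructor
  · intro h f hf hC
    exact closure_minimal (t := {x | f x = 0}) hC (clo_zero hf) h
  · intro h
    obtain ⟨S, hS, hE⟩ := clo_iff.1 (isClosed_closure (s := C))
    change x ∈ closure C
    rw [hE]
    intro f hf
    refine h f (hS hf) fun y hy => ?_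
    have : y ∈ closure C := subset_closure hy
    rw [hE] at this
    exact this f hf

lemma noeth : @TopologicalSpace.NoetherianSpace X (zar k X) :=
  letI := zar k X
  Topology.IsInducing.noetherianSpace ⟨rfl⟩

lemma irr_iff {C : Set X} : Irr k C ↔ C.Nonempty ∧ ∀ f ∈ reg k X,
    ∀ g ∈ reg k X, (∀ x ∈ C, f x * g x = 0) →
      (∀ x ∈ C, f x = 0) ∨ ∀ x ∈ C, g x = 0 := by
  letI := zar k X
  rw [Irr, _root_.IsIrreducible, isPreirreducible_iff_isClosed_union_isClosed]
  refine and_congr_right fun _ => ⟨fun h f hf g hg hfg => ?_, fun h C₁ C₂ h₁ h₂ hC => ?_⟩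
  · exact h {x | f x = 0} {x | g x = 0} (clo_zero hf) (clo_zero hg)
      fun x hx => mul_eq_zero.1 (hfg x hx)
  · obtain ⟨S, hS, rfl⟩ := clo_iff.1 h₁
    obtain ⟨T, hT, rfl⟩ := clo_iff.1 h₂
    by_contra! hcon
    obtain ⟨⟨x, hx, hx'⟩, y, hy, hy'⟩ := And.intro (Set.not_subset.1 hcon.1)
      (Set.not_subset.1 hcon.2)
    simp only [Set.mem_ofPred_eq, not_forall] at hx' hy'
    obtain ⟨f, hf, hfx⟩ := hx'
    obtain ⟨g, hg, hgy⟩ := hy'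
    rcases h f (hS hf) g (hT hg) fun z hz => by
      rcases hC hz with h | h
      · rw [h f hf, zero_mul]
      · rw [h g hg, mul_zero] with h | h
    · exact hfx (h x hx)
    · exact hgy (h y hy)

/-- Morphisms. -/
def Mor (k : Type) [Field k] {X Y : Type} [Aff k X] [Aff k Y] (φ : X → Y) : Prop :=
  ∀ f ∈ reg k Y, f ∘ φ ∈ reg k X

lemma Mor.comp {ψ : Y → Z} {φ : X → Y} (hψ : Mor k ψ) (hφ : Mor k φ) : Mor k (ψ ∘ φ) :=
  fun f hf => hφ _ (hψ f hf)

lemma Mor.id : Mor k (fun x : X => x) := fun _ hf => hf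

lemma Mor.continuous {φ : X → Y} (hφ : Mor k φ) : @Continuous X Y (zar k X) (zar k Y) φ := by
  letI := zar k X
  letI := zar k Y
  refine continuous_iff_isClosed.2 fun C hC => ?_
  obtain ⟨S, hS, rfl⟩ := clo_iff.1 hC
  refine clo_iff.2 ⟨(fun f => f ∘ φ) '' S, ?_, ?_⟩
  · rintro _ ⟨f, hf, rfl⟩
    exact hφ f (hS hf)
  · ext x; simp

lemma Irr.image {φ : X → Y} (hφ : Mor k φ) {C : Set X} (hC : Irr k C) : Irr k (φ '' C) := by
  letI := zar k X
  letI := zar k Y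
  exact _root_.IsIrreducible.image hC φ hφ.continuous.continuousOn

lemma Clo.preimage {φ : X → Y} (hφ : Mor k φ) {C : Set Y} (hC : Clo k C) : Clo k (φ ⁻¹' C) := by
  letI := zar k X
  letI := zar k Y
  exact IsClosed.preimage hφ.continuous hC

/-- Composition with a map, as an algebra homomorphism. -/
def pull (k : Type) [Field k] {X Y : Type} (φ : X → Y) : (Y → k) →ₐ[k] (X → k) where
  toFun f := f ∘ φ
  map_one' := rfl
  map_mul' _ _ := rfl
  map_zero' := rfl
  map_add' _ _ := rfl
  commutes' _ := rfl

instance instAffProd : Aff k (X × Y) where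
  algebra := (reg k X).map (pull k Prod.fst) ⊔ (reg k Y).map (pull k Prod.snd)
  fg := (Aff.fg.map _).sup (Aff.fg.map _)
  exists_point := by
    intro φ
    have h₁ : (reg k X).map (pull k (Prod.fst : X × Y → X)) ≤
      (reg k X).map (pull k Prod.fst) ⊔ (reg k Y).map (pull k Prod.snd) := le_sup_left
    have h₂ : (reg k Y).map (pull k (Prod.snd : X × Y → Y)) ≤
      (reg k X).map (pull k Prod.fst) ⊔ (reg k Y).map (pull k Prod.snd) := le_sup_right
    obtain ⟨x, hx⟩ := Aff.exists_point ((φ.comp (Subalgebra.inclusion h₁)).comp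
      (((pull k (Prod.fst : X × Y → X)).comp (reg k X).val).codRestrict _
        fun f => ⟨f, f.2, rfl⟩))
    obtain ⟨y, hy⟩ := Aff.exists_point ((φ.comp (Subalgebra.inclusion h₂)).comp
      (((pull k (Prod.snd : X × Y → Y)).comp (reg k Y).val).codRestrict _
        fun f => ⟨f, f.2, rfl⟩))
    refine ⟨(x, y), eq_eval_of_le (sup_le ?_ ?_)⟩
    · rintro _ ⟨f, hf, rfl⟩
      exact ⟨⟨_, h₁ ⟨f, hf, rfl⟩⟩, hx ⟨f, hf⟩, rfl⟩
    · rintro _ ⟨f, hf, rfl⟩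
      exact ⟨⟨_, h₂ ⟨f, hf, rfl⟩⟩, hy ⟨f, hf⟩, rfl⟩
  separated := by
    rintro ⟨x, y⟩ ⟨x', y'⟩ h
    refine Prod.ext (Aff.separated (k := k) _ _ fun f hf => ?_)
      (Aff.separated (k := k) _ _ fun f hf => ?_)
    · exact h (f ∘ Prod.fst) ((le_sup_left : (reg k X).map (pull k (Prod.fst : X × Y → X)) ≤ _)
        ⟨f, hf, rfl⟩)
    · exact h (f ∘ Prod.snd) ((le_sup_right : (reg k Y).map (pull k (Prod.snd : X × Y → Y)) ≤ _)
        ⟨f, hf, rfl⟩)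

lemma Mor.fst : Mor k (Prod.fst : X × Y → X) := fun f hf =>
  (le_sup_left : (reg k X).map (pull k (Prod.fst : X × Y → X)) ≤ reg k (X × Y)) ⟨f, hf, rfl⟩

lemma Mor.snd : Mor k (Prod.snd : X × Y → Y) := fun f hf =>
  (le_sup_right : (reg k Y).map (pull k (Prod.snd : X × Y → Y)) ≤ reg k (X × Y)) ⟨f, hf, rfl⟩

lemma Mor.prodMk {φ : Z → X} {ψ : Z → Y} (hφ : Mor k φ) (hψ : Mor k ψ) :
    Mor k fun z => (φ z, ψ z) := by
  suffices reg k (X × Y) ≤ (reg k Z).comap (pull k fun z => (φ z, ψ z)) from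
    fun f hf => this hf
  refine sup_le ?_ ?_
  · rintro _ ⟨f, hf, rfl⟩
    exact hφ f hf
  · rintro _ ⟨f, hf, rfl⟩
    exact hψ f hf

lemma Mor.const (y : Y) : Mor k fun _ : X => y := fun f _ =>
  (reg k X).algebraMap_mem (f y)

/-- A regular function on a product takes its slices in a finite-dimensional space. -/
lemma exists_slice_space {f : X × Y → k} (hf : f ∈ reg k (X × Y)) :
    ∃ S : Submodule k (X → k), S.FG ∧ S ≤ Subalgebra.toSubmodule (reg k X) ∧
      ∀ y, (fun x => f (x, y)) ∈ S := by
  have hr : reg k (X × Y) = Algebra.adjoin k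
      (((reg k X).map (pull k (Prod.fst : X × Y → X)) : Set (X × Y → k)) ∪
        ((reg k Y).map (pull k (Prod.snd : X × Y → Y)) : Set (X × Y → k))) := by
    rw [Algebra.adjoin_union, Algebra.adjoin_eq, Algebra.adjoin_eq]; rfl
  rw [hr] at hf
  induction hf using Algebra.adjoin_induction with
  | mem f h =>
    rcases h with ⟨g, hg, rfl⟩ | ⟨g, hg, rfl⟩
    · refine ⟨k ∙ g, Submodule.fg_span_singleton _, ?_, fun y => Submodule.mem_span_singleton_self _⟩
      simpa using hg
    · refine ⟨k ∙ 1, Submodule.fg_span_singleton _, ?_, fun y =>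
        Submodule.mem_span_singleton.2 ⟨g y, by ext; exact mul_one _⟩⟩
      simp
  | algebraMap c =>
    refine ⟨k ∙ 1, Submodule.fg_span_singleton _, ?_, fun y =>
        Submodule.mem_span_singleton.2 ⟨c, by ext; simp⟩⟩
    simp
  | add f g _ _ h₁ h₂ =>
    obtain ⟨S, hS, hS', hf⟩ := h₁
    obtain ⟨T, hT, hT', hg⟩ := h₂
    exact ⟨S ⊔ T, hS.sup hT, sup_le hS' hT', fun y => Submodule.add_mem_sup (hf y) (hg y)⟩
  | mul f g _ _ h₁ h₂ =>
    obtain ⟨S, hS, hS', hf⟩ := h₁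
    obtain ⟨T, hT, hT', hg⟩ := h₂
    refine ⟨S * T, hS.mul hT, ?_, fun y => Submodule.mul_mem_mul (hf y) (hg y)⟩
    exact Submodule.mul_le.2 fun a ha b hb => (reg k X).mul_mem (hS' ha) (hT' hb)

lemma Irr.prod {C : Set X} {D : Set Y} (hC : Irr k C) (hD : Irr k D) : Irr k (C ×ˢ D) := by
  letI := zar k X
  letI := zar k Y
  letI := zar k (X × Y)
  refine ⟨hC.1.prod hD.1, isPreirreducible_iff_isClosed_union_isClosed.2 fun E F hE hF h => ?_⟩
  have key : ∀ E : Set (X × Y), Clo k E → IsClosed (⋂ y ∈ D, (fun x => (x, y)) ⁻¹' E) :=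
    fun E hE => isClosed_biInter fun y _ => Clo.preimage (Mor.id.prodMk (Mor.const y)) hE
  have key2 : C ⊆ (⋂ y ∈ D, (fun x => (x, y)) ⁻¹' E) ∪ ⋂ y ∈ D, (fun x => (x, y)) ⁻¹' F := by
    intro x hx
    have := isPreirreducible_iff_isClosed_union_isClosed.1 hD.2 ((fun y => (x, y)) ⁻¹' E)
      ((fun y => (x, y)) ⁻¹' F) (Clo.preimage ((Mor.const x).prodMk Mor.id) hE)
      (Clo.preimage ((Mor.const x).prodMk Mor.id) hF) fun y hy => h ⟨hx, hy⟩
    simpa [Set.subset_def] using this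
  rcases isPreirreducible_iff_isClosed_union_isClosed.1 hC.2 _ _ (key E hE) (key F hF) key2
    with h' | h'
  · left
    rintro ⟨x, y⟩ ⟨hx, hy⟩
    exact Set.mem_iInter₂.1 (h' hx) y hy
  · right
    rintro ⟨x, y⟩ ⟨hx, hy⟩
    exact Set.mem_iInter₂.1 (h' hx) y hy

/-! ### Extension of points along dominant morphisms -/

lemma exists_algHom_of_ne_top {A : Type} [CommRing A] [Algebra k A] [Algebra.FiniteType k A]
    {I : Ideal A} (hI : I ≠ ⊤) : ∃ φ : A →ₐ[k] k, ∀ a ∈ I, φ a = 0 := by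
  obtain ⟨M, hM, hIM⟩ := Ideal.exists_le_maximal I hI
  letI := Ideal.Quotient.field M
  have := finite_of_finite_type_of_isJacobsonRing k (A ⧸ M)
  let e : k ≃ₐ[k] A ⧸ M := AlgEquiv.ofBijective (Algebra.ofId k (A ⧸ M))
    (IsAlgClosed.algebraMap_bijective_of_isIntegral (k := k) (K := A ⧸ M))
  refine ⟨e.symm.toAlgHom.comp (Ideal.Quotient.mkₐ k M), fun a ha => ?_⟩
  have : Ideal.Quotient.mkₐ k M a = 0 := Ideal.Quotient.eq_zero_iff_mem.2 (hIM ha)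
  change e.symm (Ideal.Quotient.mkₐ k M a) = 0
  rw [this, map_zero]

lemma exists_extension {A B : Type} [CommRing A] [CommRing B] [IsDomain A] [IsDomain B]
    [Algebra k A] [Algebra k B] [Algebra.FiniteType k A] [Algebra.FiniteType k B]
    (i : B →ₐ[k] A) (hi : Function.Injective i) :
    ∃ b : B, b ≠ 0 ∧ ∀ φ : B →ₐ[k] k, φ b ≠ 0 → ∃ ψ : A →ₐ[k] k, ψ.comp i = φ := by
  have : IsNoetherianRing B := Algebra.FiniteType.isNoetherianRing k B
  have hft : i.toRingHom.FiniteType :=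
    RingHom.FiniteType.of_comp_finiteType (f := algebraMap k B)
      (by rw [show i.toRingHom.comp (algebraMap k B) = algebraMap k A from i.comp_algebraMap]
          exact (RingHom.finiteType_algebraMap).2 inferInstance)
  have hfp := (RingHom.FinitePresentation.of_finiteType).1 hft
  obtain ⟨S, hS⟩ := PrimeSpectrum.exists_constructibleSetData_iff.2
    (PrimeSpectrum.isConstructible_range_comap hfp)
  have hbot : (⊥ : PrimeSpectrum B) ∈ S.toSet := by
    rw [hS]
    refine ⟨⊥, ?_⟩
    ext x
    change i x = 0 ↔ x = 0
    exact map_eq_zero_iff i hi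
  simp only [PrimeSpectrum.ConstructibleSetData.toSet, Set.mem_iUnion] at hbot
  obtain ⟨c, hc, hcb⟩ := hbot
  have hg : ∀ j, c.g j = 0 := fun j => hcb.1 ⟨j, rfl⟩
  have hf : c.f ≠ 0 := fun h => hcb.2 (by
    rintro _ rfl
    exact h)
  refine ⟨c.f, hf, fun φ hφ => ?_⟩
  let y : PrimeSpectrum B := ⟨RingHom.ker φ, RingHom.ker_isPrime _⟩
  have hy : y ∈ S.toSet := by
    simp only [PrimeSpectrum.ConstructibleSetData.toSet, Set.mem_iUnion]
    refine ⟨c, hc, ?_, fun h => hφ (h rfl)⟩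
    rintro _ ⟨j, rfl⟩
    rw [hg j]
    exact zero_mem _
  rw [hS] at hy
  obtain ⟨x, hx⟩ := hy
  obtain ⟨ψ, hψ⟩ := exists_algHom_of_ne_top (k := k) x.2.ne_top
  refine ⟨ψ, AlgHom.ext fun b => ?_⟩
  have hb : b - algebraMap k B (φ b) ∈ y.asIdeal := by
    change φ _ = 0
    simp
  rw [← hx] at hb
  have := hψ _ hb
  simpa [sub_eq_zero] using this

lemma exists_extension_of_prime {A B : Type} [CommRing A] [CommRing B]
    [Algebra k A] [Algebra k B] [Algebra.FiniteType k A] [Algebra.FiniteType k B]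
    (Φ : B →ₐ[k] A) (I : Ideal A) [I.IsPrime] :
    ∃ b : B, Φ b ∉ I ∧ ∀ φ : B →ₐ[k] k, (∀ f, Φ f ∈ I → φ f = 0) → φ b ≠ 0 →
      ∃ ψ : A →ₐ[k] k, (∀ a ∈ I, ψ a = 0) ∧ ∀ f, ψ (Φ f) = φ f := by
  have hJp : (I.comap Φ).IsPrime := Ideal.IsPrime.comap _
  let i : (B ⧸ I.comap Φ) →ₐ[k] (A ⧸ I) := Ideal.quotientMapₐ I Φ le_rfl
  have hi : Function.Injective i := Ideal.quotientMap_injective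
  obtain ⟨b, hb, hext⟩ := exists_extension (k := k) i hi
  obtain ⟨p, rfl⟩ := Ideal.Quotient.mk_surjective b
  refine ⟨p, fun h => hb (Ideal.Quotient.eq_zero_iff_mem.2 h), fun φ hφ hp => ?_⟩
  obtain ⟨ψ, hψ⟩ := hext (Ideal.Quotient.liftₐ (I.comap Φ) φ hφ) hp
  refine ⟨ψ.comp (Ideal.Quotient.mkₐ k I), fun a ha => ?_, fun f =>
    DFunLike.congr_fun hψ (Ideal.Quotient.mk _ f)⟩
  change ψ (Ideal.Quotient.mk I a) = 0
  rw [Ideal.Quotient.eq_zero_iff_mem.2 ha, map_zero]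

/-- The image of an irreducible closed set contains a dense open subset of its closure. -/
theorem exists_open_image {φ : X → Y} (hφ : Mor k φ) {C : Set X} (hC : Clo k C) (hI : Irr k C) :
    ∃ p ∈ reg k Y, (∃ x ∈ C, p (φ x) ≠ 0) ∧
      ∀ y ∈ closure[zar k Y] (φ '' C), p y ≠ 0 → y ∈ φ '' C := by
  have ftX : Algebra.FiniteType k (reg k X) := (Subalgebra.fg_iff_finiteType _).1 Aff.fg
  have ftY : Algebra.FiniteType k (reg k Y) := (Subalgebra.fg_iff_finiteType _).1 Aff.fg
  let I : Ideal (reg k X) := ⨅ x ∈ C, RingHom.ker ((Pi.evalAlgHom k (fun _ : X => k) x).comp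
    (reg k X).val)
  have memI : ∀ f : reg k X, f ∈ I ↔ ∀ x ∈ C, f.1 x = 0 := fun f => by
    simp only [I, Submodule.mem_iInf]; rfl
  have hIp : I.IsPrime := by
    have h := irr_iff.1 hI
    refine ⟨fun h1 => ?_, fun {f g} hfg => ?_⟩
    · obtain ⟨x, hx⟩ := h.1
      exact one_ne_zero ((memI 1).1 (h1 ▸ Submodule.mem_top) x hx)
    · rw [memI, memI]
      exact h.2 f f.2 g g.2 ((memI _).1 hfg)
  let Φ : reg k Y →ₐ[k] reg k X := ((pull k φ).comp (reg k Y).val).codRestrict _ fun f => hφ f f.2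
  obtain ⟨p, hp, hext⟩ := exists_extension_of_prime (k := k) Φ I
  refine ⟨p, p.2, ?_, fun y hy hpy => ?_⟩
  · by_contra! hcon
    exact hp ((memI _).2 hcon)
  · let ev : reg k Y →ₐ[k] k := (Pi.evalAlgHom k (fun _ : Y => k) y).comp (reg k Y).val
    obtain ⟨ψ, hψI, hψ⟩ := hext ev (fun f hf => mem_closure.1 hy f f.2 (by
      rintro _ ⟨x, hx, rfl⟩
      exact (memI _).1 hf x hx)) hpy
    obtain ⟨x, hx⟩ := Aff.exists_point ψ
    refine ⟨x, ?_, Aff.separated (k := k) _ _ fun f hf => ?_⟩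
    · letI := zar k X
      rw [← IsClosed.closure_eq hC]
      exact mem_closure.2 fun f hf hfC =>
        (hx ⟨f, hf⟩).symm.trans (hψI _ ((memI ⟨f, hf⟩).2 hfC))
    · exact (hx (Φ ⟨f, hf⟩)).symm.trans (hψ ⟨f, hf⟩)

end General

/-! ### Vector spaces and general linear groups as affine sets -/

section VectorSpace
variable {V W X Y : Type} [AddCommGroup V] [Module k V] [FiniteDimensional k V]
  [AddCommGroup W] [Module k W] [FiniteDimensional k W] [Aff k X] [Aff k Y]

instance (priority := 50) instAffVectorSpace : Aff k V where
  algebra := Algebra.adjoin k (Set.range fun l : Module.Dual k V => (l : V → k))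
  fg := by
    classical
    let b := Module.finBasis k V
    have : Algebra.adjoin k (Set.range fun l : Module.Dual k V => (l : V → k)) =
        Algebra.adjoin k ((Finset.univ.image fun i => (b.coord i : V → k) : Finset (V → k)) :
          Set (V → k)) := by
      refine le_antisymm (Algebra.adjoin_le ?_) (Algebra.adjoin_mono ?_)
      · rintro _ ⟨l, rfl⟩
        have : (l : V → k) = ∑ i, l (b i) • (b.coord i : V → k) := by
          ext v
          conv_lhs => rw [← b.sum_repr v, map_sum]
          simp [mul_comm]
        change (l : V → k) ∈ _
        rw [this]
        exact Subalgebra.sum_mem _ fun i _ => Subalgebra.smul_mem _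
          (Algebra.subset_adjoin (by simp)) _
      · intro f hf
        simp only [Finset.coe_image, Finset.coe_univ, Set.image_univ, Set.mem_range] at hf
        obtain ⟨i, rfl⟩ := hf
        exact ⟨b.coord i, rfl⟩
    rw [this]
    exact ⟨_, rfl⟩
  exists_point := by
    intro φ
    have hm : ∀ l : Module.Dual k V, (l : V → k) ∈
        Algebra.adjoin k (Set.range fun l : Module.Dual k V => (l : V → k)) :=
      fun l => Algebra.subset_adjoin ⟨l, rfl⟩
    let e : Module.Dual k (Module.Dual k V) :=
      { toFun := fun l => φ ⟨l, hm l⟩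
        map_add' := fun l m => by rw [← map_add]; rfl
        map_smul' := fun c l => by rw [RingHom.id_apply, ← map_smul]; rfl }
    refine ⟨(Module.evalEquiv k V).symm e, eq_eval_of_le (Algebra.adjoin_le ?_)⟩
    rintro _ ⟨l, rfl⟩
    refine ⟨⟨l, hm l⟩, ?_, rfl⟩
    change e l = l ((Module.evalEquiv k V).symm e)
    conv_lhs => rw [← (Module.evalEquiv k V).apply_symm_apply e]
    simp
  separated := by
    intro x y h
    refine (Module.forall_dual_apply_eq_zero_iff k (x - y)).1 (fun l => ?_) |> sub_eq_zero.1
    rw [map_sub, sub_eq_zero]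
    exact h l (Algebra.subset_adjoin ⟨l, rfl⟩)

lemma dual_mem_reg (l : Module.Dual k V) : (l : V → k) ∈ reg k V :=
  Algebra.subset_adjoin ⟨l, rfl⟩

lemma mor_vector_iff {φ : X → V} :
    Mor k φ ↔ ∀ l : Module.Dual k V, (fun x => l (φ x)) ∈ reg k X := by
  refine ⟨fun h l => h _ (dual_mem_reg l), fun h => ?_⟩
  suffices reg k V ≤ (reg k X).comap (pull k φ) from fun f hf => this hf
  refine Algebra.adjoin_le ?_
  rintro _ ⟨l, rfl⟩
  exact h l

lemma LinearMap.mor (T : V →ₗ[k] W) : Mor k T :=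
  mor_vector_iff.2 fun l => dual_mem_reg (l ∘ₗ T)

lemma mor_scalar_iff {φ : X → k} : Mor k φ ↔ φ ∈ reg k X := by
  rw [mor_vector_iff]
  refine ⟨fun h => h LinearMap.id, fun h l => ?_⟩
  have : (fun x => l (φ x)) = l 1 • φ := by
    ext x
    rw [Pi.smul_apply, smul_eq_mul, mul_comm, ← smul_eq_mul, ← map_smul, smul_eq_mul, mul_one]
  rw [this]
  exact Subalgebra.smul_mem _ h _

lemma Mor.smul {f : X → k} {φ : X → V} (hf : f ∈ reg k X) (hφ : Mor k φ) :
    Mor k fun x => f x • φ x := by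
  refine mor_vector_iff.2 fun l => ?_
  simp only [map_smul, smul_eq_mul]
  exact mul_mem hf (mor_vector_iff.1 hφ l)

lemma Mor.sum {ι : Type*} (s : Finset ι) {φ : ι → X → V} (hφ : ∀ i ∈ s, Mor k (φ i)) :
    Mor k fun x => ∑ i ∈ s, φ i x := by
  refine mor_vector_iff.2 fun l => ?_
  simp only [map_sum]
  have : (fun x => ∑ i ∈ s, l (φ i x)) = ∑ i ∈ s, fun x => l (φ i x) := by ext; simp
  rw [this]
  exact sum_mem fun i hi => mor_vector_iff.1 (hφ i hi) l

end VectorSpace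

section GeneralLinear
variable {X : Type} [Aff k X]

/-- The coordinate functions on `GL_n`. -/
def coordFun (n : ℕ) (k : Type) [Field k] (i : Fin n × Fin n × Bool) (g : GLn n k) : k :=
  if i.2.2 then (g : Matrix (Fin n) (Fin n) k) i.1 i.2.1
    else ((g⁻¹ : GLn n k) : Matrix (Fin n) (Fin n) k) i.1 i.2.1

/-- Evaluation of polynomials as functions on `GL_n`. -/
noncomputable def evalHom (n : ℕ) (k : Type) [Field k] :
    MvPolynomial (Fin n × Fin n × Bool) k →ₐ[k] (GLn n k → k) :=
  MvPolynomial.aeval (coordFun n k)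

lemma evalHom_apply (p : MvPolynomial (Fin n × Fin n × Bool) k) (g : GLn n k) :
    evalHom n k p g = evalAt g p := by
  have : (Pi.evalAlgHom k (fun _ : GLn n k => k) g).comp (evalHom n k) =
      MvPolynomial.aeval fun i => coordFun n k i g := by
    refine MvPolynomial.algHom_ext fun i => ?_
    simp [evalHom]
  exact DFunLike.congr_fun this p

lemma coordFun_mem (i : Fin n × Fin n × Bool) : coordFun n k i ∈ (evalHom n k).range :=
  ⟨MvPolynomial.X i, by simp [evalHom]⟩

lemma evalHom_range_le {A : Subalgebra k (GLn n k → k)} (h : ∀ i, coordFun n k i ∈ A) :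
    (evalHom n k).range ≤ A := by
  rintro _ ⟨p, rfl⟩
  change evalHom n k p ∈ A
  induction p using MvPolynomial.induction_on with
  | C a => simp [evalHom]
  | add p q hp hq => rw [map_add]; exact add_mem hp hq
  | mul_X p i hp =>
    rw [map_mul]
    exact mul_mem hp (by simpa [evalHom] using h i)

noncomputable instance instAffGLn : Aff k (GLn n k) where
  algebra := (evalHom n k).range
  fg := by
    rw [← Algebra.map_top]
    exact Algebra.FiniteType.out.map _
  exists_point := by
    intro φ
    let c (i) : (evalHom n k).range := ⟨coordFun n k i, coordFun_mem i⟩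
    let A : Matrix (Fin n) (Fin n) k := .of fun i j => φ (c (i, j, true))
    let B : Matrix (Fin n) (Fin n) k := .of fun i j => φ (c (i, j, false))
    have hAB : A * B = 1 := by
      ext i j
      have : ∑ l, c (i, l, true) * c (l, j, false) = algebraMap k _ (if i = j then 1 else 0) := by
        ext g
        have h1 : (g.1 * g⁻¹.1) i j = (1 : Matrix (Fin n) (Fin n) k) i j := by
          rw [← Units.val_mul, mul_inv_cancel, Units.val_one]
        rw [Matrix.mul_apply, Matrix.one_apply] at h1
        rw [AddSubmonoidClass.coe_finsetSum, Finset.sum_apply]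
        exact h1
      simp only [Matrix.mul_apply, A, B, Matrix.of_apply, ← map_mul, ← map_sum, this,
        AlgHom.commutes, Matrix.one_apply]
      rfl
    let g : GLn n k := ⟨A, B, hAB, mul_eq_one_comm.1 hAB⟩
    refine ⟨g, eq_eval_of_le (evalHom_range_le fun i => ⟨c i, ?_, rfl⟩)⟩
    change φ (c i) = coordFun n k i g
    obtain ⟨i, j, b⟩ := i
    cases b <;> simp [coordFun, A, B, g]
  separated := by
    intro g h H
    ext i j
    exact H _ (coordFun_mem (i, j, true))

lemma entry_mem (i j : Fin n) : (fun g : GLn n k => (g : Matrix (Fin n) (Fin n) k) i j) ∈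
    reg k (GLn n k) := coordFun_mem (i, j, true)

lemma inv_entry_mem (i j : Fin n) :
    (fun g : GLn n k => ((g⁻¹ : GLn n k) : Matrix (Fin n) (Fin n) k) i j) ∈ reg k (GLn n k) :=
  coordFun_mem (i, j, false)

lemma mor_GLn {φ : X → GLn n k}
    (h : ∀ i j, (fun x => (φ x : Matrix (Fin n) (Fin n) k) i j) ∈ reg k X)
    (h' : ∀ i j, (fun x => ((φ x)⁻¹ : GLn n k).1 i j) ∈ reg k X) : Mor k φ := by
  suffices reg k (GLn n k) ≤ (reg k X).comap (pull k φ) from fun f hf => this hf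
  refine evalHom_range_le ?_
  rintro ⟨i, j, b⟩
  cases b
  · exact h' i j
  · exact h i j

lemma Mor.inv {φ : X → GLn n k} (hφ : Mor k φ) : Mor k fun x => (φ x)⁻¹ := by
  refine mor_GLn (fun i j => hφ _ (inv_entry_mem i j)) fun i j => ?_
  simp only [inv_inv]
  exact hφ _ (entry_mem i j)

lemma Mor.mul {φ ψ : X → GLn n k} (hφ : Mor k φ) (hψ : Mor k ψ) : Mor k fun x => φ x * ψ x := by
  have aux : ∀ a b : X → GLn n k, Mor k a → Mor k b → ∀ i j : Fin n,
      (fun x => (a x * b x : GLn n k).1 i j) ∈ reg k X := by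
    intro a b ha hb i j
    have : (fun x => (a x * b x : GLn n k).1 i j) =
        ∑ l, (fun x => (a x).1 i l) * fun x => (b x).1 l j := by
      ext x; simp [Matrix.mul_apply]
    rw [this]
    exact sum_mem fun l _ => mul_mem (ha _ (entry_mem i l)) (hb _ (entry_mem l j))
  refine mor_GLn (aux _ _ hφ hψ) fun i j => ?_
  simp only [mul_inv_rev]
  exact aux _ _ hψ.inv hφ.inv i j

lemma mor_conj (g : GLn n k) : Mor k fun x : GLn n k => g * x * g⁻¹ :=
  ((Mor.const g).mul Mor.id).mul (Mor.const g⁻¹)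

noncomputable instance : TopologicalSpace (GLn n k) := zar k (GLn n k)

lemma zclosed_iff {C : Set (GLn n k)} : ZClosed C ↔ Clo k C := by
  rw [clo_iff]
  constructor
  · rintro ⟨S, rfl⟩
    refine ⟨evalHom n k '' S, ?_, ?_⟩
    · rintro _ ⟨p, _, rfl⟩
      exact ⟨p, rfl⟩
    · ext g; simp [evalHom_apply]
  · rintro ⟨S, hS, rfl⟩
    refine ⟨evalHom n k ⁻¹' S, ?_⟩
    ext g
    constructor
    · intro h p hp
      rw [← evalHom_apply]
      exact h _ hp
    · intro h f hf
      obtain ⟨p, rfl⟩ := hS hf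
      exact (evalHom_apply p g).trans (h p hf)

lemma zconnected_iff {C : Set (GLn n k)} : ZConnected C ↔ Irr k C := by
  rw [Irr, IsIrreducible, isPreirreducible_iff_isClosed_union_isClosed, ZConnected]
  simp only [zclosed_iff]

end GeneralLinear

/-! ### Closed subgroups and identity components -/

/-- Closed subgroups of the general linear group. -/
abbrev IsClo (H : Subgroup (GLn n k)) : Prop := Clo k (H : Set (GLn n k))

/-- Irreducible subgroups of the general linear group. -/
abbrev IsIrr (H : Subgroup (GLn n k)) : Prop := Irr k (H : Set (GLn n k))

section General
variable {X : Type} [Aff k X]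

lemma exists_minimal_clo (p : Set X → Prop) (h : ∃ C, Clo k C ∧ p C) :
    ∃ C, Clo k C ∧ p C ∧ ∀ D, Clo k D → p D → D ⊆ C → D = C := by
  letI := zar k X
  have hN : TopologicalSpace.NoetherianSpace X := noeth (k := k)
  have wf : WellFounded ((· < ·) : TopologicalSpace.Closeds X → _ → Prop) :=
    wellFounded_lt
  obtain ⟨C, hC, hp⟩ := h
  obtain ⟨M, hM, hmin⟩ := wf.has_min {D : TopologicalSpace.Closeds X | p D} ⟨⟨C, hC⟩, hp⟩
  refine ⟨M, M.isClosed, hM, fun D hD hpD hDM => ?_⟩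
  by_contra hne
  exact hmin ⟨D, hD⟩ hpD (lt_of_le_of_ne hDM fun h => hne (congrArg SetLike.coe h))

lemma Irr.closure {C : Set X} (hC : Irr k C) : Irr k (closure[zar k X] C) := by
  letI := zar k X
  exact IsIrreducible.closure hC

lemma Irr.directed_union {S : Set (Set X)} (hS : ∀ C ∈ S, Irr k C) (hne : S.Nonempty)
    (hd : ∀ C ∈ S, ∀ D ∈ S, ∃ E ∈ S, C ⊆ E ∧ D ⊆ E) : Irr k (⋃₀ S) := by
  refine irr_iff.2 ⟨?_, fun f hf g hg h => ?_⟩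
  · obtain ⟨C, hC⟩ := hne
    obtain ⟨x, hx⟩ := (hS C hC).1
    exact ⟨x, C, hC, hx⟩
  · by_contra! hcon
    obtain ⟨⟨x, ⟨C, hC, hx⟩, hfx⟩, y, ⟨D, hD, hy⟩, hgy⟩ := hcon
    obtain ⟨E, hE, hCE, hDE⟩ := hd C hC D hD
    rcases (irr_iff.1 (hS E hE)).2 f hf g hg fun z hz => h z ⟨E, hE, hz⟩ with h | h
    · exact hfx (h x (hCE hx))
    · exact hgy (h y (hDE hy))

lemma Irr.singleton (x : X) : Irr k ({x} : Set X) := by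
  letI := zar k X
  exact isIrreducible_singleton

/-- On an irreducible set, two regular functions that are not identically zero are simultaneously
nonzero somewhere. -/
lemma Irr.exists_ne {C : Set X} (hC : Irr k C) {f g : X → k} (hf : f ∈ reg k X)
    (hg : g ∈ reg k X) {x y : X} (hx : x ∈ C) (hy : y ∈ C) (hfx : f x ≠ 0) (hgy : g y ≠ 0) :
    ∃ z ∈ C, f z ≠ 0 ∧ g z ≠ 0 := by
  by_contra! hcon
  rcases (irr_iff.1 hC).2 f hf g hg fun z hz => by
    by_cases h : f z = 0
    · rw [h, zero_mul]
    · rw [hcon z hz h, mul_zero] with h | h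
  · exact hfx (h x hx)
  · exact hgy (h y hy)

/-- A regular function with finitely many values on an irreducible set is constant there. -/
lemma Irr.const_of_finite {C : Set X} (hC : Irr k C) {f : X → k} (hf : f ∈ reg k X)
    (hfin : (f '' C).Finite) {x y : X} (hx : x ∈ C) (hy : y ∈ C) : f x = f y := by
  classical
  have key : ∀ s : Finset k, (∀ z ∈ C, ∏ a ∈ s, (f z - a) = 0) → ∃ a ∈ s, ∀ z ∈ C, f z = a := by
    intro s
    induction s using Finset.induction_on with
    | empty =>
      intro h
      simpa using h x hx
    | insert a s ha ih =>
      intro h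
      rcases (irr_iff.1 hC).2 (fun z => f z - a) (sub_mem hf ((reg k X).algebraMap_mem a))
        (fun z => ∏ a ∈ s, (f z - a)) (by
          have : (fun z => ∏ a ∈ s, (f z - a)) = ∏ a ∈ s, (f - algebraMap k (X → k) a) := by
            ext z; simp
          rw [this]
          exact prod_mem fun a _ => sub_mem hf ((reg k X).algebraMap_mem a))
        (fun z hz => by simpa [Finset.prod_insert ha] using h z hz) with h | h
      · exact ⟨a, by simp, fun z hz => sub_eq_zero.1 (h z hz)⟩
      · obtain ⟨b, hb, hb'⟩ := ih h
        exact ⟨b, by simp [hb], hb'⟩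
  obtain ⟨a, -, ha⟩ := key hfin.toFinset fun z hz =>
    Finset.prod_eq_zero (i := f z) (by simpa using ⟨z, hz, rfl⟩) (sub_self _)
  rw [ha x hx, ha y hy]

end General

section Subgroups

lemma Irr.mul {C D : Set (GLn n k)} (hC : Irr k C) (hD : Irr k D) : Irr k (C * D) := by
  have := Irr.image (Mor.fst.mul Mor.snd) (hC.prod hD)
  rwa [Set.image_prod, Set.image2_mul] at this

/-- The closure of a subgroup. -/
def closureSubgroup (H : Subgroup (GLn n k)) : Subgroup (GLn n k) where
  carrier := closure (H : Set (GLn n k))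
  one_mem' := subset_closure H.one_mem
  mul_mem' := by
    have h1 : ∀ a ∈ H, ∀ b ∈ closure (H : Set (GLn n k)), a * b ∈ closure (H : Set (GLn n k)) := by
      intro a ha b hb
      exact map_mem_closure (Mor.continuous ((Mor.const a).mul Mor.id)) hb
        fun x hx => H.mul_mem ha hx
    intro a b ha hb
    have := map_mem_closure (Mor.continuous (Mor.id.mul (Mor.const b))) ha
        (t := closure (H : Set (GLn n k))) fun x hx => h1 x hx b hb
    rwa [closure_closure] at this
  inv_mem' := by
    intro a ha
    exact map_mem_closure (Mor.continuous (Mor.inv Mor.id)) ha fun x hx => H.inv_mem hx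

/-- A subgroup that is the image of an irreducible closed set under a morphism is closed. -/
theorem clo_of_image {X : Type} [Aff k X] {φ : X → GLn n k} (hφ : Mor k φ) {C : Set X}
    (hC : Clo k C) (hI : Irr k C) {H : Subgroup (GLn n k)} (hH : φ '' C = H) :
    IsClo H := by
  obtain ⟨p, hp, ⟨x, hx, hpx⟩, hop⟩ := exists_open_image hφ hC hI
  rw [hH] at hop
  have hxH : φ x ∈ H := by
    have : φ x ∈ φ '' C := ⟨x, hx, rfl⟩
    rwa [hH] at this
  suffices closure (H : Set (GLn n k)) ⊆ H from closure_subset_iff_isClosed.1 this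
  intro y hy
  have hy' : y ∈ closureSubgroup H := hy
  by_contra hyH
  have h0 : ∀ h ∈ H, p (y * h) = 0 := by
    intro h hh
    by_contra hne
    have h1 : y * h ∈ closureSubgroup H := mul_mem hy' (subset_closure hh)
    have h2 : y * h ∈ H := hop _ h1 hne
    exact hyH ((Subgroup.mul_mem_cancel_right H hh).1 h2)
  have h3 : y⁻¹ * φ x ∈ closureSubgroup H := mul_mem (inv_mem hy') (subset_closure hxH)
  have h4 := mem_closure.1 (show y⁻¹ * φ x ∈ closure[zar k (GLn n k)] (H : Set (GLn n k)) from h3)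
    (fun z => p (y * z)) (((Mor.const y).mul Mor.id) p hp) h0
  exact hpx (by simpa using h4)

/-- The identity component. -/
def idc (H : Subgroup (GLn n k)) : Subgroup (GLn n k) where
  carrier := ⋃₀ {C | Irr k C ∧ (1 : GLn n k) ∈ C ∧ C ⊆ H}
  one_mem' := ⟨{1}, ⟨Irr.singleton 1, rfl, by simp⟩, rfl⟩
  mul_mem' := by
    rintro a b ⟨C, ⟨hC, h1, hCH⟩, ha⟩ ⟨D, ⟨hD, h1', hDH⟩, hb⟩
    refine ⟨C * D, ⟨hC.mul hD, ⟨1, h1, 1, h1', one_mul 1⟩, ?_⟩, Set.mul_mem_mul ha hb⟩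
    rintro _ ⟨c, hc, d, hd, rfl⟩
    exact H.mul_mem (hCH hc) (hDH hd)
  inv_mem' := by
    rintro a ⟨C, ⟨hC, h1, hCH⟩, ha⟩
    refine ⟨(fun x => x⁻¹) '' C, ⟨Irr.image (Mor.inv Mor.id) hC, ⟨1, h1, inv_one⟩, ?_⟩, a, ha, rfl⟩
    rintro _ ⟨c, hc, rfl⟩
    exact H.inv_mem (hCH hc)

variable {H K : Subgroup (GLn n k)}

lemma idc_le : idc H ≤ H := by
  rintro x ⟨C, ⟨-, -, h⟩, hx⟩
  exact h hx

lemma irr_idc (H : Subgroup (GLn n k)) : IsIrr (idc H) := by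
  refine Irr.directed_union (fun C hC => hC.1) ⟨{1}, Irr.singleton 1, rfl, by simp⟩ ?_
  rintro C ⟨hC, h1, hCH⟩ D ⟨hD, h1', hDH⟩
  refine ⟨C * D, ⟨hC.mul hD, ⟨1, h1, 1, h1', one_mul 1⟩, ?_⟩, fun c hc => ⟨c, hc, 1, h1', mul_one c⟩,
    fun d hd => ⟨1, h1, d, hd, one_mul d⟩⟩
  rintro _ ⟨c, hc, d, hd, rfl⟩
  exact H.mul_mem (hCH hc) (hDH hd)

lemma subset_idc {C : Set (GLn n k)} (hC : Irr k C) (h1 : (1 : GLn n k) ∈ C) (hCH : C ⊆ H) :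
    C ⊆ idc H := fun _ hx => ⟨C, ⟨hC, h1, hCH⟩, hx⟩

lemma le_idc (hK : IsIrr K) (h : K ≤ H) : K ≤ idc H :=
  subset_idc hK K.one_mem h

lemma clo_idc (hH : IsClo H) : IsClo (idc H) := by
  refine closure_subset_iff_isClosed.1 ?_
  exact subset_idc (irr_idc H).closure (subset_closure (idc H).one_mem)
    (closure_minimal idc_le hH)

lemma conj_mem_idc {g : GLn n k} (hg : ∀ x ∈ H, g * x * g⁻¹ ∈ H) {x : GLn n k} (hx : x ∈ idc H) :
    g * x * g⁻¹ ∈ idc H := by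
  refine subset_idc (C := (fun x => g * x * g⁻¹) '' idc H) (Irr.image (mor_conj g) (irr_idc H))
    ⟨1, one_mem _, by simp⟩ ?_ ⟨x, hx, rfl⟩
  rintro _ ⟨y, hy, rfl⟩
  exact hg y (idc_le hy)

end Subgroups

/-! ### Rational representations -/

/-- A rational representation of `G` on `V`, given by a function on the whole of `GL_n` of which
only the values on `G` matter. -/
structure RatRep (G : Subgroup (GLn n k)) (V : Type) [AddCommGroup V] [Module k V] where
  toFun : GLn n k → (V →ₗ[k] V)
  map_one : toFun 1 = 1
  map_mul : ∀ g ∈ G, ∀ h ∈ G, toFun (g * h) = toFun g * toFun h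
  regular : ∀ (v : V) (l : Module.Dual k V), ∃ f ∈ reg k (GLn n k), ∀ g ∈ G, l (toFun g v) = f g

instance (G : Subgroup (GLn n k)) (V : Type) [AddCommGroup V] [Module k V] :
    CoeFun (RatRep G V) fun _ => GLn n k → (V →ₗ[k] V) := ⟨RatRep.toFun⟩

section
variable {V W : Type} [AddCommGroup V] [Module k V] [AddCommGroup W] [Module k W]

lemma regular_of_span {G : Set (GLn n k)} {T : GLn n k → (V →ₗ[k] V)} {S : Set V}
    (hS : Submodule.span k S = ⊤) {S' : Set (Module.Dual k V)} (hS' : Submodule.span k S' = ⊤)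
    (h : ∀ v ∈ S, ∀ l ∈ S', ∃ f ∈ reg k (GLn n k), ∀ g ∈ G, l (T g v) = f g)
    (v : V) (l : Module.Dual k V) : ∃ f ∈ reg k (GLn n k), ∀ g ∈ G, l (T g v) = f g := by
  have h1 : ∀ v ∈ S, ∀ l : Module.Dual k V,
      ∃ f ∈ reg k (GLn n k), ∀ g ∈ G, l (T g v) = f g := by
    intro v hv l
    induction (hS' ▸ Submodule.mem_top : l ∈ Submodule.span k S') using Submodule.span_induction with
    | mem l hl => exact h v hv l hl
    | zero => exact ⟨0, zero_mem _, fun g _ => by simp⟩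
    | add a b _ _ ha hb =>
      obtain ⟨f, hf, hf'⟩ := ha
      obtain ⟨f₂, hf₂, hf₂'⟩ := hb
      exact ⟨f + f₂, add_mem hf hf₂, fun g hg => by simp [hf' g hg, hf₂' g hg]⟩
    | smul c a _ ha =>
      obtain ⟨f, hf, hf'⟩ := ha
      exact ⟨c • f, Subalgebra.smul_mem _ hf _, fun g hg => by simp [hf' g hg]⟩
  induction (hS ▸ Submodule.mem_top : v ∈ Submodule.span k S) using Submodule.span_induction with
  | mem v hv => exact h1 v hv l
  | zero => exact ⟨0, zero_mem _, fun g _ => by simp⟩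
  | add a b _ _ ha hb =>
    obtain ⟨f, hf, hf'⟩ := ha
    obtain ⟨f₂, hf₂, hf₂'⟩ := hb
    exact ⟨f + f₂, add_mem hf hf₂, fun g hg => by simp [hf' g hg, hf₂' g hg]⟩
  | smul c a _ ha =>
    obtain ⟨f, hf, hf'⟩ := ha
    exact ⟨c • f, Subalgebra.smul_mem _ hf _, fun g hg => by simp [hf' g hg]⟩

lemma span_dual_eq_top [FiniteDimensional k V] {S : Set (Module.Dual k V)}
    (h : ∀ v, (∀ l ∈ S, l v = 0) → v = 0) : Submodule.span k S = ⊤ := by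
  have h1 : (Submodule.span k S).dualCoannihilator = ⊥ := by
    refine (Submodule.eq_bot_iff _).2 fun v hv => h v fun l hl => ?_
    exact (Submodule.mem_dualCoannihilator _).1 hv l (Submodule.subset_span hl)
  rw [← Subspace.dualCoannihilator_dualAnnihilator_eq (W := Submodule.span k S), h1,
    Submodule.dualAnnihilator_bot]

end

namespace RatRep
variable {G H : Subgroup (GLn n k)} {V W : Type} [AddCommGroup V] [Module k V]
  [AddCommGroup W] [Module k W] (ρ : RatRep G V)

lemma mul_apply {g h : GLn n k} (hg : g ∈ G) (hh : h ∈ G) (v : V) : ρ (g * h) v = ρ g (ρ h v) := by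
  rw [ρ.map_mul g hg h hh]; rfl

lemma one_apply (v : V) : ρ 1 v = v := by rw [ρ.map_one]; rfl

lemma inv_apply_self {g : GLn n k} (hg : g ∈ G) (v : V) : ρ g⁻¹ (ρ g v) = v := by
  rw [← ρ.mul_apply (inv_mem hg) hg, inv_mul_cancel, one_apply]

lemma apply_inv_self {g : GLn n k} (hg : g ∈ G) (v : V) : ρ g (ρ g⁻¹ v) = v := by
  rw [← ρ.mul_apply hg (inv_mem hg), mul_inv_cancel, one_apply]

lemma apply_eq_zero {g : GLn n k} (hg : g ∈ G) {v : V} : ρ g v = 0 ↔ v = 0 := by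
  refine ⟨fun h => ?_, fun h => by rw [h, map_zero]⟩
  rw [← ρ.inv_apply_self hg v, h, map_zero]

/-- Restriction to a subgroup. -/
@[simps]
def mono (h : H ≤ G) : RatRep H V where
  toFun := ρ
  map_one := ρ.map_one
  map_mul g hg x hx := ρ.map_mul g (h hg) x (h hx)
  regular v l := by
    obtain ⟨f, hf, hf'⟩ := ρ.regular v l
    exact ⟨f, hf, fun g hg => hf' g (h hg)⟩

/-- A subspace is stable. -/
def Stable (U : Submodule k V) : Prop := ∀ g ∈ G, ∀ v ∈ U, ρ g v ∈ U

/-- A linear retraction onto a subspace. -/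
noncomputable def _root_.Submodule.retr (U : Submodule k V) : V →ₗ[k] U :=
  (U.subtype.exists_leftInverse_of_injective U.ker_subtype).choose

lemma _root_.Submodule.retr_apply (U : Submodule k V) (u : U) : U.retr u = u :=
  DFunLike.congr_fun (U.subtype.exists_leftInverse_of_injective U.ker_subtype).choose_spec u

lemma _root_.Submodule.coe_retr (U : Submodule k V) {u : V} (hu : u ∈ U) : (U.retr u : V) = u := by
  rw [U.retr_apply ⟨u, hu⟩]

/-- The subrepresentation on a stable subspace. -/
noncomputable def sub (U : Submodule k V) (hU : ρ.Stable U) : RatRep G U where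
  toFun g := U.retr ∘ₗ ρ g ∘ₗ U.subtype
  map_one := by
    ext u
    simp [ρ.one_apply, U.retr_apply]
  map_mul g hg h hh := by
    ext u
    simp [ρ.mul_apply hg hh, U.coe_retr, hU h hh u u.2, hU g hg _ (hU h hh u u.2)]
  regular v l := ρ.regular v (l ∘ₗ U.retr)

lemma sub_apply {U : Submodule k V} (hU : ρ.Stable U) {g : GLn n k} (hg : g ∈ G) (u : U) :
    (ρ.sub U hU g u : V) = ρ g u := U.coe_retr (hU g hg u u.2)

/-- A linear section of the projection to a quotient. -/
noncomputable def _root_.Submodule.sect (U : Submodule k V) : (V ⧸ U) →ₗ[k] V :=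
  (U.mkQ.exists_rightInverse_of_surjective U.range_mkQ).choose

lemma _root_.Submodule.mkQ_sect (U : Submodule k V) (u : V ⧸ U) : U.mkQ (U.sect u) = u :=
  DFunLike.congr_fun (U.mkQ.exists_rightInverse_of_surjective U.range_mkQ).choose_spec u

lemma mkQ_apply_sect {U : Submodule k V} (hU : ρ.Stable U) {g : GLn n k} (hg : g ∈ G) (v : V) :
    U.mkQ (ρ g (U.sect (U.mkQ v))) = U.mkQ (ρ g v) := by
  rw [← sub_eq_zero, ← map_sub, ← map_sub, ← LinearMap.mem_ker, Submodule.ker_mkQ]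
  refine hU g hg _ ?_
  refine (Submodule.Quotient.mk_eq_zero U).1 ?_
  change U.mkQ _ = 0
  rw [map_sub, U.mkQ_sect, sub_self]

/-- The quotient representation by a stable subspace. -/
noncomputable def quot (U : Submodule k V) (hU : ρ.Stable U) : RatRep G (V ⧸ U) where
  toFun g := U.mkQ ∘ₗ ρ g ∘ₗ U.sect
  map_one := by
    refine LinearMap.ext fun v => ?_
    simp only [LinearMap.comp_apply, ρ.one_apply, U.mkQ_sect]; rfl
  map_mul g hg h hh := by
    refine LinearMap.ext fun v => ?_
    simp only [LinearMap.comp_apply, ρ.mul_apply hg hh, Module.End.mul_apply]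
    exact (ρ.mkQ_apply_sect hU hg _).symm
  regular v l := ρ.regular (U.sect v) (l ∘ₗ U.mkQ)

lemma quot_apply {U : Submodule k V} (hU : ρ.Stable U) {g : GLn n k} (hg : g ∈ G) (v : V) :
    ρ.quot U hU g (U.mkQ v) = U.mkQ (ρ g v) :=
  ρ.mkQ_apply_sect hU hg v

/-- The dual representation. -/
noncomputable def dual [FiniteDimensional k V] : RatRep G (Module.Dual k V) where
  toFun g := (ρ g⁻¹).dualMap
  map_one := by
    ext l v
    simp [ρ.one_apply]
  map_mul g hg h hh := by
    ext l v
    simp [ρ.mul_apply (inv_mem hh) (inv_mem hg)]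
  regular l m := by
    obtain ⟨f, hf, hf'⟩ := ρ.regular ((Module.evalEquiv k V).symm m) l
    refine ⟨fun g => f g⁻¹, (Mor.inv Mor.id) f hf, fun g hg => ?_⟩
    change _ = f g⁻¹
    rw [← hf' _ (inv_mem hg)]
    exact (Module.apply_evalEquiv_symm_apply k V ((ρ g⁻¹).dualMap l) m).symm

lemma dual_apply [FiniteDimensional k V] (g : GLn n k) (l : Module.Dual k V) (v : V) :
    ρ.dual g l v = l (ρ g⁻¹ v) := rfl

/-- Closedness of sets cut out by matrix coefficients. -/
lemma clo_coeff [FiniteDimensional k V] (hG : IsClo G)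
    (T : Set (V × Module.Dual k V)) : Clo k {g | g ∈ G ∧ ∀ p ∈ T, p.2 (ρ g p.1) = p.2 p.1} := by
  choose f hf hf' using fun p : V × Module.Dual k V => ρ.regular p.1 p.2
  have : {g | g ∈ G ∧ ∀ p ∈ T, p.2 (ρ g p.1) = p.2 p.1} =
      (G : Set (GLn n k)) ∩ ⋂ p ∈ T, {g | f p g - p.2 p.1 = 0} := by
    ext g
    simp only [Set.mem_ofPred_eq, Set.mem_inter_iff, SetLike.mem_coe, Set.mem_iInter]
    refine and_congr_right fun hg => forall₂_congr fun p _ => ?_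
    rw [← hf' p g hg, sub_eq_zero]
  rw [this]
  exact IsClosed.inter hG (isClosed_biInter fun p _ =>
    clo_zero (sub_mem (hf p) ((reg k (GLn n k)).algebraMap_mem _)))

/-- The set-theoretic stabilizer of a subspace is closed. -/
lemma clo_stab [FiniteDimensional k V] (hG : IsClo G) (U : Submodule k V) :
    Clo k {g | g ∈ G ∧ ∀ v ∈ U, ρ g v ∈ U} := by
  convert ρ.clo_coeff hG {p | p.1 ∈ U ∧ p.2 ∈ U.dualAnnihilator} using 4 with g
  constructor
  · rintro h ⟨v, l⟩ ⟨hv, hl⟩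
    rw [(Submodule.mem_dualAnnihilator _).1 hl _ hv,
      (Submodule.mem_dualAnnihilator _).1 hl _ (h v hv)]
  · intro h v hv
    by_contra hcon
    obtain ⟨l, hl, hl'⟩ := Submodule.exists_dual_map_eq_bot_of_notMem hcon inferInstance
    have hl'' : l ∈ U.dualAnnihilator := (Submodule.mem_dualAnnihilator _).2 fun w hw => by
      have : l w ∈ U.map l := ⟨w, hw, rfl⟩
      rwa [hl', Submodule.mem_bot] at this
    exact hl ((h (v, l) ⟨hv, hl''⟩).trans ((Submodule.mem_dualAnnihilator _).1 hl'' _ hv))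

lemma clo_fix [FiniteDimensional k V] (hG : IsClo G) (v : V) : Clo k {g | g ∈ G ∧ ρ g v = v} := by
  convert ρ.clo_coeff hG {p | p.1 = v} using 4 with g
  constructor
  · rintro h ⟨w, l⟩ rfl
    exact congrArg l h
  · intro h
    rw [← sub_eq_zero, ← Module.forall_dual_apply_eq_zero_iff k]
    intro l
    rw [map_sub, sub_eq_zero]
    exact h (v, l) rfl

/-- The action map agrees with a morphism. -/
lemma exists_mor [FiniteDimensional k V] :
    ∃ F : GLn n k × V → V, Mor k F ∧ ∀ g ∈ G, ∀ v, F (g, v) = ρ g v := by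
  let b := Module.finBasis k V
  choose f hf hf' using fun i j => ρ.regular (b i) (b.coord j)
  refine ⟨fun p => ∑ i, ∑ j, (b.coord i p.2 * f i j p.1) • b j, ?_, fun g hg v => ?_⟩
  · exact Mor.sum _ fun i _ => Mor.sum _ fun j _ => Mor.smul
      (mul_mem (Mor.snd _ (dual_mem_reg (b.coord i))) (Mor.fst _ (hf i j))) (Mor.const _)
  · conv_rhs => rw [← b.sum_repr v, map_sum]
    refine Finset.sum_congr rfl fun i _ => ?_
    rw [map_smul]
    conv_rhs => rw [← b.sum_repr (ρ g (b i)), Finset.smul_sum]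
    refine Finset.sum_congr rfl fun j _ => ?_
    rw [← hf' i j g hg, smul_smul]
    rfl

/-- Orbit maps agree with morphisms. -/
lemma exists_orbit_mor [FiniteDimensional k V] (v : V) :
    ∃ F : GLn n k → V, Mor k F ∧ ∀ g ∈ G, F g = ρ g v := by
  obtain ⟨F, hF, hF'⟩ := ρ.exists_mor
  exact ⟨fun g => F (g, v), hF.comp (Mor.id.prodMk (Mor.const v)), fun g hg => hF' g hg v⟩

end RatRep

/-- The tautological representation. -/
noncomputable def stdRep (G : Subgroup (GLn n k)) : RatRep G (Fin n → k) where
  toFun g := Matrix.mulVecLin g.1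
  map_one := by simp; rfl
  map_mul g _ h _ := by simp [Matrix.mulVecLin_mul]; rfl
  regular := by
    refine regular_of_span (Pi.basisFun k (Fin n)).span_eq
      (S' := Set.range fun i => LinearMap.proj i)
      (span_dual_eq_top fun v hv => funext fun i => hv _ ⟨i, rfl⟩) ?_
    rintro _ ⟨j, rfl⟩ _ ⟨i, rfl⟩
    exact ⟨_, entry_mem i j, fun g _ => by simp⟩

/-! ### Function spaces, exterior powers and Chevalley's theorem -/

section Functions
variable {X : Type} [Aff k X] {G : Subgroup (GLn n k)} {A : X × GLn n k → X}

/-- Finitely many regular functions lie in a finite-dimensional stable space. -/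
lemma exists_stable_space (hA : Mor k A)
    (hmul : ∀ x, ∀ g ∈ G, ∀ h ∈ G, A (x, g * h) = A (A (x, g), h)) (h1 : ∀ x, A (x, 1) = x)
    (F : Finset (X → k)) (hF : ∀ f ∈ F, f ∈ reg k X) :
    ∃ E : Submodule k (X → k), FiniteDimensional k E ∧ E ≤ Subalgebra.toSubmodule (reg k X) ∧
      (∀ f ∈ F, f ∈ E) ∧ ∀ g ∈ G, ∀ f ∈ E, (fun x => f (A (x, g))) ∈ E := by
  choose! S hS hS' hSA using fun f (hf : f ∈ F) => exists_slice_space (hA f (hF f hf))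
  let E := Submodule.span k {e | ∃ f ∈ F, ∃ g ∈ G, e = fun x => f (A (x, g))}
  have hES : E ≤ ⨆ f ∈ F, S f := by
    refine Submodule.span_le.2 ?_
    rintro _ ⟨f, hf, g, hg, rfl⟩
    exact Submodule.mem_iSup_of_mem f (Submodule.mem_iSup_of_mem hf (hSA f hf g))
  have hfd : FiniteDimensional k (⨆ f ∈ F, S f : Submodule k (X → k)) := by
    rw [← Submodule.fg_iff_finiteDimensional]
    exact Submodule.fg_biSup F S hS
  refine ⟨E, Submodule.finiteDimensional_of_le hES, ?_, fun f hf => ?_, fun g hg f hf => ?_⟩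
  · exact hES.trans (iSup₂_le fun f hf => hS' f hf)
  · exact Submodule.subset_span ⟨f, hf, 1, one_mem G, by simp [h1]⟩
  · refine Submodule.span_induction (p := fun f _ => (fun x => f (A (x, g))) ∈ E) ?_ ?_ ?_ ?_ hf
    · rintro _ ⟨f, hf, h, hh, rfl⟩
      exact Submodule.subset_span ⟨f, hf, g * h, mul_mem hg hh, by simp [hmul _ g hg h hh]⟩
    · exact zero_mem E
    · exact fun a b _ _ ha hb => add_mem ha hb
    · exact fun c a _ ha => E.smul_mem c ha

/-- The representation on a stable space of regular functions. -/
noncomputable def fnRep (hA : Mor k A)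
    (hmul : ∀ x, ∀ g ∈ G, ∀ h ∈ G, A (x, g * h) = A (A (x, g), h)) (h1 : ∀ x, A (x, 1) = x)
    (E : Submodule k (X → k)) [FiniteDimensional k E] (hE : E ≤ Subalgebra.toSubmodule (reg k X))
    (hst : ∀ g ∈ G, ∀ f ∈ E, (fun x => f (A (x, g))) ∈ E) : RatRep G E where
  toFun g := E.retr ∘ₗ LinearMap.funLeft k k (fun x => A (x, g)) ∘ₗ E.subtype
  map_one := by
    refine LinearMap.ext fun f => ?_
    have : LinearMap.funLeft k k (fun x => A (x, 1)) f.1 = f.1 := funext fun x => by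
      simp [LinearMap.funLeft, h1]
    simp [this, E.retr_apply]
  map_mul g hg h hh := by
    refine LinearMap.ext fun f => Subtype.ext ?_
    have e1 : ∀ g ∈ G, ∀ f : E, (E.retr (LinearMap.funLeft k k (fun x => A (x, g)) f.1) : X → k) =
      fun x => f.1 (A (x, g)) := fun g hg f => E.coe_retr (hst g hg f.1 f.2)
    simp only [LinearMap.comp_apply, Submodule.subtype_apply, Module.End.mul_apply]
    rw [e1 g hg, e1 (g * h) (mul_mem hg hh), e1 h hh]
    funext x
    rw [hmul x g hg h hh]
  regular := by
    refine regular_of_span (S := Set.univ) (Submodule.span_univ)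
      (S' := Set.range fun x => LinearMap.proj x ∘ₗ E.subtype)
      (span_dual_eq_top fun v hv => Subtype.ext (funext fun i => hv _ ⟨i, rfl⟩)) ?_
    rintro f - _ ⟨x, rfl⟩
    refine ⟨fun g => f.1 (A (x, g)), (hA.comp ((Mor.const x).prodMk Mor.id)) f.1 (hE f.2),
      fun g hg => ?_⟩
    change (E.retr (LinearMap.funLeft k k (fun x => A (x, g)) f.1) : X → k) x = _
    exact congrFun (E.coe_retr (hst g hg f.1 f.2)) x

lemma fnRep_apply (hA : Mor k A)
    (hmul : ∀ x, ∀ g ∈ G, ∀ h ∈ G, A (x, g * h) = A (A (x, g), h)) (h1 : ∀ x, A (x, 1) = x)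
    (E : Submodule k (X → k)) [FiniteDimensional k E] (hE : E ≤ Subalgebra.toSubmodule (reg k X))
    (hst : ∀ g ∈ G, ∀ f ∈ E, (fun x => f (A (x, g))) ∈ E) {g : GLn n k} (hg : g ∈ G) (f : E) :
    (fnRep hA hmul h1 E hE hst g f : X → k) = fun x => f.1 (A (x, g)) :=
  E.coe_retr (hst g hg f.1 f.2)

end Functions

section Exterior
variable {V : Type} [AddCommGroup V] [Module k V]

lemma ιMulti_ne_zero_iff {d : ℕ} {v : Fin d → V} :
    exteriorPower.ιMulti k d v ≠ 0 ↔ LinearIndependent k v := by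
  constructor
  · intro h
    by_contra hv
    exact h (AlternatingMap.map_linearDependent _ v hv)
  · intro h
    have h1 := (exteriorPower.ιMulti_family_linearIndependent_field (n := d) h).ne_zero
      (Set.powersetCard.ofFinEmbEquiv (RelEmbedding.refl _))
    simpa [exteriorPower.ιMulti_family] using h1

/-- Exterior powers of a rational representation. -/
noncomputable def RatRep.ext {G : Subgroup (GLn n k)} [FiniteDimensional k V] (ρ : RatRep G V)
    (d : ℕ) : RatRep G (⋀[k]^d V) where
  toFun g := exteriorPower.map d (ρ g)
  map_one := by
    rw [ρ.map_one]
    exact exteriorPower.map_id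
  map_mul g hg h hh := by
    rw [ρ.map_mul g hg h hh]
    exact exteriorPower.map_comp (ρ h) (ρ g)
  regular := by
    let b := Module.finBasis k V
    refine regular_of_span (S := Set.range (exteriorPower.ιMulti k d))
      (exteriorPower.ιMulti_span k d V) (S' := Set.range (exteriorPower.ιMultiDual k d b))
      (span_dual_eq_top fun v hv => (b.exteriorPower d).ext_elem fun s => ?_) ?_
    · rw [exteriorPower.basis_repr_apply, hv _ ⟨s, rfl⟩, map_zero]; rfl
    · rintro _ ⟨v, rfl⟩ _ ⟨s, rfl⟩
      choose f hf hf' using fun (i : Fin d) (j : Fin d) => ρ.regular (v i)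
        (b.coord (Set.powersetCard.ofFinEmbEquiv.symm s j))
      refine ⟨fun g => (Matrix.of fun i j => f i j g).det, ?_, fun g hg => ?_⟩
      · have : (fun g : GLn n k => (Matrix.of fun i j => f i j g).det) =
            (Matrix.of fun i j => f i j).det := by
          funext g
          rw [Matrix.det_apply, Matrix.det_apply]
          simp [Finset.prod_apply]
        rw [this, Matrix.det_apply]
        refine sum_mem fun σ _ => ?_
        rw [Units.smul_def]
        exact zsmul_mem (prod_mem fun i _ => hf _ _) _
      · rw [exteriorPower.map_apply_ιMulti, exteriorPower.ιMultiDual_apply_ιMulti]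
        simp only [Function.comp_apply, hf' _ _ g hg]

/-- The stabilizer of a subspace as the stabilizer of a line in an exterior power. -/
lemma RatRep.ext_stab {G : Subgroup (GLn n k)} [FiniteDimensional k V] (ρ : RatRep G V)
    (W : Submodule k V) : ∃ v : ⋀[k]^(Module.finrank k W) V, v ≠ 0 ∧ ∀ g ∈ G,
      (∀ w ∈ W, ρ g w ∈ W) ↔ ∃ c : k, ρ.ext (Module.finrank k W) g v = c • v := by
  set d := Module.finrank k W
  let b := Module.finBasis k W
  have hb : LinearIndependent k (W.subtype ∘ b) := b.linearIndependent.map' _ W.ker_subtype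
  refine ⟨exteriorPower.ιMulti k d (W.subtype ∘ b), ιMulti_ne_zero_iff.2 hb, fun g hg => ?_⟩
  have hgi : LinearMap.ker (ρ g) = ⊥ :=
    LinearMap.ker_eq_bot'.2 fun v hv => (ρ.apply_eq_zero hg).1 hv
  change _ ↔ ∃ c : k, exteriorPower.map d (ρ g) _ = _
  simp only [exteriorPower.map_apply_ιMulti]
  constructor
  · intro h
    let T : W →ₗ[k] W := (ρ g).restrict h
    have h1 : Module.finrank k (⋀[k]^d W) = 1 := by
      rw [exteriorPower.finrank_eq, Nat.choose_self]
    obtain ⟨c, hc⟩ := exists_smul_eq_of_finrank_eq_one h1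
      (ιMulti_ne_zero_iff.2 b.linearIndependent) (exteriorPower.ιMulti k d (T ∘ b))
    refine ⟨c, ?_⟩
    have := congrArg (exteriorPower.map d W.subtype) hc
    rw [map_smul, exteriorPower.map_apply_ιMulti, exteriorPower.map_apply_ιMulti] at this
    exact this.symm
  · rintro ⟨c, hc⟩
    have hgb : LinearIndependent k (ρ g ∘ (W.subtype ∘ b)) := hb.map' _ hgi
    have hc0 : c ≠ 0 := by
      rintro rfl
      exact ιMulti_ne_zero_iff.2 hgb (by rw [hc, zero_smul])
    have key : ∀ i, ρ g (b i) ∈ W := by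
      intro i
      by_contra hcon
      have hli : LinearIndependent k (Fin.cons (ρ g (b i)) (W.subtype ∘ b) : Fin (d + 1) → V) := by
        refine linearIndependent_finCons.2 ⟨hb, fun hmem => hcon ?_⟩
        refine Submodule.span_le.2 ?_ hmem
        rintro _ ⟨j, rfl⟩
        exact (b j).2
      refine ιMulti_ne_zero_iff.2 hli (Subtype.ext ?_)
      have h0 : exteriorPower.ιMulti k (d + 1)
          (Fin.cons (ρ g (b i)) (ρ g ∘ (W.subtype ∘ b)) : Fin (d + 1) → V) = 0 :=
        AlternatingMap.map_eq_zero_of_eq _ _ (i := 0) (j := i.succ) (by simp)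
          (Fin.succ_ne_zero i).symm
      have h0' := congrArg Subtype.val h0
      have hc' := congrArg Subtype.val hc
      simp only [exteriorPower.ιMulti_apply_coe, ExteriorAlgebra.ιMulti_succ_apply,
        ZeroMemClass.coe_zero, Fin.cons_zero] at h0' hc' ⊢
      have e1 : ∀ u : Fin d → V, (Matrix.vecTail (Fin.cons (ρ g (b i)) u : Fin (d + 1) → V)) = u :=
        fun u => by ext; simp [Matrix.vecTail]
      rw [e1] at h0' ⊢
      rw [hc', Submodule.coe_smul, mul_smul_comm, smul_eq_zero] at h0'
      exact h0'.resolve_left hc0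
    intro w hw
    have := b.sum_repr ⟨w, hw⟩
    rw [← Subtype.coe_mk w hw, ← this]
    simp only [AddSubmonoidClass.coe_finsetSum, Submodule.coe_smul, map_sum, map_smul]
    exact sum_mem fun i _ => W.smul_mem _ (key i)

/-- Chevalley: a closed subgroup is the stabilizer of a line. -/
theorem exists_line {G : Subgroup (GLn n k)} (hG : IsClo G) :
    ∃ (V : Type) (_ : AddCommGroup V) (_ : Module k V) (_ : FiniteDimensional k V)
      (ρ : RatRep (⊤ : Subgroup (GLn n k)) V) (v : V), v ≠ 0 ∧
      ∀ g, g ∈ G ↔ ∃ c : k, ρ g v = c • v := by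
  let I : Ideal (reg k (GLn n k)) :=
    { carrier := {f | ∀ g ∈ G, f.1 g = 0}
      add_mem' := fun ha hb g hg => by simp [ha g hg, hb g hg]
      zero_mem' := fun g _ => rfl
      smul_mem' := fun c f hf g hg => by simp [hf g hg] }
  obtain ⟨F, hF⟩ := (isNoetherianRing_iff_ideal_fg _).1 inferInstance I
  classical
  let A : GLn n k × GLn n k → GLn n k := fun p => p.1 * p.2
  have hA : Mor k A := Mor.fst.mul Mor.snd
  have hmul : ∀ x, ∀ g ∈ (⊤ : Subgroup (GLn n k)), ∀ h ∈ (⊤ : Subgroup (GLn n k)),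
      A (x, g * h) = A (A (x, g), h) := fun x g _ h _ => (mul_assoc x g h).symm
  have h1 : ∀ x, A (x, 1) = x := fun x => mul_one x
  obtain ⟨E, hfd, hEr, hFE, hst⟩ := exists_stable_space hA hmul h1 (F.image Subtype.val)
    (by simp +contextual)
  let W : Submodule k E :=
    { carrier := {f | ∀ g ∈ G, f.1 g = 0}
      add_mem' := fun ha hb g hg => by simp [ha g hg, hb g hg]
      zero_mem' := fun g _ => rfl
      smul_mem' := fun c f hf g hg => by simp [hf g hg] }
  let ρ := fnRep hA hmul h1 E hEr hst
  obtain ⟨v, hv, hvs⟩ := ρ.ext_stab W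
  refine ⟨_, _, _, inferInstance, ρ.ext (Module.finrank k W), v, hv, fun g => ?_⟩
  rw [← hvs g trivial]
  have hρ : ∀ f x, (ρ g f).1 x = f.1 (x * g) := fun f x => by
    rw [fnRep_apply hA hmul h1 E hEr hst trivial]
  constructor
  · intro hg w hw x hx
    rw [hρ]
    exact hw _ (mul_mem hx hg)
  · intro h
    obtain ⟨S, hS, hGS⟩ := clo_iff.1 hG
    have hFg : ∀ f ∈ F, f.1 g = 0 := by
      intro f hf
      have hfI : f ∈ I := hF ▸ Submodule.subset_span hf
      have := h ⟨f.1, hFE _ (Finset.mem_image_of_mem _ hf)⟩ hfI 1 (one_mem G)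
      rwa [hρ, one_mul] at this
    have hIg : I ≤ RingHom.ker ((Pi.evalRingHom (fun _ : GLn n k => k) g).comp
        (reg k (GLn n k)).val.toRingHom) := by
      rw [← hF]
      exact Submodule.span_le.2 fun f hf => hFg f hf
    change g ∈ (G : Set (GLn n k))
    rw [hGS]
    intro f hf
    refine hIg (x := ⟨f, hS hf⟩) fun x hx => ?_
    have : x ∈ {x | ∀ f ∈ S, f x = 0} := hGS ▸ hx
    exact this f hf

end Exterior

open scoped commutatorElement

/-! ### The theorems of Burnside, Kolchin and Lie–Kolchin -/

section
variable {V : Type} [AddCommGroup V] [Module k V] [FiniteDimensional k V]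

/-- Burnside's theorem. -/
theorem burnside [Nontrivial V] (A : Subalgebra k (Module.End k V))
    (hA : ∀ U : Submodule k V, (∀ a ∈ A, ∀ u ∈ U, a u ∈ U) → U = ⊥ ∨ U = ⊤) : A = ⊤ := by
  have hs : IsSimpleModule A V := by
    rw [isSimpleModule_iff]
    refine { exists_pair_ne := ⟨⊥, ⊤, bot_ne_top⟩, eq_bot_or_eq_top := fun U => ?_ }
    have := hA (U.restrictScalars k) fun a ha u hu => U.smul_mem (⟨a, ha⟩ : A) hu
    rcases this with h | h
    · exact Or.inl ((Submodule.restrictScalars_eq_bot_iff k A V).1 h)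
    · exact Or.inr ((Submodule.restrictScalars_eq_top_iff k A V).1 h)
  have hsc : ∀ φ : Module.End A V, ∃ c : k, ∀ v, φ v = c • v := by
    intro φ
    obtain ⟨c, hc⟩ := Module.End.exists_eigenvalue (φ.restrictScalars k)
    obtain ⟨v, hv⟩ := hc.exists_hasEigenvector
    refine ⟨c, fun w => ?_⟩
    let E : Submodule k V := Module.End.eigenspace (φ.restrictScalars k) c
    rcases hA E fun a ha u hu => by
      rw [Module.End.mem_eigenspace_iff] at hu ⊢
      change φ u = c • u at hu
      change φ ((⟨a, ha⟩ : A) • u) = c • (a u)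
      rw [map_smul, hu]
      exact map_smul a c u with h | h
    · exact absurd ((Submodule.eq_bot_iff _).1 h v hv.1) hv.2
    · have : w ∈ E := h ▸ Submodule.mem_top
      exact Module.End.mem_eigenspace_iff.1 this
  refine (eq_top_iff).2 fun T _ => ?_
  let f : Module.End (Module.End A V) V :=
    { toFun := T
      map_add' := T.map_add
      map_smul' := fun φ v => by
        obtain ⟨c, hc⟩ := hsc φ
        change T (φ v) = φ (T v)
        rw [hc, hc, map_smul] }
  classical
  obtain ⟨a, ha⟩ := jacobson_density f (Finset.univ.image (Module.finBasis k V))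
  have : T = a.1 := (Module.finBasis k V).ext fun i => ha _ (by simp)
  rw [this]
  exact a.2

namespace RatRep
variable {G : Subgroup (GLn n k)} (ρ : RatRep G V)

/-- Irreducible representations. -/
def Simple {V : Type} [AddCommGroup V] [Module k V] (ρ : RatRep G V) : Prop :=
  Nontrivial V ∧ ∀ U, ρ.Stable U → U = ⊥ ∨ U = ⊤

lemma exists_simple_sub {W : Submodule k V} (hW : W ≠ ⊥) (hs : ρ.Stable W) :
    ∃ (U : Submodule k V) (hU : ρ.Stable U), U ≤ W ∧ (ρ.sub U hU).Simple := by
  obtain ⟨U, ⟨hU, hU0, hUW⟩, hmin⟩ := WellFounded.has_min (α := Submodule k V) wellFounded_lt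
    {U | ρ.Stable U ∧ U ≠ ⊥ ∧ U ≤ W} ⟨W, hs, hW, le_rfl⟩
  refine ⟨U, hU, hUW, (Submodule.nontrivial_iff_ne_bot).2 hU0, fun U' hU' => ?_⟩
  by_contra! hcon
  have hlt : U'.map U.subtype < U := by
    refine lt_of_le_of_ne (Submodule.map_subtype_le U U') fun he => hcon.2 ?_
    exact Submodule.map_injective_of_injective U.subtype_injective
      (he.trans (Submodule.map_subtype_top U).symm)
  refine hmin (U'.map U.subtype) ⟨?_, ?_, hlt.le.trans hUW⟩ hlt
  · rintro g hg _ ⟨u, hu, rfl⟩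
    exact ⟨_, hU' g hg u hu, ρ.sub_apply hU hg u⟩
  · intro h
    exact hcon.1 (Submodule.map_injective_of_injective U.subtype_injective
      (h.trans (Submodule.map_bot _).symm))

/-- Kolchin's theorem, for irreducible representations. -/
lemma Simple.eq_one {ρ : RatRep G V} (hρ : ρ.Simple) (h : ∀ g ∈ G, IsNilpotent (ρ g - 1))
    {g : GLn n k} (hg : g ∈ G) : ρ g = 1 := by
  have := hρ.1
  let M : Submonoid (Module.End k V) :=
    { carrier := {T | ∃ g ∈ G, ρ g = T}
      one_mem' := ⟨1, one_mem G, ρ.map_one⟩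
      mul_mem' := by
        rintro _ _ ⟨g, hg, rfl⟩ ⟨h, hh, rfl⟩
        exact ⟨g * h, mul_mem hg hh, ρ.map_mul g hg h hh⟩ }
  have htop : Algebra.adjoin k (M : Set (Module.End k V)) = ⊤ :=
    burnside _ fun U hU => hρ.2 U fun g hg u hu =>
      hU _ (Algebra.subset_adjoin ⟨g, hg, rfl⟩) u hu
  have htr : ∀ g ∈ G, LinearMap.trace k V (ρ g) = Module.finrank k V := by
    intro g hg
    have h1 := (LinearMap.isNilpotent_trace_of_isNilpotent (h g hg)).eq_zero
    rw [map_sub, sub_eq_zero] at h1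
    rw [h1]
    exact LinearMap.trace_one k V
  have hz : ∀ T : Module.End k V, LinearMap.trace k V ((ρ g - 1) * T) = 0 := by
    intro T
    have hT : T ∈ Submodule.span k (M : Set (Module.End k V)) := by
      have : T ∈ Subalgebra.toSubmodule (Algebra.adjoin k (M : Set (Module.End k V))) := by
        rw [htop]; exact Submodule.mem_top
      rwa [Algebra.adjoin_eq_span, Submonoid.closure_eq] at this
    induction hT using Submodule.span_induction with
    | mem T hT =>
      obtain ⟨x, hx, rfl⟩ := hT
      rw [sub_mul, one_mul, map_sub, ← ρ.map_mul g hg x hx, htr _ hx, htr _ (mul_mem hg hx), sub_self]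
    | zero => simp
    | add a b _ _ ha hb => rw [mul_add, map_add, ha, hb, add_zero]
    | smul c a _ ha => rw [mul_smul_comm, map_smul, ha, smul_zero]
  refine sub_eq_zero.1 (LinearMap.ext fun v => ?_)
  by_contra hv
  obtain ⟨l, hl⟩ : ∃ l : Module.Dual k V, l ((ρ g - 1) v) ≠ 0 := by
    by_contra! hcon
    exact hv ((Module.forall_dual_apply_eq_zero_iff k _).1 hcon)
  have := hz (l.smulRight v)
  rw [show (ρ g - 1) * l.smulRight v = l.smulRight ((ρ g - 1) v) from
    LinearMap.ext fun x => by simp, LinearMap.trace_smulRight] at this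
  exact hl this

/-- Kolchin's theorem. -/
theorem kolchin (h : ∀ g ∈ G, IsNilpotent (ρ g - 1)) [Nontrivial V] :
    ∃ v ≠ 0, ∀ g ∈ G, ρ g v = v := by
  obtain ⟨U, hU, -, hs⟩ := ρ.exists_simple_sub (W := ⊤) top_ne_bot fun _ _ _ _ => trivial
  have := hs.1
  obtain ⟨u, hu⟩ := exists_ne (0 : U)
  refine ⟨u, fun h => hu (Subtype.ext h), fun g hg => ?_⟩
  have h1 := hs.eq_one (fun g hg => ?_) hg
  · rw [← ρ.sub_apply hU hg u, h1]; rfl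
  · obtain ⟨m, hm⟩ := h g hg
    refine ⟨m, LinearMap.ext fun x => Subtype.ext ?_⟩
    have key : ∀ j, (((ρ.sub U hU g - 1 : Module.End k U) ^ j) x : V) =
        ((ρ g - 1 : Module.End k V) ^ j) x := by
      intro j
      induction j with
      | zero => rfl
      | succ j ih =>
        rw [pow_succ', pow_succ', Module.End.mul_apply, Module.End.mul_apply, ← ih]
        simp [ρ.sub_apply hU hg]
    rw [key m, hm]; rfl

end RatRep
end

/-- The derived series inside `GL_n`. -/
def dser (H : Subgroup (GLn n k)) : ℕ → Subgroup (GLn n k)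
  | 0 => H
  | m + 1 => ⁅dser H m, dser H m⁆

lemma dser_commutator (H : Subgroup (GLn n k)) (m : ℕ) : dser ⁅H, H⁆ m = dser H (m + 1) := by
  induction m with
  | zero => rfl
  | succ m ih => rw [dser, ih]; rfl

lemma dser_mono {H K : Subgroup (GLn n k)} (h : H ≤ K) (m : ℕ) : dser H m ≤ dser K m := by
  induction m with
  | zero => exact h
  | succ m ih => exact Subgroup.commutator_mono ih ih

lemma dser_le (H : Subgroup (GLn n k)) (m : ℕ) : dser H m ≤ H := by
  induction m with
  | zero => exact le_rfl
  | succ m ih =>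
    refine Subgroup.commutator_le.2 fun a ha b hb => ?_
    exact mul_mem (mul_mem (mul_mem (ih ha) (ih hb)) (inv_mem (ih ha))) (inv_mem (ih hb))

lemma dser_antitone (H : Subgroup (GLn n k)) {i j : ℕ} (h : i ≤ j) : dser H j ≤ dser H i := by
  induction h with
  | refl => exact le_rfl
  | step _ ih => exact (dser_le (dser H _) 1).trans ih

lemma isSolvable_iff_dser {H : Subgroup (GLn n k)} : IsSolvable H ↔ ∃ m, dser H m = ⊥ := by
  have key : ∀ m, (derivedSeries H m).map H.subtype = dser H m := by
    intro m
    induction m with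
    | zero => simp [dser, ← MonoidHom.range_eq_map]
    | succ m ih => rw [derivedSeries_succ, Subgroup.map_commutator, ih]; rfl
  change Group.IsSolvable H ↔ _
  rw [Group.isSolvable_def]
  refine exists_congr fun m => ?_
  rw [← key m, Subgroup.map_eq_bot_iff_of_injective _ H.subtype_injective]

/-- Commutator subgroups of irreducible subgroups are irreducible. -/
lemma irr_commutator {H : Subgroup (GLn n k)} (hH : IsIrr H) : IsIrr (⁅H, H⁆) := by
  have : idc ⁅H, H⁆ = ⁅H, H⁆ := by
    refine le_antisymm idc_le (Subgroup.commutator_le.2 fun a ha b hb => ?_)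
    refine subset_idc (C := (fun x => ⁅x, b⁆) '' H)
      (Irr.image (((Mor.id.mul (Mor.const b)).mul (Mor.inv Mor.id)).mul (Mor.const b⁻¹)) hH)
      ⟨1, one_mem H, by simp⟩ ?_ ⟨a, ha, rfl⟩
    rintro _ ⟨x, hx, rfl⟩
    exact Subgroup.commutator_mem_commutator hx hb
  rw [← this]
  exact irr_idc _

section
variable {V : Type} [AddCommGroup V] [Module k V] [FiniteDimensional k V]

lemma RatRep.Simple.scalar_of_comm {G : Subgroup (GLn n k)} {ρ : RatRep G V} (hρ : ρ.Simple)
    {T : V →ₗ[k] V} (hT : ∀ g ∈ G, ∀ v, T (ρ g v) = ρ g (T v)) : ∃ c : k, ∀ v, T v = c • v := by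
  have := hρ.1
  obtain ⟨c, hc⟩ := Module.End.exists_eigenvalue T
  obtain ⟨v, hv⟩ := hc.exists_hasEigenvector
  refine ⟨c, fun w => ?_⟩
  rcases hρ.2 (Module.End.eigenspace T c) fun g hg u hu => by
    rw [Module.End.mem_eigenspace_iff] at hu ⊢
    rw [hT g hg, hu, map_smul] with h | h
  · exact absurd ((Submodule.eq_bot_iff _).1 h v hv.1) hv.2
  · have : w ∈ Module.End.eigenspace T c := h ▸ Submodule.mem_top
    exact Module.End.mem_eigenspace_iff.1 this

lemma RatRep.det_eq_one {G : Subgroup (GLn n k)} (ρ : RatRep G V) {g : GLn n k}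
    (hg : g ∈ ⁅G, G⁆) : LinearMap.det (ρ g) = 1 := by
  let δ : G →* k :=
    { toFun := fun g => LinearMap.det (ρ g)
      map_one' := by
        change LinearMap.det (ρ.toFun 1) = 1
        rw [RatRep.map_one, _root_.map_one]
      map_mul' := fun a b => by
        change LinearMap.det (ρ.toFun (a * b)) = _
        rw [RatRep.map_mul ρ _ a.2 _ b.2, _root_.map_mul] }
  have h1 : ⁅G, G⁆ ≤ δ.ker.map G.subtype := by
    refine Subgroup.commutator_le.2 fun a ha b hb =>
      ⟨⁅(⟨a, ha⟩ : G), (⟨b, hb⟩ : G)⁆, ?_, rfl⟩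
    have hinv : ∀ x : G, δ x * δ x⁻¹ = 1 := fun x => by rw [← _root_.map_mul, mul_inv_cancel, _root_.map_one]
    change δ _ = 1
    simp only [commutatorElement_def, _root_.map_mul]
    linear_combination δ ⟨b, hb⟩ * δ ⟨b, hb⟩⁻¹ * hinv ⟨a, ha⟩ + hinv ⟨b, hb⟩
  obtain ⟨x, hx, rfl⟩ := h1 hg
  exact hx

/-- The Lie–Kolchin theorem. -/
theorem lie_kolchin {H : Subgroup (GLn n k)} (hH : IsIrr H)
    (hsol : IsSolvable H) (ρ : RatRep H V) [Nontrivial V] :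
    ∃ v ≠ 0, ∀ h ∈ H, ∃ c : k, ρ h v = c • v := by
  obtain ⟨m, hm⟩ := isSolvable_iff_dser.1 hsol
  clear hsol
  induction m generalizing H V with
  | zero =>
    obtain ⟨v, hv⟩ := exists_ne (0 : V)
    refine ⟨v, hv, fun h hh => ⟨1, ?_⟩⟩
    change H = ⊥ at hm
    rw [hm, Subgroup.mem_bot] at hh
    rw [hh, ρ.one_apply, one_smul]
  | succ m ih =>
    classical
    obtain ⟨U, hU, -, hs⟩ := ρ.exists_simple_sub (W := ⊤) top_ne_bot fun _ _ _ _ => trivial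
    suffices ∃ u : U, u ≠ 0 ∧ ∀ h ∈ H, ∃ c : k, ρ.sub U hU h u = c • u by
      obtain ⟨u, hu, h⟩ := this
      refine ⟨u, fun h => hu (Subtype.ext h), fun g hg => ?_⟩
      obtain ⟨c, hc⟩ := h g hg
      exact ⟨c, by rw [← ρ.sub_apply hU hg u, hc]; rfl⟩
    generalize ρ.sub U hU = σ at hs
    have := hs.1
    have hle : ⁅H, H⁆ ≤ H := dser_le H 1
    obtain ⟨v, hv, hχ⟩ := ih (irr_commutator hH) (σ.mono hle) (by rw [dser_commutator, hm])
    choose! χ hχ using hχ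
    simp only [RatRep.mono_toFun] at hχ
    obtain ⟨l, hl⟩ : ∃ l : Module.Dual k U, l v = 1 := by
      obtain ⟨l, hl⟩ : ∃ l : Module.Dual k U, l v ≠ 0 := by
        by_contra! hcon
        exact hv ((Module.forall_dual_apply_eq_zero_iff k _).1 hcon)
      exact ⟨(l v)⁻¹ • l, by simp [hl]⟩
    obtain ⟨f, hf, hf'⟩ := σ.regular v l
    have hχf : ∀ h ∈ ⁅H, H⁆, χ h = f h := fun h hh => by
      rw [← hf' h (hle hh), hχ h hh, map_smul, hl, smul_eq_mul, mul_one]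
    have hcomm : ∀ g ∈ H, ∀ h ∈ ⁅H, H⁆, g⁻¹ * h * g ∈ ⁅H, H⁆ := fun g hg h hh => by
      have : h⁻¹ * (g⁻¹ * h * g) = ⁅h⁻¹, g⁻¹⁆ := by simp [commutatorElement_def, mul_assoc]
      rw [← mul_inv_cancel_left h (g⁻¹ * h * g), this]
      exact mul_mem hh (Subgroup.commutator_mem_commutator (inv_mem (hle hh)) (inv_mem hg))
    have hconj : ∀ h ∈ ⁅H, H⁆, ∀ g ∈ H, χ (g⁻¹ * h * g) = χ h := by
      intro h hh g hg
      have hm : Mor k fun g : GLn n k => g⁻¹ * h * g :=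
        ((Mor.inv Mor.id).mul (Mor.const h)).mul Mor.id
      have := hH.const_of_finite (hm f hf) ?_ hg (one_mem H)
      · rw [hχf h hh, hχf _ (hcomm g hg h hh)]
        simpa using this
      · refine (Module.End.finite_hasEigenvalue (σ h)).subset ?_
        rintro _ ⟨x, hx, rfl⟩
        refine Module.End.hasEigenvalue_of_hasEigenvector (x := σ x v) ⟨?_, ?_⟩
        · rw [Module.End.mem_eigenspace_iff]
          change _ = f (x⁻¹ * h * x) • _
          rw [← hχf _ (hcomm x hx h hh), ← map_smul, ← hχ _ (hcomm x hx h hh),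
            ← σ.mul_apply (hle hh) hx, ← σ.mul_apply hx (hle (hcomm x hx h hh))]
          congr 2
          group
        · exact fun h0 => hv ((σ.apply_eq_zero hx).1 h0)
    have hscal : ∀ h ∈ ⁅H, H⁆, ∀ w, σ h w = χ h • w := by
      let E : Submodule k U :=
        { carrier := {w | ∀ h ∈ ⁅H, H⁆, σ h w = χ h • w}
          add_mem' := fun ha hb h hh => by rw [map_add, ha h hh, hb h hh, smul_add]
          zero_mem' := fun h _ => by simp
          smul_mem' := fun c x hx h hh => by rw [map_smul, hx h hh, smul_comm] }
      rcases hs.2 E fun g hg u hu h hh => by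
        have := hu _ (hcomm g hg h hh)
        rw [hconj h hh g hg] at this
        rw [← map_smul, ← this, ← σ.mul_apply (hle hh) hg, ← σ.mul_apply hg (hle (hcomm g hg h hh))]
        congr 2
        group with h | h
      · exact absurd ((Submodule.eq_bot_iff _).1 h v hχ) hv
      · intro h' hh w
        exact (h ▸ Submodule.mem_top : w ∈ E) h' hh
    have hχ1 : ∀ h ∈ ⁅H, H⁆, χ h = 1 := by
      intro h hh
      have hpow : ∀ h ∈ ⁅H, H⁆, (χ h) ^ Module.finrank k U = 1 := fun h hh => by
        rw [← σ.det_eq_one hh, show σ h = χ h • LinearMap.id from LinearMap.ext (hscal h hh),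
          LinearMap.det_smul, LinearMap.det_id, mul_one]
      have h1 := (irr_commutator hH).const_of_finite hf ?_ hh (one_mem _)
      · rw [hχf h hh, h1, ← hχf 1 (one_mem _)]
        have := hscal 1 (one_mem _) v
        rw [σ.one_apply] at this
        have h2 : (χ 1 - 1) • v = 0 := by rw [sub_smul, ← this, one_smul, sub_self]
        exact sub_eq_zero.1 ((smul_eq_zero.1 h2).resolve_right hv)
      · have hp : 0 < Module.finrank k U := Module.finrank_pos
        refine ((Polynomial.nthRoots (Module.finrank k U) (1 : k)).toFinset.finite_toSet).subset ?_
        rintro _ ⟨x, hx, rfl⟩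
        simp [Polynomial.mem_nthRoots hp, ← hχf x hx, hpow x hx]
    refine ⟨v, hv, fun h hh => ?_⟩
    obtain ⟨c, hc⟩ := hs.scalar_of_comm (T := σ h) fun g hg w => by
      have h1 := hscal ⁅h, g⁆ (Subgroup.commutator_mem_commutator hh hg) (σ (g * h) w)
      rw [hχ1 _ (Subgroup.commutator_mem_commutator hh hg), one_smul, ← σ.mul_apply
        (hle (Subgroup.commutator_mem_commutator hh hg)) (mul_mem hg hh)] at h1
      rw [← σ.mul_apply hh hg, ← σ.mul_apply hg hh, ← h1]
      congr 2
      simp [commutatorElement_def, mul_assoc]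
    exact ⟨c, hc v⟩

end

/-! ### Cones and fixed lines -/

section Cone
variable {V : Type} [AddCommGroup V] [Module k V] [FiniteDimensional k V]

/-- Hilbert's Nullstellensatz. -/
lemma exists_pow_mem {X : Type} [Aff k X] (J : Ideal (reg k X)) (m : reg k X)
    (h : ∀ x : X, (∀ f ∈ J, f.1 x = 0) → m.1 x = 0) : ∃ N, m ^ N ∈ J := by
  haveI := Aff.fg (k := k) (X := X)
  haveI : Algebra.FiniteType k (reg k X) := by
    rw [← Subalgebra.fg_iff_finiteType]; exact Aff.fg
  haveI : IsJacobsonRing (reg k X) := isJacobsonRing_of_finiteType (A := k)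
  change m ∈ J.radical
  rw [Ideal.radical_eq_jacobson, Ideal.jacobson, Submodule.mem_sInf]
  rintro M ⟨hJM, hM⟩
  obtain ⟨φ, hφ⟩ := exists_algHom_of_ne_top (k := k) hM.ne_top
  obtain ⟨x, hx⟩ := Aff.exists_point φ
  have hker : M = RingHom.ker φ := hM.eq_of_le (RingHom.ker_ne_top _) fun a ha => hφ a ha
  rw [hker]
  change φ m = 0
  rw [hx]
  exact h x fun f hf => by rw [← hx]; exact hφ f (hJM hf)

/-- The linear functions. -/
noncomputable def linFun (k : Type) [Field k] (V : Type) [AddCommGroup V] [Module k V] :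
    Submodule k (V → k) := LinearMap.range (LinearMap.ltoFun k V k k)

lemma pow_linFun_smul {d : ℕ} {f : V → k} (hf : f ∈ linFun k V ^ d) (t : k) (x : V) :
    f (t • x) = t ^ d * f x := by
  induction d generalizing f with
  | zero =>
    rw [pow_zero, Submodule.mem_one] at hf
    obtain ⟨c, rfl⟩ := hf
    simp
  | succ d ih =>
    rw [pow_succ] at hf
    induction hf using Submodule.mul_induction_on' with
    | mem_mul_mem f hf g hg =>
      obtain ⟨l, rfl⟩ := hg
      simp only [Pi.mul_apply, ih hf, LinearMap.ltoFun_apply, map_smul, smul_eq_mul]; ring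
    | add f _ g _ hf hg => simp only [Pi.add_apply, hf, hg]; ring

lemma exists_homogeneous_components {f : V → k} (hf : f ∈ reg k V) :
    ∃ q : ℕ →₀ (V → k), (∀ d, q d ∈ linFun k V ^ d) ∧ f = q.sum fun _ g => g := by
  have : f ∈ ⨆ d : ℕ, linFun k V ^ d := by
    have hf' : f ∈ Subalgebra.toSubmodule
        (Algebra.adjoin k (Set.range fun l : Module.Dual k V => (l : V → k))) := hf
    rw [Algebra.adjoin_eq_span] at hf'
    refine Submodule.span_le.2 ?_ hf'
    intro g hg
    suffices ∃ d : ℕ, g ∈ linFun k V ^ d by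
      obtain ⟨d, hd⟩ := this
      exact Submodule.mem_iSup_of_mem d hd
    induction hg using Submonoid.closure_induction with
    | mem g hg =>
      obtain ⟨l, rfl⟩ := hg
      exact ⟨1, by rw [pow_one]; exact ⟨l, rfl⟩⟩
    | one => exact ⟨0, by rw [pow_zero]; exact Submodule.one_le.1 le_rfl⟩
    | mul g h _ _ hg hh =>
      obtain ⟨d, hd⟩ := hg
      obtain ⟨e, he⟩ := hh
      exact ⟨d + e, by rw [pow_add]; exact Submodule.mul_mem_mul hd he⟩
  rw [Submodule.mem_iSup_iff_exists_finsupp] at this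
  obtain ⟨q, hq, rfl⟩ := this
  exact ⟨q, hq, rfl⟩

lemma exists_pow_eq_mul {X : Set V} (hX : Clo k X) (hc : ∀ (t : k), ∀ x ∈ X, t • x ∈ X)
    {l : Module.Dual k V} (hl : ∀ x ∈ X, l x = 0 → x = 0) (m : Module.Dual k V) :
    ∃ N, ∃ q ∈ linFun k V ^ N, ∀ x ∈ X, m x ^ (N + 1) = l x * q x := by
  let I : Ideal (reg k V) :=
    { carrier := {f | ∀ x ∈ X, f.1 x = 0}
      add_mem' := fun {f g} hf hg x hx => by simp [hf x hx, hg x hx]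
      zero_mem' := fun x _ => rfl
      smul_mem' := fun c f hf x hx => by simp [hf x hx] }
  let lr : reg k V := ⟨l, dual_mem_reg l⟩
  obtain ⟨N, hN⟩ := exists_pow_mem (I ⊔ Ideal.span {lr}) ⟨m, dual_mem_reg m⟩ (by
    intro x hx
    obtain ⟨S, hS, rfl⟩ := clo_iff.1 hX
    have hxX : x ∈ {x | ∀ f ∈ S, f x = 0} := fun f hf =>
      hx ⟨f, hS hf⟩ (Ideal.mem_sup_left fun y hy => hy f hf)
    have := hl x hxX (hx lr (Ideal.mem_sup_right (Ideal.subset_span rfl)))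
    simp [this])
  have hN' := Ideal.mul_mem_left _ ⟨m, dual_mem_reg m⟩ hN
  rw [← pow_succ', Submodule.mem_sup] at hN'
  obtain ⟨p, hp, r, hr, hpr⟩ := hN'
  obtain ⟨q, rfl⟩ := Ideal.mem_span_singleton'.1 hr
  obtain ⟨Q, hQ, hqQ⟩ := exists_homogeneous_components q.2
  refine ⟨N, Q N, hQ N, fun x hx => ?_⟩
  have key : ∀ y ∈ X, m y ^ (N + 1) = l y * q.1 y := fun y hy => by
    have := congrArg (fun f : reg k V => f.1 y) hpr
    simp only [Subalgebra.coe_add, Subalgebra.coe_mul, Pi.add_apply, Pi.mul_apply,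
      Subalgebra.coe_pow, Pi.pow_apply, hp y hy, zero_add] at this
    rw [← this, mul_comm]
  let P : Polynomial k := Polynomial.C (m x ^ (N + 1)) * Polynomial.X ^ (N + 1)
  let R : Polynomial k := Q.sum fun d f => Polynomial.C (l x * f x) * Polynomial.X ^ (d + 1)
  have hPR : P = R := by
    refine Polynomial.funext fun t => ?_
    have := key (t • x) (hc t x hx)
    rw [hqQ] at this
    simp only [P, R, Finsupp.sum, Polynomial.eval_finsetSum, Polynomial.eval_mul,
      Polynomial.eval_C, Polynomial.eval_pow, Polynomial.eval_X]
    simp only [map_smul, smul_eq_mul, Finsupp.sum, Finset.sum_apply, Finset.mul_sum] at this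
    rw [mul_comm, ← mul_pow, this]
    refine Finset.sum_congr rfl fun d _ => ?_
    rw [pow_linFun_smul (hQ d)]; ring
  have := congrArg (fun p => Polynomial.coeff p (N + 1)) hPR
  simp only [P, R, Finsupp.sum, Polynomial.finsetSum_coeff, Polynomial.coeff_C_mul,
    Polynomial.coeff_X_pow, add_left_inj] at this
  simp only [if_true, mul_one, mul_ite, mul_zero, Finset.sum_ite_eq] at this
  rw [this]
  split_ifs with h
  · rfl
  · simp [Finsupp.notMem_support_iff.1 h]

/-- A hyperplane section of a closed cone which avoids the origin at infinity is finite. -/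
theorem finite_slice {X : Set V} (hX : Clo k X) (hc : ∀ (t : k), ∀ x ∈ X, t • x ∈ X)
    {l : Module.Dual k V} (hl : ∀ x ∈ X, l x = 0 → x = 0) : {x | x ∈ X ∧ l x = 1}.Finite := by
  classical
  let S := {x | x ∈ X ∧ l x = 1}
  let r : (V → k) →ₐ[k] (S → k) := pull k (Subtype.val : S → V)
  let D : Submodule k (S → k) := (linFun k V).map r.toLinearMap
  have hmD : ∀ m : Module.Dual k V, (fun x : S => m x) ∈ D := fun m => ⟨m, ⟨m, rfl⟩, rfl⟩
  have h1 : (1 : S → k) ∈ D := by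
    convert hmD l using 1
    ext x; exact x.2.2.symm
  have hmono : ∀ {i j : ℕ}, i ≤ j → D ^ i ≤ D ^ j := fun {i j} h =>
    pow_le_pow_right' (Submodule.one_le.2 h1) h
  let b := Module.finBasis k (Module.Dual k V)
  have hb : D = Submodule.span k (Set.range fun i => (fun x : S => b i x)) := by
    refine le_antisymm ?_ (Submodule.span_le.2 ?_)
    · rintro _ ⟨_, ⟨m, rfl⟩, rfl⟩
      have : r.toLinearMap (LinearMap.ltoFun k V k k m) =
          ∑ i, b.repr m i • (fun x : S => b i x) := by
        ext x
        change m x = _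
        conv_lhs => rw [← b.sum_repr m]
        simp only [LinearMap.sum_apply, LinearMap.smul_apply, Finset.sum_apply, Pi.smul_apply]
      rw [this]
      exact Submodule.sum_mem _ fun i _ => Submodule.smul_mem _ _ (Submodule.subset_span ⟨i, rfl⟩)
    · rintro _ ⟨i, rfl⟩
      exact hmD (b i)
  have hpow : ∀ m : Module.Dual k V, ∃ N, (fun x : S => m x) ^ (N + 1) ∈ D ^ N := by
    intro m
    obtain ⟨N, q, hq, h⟩ := exists_pow_eq_mul hX hc hl m
    refine ⟨N, ?_⟩
    rw [← Submodule.map_pow]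
    refine ⟨q, hq, ?_⟩
    ext x
    change q x = m x ^ (N + 1)
    rw [h x x.2.1, x.2.2, one_mul]
  choose N hN using fun i => hpow (b i)
  have hmon : ∀ d, ∀ f ∈ (Set.range fun i => (fun x : S => b i x)) ^ d,
      ∃ a : Fin _ → ℕ, ∑ i, a i = d ∧ f = ∏ i, (fun x : S => b i x) ^ a i := by
    intro d
    induction d with
    | zero => intro f hf; exact ⟨0, by simp, by simpa using hf⟩
    | succ d ih =>
      intro f hf
      rw [pow_succ] at hf
      obtain ⟨g, hg, _, ⟨i, rfl⟩, rfl⟩ := hf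
      obtain ⟨a, ha, rfl⟩ := ih g hg
      refine ⟨a + Pi.single i 1, by simp [Finset.sum_add_distrib, ha], ?_⟩
      simp only [Pi.add_apply, pow_add, Finset.prod_mul_distrib]
      congr 1
      rw [Finset.prod_eq_single i] <;> simp +contextual
  have hstep : ∀ d, ∑ i, N i < d → D ^ d ≤ D ^ (d - 1) := by
    intro d hd
    conv_lhs => rw [hb, Submodule.span_pow]
    refine Submodule.span_le.2 fun f hf => ?_
    obtain ⟨a, ha, rfl⟩ := hmon d f hf
    obtain ⟨i, -, hi⟩ := Finset.exists_lt_of_sum_lt (ha ▸ hd)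
    rw [← Finset.mul_prod_erase _ _ (Finset.mem_univ i)]
    have h2 : ∏ j ∈ Finset.univ.erase i, (fun x : S => b j x) ^ a j ∈
        D ^ (∑ j ∈ Finset.univ.erase i, a j) := by
      induction Finset.univ.erase i using Finset.induction_on with
      | empty => rw [Finset.prod_empty, Finset.sum_empty, pow_zero]; exact Submodule.one_le.1 le_rfl
      | insert j s hj ih =>
        rw [Finset.prod_insert hj, Finset.sum_insert hj, pow_add]
        exact Submodule.mul_mem_mul (Submodule.pow_mem_pow _ (hmD _) _) ih
    have h3 : (fun x : S => b i x) ^ a i ∈ D ^ (a i - 1) := by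
      obtain ⟨c, hc⟩ := Nat.exists_eq_add_of_lt hi
      rw [show a i = N i + 1 + c by omega, pow_add, show N i + 1 + c - 1 = N i + c by omega,
        pow_add]
      exact Submodule.mul_mem_mul (hN i) (Submodule.pow_mem_pow _ (hmD _) _)
    have h4 := Submodule.mul_mem_mul h3 h2
    rw [← pow_add] at h4
    have := Finset.add_sum_erase Finset.univ a (Finset.mem_univ i)
    rwa [show d - 1 = a i - 1 + ∑ j ∈ Finset.univ.erase i, a j by omega]
  have hstab : ∀ d, D ^ d ≤ D ^ (∑ i, N i) := by
    intro d
    induction d with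
    | zero => exact hmono (Nat.zero_le _)
    | succ d ih =>
      rcases Nat.lt_or_ge (∑ i, N i) (d + 1) with h | h
      · exact (hstep _ h).trans ih
      · exact hmono h
  have hfg : (D ^ (∑ i, N i)).FG := by
    refine Submodule.FG.pow (Submodule.FG.map _ ?_) _
    exact (Module.finite_def.1 (inferInstance : Module.Finite k (V →ₗ[k] k))).map (LinearMap.ltoFun k V k k) |> fun h => by
      rwa [← LinearMap.range_eq_map] at h
  let A : Subalgebra k (S → k) := (D ^ (∑ i, N i)).toSubalgebra
    (hmono (Nat.zero_le _) (by rw [pow_zero]; exact Submodule.one_le.1 le_rfl))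
    (fun f g hf hg => by
      refine hstab (∑ i, N i + ∑ i, N i) ?_
      rw [pow_add]; exact Submodule.mul_mem_mul hf hg)
  have hval : ∀ m : Module.Dual k V, ((fun x => m x) '' S).Finite := by
    intro m
    obtain ⟨p, hp, hpm⟩ := IsIntegral.of_mem_of_fg A (by simpa [A] using hfg) (fun x : S => m x)
      (hstab 1 (by rw [pow_one]; exact hmD m))
    refine (p.roots.toFinset.finite_toSet).subset ?_
    rintro _ ⟨x, hx, rfl⟩
    have := congrArg (Pi.evalAlgHom k (fun _ : S => k) ⟨x, hx⟩) hpm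
    rw [← Polynomial.aeval_def, ← Polynomial.aeval_algHom_apply] at this
    simpa [Polynomial.mem_roots hp.ne_zero] using this
  refine Set.Finite.of_injOn (f := fun x i => b i x) (t := Set.pi Set.univ fun i => (fun x => b i x) '' S) ?_ ?_
    (Set.Finite.pi fun i => hval (b i))
  · intro x hx i _; exact ⟨x, hx, rfl⟩
  · intro x hx y hy hxy
    refine sub_eq_zero.1 ((Module.forall_dual_apply_eq_zero_iff k (x - y)).1 fun m => ?_)
    have h0 : Module.Dual.eval k V (x - y) = 0 := b.ext fun i => by
      simpa [sub_eq_zero] using congrFun hxy i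
    exact LinearMap.congr_fun h0 m

/-- Borel's fixed point theorem. -/
theorem exists_fixed_line {H : Subgroup (GLn n k)} (hH : IsIrr H)
    (hsol : IsSolvable H) (ρ : RatRep H V) {X : Set V} (hX : Clo k X)
    (hc : ∀ (t : k), ∀ x ∈ X, t • x ∈ X) (hs : ∀ h ∈ H, ∀ x ∈ X, ρ h x ∈ X)
    (hne : ∃ x ∈ X, x ≠ 0) : ∃ x ∈ X, x ≠ 0 ∧ ∀ h ∈ H, ∃ c : k, ρ h x = c • x := by
  suffices ∀ (d : ℕ) (V : Type) [AddCommGroup V] [Module k V] [FiniteDimensional k V]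
      (ρ : RatRep H V) (X : Set V) (_ : Clo k X) (_ : ∀ (t : k), ∀ x ∈ X, t • x ∈ X)
      (_ : ∀ h ∈ H, ∀ x ∈ X, ρ h x ∈ X) (_ : ∃ x ∈ X, x ≠ 0), Module.finrank k V = d →
      ∃ x ∈ X, x ≠ 0 ∧ ∀ h ∈ H, ∃ c : k, ρ h x = c • x from this _ V ρ X hX hc hs hne rfl
  clear hX hc hs hne X ρ
  intro d
  induction d using Nat.strong_induction_on with
  | _ d ih =>
  intro V _ _ _ ρ X hX hc hs hne hd
  obtain ⟨x₁, hx₁, hx₁0⟩ := hne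
  haveI : Nontrivial V := ⟨⟨x₁, 0, hx₁0⟩⟩
  obtain ⟨l, hl0, hl⟩ := lie_kolchin hH hsol ρ.dual
  choose! χ hχ using hl
  have hχ' : ∀ h ∈ H, ∀ v, l (ρ h⁻¹ v) = χ h * l v := fun h hh v => by
    rw [← ρ.dual_apply, hχ h hh]; rfl
  by_cases hA : ∃ x ∈ X, x ≠ 0 ∧ l x = 0
  · obtain ⟨x, hx, hx0, hlx⟩ := hA
    let U : Submodule k V := LinearMap.ker l
    have hU : ρ.Stable U := fun g hg v hv => by
      have := hχ' g⁻¹ (H.inv_mem hg) v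
      rw [inv_inv, LinearMap.mem_ker.1 hv, mul_zero] at this
      exact this
    have hlt : Module.finrank k U < d := by
      rw [← hd]
      refine Submodule.finrank_lt fun h => hl0 ?_
      exact LinearMap.ker_eq_top.1 h
    obtain ⟨y, hy, hy0, hyc⟩ := ih _ hlt U (ρ.sub U hU) (Subtype.val ⁻¹' X)
      (Clo.preimage (LinearMap.mor U.subtype) hX) (fun t y hy => hc t y hy)
      (fun h hh y hy => by
        change (ρ.sub U hU h y : V) ∈ X
        rw [ρ.sub_apply hU hh]; exact hs h hh y hy)
      ⟨⟨x, hlx⟩, hx, fun h => hx0 (congrArg Subtype.val h)⟩ rfl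
    refine ⟨y, hy, fun h => hy0 (Subtype.ext h), fun h hh => ?_⟩
    obtain ⟨c, hc⟩ := hyc h hh
    exact ⟨c, by rw [← ρ.sub_apply hU hh, hc]; rfl⟩
  · have hA' : ∀ x ∈ X, l x = 0 → x = 0 := fun x hx h => by
      by_contra h0; exact hA ⟨x, hx, h0, h⟩
    have hfin := finite_slice hX hc hA'
    have hlx : l x₁ ≠ 0 := fun h => hx₁0 (hA' x₁ hx₁ h)
    let x := (l x₁)⁻¹ • x₁
    have hxX : x ∈ X := hc _ _ hx₁
    have hx1 : l x = 1 := by simp [x, hlx]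
    have hslice : ∀ h ∈ H, χ h • ρ h x ∈ {x | x ∈ X ∧ l x = 1} := fun h hh => by
      refine ⟨hc _ _ (hs h hh x hxX), ?_⟩
      have := hχ' h hh (ρ h x)
      rw [ρ.inv_apply_self hh, hx1] at this
      simp [← this]
    have hfix : ∀ h ∈ H, χ h • ρ h x = x := by
      intro h hh
      refine sub_eq_zero.1 ((Module.forall_dual_apply_eq_zero_iff k _).1 fun m => ?_)
      obtain ⟨f₁, hf₁, h₁⟩ := ρ.dual.regular l (Module.Dual.eval k V x)
      obtain ⟨f₂, hf₂, h₂⟩ := ρ.regular x m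
      have hval : ∀ h ∈ H, (f₁ * f₂) h = m (χ h • ρ h x) := fun h hh => by
        rw [Pi.mul_apply, ← h₁ h hh, ← h₂ h hh, map_smul m, smul_eq_mul]
        congr 1
        rw [Module.Dual.eval_apply, hχ h hh]
        simp [hx1]
      have hconst := hH.const_of_finite (mul_mem hf₁ hf₂) ((hfin.image m).subset (by
        rintro _ ⟨g, hg, rfl⟩
        exact ⟨_, hslice g hg, (hval g hg).symm⟩)) hh H.one_mem
      rw [hval h hh, hval 1 H.one_mem, ρ.one_apply] at hconst
      have h1 : χ 1 = 1 := by
        have := hχ' 1 H.one_mem x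
        rw [inv_one, ρ.one_apply, hx1, mul_one] at this
        exact this.symm
      rw [map_sub, hconst, h1, one_smul, sub_self]
    refine ⟨x, hxX, fun h => by simp [h] at hx1, fun h hh => ⟨(χ h)⁻¹, ?_⟩⟩
    have hne : χ h ≠ 0 := fun h0 => by
      have := (hslice h hh).2
      simp [h0] at this
    rw [eq_inv_smul_iff₀ hne, hfix h hh]

end Cone

/-! ### Conjugacy of Borel subgroups -/

section

section Conj

/-- The conjugate subgroup `g H g⁻¹`. -/
def cj (g : GLn n k) (H : Subgroup (GLn n k)) : Subgroup (GLn n k) :=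
  H.map (MulAut.conj g).toMonoidHom

variable {g h : GLn n k} {H K : Subgroup (GLn n k)}

lemma mem_cj {x : GLn n k} : x ∈ cj g H ↔ g⁻¹ * x * g ∈ H := by
  constructor
  · rintro ⟨y, hy, rfl⟩
    simpa [mul_assoc] using hy
  · exact fun hx => ⟨_, hx, by simp [mul_assoc]⟩

lemma conj_mem_cj {x : GLn n k} (hx : x ∈ H) : g * x * g⁻¹ ∈ cj g H :=
  mem_cj.2 (by simpa [mul_assoc] using hx)

lemma cj_mul : cj (g * h) H = cj g (cj h H) := by
  ext x; simp only [mem_cj, mul_inv_rev, mul_assoc]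

lemma cj_one : cj 1 H = H := by ext x; simp [mem_cj]

lemma cj_inv_cj : cj g⁻¹ (cj g H) = H := by rw [← cj_mul, inv_mul_cancel, cj_one]

lemma cj_cj_inv : cj g (cj g⁻¹ H) = H := by rw [← cj_mul, mul_inv_cancel, cj_one]

lemma cj_mono (h : H ≤ K) : cj g H ≤ cj g K := Subgroup.map_mono h

lemma cj_le_iff : cj g H ≤ K ↔ H ≤ cj g⁻¹ K :=
  ⟨fun h => cj_inv_cj (g := g) (H := H) ▸ cj_mono h, fun h => cj_cj_inv (g := g) (H := K) ▸ cj_mono h⟩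

lemma cj_eq_self (hg : g ∈ H) : cj g H = H := by
  ext x
  rw [mem_cj, H.mul_mem_cancel_right hg, H.mul_mem_cancel_left (H.inv_mem hg)]

lemma coe_cj : (cj g H : Set (GLn n k)) = (fun x => g⁻¹ * x * g) ⁻¹' H := by
  ext x; exact mem_cj

lemma clo_cj (hH : IsClo H) : IsClo (cj g H) := by
  rw [IsClo, coe_cj]
  exact Clo.preimage (((Mor.const g⁻¹).mul Mor.id).mul (Mor.const g)) hH

lemma irr_cj (hH : IsIrr H) : IsIrr (cj g H) :=
  Irr.image (mor_conj g) hH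

lemma solvable_cj (hH : IsSolvable H) : IsSolvable (cj g H) := by
  have : Group.IsSolvable H := hH
  exact Group.isSolvable_of_surjective (f := (MulAut.conj g).toMonoidHom.subgroupMap H)
    (MonoidHom.subgroupMap_surjective _ _)

lemma solvable_mono (h : K ≤ H) (hH : IsSolvable H) : IsSolvable K := by
  obtain ⟨m, hm⟩ := isSolvable_iff_dser.1 hH
  exact isSolvable_iff_dser.2 ⟨m, le_bot_iff.1 (hm ▸ dser_mono h m)⟩

/-- A closed subgroup is not conjugate to a proper subgroup of itself. -/
lemma cj_eq_of_le (hH : IsClo H) (h : cj g H ≤ H) : cj g H = H := by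
  obtain ⟨C, -, ⟨i, rfl⟩, hmin⟩ := exists_minimal_clo (k := k)
    (fun C : Set (GLn n k) => ∃ i : ℕ, C = cj (g ^ i) H) ⟨H, hH, 0, by rw [pow_zero, cj_one]⟩
  have h1 := hmin (cj (g ^ (i + 1)) H) (clo_cj hH) ⟨i + 1, rfl⟩
    (by rw [pow_succ, cj_mul]; exact cj_mono h)
  rw [SetLike.coe_set_eq, pow_succ, cj_mul] at h1
  rw [← cj_inv_cj (g := g ^ i) (H := cj g H), h1, cj_inv_cj]

end Conj

variable {G : Subgroup (GLn n k)} {V : Type} [AddCommGroup V] [Module k V]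

/-- The stabiliser of a line. -/
def RatRep.lineStab (ρ : RatRep G V) (v : V) : Subgroup (GLn n k) where
  carrier := {g | g ∈ G ∧ ∃ c : k, ρ g v = c • v}
  one_mem' := ⟨G.one_mem, 1, by rw [ρ.one_apply, one_smul]⟩
  mul_mem' := by
    rintro g h ⟨hg, c, hc⟩ ⟨hh, d, hd⟩
    exact ⟨G.mul_mem hg hh, d * c, by rw [ρ.mul_apply hg hh, hd, map_smul, hc, mul_smul]⟩
  inv_mem' := by
    rintro g ⟨hg, c, hc⟩
    refine ⟨G.inv_mem hg, ?_⟩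
    by_cases h0 : c = 0
    · rw [h0, zero_smul, ρ.apply_eq_zero hg] at hc
      exact ⟨0, by simp [hc]⟩
    · refine ⟨c⁻¹, ?_⟩
      rw [eq_inv_smul_iff₀ h0, ← map_smul, ← hc, ρ.inv_apply_self hg]

lemma RatRep.mem_lineStab {ρ : RatRep G V} {v : V} {g : GLn n k} :
    g ∈ ρ.lineStab v ↔ g ∈ G ∧ ∃ c : k, ρ g v = c • v := Iff.rfl

lemma RatRep.clo_lineStab [FiniteDimensional k V] (ρ : RatRep G V) (hG : IsClo G) (v : V) :
    IsClo (ρ.lineStab v) := by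
  convert ρ.clo_stab hG (Submodule.span k {v}) using 1
  ext g
  refine and_congr_right fun _ => ⟨?_, fun h => ?_⟩
  · rintro ⟨c, hc⟩ w hw
    obtain ⟨d, rfl⟩ := Submodule.mem_span_singleton.1 hw
    rw [map_smul, hc]
    exact Submodule.smul_mem _ _ (Submodule.smul_mem _ _ (Submodule.mem_span_singleton_self v))
  · obtain ⟨c, hc⟩ := Submodule.mem_span_singleton.1 (h v (Submodule.mem_span_singleton_self v))
    exact ⟨c, hc.symm⟩

/-- The closed cone over an orbit. -/
def RatRep.cone (ρ : RatRep G V) [FiniteDimensional k V] (v : V) : Set V :=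
  closure[zar k V] {w | ∃ (t : k), ∃ g ∈ G, w = t • ρ g v}

lemma closure_sub {X : Type} [Aff k X] {C D : Set X} (h : C ⊆ D) (hD : Clo k D) :
    closure[zar k X] C ⊆ D := by
  letI := zar k X
  exact closure_minimal h hD

lemma mem_reg_scalar {f : k → k} : f ∈ reg k k ↔ ∃ P : Polynomial k, ∀ t, f t = P.eval t := by
  constructor
  · intro hf
    change f ∈ Algebra.adjoin k (Set.range fun l : Module.Dual k k => (l : k → k)) at hf
    induction hf using Algebra.adjoin_induction with
    | mem f hf =>
      obtain ⟨l, rfl⟩ := hf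
      refine ⟨Polynomial.C (l 1) * Polynomial.X, fun t => ?_⟩
      have := l.map_smul t 1
      simp only [smul_eq_mul, mul_one] at this
      change l t = _
      rw [this, Polynomial.eval_mul, Polynomial.eval_C, Polynomial.eval_X, mul_comm]
    | algebraMap c => exact ⟨Polynomial.C c, fun t => by simp⟩
    | add f g _ _ hf hg =>
      obtain ⟨P, hP⟩ := hf
      obtain ⟨Q, hQ⟩ := hg
      exact ⟨P + Q, fun t => by simp [hP, hQ]⟩
    | mul f g _ _ hf hg =>
      obtain ⟨P, hP⟩ := hf
      obtain ⟨Q, hQ⟩ := hg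
      exact ⟨P * Q, fun t => by simp [hP, hQ]⟩
  · rintro ⟨P, hP⟩
    have hf : f = Polynomial.aeval (fun t : k => t) P := by
      ext t
      rw [hP]
      simp
    rw [hf]
    exact Algebra.adjoin_le (Set.singleton_subset_iff.2 (dual_mem_reg LinearMap.id))
      (Polynomial.aeval_mem_adjoin_singleton k _)

lemma irr_scalar : Irr k (Set.univ : Set k) := by
  rw [irr_iff]
  refine ⟨Set.univ_nonempty, fun f hf g hg h => ?_⟩
  obtain ⟨P, hP⟩ := mem_reg_scalar.1 hf
  obtain ⟨Q, hQ⟩ := mem_reg_scalar.1 hg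
  have : P * Q = 0 := Polynomial.funext fun t => by
    simpa [hP, hQ] using h t trivial
  rcases mul_eq_zero.1 this with h | h
  · exact Or.inl fun t _ => by simp [hP, h]
  · exact Or.inr fun t _ => by simp [hQ, h]

section Cone
variable [FiniteDimensional k V] (ρ : RatRep G V) (v : V)

lemma RatRep.clo_cone : Clo k (ρ.cone v) := @isClosed_closure _ (zar k V) _

lemma RatRep.mem_cone (t : k) {g : GLn n k} (hg : g ∈ G) : t • ρ g v ∈ ρ.cone v :=
  @subset_closure _ (zar k V) _ _ ⟨t, g, hg, rfl⟩

lemma RatRep.self_mem_cone : v ∈ ρ.cone v := by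
  simpa [ρ.one_apply] using ρ.mem_cone v 1 G.one_mem

lemma RatRep.cone_smul (t : k) {w : V} (hw : w ∈ ρ.cone v) : t • w ∈ ρ.cone v := by
  have h : Clo k ((fun w : V => t • w) ⁻¹' ρ.cone v) :=
    Clo.preimage (LinearMap.mor (t • LinearMap.id)) (ρ.clo_cone v)
  refine closure_sub (k := k) (C := {w | ∃ (t : k), ∃ g ∈ G, w = t • ρ g v}) ?_ h hw
  rintro _ ⟨s, g, hg, rfl⟩
  change t • s • ρ g v ∈ ρ.cone v
  rw [smul_smul]
  exact ρ.mem_cone v _ hg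

lemma RatRep.cone_stable {g : GLn n k} (hg : g ∈ G) {w : V} (hw : w ∈ ρ.cone v) :
    ρ g w ∈ ρ.cone v := by
  have h : Clo k (ρ g ⁻¹' ρ.cone v) := Clo.preimage (LinearMap.mor (ρ g)) (ρ.clo_cone v)
  refine closure_sub (k := k) (C := {w | ∃ (t : k), ∃ g ∈ G, w = t • ρ g v}) ?_ h hw
  rintro _ ⟨s, h, hh, rfl⟩
  change ρ g (s • ρ h v) ∈ ρ.cone v
  rw [map_smul, ← ρ.mul_apply hg hh]
  exact ρ.mem_cone v _ (G.mul_mem hg hh)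

lemma RatRep.cone_subset {X : Set V} (hX : Clo k X) (hc : ∀ (t : k), ∀ x ∈ X, t • x ∈ X)
    (hs : ∀ g ∈ G, ∀ x ∈ X, ρ g x ∈ X) (hv : v ∈ X) : ρ.cone v ⊆ X := by
  refine closure_sub ?_ hX
  rintro _ ⟨t, g, hg, rfl⟩
  exact hc _ _ (hs g hg v hv)

lemma RatRep.exists_cone_mor : ∃ F : GLn n k × k → V, Mor k F ∧
    (∀ g ∈ G, ∀ t, F (g, t) = t • ρ g v) ∧
    F '' ((G : Set (GLn n k)) ×ˢ Set.univ) = {w | ∃ (t : k), ∃ g ∈ G, w = t • ρ g v} := by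
  obtain ⟨F, hF, h⟩ := ρ.exists_orbit_mor v
  refine ⟨fun p => p.2 • F p.1, Mor.smul (mor_scalar_iff.1 Mor.snd) (hF.comp Mor.fst),
    fun g hg t => by simp only [h g hg], ?_⟩
  ext w
  constructor
  · rintro ⟨⟨g, t⟩, ⟨hg, -⟩, rfl⟩
    exact ⟨t, g, hg, by simp only [h g hg]⟩
  · rintro ⟨t, g, hg, rfl⟩
    exact ⟨(g, t), ⟨hg, trivial⟩, by simp only [h g hg]⟩

lemma RatRep.irr_cone (hG : IsIrr G) : Irr k (ρ.cone v) := by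
  obtain ⟨F, hF, -, h⟩ := ρ.exists_cone_mor v
  rw [RatRep.cone, ← h]
  exact ((hG.prod irr_scalar).image hF).closure

lemma RatRep.cone_exists_open (hG : IsClo G) (hI : IsIrr G) :
    ∃ p ∈ reg k V, (∃ w ∈ ρ.cone v, p w ≠ 0) ∧
      ∀ w ∈ ρ.cone v, p w ≠ 0 → ∃ (t : k), ∃ g ∈ G, w = t • ρ g v := by
  obtain ⟨F, hF, -, h⟩ := ρ.exists_cone_mor v
  have hclo : Clo k ((G : Set (GLn n k)) ×ˢ (Set.univ : Set k)) := by
    rw [Set.prod_univ]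
    exact Clo.preimage Mor.fst hG
  obtain ⟨p, hp, ⟨x, hx, hpx⟩, hp2⟩ := exists_open_image hF hclo (hI.prod irr_scalar)
  rw [h] at hp2
  refine ⟨p, hp, ⟨F x, ?_, hpx⟩, hp2⟩
  have : F x ∈ {w | ∃ (t : k), ∃ g ∈ G, w = t • ρ g v} := h ▸ Set.mem_image_of_mem F hx
  exact @subset_closure _ (zar k V) _ _ this

/-- There is a closed cone all of whose nonzero points form a single orbit up to scalars. -/
lemma RatRep.exists_minimal_cone [Nontrivial V] (hG : IsClo G) (hI : IsIrr G) :
    ∃ x : V, x ≠ 0 ∧ ∀ w ∈ ρ.cone x, w ≠ 0 → ∃ (t : k), ∃ g ∈ G, w = t • ρ g x := by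
  obtain ⟨X, hX, ⟨hc, hs, x, hx, hx0⟩, hmin⟩ := exists_minimal_clo (k := k)
    (fun X : Set V => (∀ (t : k), ∀ x ∈ X, t • x ∈ X) ∧ (∀ g ∈ G, ∀ x ∈ X, ρ g x ∈ X) ∧
      ∃ x ∈ X, x ≠ 0)
    ⟨Set.univ, @isClosed_univ _ (zar k V), fun _ _ _ => trivial, fun _ _ _ _ => trivial,
      (exists_ne (0 : V)).imp fun x hx => ⟨trivial, hx⟩⟩
  have hcone : ∀ y ∈ X, y ≠ 0 → ρ.cone y = X := fun y hy hy0 =>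
    hmin _ (ρ.clo_cone y) ⟨fun t _ => ρ.cone_smul y t, fun g hg _ => ρ.cone_stable y hg,
      y, ρ.self_mem_cone y, hy0⟩ (ρ.cone_subset y hX hc hs hy)
  refine ⟨x, hx0, fun y hy hy0 => ?_⟩
  obtain ⟨p, hp, ⟨w, hw, hpw⟩, hp2⟩ := ρ.cone_exists_open x hG hI
  rw [hcone x hx hx0] at hy
  obtain ⟨l, hl⟩ : ∃ l : Module.Dual k V, l y ≠ 0 := by
    by_contra! h
    exact hy0 ((Module.forall_dual_apply_eq_zero_iff k y).1 h)
  rw [hcone x hx hx0, ← hcone y hy hy0] at hw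
  obtain ⟨z, hz, hpz, hlz⟩ := (ρ.irr_cone y hI).exists_ne hp (dual_mem_reg l) hw
    (ρ.self_mem_cone y) hpw hl
  have hplreg : p * l ∈ reg k V := mul_mem hp (dual_mem_reg l)
  obtain ⟨_, ⟨t, g, hg, rfl⟩, hz'⟩ : ∃ z ∈ {w | ∃ (t : k), ∃ g ∈ G, w = t • ρ g y},
      (p * l) z ≠ 0 := by
    by_contra! h
    exact mul_ne_zero hpz hlz (mem_closure.1 hz _ hplreg h)
  obtain ⟨hp', hl'⟩ := mul_ne_zero_iff.1 hz'
  have ht : t ≠ 0 := fun h => hl' (by simp [h])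
  obtain ⟨s, g', hg', h⟩ := hp2 _ (by
    rw [hcone x hx hx0, ← hcone y hy hy0]; exact ρ.mem_cone y t hg) hp'
  refine ⟨t⁻¹ * s, g⁻¹ * g', G.mul_mem (G.inv_mem hg) hg', ?_⟩
  rw [ρ.mul_apply (G.inv_mem hg) hg', mul_smul, ← map_smul, ← h, map_smul, ρ.inv_apply_self hg,
    inv_smul_smul₀ ht]

end Cone

lemma commutator_trivial {H : Subgroup (GLn n k)} {ρ : RatRep G V} (hHG : H ≤ G)
    {F F' : Submodule k V} (hF : ∀ g ∈ H, ∀ v ∈ F, ρ g v = v)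
    (hF' : ∀ g ∈ H, ∀ v ∈ F', ρ g v - v ∈ F) : ∀ g ∈ ⁅H, H⁆, ∀ v ∈ F', ρ g v = v := by
  intro g hg v hv
  let S : Subgroup (GLn n k) :=
    { carrier := {g | g ∈ G ∧ ρ g v = v}
      one_mem' := ⟨G.one_mem, ρ.one_apply v⟩
      mul_mem' := fun {a b} ha hb => ⟨G.mul_mem ha.1 hb.1, by
        rw [ρ.mul_apply ha.1 hb.1, hb.2, ha.2]⟩
      inv_mem' := fun {a} ha => ⟨G.inv_mem ha.1, by
        conv_lhs => rw [← ha.2]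
        exact ρ.inv_apply_self ha.1 v⟩ }
  have key : ∀ a ∈ H, ∀ b ∈ H, ρ (a * b) v = ρ a v + ρ b v - v := by
    intro a ha b hb
    have h1 := hF a ha _ (hF' b hb v hv)
    rw [map_sub] at h1
    rw [ρ.mul_apply (hHG ha) (hHG hb), sub_eq_iff_eq_add.1 h1]
    abel
  suffices ⁅H, H⁆ ≤ S from (this hg).2
  rw [Subgroup.commutator_le]
  intro a ha b hb
  have haG := hHG ha
  have hbG := hHG hb
  refine ⟨G.mul_mem (G.mul_mem (G.mul_mem haG hbG) (G.inv_mem haG)) (G.inv_mem hbG), ?_⟩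
  have hinv : ∀ a ∈ H, ρ a⁻¹ v = v + v - ρ a v := by
    intro a ha
    have := key a ha a⁻¹ (H.inv_mem ha)
    rw [mul_inv_cancel, ρ.one_apply] at this
    rw [eq_sub_iff_add_eq, add_comm, ← sub_eq_iff_eq_add, ← this]
  rw [commutatorElement_def, key _ (H.mul_mem (H.mul_mem ha hb) (H.inv_mem ha)) _ (H.inv_mem hb),
    key _ (H.mul_mem ha hb) _ (H.inv_mem ha), key a ha b hb, hinv a ha, hinv b hb]
  abel

lemma commutator_eigen {H : Subgroup (GLn n k)} (ρ : RatRep G V) (hHG : H ≤ G) {v : V}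
    (hv : ∀ g ∈ H, ∃ c : k, ρ g v = c • v) : ∀ g ∈ ⁅H, H⁆, ρ g v = v := by
  intro g hg
  by_cases hv0 : v = 0
  · rw [hv0, map_zero]
  choose! c hc using hv
  have hmul : ∀ a ∈ H, ∀ b ∈ H, c (a * b) = c a * c b := by
    intro a ha b hb
    have := hc _ (H.mul_mem ha hb)
    rw [ρ.mul_apply (hHG ha) (hHG hb), hc b hb, map_smul, hc a ha, smul_smul] at this
    rw [← smul_left_injective k hv0 this, mul_comm]
  have hone : c 1 = 1 := by
    have := hc 1 H.one_mem
    rw [ρ.one_apply] at this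
    exact smul_left_injective k hv0 (by simpa using this.symm)
  let S : Subgroup (GLn n k) :=
    { carrier := {g | g ∈ H ∧ c g = 1}
      one_mem' := ⟨H.one_mem, hone⟩
      mul_mem' := fun {a b} ha hb => ⟨H.mul_mem ha.1 hb.1, by
        rw [hmul a ha.1 b hb.1, ha.2, hb.2, mul_one]⟩
      inv_mem' := fun {a} ha => ⟨H.inv_mem ha.1, by
        have := hmul a ha.1 a⁻¹ (H.inv_mem ha.1)
        rwa [mul_inv_cancel, hone, ha.2, one_mul, eq_comm] at this⟩ }
  have : ⁅H, H⁆ ≤ S := by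
    rw [Subgroup.commutator_le]
    intro a ha b hb
    have ha' := hmul a ha a⁻¹ (H.inv_mem ha)
    have hb' := hmul b hb b⁻¹ (H.inv_mem hb)
    rw [mul_inv_cancel, hone] at ha' hb'
    refine ⟨H.mul_mem (H.mul_mem (H.mul_mem ha hb) (H.inv_mem ha)) (H.inv_mem hb), ?_⟩
    rw [commutatorElement_def, hmul _ (H.mul_mem (H.mul_mem ha hb) (H.inv_mem ha)) _ (H.inv_mem hb),
      hmul _ (H.mul_mem ha hb) _ (H.inv_mem ha), hmul a ha b hb,
      mul_right_comm (c a), ← ha', one_mul, ← hb']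
  obtain ⟨hgH, hg1⟩ := this hg
  rw [hc g hgH, hg1, one_smul]

lemma mem_dser_trivial {H : Subgroup (GLn n k)} {m : ℕ}
    (h : ∀ g ∈ dser H m, ∀ v, stdRep H g v = v) : IsSolvable H := by
  refine isSolvable_iff_dser.2 ⟨m, le_bot_iff.1 fun g hg => ?_⟩
  rw [Subgroup.mem_bot]
  ext i j
  have := congrFun (h g hg (Pi.single j 1)) i
  simpa [stdRep, Matrix.one_apply, Pi.single_apply] using this

/-- Existence of a Borel subgroup into which every connected solvable subgroup is conjugate. -/
theorem exists_borel_aux (G : Subgroup (GLn n k)) (hG : IsClo G) (hI : IsIrr G) :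
    ∃ B ≤ G, IsClo B ∧ IsIrr B ∧ IsSolvable B ∧
      ∀ H ≤ G, IsIrr H → IsSolvable H → ∃ g ∈ G, cj g H ≤ B := by
  suffices ∀ (d : ℕ) (G : Subgroup (GLn n k)) (F : Submodule k (Fin n → k)) (m : ℕ),
      IsClo G → IsIrr G → (stdRep G).Stable F →
      (∀ g ∈ dser G m, ∀ v ∈ F, stdRep G g v = v) →
      Module.finrank k ((Fin n → k) ⧸ F) = d →
      ∃ B ≤ G, IsClo B ∧ IsIrr B ∧ IsSolvable B ∧
      ∀ H ≤ G, IsIrr H → IsSolvable H → ∃ g ∈ G, cj g H ≤ B from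
    this _ G ⊥ 0 hG hI (fun g _ v hv => by rw [(Submodule.mem_bot k).1 hv, map_zero]; exact zero_mem _)
      (fun g _ v hv => by rw [(Submodule.mem_bot k).1 hv, map_zero]) rfl
  clear hG hI G
  intro d
  induction d using Nat.strong_induction_on with
  | _ d ih =>
  intro G F m hG hI hF hm hd
  by_cases htop : F = ⊤
  · refine ⟨G, le_rfl, hG, hI, mem_dser_trivial (m := m) fun g hg v => hm g hg v (htop ▸ trivial),
      fun H hH _ _ => ⟨1, G.one_mem, by rwa [cj_one]⟩⟩
  haveI : Nontrivial ((Fin n → k) ⧸ F) := Submodule.Quotient.nontrivial_iff.2 htop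
  let ρ := (stdRep G).quot F hF
  obtain ⟨x, hx0, hx⟩ := ρ.exists_minimal_cone hG hI
  let G₁ := idc (ρ.lineStab x)
  have hG₁ : G₁ ≤ G := idc_le.trans fun g hg => hg.1
  obtain ⟨y, rfl⟩ := F.mkQ_surjective x
  let F' := F ⊔ Submodule.span k {y}
  have hline : ∀ g ∈ G₁, ∃ c : k, stdRep G g y - c • y ∈ F := by
    intro g hg
    obtain ⟨hgG, c, hc⟩ := idc_le hg
    refine ⟨c, ?_⟩
    rwa [(stdRep G).quot_apply hF hgG, ← map_smul, ← sub_eq_zero, ← map_sub, Submodule.mkQ_apply,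
      Submodule.Quotient.mk_eq_zero] at hc
  have hF' : (stdRep G₁).Stable F' := by
    intro g hg v hv
    obtain ⟨a, ha, b, hb, rfl⟩ := Submodule.mem_sup.1 hv
    obtain ⟨t, rfl⟩ := Submodule.mem_span_singleton.1 hb
    rw [map_add, map_smul]
    refine F'.add_mem (Submodule.mem_sup_left (hF g (hG₁ hg) a ha)) (F'.smul_mem _ ?_)
    obtain ⟨c, hc⟩ := hline g hg
    rw [show stdRep G₁ g y = (stdRep G g y - c • y) + c • y by
      rw [sub_add_cancel]; rfl]
    exact F'.add_mem (Submodule.mem_sup_left hc)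
      (F'.smul_mem _ (Submodule.mem_sup_right (Submodule.mem_span_singleton_self y)))
  have hcomm : ∀ g ∈ dser G₁ 1, ∀ v ∈ F', stdRep G g v - v ∈ F := by
    intro g hg v hv
    obtain ⟨a, ha, b, hb, rfl⟩ := Submodule.mem_sup.1 hv
    obtain ⟨t, rfl⟩ := Submodule.mem_span_singleton.1 hb
    have hgG := hG₁ (dser_le _ _ hg)
    rw [← Submodule.Quotient.mk_eq_zero, ← Submodule.mkQ_apply, map_sub,
      ← (stdRep G).quot_apply hF hgG, map_add, map_smul, Submodule.mkQ_apply F a,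
      (Submodule.Quotient.mk_eq_zero F).2 ha, zero_add, map_smul,
      commutator_eigen ρ hG₁ (fun g hg => (idc_le hg).2) g hg, sub_self]
  have hm' : ∀ g ∈ dser G₁ (m + 1 + 1), ∀ v ∈ F', stdRep G₁ g v = v := by
    refine commutator_trivial (ρ := stdRep G₁) (H := dser G₁ (m + 1)) (dser_le _ _) (F := F) ?_ ?_
    · intro g hg v hv
      exact hm g (dser_antitone G (Nat.le_succ m) (dser_mono hG₁ _ hg)) v hv
    · intro g hg v hv
      exact hcomm g (dser_antitone _ (by omega) hg) v hv
  have hlt : Module.finrank k ((Fin n → k) ⧸ F') < d := by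
    have h1 := Submodule.finrank_quotient_add_finrank F
    have h2 := Submodule.finrank_quotient_add_finrank F'
    have h3 : Module.finrank k F < Module.finrank k F' := by
      refine Submodule.finrank_lt_finrank_of_lt (lt_of_le_of_ne le_sup_left fun h => hx0 ?_)
      rw [Submodule.mkQ_apply, Submodule.Quotient.mk_eq_zero, h]
      exact Submodule.mem_sup_right (Submodule.mem_span_singleton_self y)
    omega
  obtain ⟨B, hBG, hB, hBI, hBs, hBc⟩ := ih _ hlt G₁ F' _ (clo_idc (ρ.clo_lineStab hG _)) (irr_idc _)
    hF' hm' rfl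
  refine ⟨B, hBG.trans hG₁, hB, hBI, hBs, fun H hH hHI hHs => ?_⟩
  obtain ⟨w, hw, hw0, hwH⟩ := exists_fixed_line hHI hHs (ρ.mono hH) (ρ.clo_cone (F.mkQ y))
    (fun t _ => ρ.cone_smul _ t) (fun h hh _ => ρ.cone_stable _ (hH hh))
    ⟨_, ρ.self_mem_cone _, hx0⟩
  obtain ⟨t, g, hg, rfl⟩ := hx w hw hw0
  have ht : t ≠ 0 := fun h => hw0 (by rw [h, zero_smul])
  have h1 : cj g⁻¹ H ≤ G₁ := by
    refine le_idc (irr_cj hHI) ?_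
    rintro _ ⟨h, hh, rfl⟩
    have hhG := hH hh
    change g⁻¹ * h * g⁻¹⁻¹ ∈ _
    rw [inv_inv]
    refine ⟨G.mul_mem (G.mul_mem (G.inv_mem hg) hhG) hg, ?_⟩
    obtain ⟨c, hc⟩ := hwH h hh
    refine ⟨c, ?_⟩
    rw [ρ.mono_toFun, map_smul, smul_comm] at hc
    have := smul_right_injective _ ht hc
    rw [ρ.mul_apply (G.mul_mem (G.inv_mem hg) hhG) hg, ρ.mul_apply (G.inv_mem hg) hhG, this,
      map_smul, ρ.inv_apply_self hg]
  obtain ⟨g₁, hg₁, h2⟩ := hBc _ h1 (irr_cj hHI) (solvable_cj hHs)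
  exact ⟨g₁ * g⁻¹, G.mul_mem (hG₁ hg₁) (G.inv_mem hg), by rwa [cj_mul]⟩

/-- Borel subgroups, in terms of the topological predicates. -/
lemma isBorel_iff {G B : Subgroup (GLn n k)} : IsBorel G B ↔
    B ≤ G ∧ IsClo B ∧ IsIrr B ∧ IsSolvable B ∧
    ∀ B' ≤ G, IsClo B' → IsIrr B' → IsSolvable B' →
      B ≤ B' → B' = B := by
  simp only [IsBorel, IsAlgSubgroup, zclosed_iff, zconnected_iff]

lemma isParabolic_iff {G P : Subgroup (GLn n k)} : IsParabolic G P ↔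
    P ≤ G ∧ IsClo P ∧ ∃ B, IsBorel G B ∧ B ≤ P := by
  simp only [IsParabolic, IsAlgSubgroup, zclosed_iff]

section Borel

lemma isBorel_cj {B : Subgroup (GLn n k)} (hB : IsBorel G B) {g : GLn n k} (hg : g ∈ G) :
    IsBorel G (cj g B) := by
  rw [isBorel_iff] at *
  obtain ⟨h1, h2, h3, h4, h5⟩ := hB
  refine ⟨cj_eq_self hg ▸ cj_mono h1, clo_cj h2, irr_cj h3, solvable_cj h4, ?_⟩
  intro B' hB' hc hi hs hle
  rw [cj_le_iff] at hle
  rw [← h5 (cj g⁻¹ B') (cj_eq_self (G.inv_mem hg) ▸ cj_mono hB') (clo_cj hc) (irr_cj hi)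
    (solvable_cj hs) hle, cj_cj_inv]

/-- All connected solvable subgroups are conjugate into a given Borel subgroup. -/
theorem IsBorel.exists_cj_le (hG : IsClo G)
    (hI : IsIrr G) {B H : Subgroup (GLn n k)} (hB : IsBorel G B) (hH : H ≤ G)
    (hHI : IsIrr H) (hHs : IsSolvable H) : ∃ g ∈ G, cj g H ≤ B := by
  obtain ⟨B₀, h1, h2, h3, h4, h5⟩ := exists_borel_aux G hG hI
  obtain ⟨b1, b2, b3, b4, b5⟩ := isBorel_iff.1 hB
  obtain ⟨g, hg, hgB⟩ := h5 B b1 b3 b4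
  rw [cj_le_iff] at hgB
  have hB0 := b5 (cj g⁻¹ B₀) (cj_eq_self (G.inv_mem hg) ▸ cj_mono h1) (clo_cj h2) (irr_cj h3)
    (solvable_cj h4) hgB
  obtain ⟨g', hg', hH'⟩ := h5 H hH hHI hHs
  exact ⟨g⁻¹ * g', G.mul_mem (G.inv_mem hg) hg', by rw [cj_mul, ← hB0]; exact cj_mono hH'⟩

/-- Conjugacy of Borel subgroups. -/
theorem IsBorel.exists_cj_eq (hG : IsClo G)
    (hI : IsIrr G) {B B' : Subgroup (GLn n k)} (hB : IsBorel G B) (hB' : IsBorel G B') :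
    ∃ g ∈ G, B' = cj g B := by
  obtain ⟨b1, b2, b3, b4, b5⟩ := isBorel_iff.1 hB
  obtain ⟨g, hg, h⟩ := IsBorel.exists_cj_le hG hI hB' b1 b3 b4
  have := isBorel_iff.1 (isBorel_cj hB hg)
  obtain ⟨c1, c2, c3, c4, c5⟩ := isBorel_iff.1 hB'
  exact ⟨g, hg, this.2.2.2.2 B' c1 c2 c3 c4 h⟩

theorem exists_isBorel (hG : IsClo G) (hI : IsIrr G) : ∃ B, IsBorel G B := by
  obtain ⟨B₀, h1, h2, h3, h4, h5⟩ := exists_borel_aux G hG hI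
  refine ⟨B₀, isBorel_iff.2 ⟨h1, h2, h3, h4, fun B' hB' hc hi hs hle => ?_⟩⟩
  obtain ⟨g, hg, h⟩ := h5 B' hB' hi hs
  exact le_antisymm (cj_eq_of_le hc (h.trans hle) ▸ h) hle

theorem exists_isBorel_ge (hG : IsClo G) (hI : IsIrr G) {H : Subgroup (GLn n k)} (hH : H ≤ G)
    (hHI : IsIrr H) (hHs : IsSolvable H) : ∃ B, IsBorel G B ∧ H ≤ B := by
  obtain ⟨B, hB⟩ := exists_isBorel hG hI
  obtain ⟨g, hg, h⟩ := IsBorel.exists_cj_le hG hI hB hH hHI hHs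
  exact ⟨cj g⁻¹ B, isBorel_cj hB (G.inv_mem hg), cj_le_iff.1 h⟩

end Borel

end

/-! ### The multiplicative group -/

/-- The character `t ↦ t ^ i`. -/
def zpowFun (k : Type) [Field k] (i : ℤ) (t : kˣ) : k := ((t ^ i : kˣ) : k)

lemma zpowFun_add (i j : ℤ) (t : kˣ) : zpowFun k (i + j) t = zpowFun k i t * zpowFun k j t := by
  simp [zpowFun, zpow_add]

lemma zpowFun_zero (t : kˣ) : zpowFun k 0 t = 1 := by simp [zpowFun]

lemma zpowFun_mul (i : ℤ) (s t : kˣ) : zpowFun k i (s * t) = zpowFun k i s * zpowFun k i t := by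
  simp [zpowFun, mul_zpow]

lemma zpowFun_one (i : ℤ) : zpowFun k i 1 = 1 := by simp [zpowFun]

lemma zpowFun_natCast (i : ℕ) (t : kˣ) : zpowFun k i t = (t : k) ^ i := by simp [zpowFun]

/-- Evaluation of Laurent polynomials on the multiplicative group. -/
noncomputable def laurentEval (k : Type) [Field k] : AddMonoidAlgebra k ℤ →ₐ[k] (kˣ → k) :=
  AddMonoidAlgebra.lift k (kˣ → k) ℤ
    { toFun := fun i => zpowFun k i.toAdd
      map_one' := by ext t; simp [zpowFun]
      map_mul' := fun i j => by ext t; simp [zpowFun, zpow_add] }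

lemma laurentEval_apply (c : AddMonoidAlgebra k ℤ) (t : kˣ) :
    laurentEval k c t = c.coeff.sum fun i a => a * zpowFun k i t := by
  simp [laurentEval, AddMonoidAlgebra.lift_apply, Finsupp.sum]

noncomputable instance instAffUnits : Aff k kˣ where
  algebra := (laurentEval k).range
  fg := by
    rw [Subalgebra.fg_iff_finiteType]
    exact Algebra.FiniteType.of_surjective (laurentEval k).rangeRestrict
      (laurentEval k).rangeRestrict_surjective
  exists_point := by
    intro φ
    let Φ : AddMonoidAlgebra k ℤ →ₐ[k] k := φ.comp (laurentEval k).rangeRestrict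
    let ψ : Multiplicative ℤ →* k := (Φ : AddMonoidAlgebra k ℤ →* k).comp
      (AddMonoidAlgebra.of k ℤ)
    let x : kˣ := ψ.toHomUnits (Multiplicative.ofAdd 1)
    refine ⟨x, ?_⟩
    have h : φ.comp (laurentEval k).rangeRestrict =
        ((Pi.evalAlgHom k (fun _ : kˣ => k) x).comp (Subalgebra.val _)).comp
          (laurentEval k).rangeRestrict := by
      apply AddMonoidAlgebra.algHom_ext'
      apply MonoidHom.ext_mint
      on_goal 1 => change ψ _ = laurentEval k (AddMonoidAlgebra.single 1 1) x
      · rw [laurentEval_apply]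
        refine Eq.trans ?_ (Finsupp.sum_single_index (by simp)).symm
        simp [zpowFun, x]
      · ext
    intro f
    obtain ⟨c, rfl⟩ := (laurentEval k).rangeRestrict_surjective f
    exact DFunLike.congr_fun h c
  separated := by
    intro x y h
    have := h (zpowFun k 1) ⟨AddMonoidAlgebra.single 1 1, by
      ext t
      change laurentEval k _ t = _
      rw [laurentEval_apply]; exact (Finsupp.sum_single_index (by simp)).trans (by simp)⟩
    ext
    simpa [zpowFun] using this

lemma mem_reg_units {f : kˣ → k} : f ∈ reg k kˣ ↔
    ∃ c : ℤ →₀ k, ∀ t, f t = c.sum fun i a => a * zpowFun k i t := by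
  constructor
  · rintro ⟨c, rfl⟩
    exact ⟨c.coeff, fun t => laurentEval_apply c t⟩
  · rintro ⟨c, hc⟩
    refine ⟨⟨c⟩, ?_⟩
    ext t
    exact (laurentEval_apply _ t).trans (hc t).symm

lemma zpowFun_mem (i : ℤ) : zpowFun k i ∈ reg k kˣ :=
  mem_reg_units.2 ⟨Finsupp.single i 1, fun t => by simp⟩

lemma exists_zpowFun_ne {i j : ℤ} (h : i ≠ j) : ∃ t : kˣ, zpowFun k i t ≠ zpowFun k j t := by
  by_contra! hc
  have h1 : ∀ t : kˣ, t ^ (i - j).natAbs = 1 := by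
    intro t
    have : t ^ (i - j) = 1 := by
      rw [zpow_sub, Units.ext (hc t), mul_inv_cancel]
    rcases Int.natAbs_eq (i - j) with h2 | h2
    · rw [h2] at this; exact_mod_cast this
    · rw [h2, zpow_neg, inv_eq_one] at this; exact_mod_cast this
  have hm : 0 < (i - j).natAbs := by omega
  classical
  obtain ⟨x, -, hx⟩ := Set.Infinite.exists_notMem_finite (s := Set.univ)
    (Set.infinite_univ (α := k)) 
    ((Polynomial.X ^ (i - j).natAbs - 1 : Polynomial k) * Polynomial.X).roots.toFinset.finite_toSet
  have hne : ((Polynomial.X ^ (i - j).natAbs - 1 : Polynomial k) * Polynomial.X) ≠ 0 :=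
    mul_ne_zero (Polynomial.X_pow_sub_C_ne_zero hm 1) Polynomial.X_ne_zero
  simp only [Finset.mem_coe, Multiset.mem_toFinset,
    Polynomial.mem_roots hne, Polynomial.IsRoot, Polynomial.eval_mul, Polynomial.eval_sub,
    Polynomial.eval_pow, Polynomial.eval_X, Polynomial.eval_one, mul_eq_zero, not_or] at hx
  apply hx.1
  have := congrArg (Units.val) (h1 (Units.mk0 x hx.2))
  simpa [sub_eq_zero] using this

lemma zpowFun_linearIndependent : LinearIndependent k (zpowFun k) := by
  have h := linearIndependent_monoidHom kˣ k
  let e : ℤ → (kˣ →* k) := fun i =>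
    ⟨⟨zpowFun k i, zpowFun_one i⟩, zpowFun_mul i⟩
  exact h.comp e fun i j hij => by
    by_contra hne
    obtain ⟨t, ht⟩ := exists_zpowFun_ne (k := k) hne
    exact ht (DFunLike.congr_fun hij t)

section Laurent
variable {V : Type} [AddCommGroup V] [Module k V]

/-- The vector valued Laurent polynomial with given coefficients. -/
noncomputable def lsum (c : ℤ →₀ V) (t : kˣ) : V := c.sum fun i v => zpowFun k i t • v

lemma lsum_add (c d : ℤ →₀ V) (t : kˣ) : lsum (c + d) t = lsum c t + lsum d t :=
  Finsupp.sum_add_index (by simp) (by simp)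

lemma lsum_single (i : ℤ) (v : V) (t : kˣ) : lsum (Finsupp.single i v) t = zpowFun k i t • v :=
  Finsupp.sum_single_index (by simp)

lemma lsum_eq {c : ℤ →₀ V} {s : Finset ℤ} (h : c.support ⊆ s) (t : kˣ) :
    lsum c t = ∑ i ∈ s, zpowFun k i t • c i :=
  Finsupp.sum_of_support_subset _ h _ (by simp)

lemma lsum_map {W : Type} [AddCommGroup W] [Module k W] (T : V →ₗ[k] W) (c : ℤ →₀ V) (t : kˣ) :
    T (lsum c t) = lsum (c.mapRange T T.map_zero) t := by
  rw [lsum_eq Finsupp.support_mapRange, lsum_eq (Finset.Subset.refl _), map_sum]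
  simp

lemma lsum_injective {c d : ℤ →₀ V} (h : ∀ t : kˣ, lsum c t = lsum d t) : c = d := by
  have key : ∀ l : Module.Dual k V, c.mapRange l l.map_zero = d.mapRange l l.map_zero := by
    intro l
    refine (linearIndependent_iff_injective_finsuppLinearCombination.1
      (zpowFun_linearIndependent (k := k))) ?_
    ext t
    have h1 := congrArg l (h t)
    rw [lsum_map, lsum_map] at h1
    simpa [Finsupp.linearCombination_apply, Finsupp.sum, lsum, Finset.sum_apply, mul_comm] using h1
  ext i
  rw [← sub_eq_zero, ← Module.forall_dual_apply_eq_zero_iff k]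
  intro l
  have := DFunLike.congr_fun (key l) i
  simpa [sub_eq_zero] using this

lemma sum_lsum_injective {s : Finset ℤ} {c d : ℤ → V}
    (h : ∀ t : kˣ, ∑ i ∈ s, zpowFun k i t • c i = ∑ i ∈ s, zpowFun k i t • d i) :
    ∀ i ∈ s, c i = d i := by
  intro i hi
  have h1 := lsum_injective (k := k) (c := Finsupp.indicator s fun i _ => c i)
    (d := Finsupp.indicator s fun i _ => d i) fun t => by
      rw [lsum_eq (Finsupp.support_indicator_subset _ _),
        lsum_eq (Finsupp.support_indicator_subset _ _)]
      rw [Finset.sum_congr rfl fun i hi => by rw [Finsupp.indicator_of_mem hi], h t]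
      exact Finset.sum_congr rfl fun i hi => by rw [Finsupp.indicator_of_mem hi]
  have := DFunLike.congr_fun h1 i
  rwa [Finsupp.indicator_of_mem hi, Finsupp.indicator_of_mem hi] at this

lemma exists_lsum [FiniteDimensional k V] {φ : kˣ → V} (hφ : Mor k φ) :
    ∃ c : ℤ →₀ V, ∀ t, φ t = lsum c t := by
  let b := Module.finBasis k V
  choose c hc using fun i => mem_reg_units.1 (mor_vector_iff.1 hφ (b.coord i))
  refine ⟨∑ i, (c i).mapRange (fun a => a • b i) (zero_smul _ _), fun t => ?_⟩
  have hs : ∀ (s : Finset (Fin (Module.finrank k V))) (d : _ → ℤ →₀ V), lsum (∑ i ∈ s, d i) t = ∑ i ∈ s, lsum (d i) t :=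
    fun s d => by
      induction s using Finset.cons_induction with
      | empty => simp [lsum]
      | cons a s ha ih => rw [Finset.sum_cons, Finset.sum_cons, lsum_add, ih]
  rw [hs, ← b.sum_repr (φ t)]
  refine Finset.sum_congr rfl fun i _ => ?_
  change b.coord i (φ t) • b i = _
  rw [hc i t, lsum_eq Finsupp.support_mapRange, Finsupp.sum, Finset.sum_smul]
  refine Finset.sum_congr rfl fun j _ => ?_
  rw [Finsupp.mapRange_apply, smul_smul, mul_comm]

lemma exists_polynomial_lsum [FiniteDimensional k V] {φ : k → V} (hφ : Mor k φ) :
    ∃ c : ℤ →₀ V, (∀ t : kˣ, φ t = lsum c t) ∧ (∀ i < 0, c i = 0) ∧ c 0 = φ 0 := by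
  let b := Module.finBasis k V
  choose P hP using fun i => mem_reg_scalar.1 (mor_vector_iff.1 hφ (b.coord i))
  let Q : (k → V) → Prop := fun φ => ∃ c : ℤ →₀ V, (∀ t : kˣ, φ t = lsum c t) ∧
    (∀ i < 0, c i = 0) ∧ c 0 = φ 0
  have hsum : ∀ {ι : Type} (s : Finset ι) (f : ι → k → V), (∀ i ∈ s, Q (f i)) →
      Q fun t => ∑ i ∈ s, f i t := by
    intro ι s f hf
    induction s using Finset.cons_induction with
    | empty => exact ⟨0, by simp [lsum], by simp, by simp⟩
    | cons a s ha ih =>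
      obtain ⟨c, h1, h2, h3⟩ := hf a (by simp)
      obtain ⟨d, h1', h2', h3'⟩ := ih fun i hi => hf i (by simp [hi])
      refine ⟨c + d, fun t => ?_, fun i hi => ?_, ?_⟩
      · rw [lsum_add, ← h1, ← h1']; exact Finset.sum_cons ha
      · rw [Finsupp.add_apply, h2 i hi, h2' i hi, add_zero]
      · rw [Finsupp.add_apply, h3, h3']; simp
  have hφ' : φ = fun t => ∑ i, ∑ m ∈ (P i).support, (t ^ m) • ((P i).coeff m • b i) := by
    ext t
    rw [← b.sum_repr (φ t)]
    refine Finset.sum_congr rfl fun i _ => ?_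
    change b.coord i (φ t) • b i = _
    rw [hP i t, Polynomial.eval_eq_sum, Polynomial.sum, Finset.sum_smul]
    exact Finset.sum_congr rfl fun m _ => by rw [smul_smul, mul_comm]
  change Q φ
  rw [hφ']
  refine hsum _ (fun i t => ∑ m ∈ (P i).support, (t ^ m) • ((P i).coeff m • b i)) fun i _ =>
    hsum _ (fun m t => (t ^ m) • ((P i).coeff m • b i)) fun m _ => ?_
  refine ⟨Finsupp.single (m : ℤ) ((P i).coeff m • b i), fun t => ?_, fun j hj => ?_, ?_⟩
  · rw [lsum_single, zpowFun_natCast]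
  · rw [Finsupp.single_eq_of_ne (by omega)]
  · rcases Nat.eq_zero_or_pos m with rfl | hm
    · simp
    · rw [Finsupp.single_eq_of_ne (by omega)]
      simp [hm.ne']

end Laurent

/-! ### Cocharacters -/

/-- A cocharacter of `GL_n`. -/
structure Cochar (n : ℕ) (k : Type) [Field k] [IsAlgClosed k] where
  toHom : kˣ →* GLn n k
  mor : Mor k toHom

namespace Cochar

noncomputable instance : CoeFun (Cochar n k) fun _ => kˣ → GLn n k := ⟨fun ν => ν.toHom⟩

variable (ν μ : Cochar n k) (G : Subgroup (GLn n k))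

lemma map_mul (s t : kˣ) : ν (s * t) = ν s * ν t := _root_.map_mul ν.toHom s t
lemma map_one : ν 1 = 1 := _root_.map_one ν.toHom
lemma map_inv (t : kˣ) : ν t⁻¹ = (ν t)⁻¹ := _root_.map_inv ν.toHom t

lemma comm (s t : kˣ) : ν s * ν t = ν t * ν s := by rw [← map_mul, mul_comm, map_mul]

@[ext] lemma ext {ν μ : Cochar n k} (h : ∀ t, ν t = μ t) : ν = μ := by
  cases ν; cases μ; congr; exact MonoidHom.ext h

/-- The cocharacter takes values in `G`. -/
def In : Prop := ∀ t, ν t ∈ G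

variable {ν G}
lemma In.mono {H : Subgroup (GLn n k)} (h : ν.In G) (hGH : G ≤ H) : ν.In H := fun t => hGH (h t)

lemma in_top : ν.In ⊤ := fun _ => trivial
variable (ν)

/-- Powers of a cocharacter. -/
def pow (N : ℤ) : Cochar n k where
  toHom := ν.toHom.comp (zpowGroupHom N)
  mor := by
    refine ν.mor.comp fun f hf => ?_
    obtain ⟨c, hc⟩ := mem_reg_units.1 hf
    have : (f ∘ zpowGroupHom N : kˣ → k) = ∑ i ∈ c.support, c i • zpowFun k (N * i) := by
      ext t
      simp only [Function.comp, hc, Finsupp.sum, Finset.sum_apply, Pi.smul_apply, smul_eq_mul]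
      exact Finset.sum_congr rfl fun i _ => by simp [zpowFun, zpow_mul]
    rw [this]
    exact sum_mem fun i _ => Subalgebra.smul_mem _ (zpowFun_mem _) _

lemma pow_apply (N : ℤ) (t : kˣ) : ν.pow N t = ν (t ^ N) := rfl

/-- The inverse cocharacter. -/
def neg : Cochar n k := ν.pow (-1)

lemma neg_apply (t : kˣ) : ν.neg t = (ν t)⁻¹ := by
  rw [neg, pow_apply, zpow_neg_one, map_inv]

lemma neg_neg : ν.neg.neg = ν := by ext t : 1; rw [neg_apply, neg_apply, inv_inv]

variable {ν}
lemma In.pow (h : ν.In G) (N : ℤ) : (ν.pow N).In G := fun t => h (t ^ N)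
lemma In.neg (h : ν.In G) : ν.neg.In G := h.pow _

variable (ν)
/-- Conjugate of a cocharacter. -/
def conj (g : GLn n k) : Cochar n k where
  toHom := (MulAut.conj g).toMonoidHom.comp ν.toHom
  mor := (mor_conj g).comp ν.mor

lemma conj_apply (g : GLn n k) (t : kˣ) : ν.conj g t = g * ν t * g⁻¹ := rfl

lemma conj_mul (g h : GLn n k) : ν.conj (g * h) = (ν.conj h).conj g := by
  ext t : 1; simp only [conj_apply]; group

lemma conj_one : ν.conj 1 = ν := by ext t : 1; simp [conj_apply]

lemma in_cj_iff (g : GLn n k) : (ν.conj g).In (cj g G) ↔ ν.In G := by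
  refine forall_congr' fun t => ?_
  rw [mem_cj, conj_apply]
  simp [mul_assoc]

/-- Product of commuting cocharacters. -/
def mul (h : ∀ s t, ν s * μ t = μ t * ν s) : Cochar n k where
  toHom :=
    { toFun := fun t => ν t * μ t
      map_one' := by simp
      map_mul' := fun s t => by
        rw [map_mul, map_mul, mul_assoc, mul_assoc, ← mul_assoc (ν t), h t s, mul_assoc] }
  mor := ν.mor.mul μ.mor

end Cochar

namespace RatRep
variable {G : Subgroup (GLn n k)} {V : Type} [AddCommGroup V] [Module k V]
  [FiniteDimensional k V] (ρ : RatRep G V) {ν : Cochar n k}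

lemma mor_end {X : Type} [Aff k X] {T : X → (V →ₗ[k] V)}
    (h : ∀ v (l : Module.Dual k V), (fun x => l (T x v)) ∈ reg k X) : Mor k T := by
  rw [mor_vector_iff]
  let S : Set (Module.Dual k (V →ₗ[k] V)) := {f | ∃ (v : V) (l : Module.Dual k V), ∀ T, f T = l (T v)}
  have hS : Submodule.span k S = ⊤ := by
    refine span_dual_eq_top fun T hT => ?_
    ext v
    rw [LinearMap.zero_apply, ← Module.forall_dual_apply_eq_zero_iff k]
    intro l
    exact hT (l ∘ₗ LinearMap.applyₗ v) ⟨v, l, fun _ => rfl⟩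
  intro l
  have hl : l ∈ Submodule.span k S := by rw [hS]; trivial
  induction hl using Submodule.span_induction with
  | mem f hf =>
    obtain ⟨v, l, hvl⟩ := hf
    simpa only [hvl] using h v l
  | zero => exact zero_mem _
  | add a b _ _ ha hb => exact add_mem ha hb
  | smul c a _ ha => exact Subalgebra.smul_mem _ ha c

lemma exists_pr (hν : ν.In G) :
    ∃ c : ℤ →₀ (V →ₗ[k] V), ∀ t, ρ (ν t) = lsum c t := by
  refine exists_lsum (mor_end fun v l => ?_)
  obtain ⟨f, hf, hfl⟩ := ρ.regular v l
  have : (fun t => l (ρ (ν t) v)) = f ∘ ν := funext fun t => hfl _ (hν t)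
  rw [this]
  exact ν.mor f hf

open scoped Classical in
/-- The projections to the weight spaces of a cocharacter. -/
noncomputable def pr (ν : Cochar n k) : ℤ →₀ (V →ₗ[k] V) :=
  if h : ∃ c : ℤ →₀ (V →ₗ[k] V), ∀ t, ρ (ν t) = lsum c t then h.choose else 0

lemma apply_eq (hν : ν.In G) (t : kˣ) : ρ (ν t) = lsum (ρ.pr ν) t := by
  have h := ρ.exists_pr hν
  rw [pr, dif_pos h]
  exact h.choose_spec t

/-- The Laurent coefficients of `t ↦ ρ (ν t) v`. -/
noncomputable def comps (ν : Cochar n k) (v : V) : ℤ →₀ V :=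
  (ρ.pr ν).mapRange (fun T => T v) rfl

lemma comps_apply (v : V) (i : ℤ) : ρ.comps ν v i = ρ.pr ν i v := by simp [comps]

lemma apply_eq_lsum (hν : ν.In G) (t : kˣ) (v : V) : ρ (ν t) v = lsum (ρ.comps ν v) t := by
  rw [ρ.apply_eq hν]
  exact lsum_map (LinearMap.applyₗ v) (ρ.pr ν) t

lemma pr_eq_of_lsum (hν : ν.In G) {v : V} {c : ℤ →₀ V} (h : ∀ t, ρ (ν t) v = lsum c t) (i : ℤ) :
    ρ.pr ν i v = c i := by
  rw [← comps_apply, lsum_injective (c := ρ.comps ν v) (d := c) fun t => by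
    rw [← ρ.apply_eq_lsum hν, h]]

lemma pr_eq_sum (hν : ν.In G) (t : kˣ) (v : V) :
    ρ (ν t) v = ∑ i ∈ (ρ.pr ν).support, zpowFun k i t • ρ.pr ν i v := by
  rw [ρ.apply_eq_lsum hν, lsum_eq (c := ρ.comps ν v) (s := (ρ.pr ν).support)
    Finsupp.support_mapRange]
  simp only [comps_apply]

lemma sum_pr (hν : ν.In G) (v : V) : ∑ i ∈ (ρ.pr ν).support, ρ.pr ν i v = v := by
  have := ρ.pr_eq_sum hν 1 v
  simp only [zpowFun_one, one_smul, ν.map_one, ρ.one_apply] at this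
  exact this.symm

lemma sum_pr_of_support (hν : ν.In G) (v : V) {s : Finset ℤ} (hs : (ρ.pr ν).support ⊆ s) :
    ∑ i ∈ s, ρ.pr ν i v = v := by
  rw [← Finset.sum_subset hs, ρ.sum_pr hν]
  intro i _ hi
  rw [Finsupp.notMem_support_iff.1 hi, LinearMap.zero_apply]

lemma apply_pr (hν : ν.In G) (s : kˣ) (i : ℤ) (v : V) :
    ρ (ν s) (ρ.pr ν i v) = zpowFun k i s • ρ.pr ν i v := by
  by_cases hi : i ∈ (ρ.pr ν).support
  · refine sum_lsum_injective (k := k) (s := (ρ.pr ν).support) (c := fun i => ρ (ν s) (ρ.pr ν i v))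
      (d := fun i => zpowFun k i s • ρ.pr ν i v) (fun t => ?_) i hi
    have h1 := congrArg (ρ (ν s)) (ρ.pr_eq_sum hν t v)
    rw [← ρ.mul_apply (hν s) (hν t), ← ν.map_mul, ρ.pr_eq_sum hν, map_sum] at h1
    simp only [map_smul] at h1
    rw [← h1]
    exact Finset.sum_congr rfl fun i _ => by rw [zpowFun_mul, smul_smul, mul_comm]
  · simp [Finsupp.notMem_support_iff.1 hi]

lemma pr_of_weight (hν : ν.In G) {i : ℤ} {v : V} (h : ∀ t, ρ (ν t) v = zpowFun k i t • v) (j : ℤ) :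
    ρ.pr ν j v = if i = j then v else 0 := by
  rw [ρ.pr_eq_of_lsum hν (c := Finsupp.single i v) (fun t => by rw [h, lsum_single]),
    Finsupp.single_apply]

lemma pr_pr (hν : ν.In G) (i j : ℤ) (v : V) :
    ρ.pr ν j (ρ.pr ν i v) = if i = j then ρ.pr ν i v else 0 :=
  ρ.pr_of_weight hν (fun t => ρ.apply_pr hν t i v) j

/-- A linear map commuting with a cocharacter commutes with the weight projections. -/
lemma pr_map {H : Subgroup (GLn n k)} {W : Type} [AddCommGroup W] [Module k W]
    [FiniteDimensional k W] (σ : RatRep H W) (hν : ν.In G) (hν' : ν.In H) (T : V →ₗ[k] W)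
    (v : V) (h : ∀ t, T (ρ (ν t) v) = σ (ν t) (T v)) (i : ℤ) :
    T (ρ.pr ν i v) = σ.pr ν i (T v) := by
  rw [σ.pr_eq_of_lsum hν' (c := (ρ.comps ν v).mapRange T T.map_zero), Finsupp.mapRange_apply,
    comps_apply]
  intro t
  rw [← h, ρ.apply_eq_lsum hν, lsum_map]

/-- The weight spaces of a cocharacter. -/
def wt (ν : Cochar n k) (i : ℤ) : Submodule k V where
  carrier := {v | ∀ t, ρ (ν t) v = zpowFun k i t • v}
  add_mem' ha hb t := by rw [map_add, ha t, hb t, smul_add]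
  zero_mem' t := by simp
  smul_mem' c v hv t := by rw [map_smul, hv t, smul_comm]

lemma mem_wt {i : ℤ} {v : V} : v ∈ ρ.wt ν i ↔ ∀ t, ρ (ν t) v = zpowFun k i t • v := Iff.rfl

lemma pr_mem_wt (hν : ν.In G) (i : ℤ) (v : V) : ρ.pr ν i v ∈ ρ.wt ν i :=
  fun t => ρ.apply_pr hν t i v

lemma pr_of_mem_wt (hν : ν.In G) {i : ℤ} {v : V} (h : v ∈ ρ.wt ν i) : ρ.pr ν i v = v := by
  rw [ρ.pr_of_weight hν h, if_pos rfl]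

lemma pr_of_mem_wt_ne (hν : ν.In G) {i j : ℤ} {v : V} (h : v ∈ ρ.wt ν i) (hij : i ≠ j) :
    ρ.pr ν j v = 0 := by
  rw [ρ.pr_of_weight hν h, if_neg hij]

lemma mem_wt_of_pr (hν : ν.In G) {i : ℤ} {v : V} (h : ∀ j ≠ i, ρ.pr ν j v = 0) :
    v ∈ ρ.wt ν i := by
  classical
  have h1 := ρ.sum_pr_of_support hν v (Finset.subset_insert i (ρ.pr ν).support)
  rw [Finset.sum_eq_single i (fun j _ hj => h j hj) (by simp)] at h1
  rw [← h1]
  exact ρ.pr_mem_wt hν i v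

lemma exists_pr_ne (hν : ν.In G) {v : V} (hv : v ≠ 0) : ∃ i, ρ.pr ν i v ≠ 0 := by
  by_contra! h
  exact hv (by rw [← ρ.sum_pr hν v]; exact Finset.sum_eq_zero fun i _ => h i)

/-- A `ν`-eigenvector is a weight vector. -/
lemma exists_wt_of_eigen (hν : ν.In G) {v : V} (hv : v ≠ 0)
    (h : ∀ t, ∃ c : k, ρ (ν t) v = c • v) : ∃ i, v ∈ ρ.wt ν i := by
  obtain ⟨i, hi⟩ := ρ.exists_pr_ne hν hv
  refine ⟨i, fun t => ?_⟩
  obtain ⟨c, hc⟩ := h t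
  have h1 : ρ.pr ν i (ρ (ν t) v) = ρ (ν t) (ρ.pr ν i v) :=
    (ρ.pr_map ρ hν hν (ρ (ν t)) v (fun s => by
      rw [← ρ.mul_apply (hν t) (hν s), ← ρ.mul_apply (hν s) (hν t), ν.comm]) i).symm
  rw [hc, map_smul, ρ.apply_pr hν] at h1
  rw [hc, smul_left_injective k hi h1]

lemma wt_neg (i : ℤ) : ρ.wt ν.neg i = ρ.wt ν (-i) := by
  have key : ∀ (t : kˣ) (j : ℤ), zpowFun k (-j) t⁻¹ = zpowFun k j t := by
    intro t j; simp [zpowFun]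
  ext v
  constructor
  · intro h t
    have := h t⁻¹
    rwa [ν.neg_apply, ν.map_inv, inv_inv, ← key, inv_inv] at this
  · intro h t
    rw [ν.neg_apply, ← ν.map_inv, h, key]

lemma pr_neg (hν : ν.In G) (i : ℤ) (v : V) : ρ.pr ν.neg i v = ρ.pr ν (-i) v := by
  have h1 : ∀ j, ρ.pr ν.neg i (ρ.pr ν j v) = if j = -i then ρ.pr ν j v else 0 := by
    intro j
    have : ρ.pr ν j v ∈ ρ.wt ν.neg (-j) := by
      rw [wt_neg, neg_neg]; exact ρ.pr_mem_wt hν j v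
    rw [ρ.pr_of_weight hν.neg this]
    congr 1
    exact propext ⟨fun h => by omega, fun h => by omega⟩
  conv_lhs => rw [← ρ.sum_pr hν v, map_sum]
  simp only [h1, Finset.sum_ite_eq']
  split_ifs with h
  · rfl
  · simp [Finsupp.notMem_support_iff.1 h]

end RatRep

section MatrixFunctions
variable {X : Type} {A : Subalgebra k (X → k)} {M : X → Matrix (Fin n) (Fin n) k}

def matrixLift (h : ∀ i j, (fun x => M x i j) ∈ A) : Matrix (Fin n) (Fin n) A :=
  Matrix.of fun i j => ⟨_, h i j⟩

lemma matrixLift_map (h : ∀ i j, (fun x => M x i j) ∈ A) (x : X) :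
    M x = ((Pi.evalRingHom (fun _ : X => k) x).comp A.val.toRingHom).mapMatrix (matrixLift h) := by
  ext i j; rfl

lemma det_mem (h : ∀ i j, (fun x => M x i j) ∈ A) : (fun x => (M x).det) ∈ A := by
  have : (fun x => (M x).det) = ((matrixLift h).det : A).1 := by
    ext x
    conv_lhs => rw [matrixLift_map h x]
    exact (RingHom.map_det _ _).symm
  rw [this]
  exact Subtype.property _

lemma adjugate_mem (h : ∀ i j, (fun x => M x i j) ∈ A) (i j : Fin n) :
    (fun x => (M x).adjugate i j) ∈ A := by
  have : (fun x => (M x).adjugate i j) = ((matrixLift h).adjugate i j : A).1 := by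
    ext x
    conv_lhs => rw [matrixLift_map h x]
    rw [← RingHom.map_adjugate]
    rfl
  rw [this]
  exact Subtype.property _

lemma matrix_mul_mem {M' : X → Matrix (Fin n) (Fin n) k} (h : ∀ i j, (fun x => M x i j) ∈ A)
    (h' : ∀ i j, (fun x => M' x i j) ∈ A) (i j : Fin n) : (fun x => (M x * M' x) i j) ∈ A := by
  have : (fun x => (M x * M' x) i j) = ∑ l, (fun x => M x i l) * fun x => M' x l j := by
    ext x; simp [Matrix.mul_apply]
  rw [this]
  exact sum_mem fun l _ => mul_mem (h i l) (h' l j)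

lemma matrix_const_mem (B : Matrix (Fin n) (Fin n) k) (i j : Fin n) :
    (fun _ : X => B i j) ∈ A := A.algebraMap_mem (B i j)

end MatrixFunctions

lemma mor_GLn_of_det {X : Type} [Aff k X] {φ : X → GLn n k}
    (h : ∀ i j, (fun x => (φ x : Matrix (Fin n) (Fin n) k) i j) ∈ reg k X) {d : k}
    (hd : ∀ x, (φ x).1.det = d) : Mor k φ := by
  refine mor_GLn h fun i j => ?_
  have : (fun x => ((φ x)⁻¹ : GLn n k).1 i j) = d⁻¹ • fun x => (φ x).1.adjugate i j := by
    ext x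
    simp [Matrix.inv_def, ← hd x]
  rw [this]
  exact Subalgebra.smul_mem _ (adjugate_mem h i j) _

/-! ### Limits along a cocharacter -/

namespace Cochar
variable {ν : Cochar n k} {G : Subgroup (GLn n k)} {p q p' q' : GLn n k}

/-- `ν t * p * (ν t)⁻¹` tends to `q` as `t` tends to `0`. -/
def Lim (ν : Cochar n k) (p q : GLn n k) : Prop :=
  ∃ φ : k → GLn n k, Mor k φ ∧ (∀ t : kˣ, φ t = ν t * p * (ν t)⁻¹) ∧ φ 0 = q

lemma dense_units {f : k → k} (hf : f ∈ reg k k) (h : ∀ t : kˣ, f t = 0) (s : k) : f s = 0 := by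
  rcases (irr_iff.1 (irr_scalar (k := k))).2 f hf _ (dual_mem_reg (LinearMap.id : k →ₗ[k] k))
    (fun x _ => by
      rcases eq_or_ne x 0 with rfl | hx
      · simp
      · rw [show f x = 0 from h (Units.mk0 x hx), zero_mul]) with h1 | h1
  · exact h1 s trivial
  · exact absurd (h1 1 trivial) one_ne_zero

lemma eq_of_units {X : Type} [Aff k X] {φ ψ : k → X} (hφ : Mor k φ) (hψ : Mor k ψ)
    (h : ∀ t : kˣ, φ t = ψ t) (s : k) : φ s = ψ s := by
  refine Aff.separated (k := k) _ _ fun f hf => ?_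
  have := dense_units (f := fun s => f (φ s) - f (ψ s)) (sub_mem (hφ f hf) (hψ f hf))
    (fun t => by rw [h, sub_self]) s
  exact sub_eq_zero.1 this

lemma Lim.unique (h : ν.Lim p q) (h' : ν.Lim p q') : q = q' := by
  obtain ⟨φ, hφ, h1, rfl⟩ := h
  obtain ⟨ψ, hψ, h2, rfl⟩ := h'
  exact eq_of_units hφ hψ (fun t => by rw [h1, h2]) 0

lemma Lim.mul (h : ν.Lim p q) (h' : ν.Lim p' q') : ν.Lim (p * p') (q * q') := by
  obtain ⟨φ, hφ, h1, rfl⟩ := h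
  obtain ⟨ψ, hψ, h2, rfl⟩ := h'
  exact ⟨fun s => φ s * ψ s, hφ.mul hψ, fun t => by simp only [h1, h2]; group, rfl⟩

lemma Lim.inv (h : ν.Lim p q) : ν.Lim p⁻¹ q⁻¹ := by
  obtain ⟨φ, hφ, h1, rfl⟩ := h
  exact ⟨fun s => (φ s)⁻¹, hφ.inv, fun t => by simp only [h1]; group, rfl⟩

lemma lim_of_comm (h : ∀ t, ν t * p = p * ν t) : ν.Lim p p :=
  ⟨fun _ => p, Mor.const p, fun t => by rw [h t]; group, rfl⟩

lemma lim_one : ν.Lim 1 1 := lim_of_comm fun t => by simp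

lemma Lim.comm (h : ν.Lim p q) (t : kˣ) : ν t * q = q * ν t := by
  obtain ⟨φ, hφ, h1, rfl⟩ := h
  have hs : Mor k fun s : k => (t : k) * s := 
    LinearMap.mor (LinearMap.mulLeft k (t : k))
  have := eq_of_units (φ := fun s => φ (t * s)) (ψ := fun s => ν t * φ s * (ν t)⁻¹)
    (hφ.comp hs) ((mor_conj (ν t)).comp hφ) (fun s => by
      have := h1 (t * s)
      rw [Units.val_mul] at this
      simp only [this, h1, ν.map_mul]
      group) 0
  simp only [mul_zero] at this
  conv_rhs => rw [this]
  group

lemma Lim.eq_of_comm (h : ν.Lim p q) (hp : ∀ t, ν t * p = p * ν t) : q = p :=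
  h.unique (lim_of_comm hp)

lemma Lim.curve_mem {C : Set (GLn n k)} (hC : Clo k C) {φ : k → GLn n k} (hφ : Mor k φ)
    (h : ∀ t : kˣ, φ t ∈ C) (s : k) : φ s ∈ C := by
  obtain ⟨S, hS, rfl⟩ := clo_iff.1 hC
  intro f hf
  exact dense_units (hφ f (hS hf)) (fun t => h t f hf) s

lemma Lim.mem (h : ν.Lim p q) (hG : IsClo G) (hν : ν.In G) (hp : p ∈ G) : q ∈ G := by
  obtain ⟨φ, hφ, h1, rfl⟩ := h
  exact Lim.curve_mem hG hφ (fun t => by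
    rw [h1]; exact G.mul_mem (G.mul_mem (hν t) hp) (G.inv_mem (hν t))) 0

lemma Lim.conj (h : ν.Lim p q) (g : GLn n k) : (ν.conj g).Lim (g * p * g⁻¹) (g * q * g⁻¹) := by
  obtain ⟨φ, hφ, h1, rfl⟩ := h
  refine ⟨fun s => g * φ s * g⁻¹, (mor_conj g).comp hφ, fun t => ?_, rfl⟩
  simp only [h1, conj_apply]
  group

/-- Elements having a limit. -/
def P (ν : Cochar n k) : Subgroup (GLn n k) where
  carrier := {p | ∃ q, ν.Lim p q}
  mul_mem' := fun ⟨_, ha⟩ ⟨_, hb⟩ => ⟨_, ha.mul hb⟩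
  one_mem' := ⟨1, lim_one⟩
  inv_mem' := fun ⟨_, ha⟩ => ⟨_, ha.inv⟩

/-- Elements contracted to `1`. -/
def U (ν : Cochar n k) : Subgroup (GLn n k) where
  carrier := {p | ν.Lim p 1}
  mul_mem' := fun ha hb => by simpa using Lim.mul ha hb
  one_mem' := lim_one
  inv_mem' := fun ha => by simpa using Lim.inv ha

/-- The centralizer of a cocharacter. -/
def C (ν : Cochar n k) : Subgroup (GLn n k) where
  carrier := {p | ∀ t, ν t * p = p * ν t}
  mul_mem' := fun {a b} ha hb t => by rw [← mul_assoc, ha t, mul_assoc, hb t, mul_assoc]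
  one_mem' := fun t => by simp
  inv_mem' := fun {a} ha t => by
    rw [eq_inv_mul_iff_mul_eq, ← mul_assoc, ← ha t, mul_assoc, mul_inv_cancel, mul_one]

lemma mem_P : p ∈ ν.P ↔ ∃ q, ν.Lim p q := Iff.rfl
lemma mem_U : p ∈ ν.U ↔ ν.Lim p 1 := Iff.rfl
lemma mem_C : p ∈ ν.C ↔ ∀ t, ν t * p = p * ν t := Iff.rfl

lemma U_le_P : ν.U ≤ ν.P := fun _ h => ⟨1, h⟩
lemma C_le_P : ν.C ≤ ν.P := fun p h => ⟨p, lim_of_comm h⟩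

lemma C_neg : ν.neg.C = ν.C := by
  ext p
  refine forall_congr' fun t => ?_
  rw [neg_apply]
  constructor
  · intro h
    have := congrArg (fun x => ν t * x * ν t) h
    simpa [mul_assoc] using this.symm
  · intro h
    rw [← eq_inv_mul_iff_mul_eq, inv_inv, ← mul_assoc, h]; group

lemma Lim.mem_C (h : ν.Lim p q) : q ∈ ν.C := h.comm

lemma Lim.inv_mul_mem_U (h : ν.Lim p q) : q⁻¹ * p ∈ ν.U := by
  have := (lim_of_comm h.mem_C).inv.mul h
  rwa [inv_mul_cancel] at this

lemma conj_mem_U {u : GLn n k} (hp : p ∈ ν.P) (hu : u ∈ ν.U) : p * u * p⁻¹ ∈ ν.U := by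
  obtain ⟨q, hq⟩ := hp
  have := (hq.mul hu).mul hq.inv
  rwa [mul_one, mul_inv_cancel] at this

lemma P_conj (g : GLn n k) : (ν.conj g).P = cj g ν.P := by
  have key : ∀ (ν : Cochar n k) (g : GLn n k), cj g ν.P ≤ (ν.conj g).P := by
    intro ν g p hp
    obtain ⟨q, hq⟩ := mem_cj.1 hp
    have := hq.conj g
    exact ⟨_, by simpa [mul_assoc] using this⟩
  refine le_antisymm ?_ (key _ _)
  have := key (ν.conj g) g⁻¹
  rw [cj_le_iff, inv_inv] at this
  rwa [← conj_mul, inv_mul_cancel, conj_one] at this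

lemma C_conj (g : GLn n k) : (ν.conj g).C = cj g ν.C := by
  ext p
  rw [mem_cj]
  refine forall_congr' fun t => ?_
  rw [conj_apply]
  constructor
  · intro h
    have := congrArg (fun x => g⁻¹ * x * g) h
    simpa [mul_assoc] using this
  · intro h
    have := congrArg (fun x => g * x * g⁻¹) h
    simpa [mul_assoc] using this

lemma in_C : ν.In ν.C := fun t s => ν.comm s t

/-- `U(ν) ∩ H` is connected, for `H` closed and normalised by `ν`. -/
lemma irr_U {H : Subgroup (GLn n k)} (hH : IsClo H) (hν : ∀ t, ∀ h ∈ H, ν t * h * (ν t)⁻¹ ∈ H) :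
    IsIrr (H ⊓ ν.U) := by
  suffices h : idc (H ⊓ ν.U) = H ⊓ ν.U by rw [← h]; exact irr_idc _
  refine le_antisymm idc_le fun u hu => ?_
  obtain ⟨hu1, φ, hφ, h1, h0⟩ := hu
  have hsub : Set.range φ ⊆ (H ⊓ ν.U : Subgroup (GLn n k)) := by
    rintro _ ⟨s, rfl⟩
    refine ⟨Lim.curve_mem hH hφ (fun t => by rw [h1]; exact hν t u hu1) s, ?_⟩
    rcases eq_or_ne s 0 with rfl | hs
    · rw [h0]; exact ν.U.one_mem
    · rw [show s = (Units.mk0 s hs : kˣ) from rfl, h1]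
      exact conj_mem_U (C_le_P (in_C _)) ⟨φ, hφ, h1, h0⟩
  have := subset_idc (C := Set.range φ) (by
    rw [← Set.image_univ]; exact irr_scalar.image hφ) ⟨0, h0⟩ hsub
  apply this
  exact ⟨1, by simpa using h1 1⟩

lemma irr_G_U (hG : IsClo G) (hν : ν.In G) : IsIrr (G ⊓ ν.U) :=
  irr_U hG fun t _ h => G.mul_mem (G.mul_mem (hν t) h) (G.inv_mem (hν t))

end Cochar

lemma zpowFun_mul_inv (c : ℤ) (t : kˣ) : 1 = zpowFun k c t * zpowFun k c t⁻¹ := by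
  rw [← zpowFun_mul, mul_inv_cancel, zpowFun_one]

namespace RatRep
variable {G : Subgroup (GLn n k)} {V : Type} [AddCommGroup V] [Module k V]
  [FiniteDimensional k V] (ρ : RatRep G V) {ν : Cochar n k}

lemma pr_of_lim (hG : IsClo G) (hν : ν.In G) {p q : GLn n k} (hp : p ∈ G)
    (h : ν.Lim p q) {c : ℤ} {v : V} (hv : v ∈ ρ.wt ν c) :
    (∀ i < c, ρ.pr ν i (ρ p v) = 0) ∧ ρ.pr ν c (ρ p v) = ρ q v := by
  have hq := h.mem hG hν hp
  obtain ⟨φ, hφ, h1, rfl⟩ := h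
  obtain ⟨F, hF, hFG⟩ := ρ.exists_orbit_mor v
  obtain ⟨d, hd, hd0, hd1⟩ := exists_polynomial_lsum (hF.comp hφ)
  have key : ∀ i, ρ.pr ν i (ρ p v) = d (i - c) := by
    intro i
    refine (ρ.pr_eq_of_lsum hν (c := d.embDomain (Equiv.addRight c).toEmbedding) (fun t => ?_)
      i).trans ?_
    · have h2 : ρ (ν t) (ρ p v) = zpowFun k c t • lsum d t := by
        rw [← hd t, Function.comp_apply, h1, hFG _ (G.mul_mem (G.mul_mem (hν t) hp)
          (G.inv_mem (hν t))), ρ.mul_apply (G.mul_mem (hν t) hp) (G.inv_mem (hν t)),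
          ρ.mul_apply (hν t) hp, ← ν.map_inv, hv, map_smul, map_smul, smul_smul]
        rw [← zpowFun_mul_inv c t, one_smul]
      rw [h2, lsum, lsum, Finsupp.sum_embDomain, Finsupp.sum, Finsupp.sum, Finset.smul_sum]
      exact Finset.sum_congr rfl fun i _ => by
        rw [smul_smul, mul_comm]; simp [zpowFun_add]
    · have := Finsupp.embDomain_apply_self (Equiv.addRight c).toEmbedding d (i - c)
      simpa using this
  refine ⟨fun i hi => by rw [key, hd0 _ (by omega)], ?_⟩
  rw [key, sub_self, hd1, Function.comp_apply, hFG _ hq]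

/-- Eigenvalues do not change in the limit: elements of `U(ν)` are unipotent. -/
lemma _root_.Stmt17.Cochar.isUnip_of_mem_U {u : GLn n k} (hu : u ∈ ν.U) : IsUnip u := by
  obtain ⟨φ, hφ, h1, h0⟩ := hu
  rw [IsUnip]
  have hc : ∀ s, (φ s).1.charpoly = (φ 0).1.charpoly := by
    intro s
    refine Polynomial.funext fun x => ?_
    rw [Matrix.eval_charpoly, Matrix.eval_charpoly]
    have hmem : (fun s => (Matrix.scalar (Fin n) x - (φ s).1).det) ∈ reg k k :=
      det_mem fun i j => sub_mem ((reg k k).algebraMap_mem _) (hφ _ (entry_mem i j))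
    have h2 : ∀ t : kˣ, (Matrix.scalar (Fin n) x - (φ t).1).det =
        (Matrix.scalar (Fin n) x - u.1).det := by
      intro t
      rw [h1, ← Matrix.eval_charpoly, ← Matrix.eval_charpoly]
      congr 1
      simp
    have h3 := fun s => sub_eq_zero.1 (Cochar.dense_units
      (sub_mem hmem ((reg k k).algebraMap_mem (Matrix.scalar (Fin n) x - u.1).det))
      (fun t => sub_eq_zero.2 (h2 t)) s)
    exact (h3 s).trans (h3 0).symm
  have h2 : (u : Matrix (Fin n) (Fin n) k).charpoly = (1 : Matrix (Fin n) (Fin n) k).charpoly := by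
    have h3 := hc 1
    have h4 := h1 1
    rw [h0] at h3
    simp only [Units.val_one, ν.map_one, one_mul, inv_one, mul_one] at h4
    rw [h4] at h3
    exact h3
  refine ⟨n, ?_⟩
  have h5 := Matrix.aeval_self_charpoly (u : Matrix (Fin n) (Fin n) k)
  rw [h2, Matrix.charpoly_one] at h5
  simpa using h5

end RatRep

/-! ### The open cell of a cocharacter -/

namespace Cochar
variable (ν : Cochar n k) {G : Subgroup (GLn n k)}

/-- The projectors to the weight spaces of a cocharacter, as matrices. -/
noncomputable def idem (i : ℤ) : Matrix (Fin n) (Fin n) k :=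
  LinearMap.toMatrix' ((stdRep ⊤).pr ν i)

/-- The weights of a cocharacter. -/
noncomputable def supp : Finset ℤ := ((stdRep ⊤).pr ν).support

lemma idem_mulVec (i : ℤ) (v : Fin n → k) : (ν.idem i).mulVec v = (stdRep ⊤).pr ν i v :=
  LinearMap.toMatrix'_mulVec _ _

lemma idem_eq_zero {i : ℤ} (hi : i ∉ ν.supp) : ν.idem i = 0 := by
  rw [idem, Finsupp.notMem_support_iff.1 hi, map_zero]

lemma mulVec_injective {A B : Matrix (Fin n) (Fin n) k} (h : ∀ v, A.mulVec v = B.mulVec v) :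
    A = B := Matrix.mulVec_injective (funext h)

lemma idem_mul (i j : ℤ) : ν.idem i * ν.idem j = if i = j then ν.idem i else 0 := by
  refine mulVec_injective fun v => ?_
  rw [← Matrix.mulVec_mulVec, idem_mulVec, idem_mulVec, (stdRep ⊤).pr_pr in_top]
  by_cases h : i = j
  · rw [if_pos h.symm, if_pos h, idem_mulVec, h]
  · rw [if_neg (Ne.symm h), if_neg h, Matrix.zero_mulVec]

lemma idem_mul_self (i : ℤ) : ν.idem i * ν.idem i = ν.idem i := by rw [idem_mul, if_pos rfl]

lemma idem_mul_ne {i j : ℤ} (h : i ≠ j) : ν.idem i * ν.idem j = 0 := by rw [idem_mul, if_neg h]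

lemma sum_mulVec (s : Finset ℤ) (A : ℤ → Matrix (Fin n) (Fin n) k) (v : Fin n → k) :
    (∑ i ∈ s, A i).mulVec v = ∑ i ∈ s, (A i).mulVec v := by
  ext i; simp only [Matrix.mulVec, Matrix.sum_apply, dotProduct, Finset.sum_apply, Finset.sum_mul]
  exact Finset.sum_comm

lemma sum_idem : ∑ i ∈ ν.supp, ν.idem i = 1 := by
  refine mulVec_injective fun v => ?_
  rw [sum_mulVec, Matrix.one_mulVec]
  simp only [idem_mulVec]
  exact (stdRep ⊤).sum_pr in_top v

lemma coe_eq (t : kˣ) : (ν t).1 = ∑ i ∈ ν.supp, zpowFun k i t • ν.idem i := by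
  refine mulVec_injective fun v => ?_
  rw [sum_mulVec]
  simp only [Matrix.smul_mulVec, idem_mulVec]
  exact (stdRep ⊤).pr_eq_sum in_top t v

lemma idem_neg (i : ℤ) : ν.neg.idem i = ν.idem (-i) := by
  refine mulVec_injective fun v => ?_
  rw [idem_mulVec, idem_mulVec, (stdRep ⊤).pr_neg in_top]

lemma idem_comm {X : Matrix (Fin n) (Fin n) k} (h : ∀ t, (ν t).1 * X = X * (ν t).1) (i : ℤ) :
    ν.idem i * X = X * ν.idem i := by
  refine mulVec_injective fun v => ?_
  rw [← Matrix.mulVec_mulVec, ← Matrix.mulVec_mulVec, idem_mulVec, idem_mulVec]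
  refine ((stdRep ⊤).pr_map (stdRep ⊤) in_top in_top (Matrix.mulVecLin X) v (fun t => ?_) i).symm
  change X.mulVec ((ν t).1.mulVec v) = (ν t).1.mulVec (X.mulVec v)
  rw [Matrix.mulVec_mulVec, Matrix.mulVec_mulVec, h]

lemma conj_eq (X : Matrix (Fin n) (Fin n) k) (t : kˣ) : (ν t).1 * X * ((ν t)⁻¹ : GLn n k).1 =
    ∑ j ∈ ν.supp, ∑ i ∈ ν.supp, zpowFun k (j - i) t • (ν.idem j * X * ν.idem i) := by
  rw [← map_inv, coe_eq, coe_eq, Finset.sum_mul, Finset.sum_mul]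
  refine Finset.sum_congr rfl fun j _ => ?_
  rw [Finset.mul_sum]
  refine Finset.sum_congr rfl fun i _ => ?_
  rw [smul_mul_assoc, smul_mul_assoc, mul_smul_comm, smul_smul]
  congr 1
  simp [zpowFun, zpow_sub]

lemma exists_poly_conj {X : Matrix (Fin n) (Fin n) k}
    (hX : ∀ i j, j < i → ν.idem j * X * ν.idem i = 0) :
    ∃ M : k → Matrix (Fin n) (Fin n) k, (∀ i j, (fun s => M s i j) ∈ reg k k) ∧
      (∀ t : kˣ, M t = (ν t).1 * X * ((ν t)⁻¹ : GLn n k).1) ∧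
      M 0 = ∑ i ∈ ν.supp, ν.idem i * X * ν.idem i := by
  refine ⟨fun s => ∑ j ∈ ν.supp, ∑ i ∈ ν.supp, s ^ (j - i).toNat • (ν.idem j * X * ν.idem i),
    fun a b => ?_, fun t => ?_, ?_⟩
  · refine mem_reg_scalar.2 ⟨∑ j ∈ ν.supp, ∑ i ∈ ν.supp, Polynomial.X ^ (j - i).toNat *
      Polynomial.C ((ν.idem j * X * ν.idem i) a b), fun t => ?_⟩
    simp only [Matrix.sum_apply, Polynomial.eval_finsetSum, Polynomial.eval_mul, Polynomial.eval_pow,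
      Polynomial.eval_X, Polynomial.eval_C, Matrix.smul_apply, smul_eq_mul]
  · rw [conj_eq]
    refine Finset.sum_congr rfl fun j _ => Finset.sum_congr rfl fun i _ => ?_
    rcases lt_or_ge j i with h | h
    · rw [hX i j h, smul_zero, smul_zero]
    · rw [← zpowFun_natCast, Int.toNat_of_nonneg (by omega)]
  · refine Finset.sum_congr rfl fun j hj => ?_
    rw [Finset.sum_eq_single j, sub_self, Int.toNat_zero, pow_zero, one_smul]
    · intro i _ hij
      rcases lt_or_ge j i with h | h
      · rw [hX i j h, smul_zero]
      · rw [zero_pow (by omega), zero_smul]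
    · exact fun h => absurd hj h

lemma det_eq_of_poly_conj {X : Matrix (Fin n) (Fin n) k} {M : k → Matrix (Fin n) (Fin n) k}
    (hM : ∀ i j, (fun s => M s i j) ∈ reg k k)
    (h : ∀ t : kˣ, M t = (ν t).1 * X * ((ν t)⁻¹ : GLn n k).1) (s : k) : (M s).det = X.det := by
  refine sub_eq_zero.1 (dense_units (sub_mem (det_mem hM) ((reg k k).algebraMap_mem X.det))
    (fun t => sub_eq_zero.2 ?_) s)
  change (M t).det = X.det
  rw [h]
  simpa using Matrix.det_units_conj (ν t) X

lemma exists_lim {p : GLn n k} (hp : ∀ i j, j < i → ν.idem j * p.1 * ν.idem i = 0) :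
    ∃ q, ν.Lim p q ∧ q.1 = ∑ i ∈ ν.supp, ν.idem i * p.1 * ν.idem i := by
  obtain ⟨M, hM, h1, h0⟩ := ν.exists_poly_conj hp
  have hd := ν.det_eq_of_poly_conj hM h1
  have hu : IsUnit p.1.det := (Matrix.isUnit_iff_isUnit_det _).1 p.isUnit
  let φ : k → GLn n k := fun s => Matrix.nonsingInvUnit (M s) (by rw [hd]; exact hu)
  have hφ : Mor k φ := mor_GLn_of_det (fun i j => hM i j) (d := p.1.det) hd
  exact ⟨φ 0, ⟨φ, hφ, fun t => Units.ext (h1 t), rfl⟩, h0⟩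

lemma exists_mem_U {X : Matrix (Fin n) (Fin n) k}
    (hX : ∀ i j, j < i → ν.idem j * X * ν.idem i = 0)
    (hX1 : ∀ i, ν.idem i * X * ν.idem i = ν.idem i) : ∃ u ∈ ν.U, u.1 = X := by
  obtain ⟨M, hM, h1, h0⟩ := ν.exists_poly_conj hX
  have hd := ν.det_eq_of_poly_conj hM h1
  simp only [hX1] at h0
  rw [sum_idem] at h0
  have hdet : X.det = 1 := by rw [← hd 0, h0, Matrix.det_one]
  let u : GLn n k := Matrix.nonsingInvUnit X (by rw [hdet]; exact isUnit_one)
  refine ⟨u, ?_, rfl⟩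
  obtain ⟨q, hq, hq1⟩ := ν.exists_lim (p := u) hX
  have : q = 1 := by
    apply Units.ext
    rw [hq1]
    change ∑ i ∈ ν.supp, ν.idem i * X * ν.idem i = _
    simp only [hX1]
    exact ν.sum_idem
  rwa [this] at hq

/-- The projector to weights at least `i`. -/
noncomputable def E (i : ℤ) : Matrix (Fin n) (Fin n) k := ∑ j ∈ ν.supp with i ≤ j, ν.idem j

lemma idem_mul_E (i j : ℤ) : ν.idem j * ν.E i = if i ≤ j then ν.idem j else 0 := by
  rw [E, Finset.mul_sum]
  by_cases hj : j ∈ ν.supp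
  · simp only [idem_mul, Finset.sum_ite_eq, Finset.mem_filter, hj, true_and]
  · rw [ν.idem_eq_zero hj]; simp

lemma E_mul_idem (i j : ℤ) : ν.E i * ν.idem j = if i ≤ j then ν.idem j else 0 := by
  rw [E, Finset.sum_mul]
  by_cases hj : j ∈ ν.supp
  · rw [Finset.sum_congr rfl fun x _ => show _ = if x = j then ν.idem j else 0 by
      rw [idem_mul]; split_ifs with h <;> simp [h]]
    simp [hj]
  · rw [ν.idem_eq_zero hj]; simp

lemma E_mul_E (i : ℤ) : ν.E i * ν.E i = ν.E i := by
  have h : ν.E i * ν.E i = ∑ j ∈ ν.supp with i ≤ j, ν.idem j * ν.E i := Finset.sum_mul _ _ _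
  rw [h]
  refine Finset.sum_congr rfl fun j hj => ?_
  rw [idem_mul_E, if_pos (Finset.mem_filter.1 hj).2]

/-- The block of `X` on the weights at least `i`, extended by the identity. -/
noncomputable def blk (i : ℤ) (X : Matrix (Fin n) (Fin n) k) : Matrix (Fin n) (Fin n) k :=
  ν.E i * X * ν.E i + (1 - ν.E i)

lemma E_mul_blk (i : ℤ) (X : Matrix (Fin n) (Fin n) k) : ν.E i * ν.blk i X = ν.E i * X * ν.E i := by
  rw [blk, mul_add, mul_sub, mul_one, E_mul_E, sub_self, add_zero, ← mul_assoc, ← mul_assoc, E_mul_E]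

lemma blk_mem (l : ℤ) (i j : Fin n) :
    (fun g : GLn n k => ν.blk l g.1 i j) ∈ reg k (GLn n k) := by
  have h := matrix_mul_mem (A := reg k (GLn n k)) (matrix_mul_mem (matrix_const_mem (ν.E l))
    (fun i j => entry_mem i j)) (matrix_const_mem (ν.E l)) i j
  exact add_mem h (matrix_const_mem (1 - ν.E l) i j)

lemma blk_isUnit {g : GLn n k} (hg : g ∈ ν.C) (i : ℤ) : IsUnit (ν.blk i g.1).det := by
  have hc : ∀ g ∈ ν.C, ν.E i * (g : GLn n k).1 * ν.E i = g.1 * ν.E i := by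
    intro g hg
    have h1 : ν.E i * g.1 = g.1 * ν.E i := by
      rw [E, Finset.sum_mul, Finset.mul_sum]
      exact Finset.sum_congr rfl fun j _ => ν.idem_comm (fun t => congrArg Units.val (hg t)) j
    rw [h1, mul_assoc, E_mul_E]
  have h2 : ν.blk i g.1 * ν.blk i (g⁻¹ : GLn n k).1 = 1 := by
    have h3 := hc g hg
    rw [mul_assoc] at h3
    conv_lhs => rw [blk, blk, hc _ (ν.C.inv_mem hg), hc g hg]
    have h4 := hc _ (ν.C.inv_mem hg)
    have h5 : ν.E i * ((g⁻¹ : GLn n k).1 * ν.E i) = (g⁻¹ : GLn n k).1 * ν.E i := by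
      rw [← mul_assoc, h4]
    have h6 : (g.1 * ν.E i) * ((g⁻¹ : GLn n k).1 * ν.E i) = ν.E i := by
      rw [mul_assoc, h5, ← mul_assoc, Units.mul_inv, one_mul]
    rw [add_mul, mul_add, mul_add, h6, sub_mul, one_mul, h5, sub_self, mul_sub, mul_one, mul_assoc,
      E_mul_E, sub_self, mul_sub, mul_one, sub_mul, one_mul, E_mul_E, sub_self]
    simp
  exact (Matrix.isUnit_iff_isUnit_det _).1 (IsUnit.of_mul_eq_one _ h2)

/-- The function defining the open cell. -/
noncomputable def cellFun (g : GLn n k) : k := ∏ i ∈ ν.supp, (ν.blk i g.1).det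

lemma exists_cell {g : GLn n k} (hg : ν.cellFun g ≠ 0) :
    ∃ u ∈ ν.neg.U, ∃ p q, ν.Lim p q ∧ g = u * p ∧
      (q⁻¹ : GLn n k).1 = ∑ i ∈ ν.supp, ν.idem i * (ν.blk i g.1)⁻¹ * ν.idem i := by
  have hD : ∀ i ∈ ν.supp, IsUnit (ν.blk i g.1).det := fun i hi =>
    isUnit_iff_ne_zero.2 (Finset.prod_ne_zero_iff.1 hg i hi)
  let X : Matrix (Fin n) (Fin n) k := ∑ i ∈ ν.supp, g.1 * (ν.E i * (ν.blk i g.1)⁻¹ * ν.idem i)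
  have hX : ∀ i ∈ ν.supp, X * ν.idem i = g.1 * (ν.E i * (ν.blk i g.1)⁻¹ * ν.idem i) := by
    intro i hi
    rw [Finset.sum_mul, Finset.sum_eq_single i]
    · rw [mul_assoc, mul_assoc, idem_mul_self]
    · intro j _ hj
      rw [mul_assoc, mul_assoc, idem_mul_ne _ hj, mul_zero, mul_zero]
    · exact fun h => absurd hi h
  have hEX : ∀ i ∈ ν.supp, ν.E i * X * ν.idem i = ν.idem i := by
    intro i hi
    rw [mul_assoc, hX i hi, ← mul_assoc, ← mul_assoc, ← mul_assoc, ← E_mul_blk, mul_assoc (ν.E i),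
      Matrix.mul_nonsing_inv _ (hD i hi), mul_one, E_mul_idem, if_pos le_rfl]
  have hAX : ∀ i j, i ≤ j → ν.idem j * X * ν.idem i = ν.idem j * ν.idem i := by
    intro i j hij
    by_cases hi : i ∈ ν.supp
    · have h1 : ν.idem j * ν.E i = ν.idem j := by rw [idem_mul_E, if_pos hij]
      conv_lhs => rw [← h1, mul_assoc, mul_assoc, ← mul_assoc _ X, hEX i hi]
    · rw [ν.idem_eq_zero hi, mul_zero, mul_zero]
  obtain ⟨u, hu, huX⟩ := ν.neg.exists_mem_U (X := X)
    (fun i j hij => by rw [idem_neg, idem_neg, hAX _ _ (by omega), idem_mul_ne _ (by omega)])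
    (fun i => by rw [idem_neg, hAX _ _ le_rfl, idem_mul_self])
  have hw : ∀ i ∈ ν.supp, ∀ j, ν.idem j * (g⁻¹ * u).1 * ν.idem i =
      ν.idem j * ν.E i * (ν.blk i g.1)⁻¹ * ν.idem i := by
    intro i hi j
    have h1 : (g⁻¹ * u).1 * ν.idem i = ν.E i * (ν.blk i g.1)⁻¹ * ν.idem i := by
      rw [Units.val_mul, huX, mul_assoc, hX i hi, ← mul_assoc, Units.inv_mul, one_mul]
    rw [mul_assoc, h1]; simp only [mul_assoc]
  obtain ⟨q, hq, hq1⟩ := ν.exists_lim (p := g⁻¹ * u) fun i j hij => by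
    by_cases hi : i ∈ ν.supp
    · rw [hw i hi, idem_mul_E, if_neg (by omega), zero_mul, zero_mul]
    · rw [ν.idem_eq_zero hi, mul_zero]
  refine ⟨u, hu, _, _, hq.inv, by group, ?_⟩
  rw [inv_inv, hq1]
  exact Finset.sum_congr rfl fun i hi => by rw [hw i hi, idem_mul_E, if_pos le_rfl]

variable {ν}

lemma cell_mem (hG : IsClo G) (hν : ν.In G) {u p : GLn n k} (hu : u ∈ ν.neg.U)
    (hp : p ∈ ν.P) (h : u * p ∈ G) : u ∈ G ∧ p ∈ G := by
  obtain ⟨V, _, _, _, ρ, v, hv, hst⟩ := exists_line hG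
  have htop : IsClo (⊤ : Subgroup (GLn n k)) := by
    rw [IsClo, Subgroup.coe_top]; exact isClosed_univ
  obtain ⟨c, hc⟩ := ρ.exists_wt_of_eigen in_top hv fun t => (hst _).1 (hν t)
  obtain ⟨a, ha⟩ := (hst _).1 h
  obtain ⟨q, hq⟩ := hp
  have hp1 := (ρ.pr_of_lim htop in_top trivial hq hc).1
  have hc' : v ∈ ρ.wt ν.neg (-c) := by rw [ρ.wt_neg, _root_.neg_neg]; exact hc
  obtain ⟨hu1, hu2⟩ := ρ.pr_of_lim htop in_top trivial (mem_U.1 (ν.neg.U.inv_mem hu)) hc'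
  have hpu : ρ p v = a • ρ u⁻¹ v := by
    rw [← map_smul, ← ha, ← ρ.mul_apply trivial trivial, inv_mul_cancel_left]
  have hwt : ρ p v ∈ ρ.wt ν c := by
    refine ρ.mem_wt_of_pr in_top fun j hj => ?_
    rcases lt_or_gt_of_ne hj with h | h
    · exact hp1 j h
    · have := hu1 (-j) (by omega)
      rw [ρ.pr_neg in_top, _root_.neg_neg] at this
      rw [hpu, map_smul, this, smul_zero]
  have hpv : ρ p v = a • v := by
    rw [ρ.pr_neg in_top, _root_.neg_neg, ρ.one_apply] at hu2
    rw [← ρ.pr_of_mem_wt in_top hwt, hpu, map_smul, hu2]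
  have hpG : p ∈ G := (hst _).2 ⟨a, hpv⟩
  exact ⟨by simpa using G.mul_mem h (G.inv_mem hpG), hpG⟩

variable (ν)
lemma cellFun_mem : ν.cellFun ∈ reg k (GLn n k) := by
  have : ν.cellFun = ∏ i ∈ ν.supp, fun g : GLn n k => (ν.blk i g.1).det := by
    ext g; simp [cellFun]
  rw [this]
  exact prod_mem fun i _ => det_mem (blk_mem ν i)

end Cochar

/-! ### Connectedness of centralisers of cocharacters -/

section Localised
variable {X : Type} [Aff k X]

/-- Functions which are regular on the open subset `d ≠ 0` of `C`. -/
def locReg (C : Set X) {d : X → k} (hd : d ∈ reg k X) : Subalgebra k (X → k) where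
  carrier := {r | ∃ N, ∃ F ∈ reg k X, ∀ x ∈ C, d x ≠ 0 → r x * d x ^ N = F x}
  mul_mem' := by
    rintro r s ⟨N, F, hF, h⟩ ⟨M, E, hE, h'⟩
    refine ⟨N + M, F * E, mul_mem hF hE, fun x hx hdx => ?_⟩
    rw [Pi.mul_apply, Pi.mul_apply, ← h x hx hdx, ← h' x hx hdx]
    ring
  add_mem' := by
    rintro r s ⟨N, F, hF, h⟩ ⟨M, E, hE, h'⟩
    refine ⟨N + M, F * d ^ M + E * d ^ N,
      add_mem (mul_mem hF (pow_mem hd _)) (mul_mem hE (pow_mem hd _)), fun x hx hdx => ?_⟩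
    simp only [Pi.add_apply, Pi.mul_apply, Pi.pow_apply, ← h x hx hdx, ← h' x hx hdx]
    ring
  algebraMap_mem' := fun c => ⟨0, _, (reg k X).algebraMap_mem c, fun x _ _ => by simp⟩

lemma reg_le_locReg (C : Set X) {d : X → k} (hd : d ∈ reg k X) : reg k X ≤ locReg C hd :=
  fun F hF => ⟨0, F, hF, fun x _ _ => by simp⟩

lemma inv_mem_locReg (C : Set X) {d : X → k} (hd : d ∈ reg k X) {e e' : X → k}
    (he : e' ∈ reg k X) (h : d = e * e') : (fun x => (e x)⁻¹) ∈ locReg C hd := by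
  refine ⟨1, e', he, fun x _ hx => ?_⟩
  have : e x ≠ 0 := fun h0 => hx (by rw [h, Pi.mul_apply, h0, zero_mul])
  rw [pow_one, h, Pi.mul_apply, inv_mul_cancel_left₀ this]

lemma Irr.rational_image {C : Set X} (hC : Irr k C) {d : X → k} (hd : d ∈ reg k X) {x₀ : X}
    (hx₀ : x₀ ∈ C) (hdx₀ : d x₀ ≠ 0) {π : X → GLn n k}
    (hπ : ∀ i, (fun x => coordFun n k i (π x)) ∈ locReg C hd) :
    Irr k (π '' {x | x ∈ C ∧ d x ≠ 0}) := by
  have hall : ∀ f ∈ reg k (GLn n k), (fun x => f (π x)) ∈ locReg C hd := fun f hf =>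
    (evalHom_range_le (A := (locReg C hd).comap (pull k π)) hπ) hf
  refine irr_iff.2 ⟨⟨_, _, ⟨hx₀, hdx₀⟩, rfl⟩, fun f hf g hg hfg => ?_⟩
  obtain ⟨N, F, hF, h⟩ := hall f hf
  obtain ⟨M, E, hE, h'⟩ := hall g hg
  by_contra! hcon
  obtain ⟨⟨_, ⟨x, ⟨hx, hdx⟩, rfl⟩, hfx⟩, ⟨_, ⟨y, ⟨hy, hdy⟩, rfl⟩, hgy⟩⟩ := hcon
  obtain ⟨z, hz, hFz, hEz⟩ := hC.exists_ne (mul_mem hF hd) hE hx hy (x := x) (y := y)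
    (mul_ne_zero (h x hx hdx ▸ mul_ne_zero hfx (pow_ne_zero _ hdx)) hdx)
    (h' y hy hdy ▸ mul_ne_zero hgy (pow_ne_zero _ hdy))
  have hdz : d z ≠ 0 := right_ne_zero_of_mul hFz
  have hFz := left_ne_zero_of_mul hFz
  rw [← h z hz hdz] at hFz
  rw [← h' z hz hdz] at hEz
  exact mul_ne_zero (left_ne_zero_of_mul hFz) (left_ne_zero_of_mul hEz) (hfg _ ⟨z, ⟨hz, hdz⟩, rfl⟩)

end Localised

namespace Cochar
variable {ν : Cochar n k} {G : Subgroup (GLn n k)}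

lemma Lim.det_eq {p q : GLn n k} (h : ν.Lim p q) : p.1.det = q.1.det := by
  obtain ⟨φ, hφ, hφt, rfl⟩ := h
  have h1 : (fun s => (φ s).1.det - p.1.det) ∈ reg k k :=
    sub_mem (hφ _ (det_mem fun i j => entry_mem i j)) ((reg k k).algebraMap_mem p.1.det)
  refine (sub_eq_zero.1 (dense_units h1 (fun t => ?_) 0)).symm
  rw [hφt, Units.val_mul, Units.val_mul, Matrix.det_units_conj, sub_self]

lemma const_of_inv {a b : k → k} (ha : a ∈ reg k k) (hb : b ∈ reg k k)
    (h : ∀ t : kˣ, a (t⁻¹ : kˣ) = b t) (t : kˣ) : b t = b 0 := by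
  obtain ⟨c, hc, hc0, -⟩ := exists_polynomial_lsum (mor_scalar_iff.2 ha)
  obtain ⟨d, hd, hd0, hd1⟩ := exists_polynomial_lsum (mor_scalar_iff.2 hb)
  have hcd : d = c.mapDomain (fun i => -i) := lsum_injective fun t => by
    rw [← hd, ← h, hc, lsum, lsum, Finsupp.sum_mapDomain_index_inj neg_injective]
    exact Finsupp.sum_congr fun i _ => by simp [zpowFun]
  have hdi : ∀ i, i ≠ 0 → d i = 0 := by
    intro i hi
    rcases lt_or_gt_of_ne hi with h0 | h0
    · exact hd0 i h0
    · rw [hcd, show i = -(-i) by simp,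
        Finsupp.mapDomain_apply (f := fun i : ℤ => -i) neg_injective]
      exact hc0 _ (by omega)
  have hds : d = Finsupp.single 0 (b 0) := by
    ext i
    rcases eq_or_ne i 0 with rfl | hi
    · simp [hd1]
    · rw [hdi i hi, Finsupp.single_eq_of_ne hi]
  rw [hd, hds, lsum_single, zpowFun_zero, one_smul]

lemma mem_C_of_mem_P {p : GLn n k} (h : p ∈ ν.P) (h' : p ∈ ν.neg.P) : p ∈ ν.C := by
  obtain ⟨q, hq⟩ := h
  obtain ⟨_, φ, hφ, hφt, -⟩ := h'
  have hq' := hq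
  obtain ⟨ψ, hψ, hψt, rfl⟩ := hq'
  have : ∀ t : kˣ, ψ t = ψ 0 := fun t => Units.ext <| Matrix.ext fun i j =>
    const_of_inv (hφ _ (entry_mem i j)) (hψ _ (entry_mem i j))
      (fun t => by simp only [Function.comp, hφt, hψt, neg_apply, map_inv, inv_inv]) t
  have h1 := this 1
  rw [hψt, map_one] at h1
  have h2 := hq.mem_C
  rw [← h1] at h2
  simpa using h2

lemma eq_one_of_mem_U {p : GLn n k} (h : p ∈ ν.P) (h' : p ∈ ν.neg.U) : p = 1 :=
  ((mem_U.1 h').eq_of_comm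
    (mem_C.1 (C_neg (ν := ν) ▸ mem_C_of_mem_P h (U_le_P h')))).symm

lemma cellFun_ne_zero_of_mem_C {g : GLn n k} (hg : g ∈ ν.C) : ν.cellFun g ≠ 0 :=
  Finset.prod_ne_zero_iff.2 fun i _ => (blk_isUnit ν hg i).ne_zero

/-- The points of the open cell of `G`. -/
lemma exists_cell_of_mem (hG : IsClo G) (hν : ν.In G) {g : GLn n k}
    (hg : g ∈ G) (h : ν.cellFun g ≠ 0) :
    ∃ u ∈ G ⊓ ν.neg.U, ∃ c ∈ G ⊓ ν.C, ∃ w ∈ G ⊓ ν.U, g = u * c * w := by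
  obtain ⟨u, hu, p, q, hpq, rfl, -⟩ := exists_cell ν h
  obtain ⟨huG, hpG⟩ := cell_mem hG hν hu ⟨q, hpq⟩ hg
  have hqG := hpq.mem hG hν hpG
  exact ⟨u, ⟨huG, hu⟩, q, ⟨hqG, hpq.mem_C⟩, q⁻¹ * p, ⟨G.mul_mem (G.inv_mem hqG) hpG,
    hpq.inv_mul_mem_U⟩, by group⟩

theorem irr_C_of (hI : IsIrr G)
    (hm : ∀ {u p q : GLn n k}, u ∈ ν.neg.U → ν.Lim p q → u * p ∈ G → q ∈ G) :
    IsIrr (G ⊓ ν.C) := by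
  classical
  choose! u hu p q hpq hup hq using fun (g : GLn n k) (hg : ν.cellFun g ≠ 0) => exists_cell ν hg
  have hR : reg k (GLn n k) ≤ locReg (G : Set (GLn n k)) (cellFun_mem ν) := reg_le_locReg _ _
  set d := ν.cellFun with hd
  have key : ∀ M : GLn n k → Matrix (Fin n) (Fin n) k,
      (∀ i j, (fun g => M g i j) ∈ locReg (G : Set (GLn n k)) (cellFun_mem ν)) →
      ∀ M' : GLn n k → Matrix (Fin n) (Fin n) k, (∀ g, d g ≠ 0 → M' g = M g) →
      ∀ i j, (fun g => M' g i j) ∈ locReg (G : Set (GLn n k)) (cellFun_mem ν) := by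
    intro M hM M' h i j
    obtain ⟨N, F, hF, h'⟩ := hM i j
    exact ⟨N, F, hF, fun x hx hdx => by simp only [h x hdx]; exact h' x hx hdx⟩
  have hinv : ∀ i j, (fun g => ((q g)⁻¹ : GLn n k).1 i j) ∈
      locReg (G : Set (GLn n k)) (cellFun_mem ν) := by
    refine key (fun g => ∑ i ∈ ν.supp, ν.idem i * (ν.blk i g.1)⁻¹ * ν.idem i) ?_ _ hq
    intro a b
    have : (fun g : GLn n k => (∑ i ∈ ν.supp, ν.idem i * (ν.blk i g.1)⁻¹ * ν.idem i) a b) =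
        ∑ i ∈ ν.supp, fun g : GLn n k => (ν.idem i * (ν.blk i g.1)⁻¹ * ν.idem i) a b := by
      ext g
      rw [Matrix.sum_apply, Finset.sum_apply]
    rw [this]
    refine sum_mem fun i hi => matrix_mul_mem (matrix_mul_mem (matrix_const_mem _) fun a b => ?_)
      (matrix_const_mem _) a b
    simp only [Matrix.inv_def, Matrix.smul_apply, smul_eq_mul, Ring.inverse_eq_inv']
    refine mul_mem (inv_mem_locReg _ _ (e' := fun g => ∏ j ∈ ν.supp.erase i, (ν.blk j g.1).det)
      ?_ ?_) (adjugate_mem (fun a b => hR (blk_mem ν i a b)) a b)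
    · have : (fun g : GLn n k => ∏ j ∈ ν.supp.erase i, (ν.blk j g.1).det) =
        ∏ j ∈ ν.supp.erase i, fun g : GLn n k => (ν.blk j g.1).det := by ext; simp
      rw [this]
      exact prod_mem fun j _ => det_mem (blk_mem ν j)
    · ext g
      exact (Finset.mul_prod_erase _ (fun j => (ν.blk j g.1).det) hi).symm
  have hval : ∀ i j, (fun g => (q g).1 i j) ∈ locReg (G : Set (GLn n k)) (cellFun_mem ν) := by
    refine key (fun g => g.1.det • ((q g)⁻¹ : GLn n k).1.adjugate) (fun i j => ?_) _ fun g hg => ?_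
    · simp only [Matrix.smul_apply, smul_eq_mul]
      exact mul_mem (hR (det_mem fun i j => entry_mem i j)) (adjugate_mem hinv i j)
    · have h1 : g.1.det = (q g).1.det := by
        have h2 : (u g).1.det = 1 := by simpa using (mem_U.1 (hu g hg)).det_eq
        conv_lhs => rw [hup g hg, Units.val_mul, Matrix.det_mul, h2, one_mul, (hpq g hg).det_eq]
      have h3 := Matrix.mul_adjugate ((q g)⁻¹ : GLn n k).1
      have h4 : (q g).1.det * ((q g)⁻¹ : GLn n k).1.det = 1 := by
        rw [← Matrix.det_mul, Units.mul_inv, Matrix.det_one]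
      have h5 := congrArg (fun X => g.1.det • ((q g).1 * X)) h3
      simp only [← mul_assoc, Units.mul_inv, one_mul, mul_smul_comm, mul_one, smul_smul] at h5
      rw [h5, h1, h4, one_smul]
  have h1 : d 1 ≠ 0 := cellFun_ne_zero_of_mem_C (one_mem _)
  convert hI.rational_image (cellFun_mem ν) G.one_mem h1 (π := q) (fun i => ?_) using 1
  · ext c
    constructor
    · rintro ⟨hcG, hcC⟩
      have hdc : d c ≠ 0 := cellFun_ne_zero_of_mem_C hcC
      refine ⟨c, ⟨hcG, hdc⟩, ?_⟩
      have h2 := hpq c hdc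
      have h4 : u c = 1 := by
        refine eq_one_of_mem_U ?_ (hu c hdc)
        have h5 : u c = c * (p c)⁻¹ := eq_mul_inv_of_mul_eq (hup c hdc).symm
        exact h5 ▸ mul_mem (C_le_P hcC) (inv_mem ⟨_, h2⟩)
      have h5 := hup c hdc
      rw [h4, one_mul] at h5
      rw [← h5] at h2
      exact h2.eq_of_comm (mem_C.1 hcC)
    · rintro ⟨g, ⟨hgG, hdg⟩, rfl⟩
      have h0 := hup g hdg
      exact ⟨hm (hu g hdg) (hpq g hdg) (h0 ▸ hgG), (hpq g hdg).mem_C⟩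
  · rcases i with ⟨i, j, b⟩
    cases b
    · exact hinv i j
    · exact hval i j

theorem irr_C (hG : IsClo G) (hI : IsIrr G) (hν : ν.In G) : IsIrr (G ⊓ ν.C) :=
  irr_C_of hI fun hu hpq h => hpq.mem hG hν (cell_mem hG hν hu ⟨_, hpq⟩ h).2

lemma inf_P_eq (hG : IsClo G) (hν : ν.In G) : ((G ⊓ ν.P : Subgroup (GLn n k)) : Set (GLn n k)) =
      ((G ⊓ ν.C : Subgroup (GLn n k)) : Set (GLn n k)) * (G ⊓ ν.U : Subgroup (GLn n k)) := by
  ext p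
  constructor
  · rintro ⟨hpG, q, hq⟩
    have hqG := hq.mem hG hν hpG
    exact ⟨q, ⟨hqG, hq.mem_C⟩, q⁻¹ * p, ⟨G.mul_mem (G.inv_mem hqG) hpG, hq.inv_mul_mem_U⟩,
      by simp⟩
  · rintro ⟨c, hc, u, hu, rfl⟩
    exact ⟨G.mul_mem hc.1 hu.1, mul_mem (C_le_P hc.2) (U_le_P hu.2)⟩

theorem irr_P (hG : IsClo G) (hI : IsIrr G) (hν : ν.In G) : IsIrr (G ⊓ ν.P) := by
  rw [IsIrr, inf_P_eq hG hν]
  exact (irr_C hG hI hν).mul (irr_G_U hG hν)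

/-- The open cell generates a connected group. -/
lemma le_of_cell (hG : IsClo G) (hI : IsIrr G) (hν : ν.In G)
    {H : Subgroup (GLn n k)} (h1 : G ⊓ ν.neg.U ≤ H) (h2 : G ⊓ ν.C ≤ H) (h3 : G ⊓ ν.U ≤ H) :
    G ≤ H := by
  have hcell : ∀ g ∈ G, ν.cellFun g ≠ 0 → g ∈ H := by
    intro g hg hd
    obtain ⟨u, hu, c, hc, w, hw, rfl⟩ := exists_cell_of_mem hG hν hg hd
    exact mul_mem (mul_mem (h1 hu) (h2 hc)) (h3 hw)
  have hone : ν.cellFun 1 ≠ 0 := cellFun_ne_zero_of_mem_C (one_mem _)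
  intro g hg
  have hm : Mor k fun x : GLn n k => x⁻¹ * g := Mor.mul (Mor.inv Mor.id) (Mor.const g)
  obtain ⟨x, hx, hx1, hx2⟩ := hI.exists_ne (cellFun_mem ν) (hm _ (cellFun_mem ν)) G.one_mem hg
    hone (by simpa using hone)
  have := mul_mem (hcell x hx hx1) (hcell (x⁻¹ * g) (G.mul_mem (G.inv_mem hx) hg) hx2)
  simpa using this

end Cochar

lemma RatRep.nilp_quot {V : Type} [AddCommGroup V] [Module k V] {H : Subgroup (GLn n k)}
    (ρ : RatRep H V) {W : Submodule k V} (hst : ρ.Stable W) {g : GLn n k} (hg : g ∈ H)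
    (h : IsNilpotent (ρ g - 1)) : IsNilpotent (ρ.quot W hst g - 1) := by
  obtain ⟨N, hN⟩ := h
  have : ∀ N : ℕ, ((ρ.quot W hst g - 1 : Module.End k (V ⧸ W)) ^ N) ∘ₗ W.mkQ =
      W.mkQ ∘ₗ ((ρ g - 1 : Module.End k V) ^ N) := by
    intro N
    induction N with
    | zero => rfl
    | succ N ih =>
      ext w
      have := LinearMap.congr_fun ih (ρ g w - w)
      simp only [LinearMap.comp_apply, pow_succ, Module.End.mul_apply, LinearMap.sub_apply,
        ρ.quot_apply hst hg, Module.End.one_apply] at this ⊢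
      rw [← this, ← map_sub]
  refine ⟨N, LinearMap.ext fun w => ?_⟩
  obtain ⟨w, rfl⟩ := W.mkQ_surjective w
  rw [← LinearMap.comp_apply, this, hN]
  simp

lemma exists_unipotent_flag {V : Type} [AddCommGroup V] [Module k V] [FiniteDimensional k V]
    {H : Subgroup (GLn n k)} (ρ : RatRep H V) (h : ∀ g ∈ H, IsNilpotent (ρ g - 1)) :
    ∃ m, ∀ g ∈ dser H m, ∀ v, ρ g v = v := by
  obtain ⟨d, hd⟩ : ∃ d, Module.finrank k V = d := ⟨_, rfl⟩
  induction d generalizing V with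
  | zero =>
    have := Module.finrank_zero_iff.1 hd
    exact ⟨0, fun g _ v => Subsingleton.elim _ _⟩
  | succ d ih =>
    have : Nontrivial V := Module.nontrivial_of_finrank_pos (R := k) (by omega)
    obtain ⟨v, hv0, hv⟩ := ρ.kolchin h
    have hst : ρ.Stable (k ∙ v) := by
      intro g hg w hw
      obtain ⟨c, rfl⟩ := Submodule.mem_span_singleton.1 hw
      rw [_root_.map_smul, hv g hg]
      exact hw
    have hfr : Module.finrank k (V ⧸ (k ∙ v)) = d := by
      have := Submodule.finrank_quotient_add_finrank (k ∙ v)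
      rw [finrank_span_singleton hv0] at this
      omega
    obtain ⟨m, hm⟩ := ih (ρ.quot _ hst) (fun g hg => ρ.nilp_quot hst hg (h g hg)) hfr
    refine ⟨m + 1, commutator_trivial (F := k ∙ v) (F' := ⊤) (dser_le H m) (fun g hg w hw => ?_)
      (fun g hg w _ => ?_) |> fun h g hg w => h g hg w trivial⟩
    · obtain ⟨c, rfl⟩ := Submodule.mem_span_singleton.1 hw
      rw [_root_.map_smul, hv g (dser_le H m hg)]
    · have := hm g hg ((k ∙ v).mkQ w)
      rw [ρ.quot_apply hst (dser_le H m hg)] at this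
      exact (Submodule.Quotient.eq _).1 this

lemma nilp_of_isUnip {G : Subgroup (GLn n k)} {g : GLn n k} (hg : IsUnip g) :
    IsNilpotent (stdRep G g - 1) := by
  have : stdRep G g - 1 = Matrix.toLin' (g.1 - 1) := by
    rw [map_sub, Matrix.toLin'_one]
    rfl
  rw [this]
  exact hg.map Matrix.toLinAlgEquiv'

lemma isSolvable_of_isUnip {H : Subgroup (GLn n k)} (h : ∀ g ∈ H, IsUnip g) : IsSolvable H := by
  obtain ⟨m, hm⟩ := exists_unipotent_flag (stdRep H) fun g hg => nilp_of_isUnip (h g hg)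
  exact mem_dser_trivial hm

namespace Cochar
variable {ν : Cochar n k} {G : Subgroup (GLn n k)}

theorem isSolvable_P (hG : IsClo G) (hν : ν.In G) (hC : IsSolvable (G ⊓ ν.C : Subgroup (GLn n k))) :
    IsSolvable (G ⊓ ν.P : Subgroup (GLn n k)) := by
  classical
  have hU : Group.IsSolvable (G ⊓ ν.U : Subgroup (GLn n k)) :=
    isSolvable_of_isUnip fun g hg => isUnip_of_mem_U hg.2
  have hC' : Group.IsSolvable (G ⊓ ν.C : Subgroup (GLn n k)) := hC
  choose! q hq using fun (p : GLn n k) (hp : p ∈ ν.P) => hp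
  let f : (G ⊓ ν.P : Subgroup (GLn n k)) →* (G ⊓ ν.C : Subgroup (GLn n k)) :=
    { toFun := fun p => ⟨q p, (hq p p.2.2).mem hG hν p.2.1, (hq p p.2.2).mem_C⟩
      map_one' := Subtype.ext ((hq 1 (one_mem _)).unique lim_one)
      map_mul' := fun a b => Subtype.ext
        ((hq _ (a * b).2.2).unique ((hq a a.2.2).mul (hq b b.2.2))) }
  refine solvable_of_ker_le_range (Subgroup.inclusion
    (inf_le_inf_left G (U_le_P (ν := ν)))) f fun p hp => ?_
  have h1 : q p = 1 := congrArg Subtype.val (MonoidHom.mem_ker.1 hp)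
  exact ⟨⟨p, p.2.1, mem_U.2 (h1 ▸ hq p p.2.2)⟩, Subtype.ext rfl⟩

end Cochar

/-! ### Images of unipotent elements are unipotent -/

section Nilpotent
variable {V : Type} [AddCommGroup V] [Module k V] [FiniteDimensional k V]

lemma nilp_of_eigenvalues {T : V →ₗ[k] V} (h : ∀ (e : k) (v : V), v ≠ 0 → T v = e • v → e = 1) :
    IsNilpotent (T - 1) := by
  have hs := IsAlgClosed.splits (minpoly k T)
  have hr : (minpoly k T).roots = Multiset.replicate (minpoly k T).roots.card 1 := by
    refine Multiset.eq_replicate.2 ⟨rfl, fun e he => ?_⟩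
    obtain ⟨v, hv⟩ := (Module.End.hasEigenvalue_of_isRoot
      (Polynomial.isRoot_of_mem_roots he)).exists_hasEigenvector
    exact h e v hv.2 hv.apply_eq_smul
  have hm := hs.eq_prod_roots_of_monic (minpoly.monic (Algebra.IsIntegral.isIntegral T))
  rw [hr, Multiset.map_replicate, Multiset.prod_replicate] at hm
  refine ⟨(minpoly k T).roots.card, ?_⟩
  have := minpoly.aeval k T
  rw [hm] at this
  simpa [Polynomial.aeval_def] using this

lemma eq_one_of_nilp {T : V →ₗ[k] V} (h : IsNilpotent (T - 1)) {e : k} {v : V} (hv : v ≠ 0)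
    (he : T v = e • v) : e = 1 := by
  obtain ⟨N, hN⟩ := h
  have : ∀ N : ℕ, ((T - 1 : Module.End k V) ^ N) v = (e - 1) ^ N • v := by
    intro N
    induction N with
    | zero => simp
    | succ N ih =>
      rw [pow_succ', Module.End.mul_apply, ih, _root_.map_smul, LinearMap.sub_apply, he,
        Module.End.one_apply, pow_succ, mul_smul, sub_smul, one_smul]
  have h0 := this N
  rw [hN, LinearMap.zero_apply, eq_comm, smul_eq_zero, or_iff_left hv] at h0
  exact sub_eq_zero.1 (pow_eq_zero_iff (fun h => by simp [h] at h0) |>.1 h0)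

lemma sub_one_pow_char_pow {A : Type} [Ring A] [Algebra k A] {p : ℕ} [CharP k p] [Fact p.Prime]
    (a : A) (N : ℕ) : (a - 1) ^ p ^ N = a ^ p ^ N - 1 := by
  rcases subsingleton_or_nontrivial A with h | h
  · exact Subsingleton.elim _ _
  · have := charP_of_injective_algebraMap (algebraMap k A).injective p
    rw [sub_pow_char_pow_of_commute _ _ (Commute.one_right a), one_pow]

end Nilpotent

lemma IsUnip.inv {h : GLn n k} (hh : IsUnip h) : IsUnip h⁻¹ := by
  have : (h⁻¹ : GLn n k).1 - 1 = -((h⁻¹ : GLn n k).1 * (h.1 - 1)) := by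
    rw [mul_sub, Units.inv_mul, mul_one, neg_sub]
  rw [IsUnip, this]
  refine IsNilpotent.neg (Commute.isNilpotent_mul_left ?_ hh)
  rw [Commute, SemiconjBy, mul_sub, sub_mul, Units.inv_mul, Units.mul_inv, mul_one, one_mul]

lemma exists_poly_pow [CharZero k] {h : GLn n k} (hh : IsUnip h) (i j : Fin n) :
    ∃ Q : Polynomial k, ∀ m : ℕ, (h ^ m).1 i j = Q.eval (m : k) := by
  obtain ⟨d, hd⟩ := hh
  refine ⟨∑ r ∈ Finset.range d, Polynomial.C ((r.factorial : k)⁻¹ * ((h.1 - 1) ^ r) i j) *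
    descPochhammer k r, fun m => ?_⟩
  have h1 : (h ^ m).1 = ∑ r ∈ Finset.range (m + 1), (m.choose r : k) • (h.1 - 1) ^ r := by
    have := Commute.add_pow (Commute.one_right (h.1 - 1)) m
    rw [sub_add_cancel] at this
    rw [Units.val_pow_eq_pow_val, this]
    refine Finset.sum_congr rfl fun r _ => ?_
    rw [one_pow, mul_one, Algebra.smul_def, Algebra.commutes, map_natCast]
  have h2 : (h ^ m).1 = ∑ r ∈ Finset.range d, (m.choose r : k) • (h.1 - 1) ^ r := by
    have e1 : ∀ e, m + 1 ≤ e → ∑ r ∈ Finset.range (m + 1), (m.choose r : k) • (h.1 - 1) ^ r =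
        ∑ r ∈ Finset.range e, (m.choose r : k) • (h.1 - 1) ^ r := fun e he =>
      Finset.sum_subset (Finset.range_mono he) fun r _ hr => by
        rw [Nat.choose_eq_zero_of_lt (by simpa using hr), Nat.cast_zero, zero_smul]
    have e2 : ∀ e, d ≤ e → ∑ r ∈ Finset.range d, (m.choose r : k) • (h.1 - 1) ^ r =
        ∑ r ∈ Finset.range e, (m.choose r : k) • (h.1 - 1) ^ r := fun e he =>
      Finset.sum_subset (Finset.range_mono he) fun r _ hr => by
        rw [pow_eq_zero_of_le (by simpa using hr) hd, smul_zero]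
    rw [h1, e1 (m + 1 + d) (by omega), e2 (m + 1 + d) (by omega)]
  rw [h2, Matrix.sum_apply, Polynomial.eval_finsetSum]
  refine Finset.sum_congr rfl fun r _ => ?_
  rw [Polynomial.eval_mul, Polynomial.eval_C, descPochhammer_eval_eq_descFactorial,
    Nat.descFactorial_eq_factorial_mul_choose, Matrix.smul_apply, smul_eq_mul, Nat.cast_mul]
  have : (r.factorial : k) ≠ 0 := Nat.cast_ne_zero.2 r.factorial_ne_zero
  field_simp

lemma exists_poly_of_reg [CharZero k] {h : GLn n k} (hh : IsUnip h) {f : GLn n k → k}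
    (hf : f ∈ reg k (GLn n k)) : ∃ Q : Polynomial k, ∀ m : ℕ, f (h ^ m) = Q.eval (m : k) := by
  let A : Subalgebra k (GLn n k → k) :=
    { carrier := {f | ∃ Q : Polynomial k, ∀ m : ℕ, f (h ^ m) = Q.eval (m : k)}
      mul_mem' := fun ⟨P, hP⟩ ⟨Q, hQ⟩ => ⟨P * Q, fun m => by simp [hP, hQ]⟩
      add_mem' := fun ⟨P, hP⟩ ⟨Q, hQ⟩ => ⟨P + Q, fun m => by simp [hP, hQ]⟩
      algebraMap_mem' := fun c => ⟨Polynomial.C c, fun m => by simp⟩ }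
  refine (evalHom_range_le (A := A) ?_) hf
  rintro ⟨i, j, b⟩
  cases b
  · obtain ⟨Q, hQ⟩ := exists_poly_pow hh.inv i j
    exact ⟨Q, fun m => by rw [← hQ, inv_pow]; simp [coordFun]⟩
  · obtain ⟨Q, hQ⟩ := exists_poly_pow hh i j
    exact ⟨Q, fun m => by rw [← hQ]; simp [coordFun]⟩

lemma RatRep.pow_apply {V : Type} [AddCommGroup V] [Module k V] {H : Subgroup (GLn n k)}
    (ρ : RatRep H V) {h : GLn n k} (hh : h ∈ H) (m : ℕ) :
    ρ (h ^ m) = (ρ h : Module.End k V) ^ m := by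
  induction m with
  | zero => ext v; simp [ρ.one_apply]
  | succ m ih => ext v; rw [pow_succ, ρ.mul_apply (pow_mem hh m) hh, ih, pow_succ]; rfl

theorem RatRep.nilp_of_isUnip {V : Type} [AddCommGroup V] [Module k V] [FiniteDimensional k V]
    {H : Subgroup (GLn n k)} (ρ : RatRep H V) {h : GLn n k} (hh : h ∈ H) (hu : IsUnip h) :
    IsNilpotent (ρ h - 1) := by
  obtain ⟨p, hp⟩ := CharP.exists k
  rcases CharP.char_is_prime_or_zero k p with hpr | rfl
  · have : Fact p.Prime := ⟨hpr⟩
    obtain ⟨N, hN⟩ := hu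
    have h1 : h ^ p ^ N = 1 := by
      refine Units.ext ?_
      have := sub_one_pow_char_pow (k := k) (p := p) h.1 N
      rw [pow_eq_zero_of_le (Nat.lt_pow_self hpr.one_lt).le hN, eq_comm, sub_eq_zero] at this
      simpa using this
    refine ⟨p ^ N, ?_⟩
    have := sub_one_pow_char_pow (k := k) (p := p) (ρ h : Module.End k V) N
    rw [this, ← ρ.pow_apply hh, h1]
    ext v
    simp [ρ.one_apply]
  · have : CharZero k := CharP.charP_to_charZero k
    refine nilp_of_eigenvalues fun e v hv he => ?_
    have hpow : ∀ m : ℕ, ρ (h ^ m) v = e ^ m • v := by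
      intro m
      induction m with
      | zero => simp [ρ.one_apply]
      | succ m ih => rw [pow_succ, ρ.mul_apply (pow_mem hh m) hh, he, _root_.map_smul, ih, smul_smul,
          pow_succ']
    obtain ⟨l, hl⟩ : ∃ l : Module.Dual k V, l v ≠ 0 := by
      by_contra! hcon
      exact hv ((Module.forall_dual_apply_eq_zero_iff k v).1 hcon)
    obtain ⟨f, hf, hfe⟩ := ρ.regular v l
    obtain ⟨Q, hQ⟩ := exists_poly_of_reg hu hf
    have hQe : ∀ m : ℕ, Q.eval (m : k) = e ^ m * l v := fun m => by
      rw [← hQ, ← hfe _ (pow_mem hh m), hpow, _root_.map_smul, smul_eq_mul]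
    have hQ0 : Q ≠ 0 := by
      rintro rfl
      have := hQe 0
      simp [hl.symm] at this
    have hshift : Q.comp (Polynomial.X + Polynomial.C 1) = Polynomial.C e * Q := by
      refine Polynomial.eq_of_infinite_eval_eq _ _ ((Set.infinite_range_of_injective
        (Nat.cast_injective (R := k))).mono ?_)
      rintro _ ⟨m, rfl⟩
      have h1 := hQe (m + 1)
      have h2 := hQe m
      push_cast at h1
      simp only [Set.mem_ofPred_eq, Polynomial.eval_comp, Polynomial.eval_add, Polynomial.eval_X,
        Polynomial.eval_C, Polynomial.eval_mul, h1, h2, pow_succ]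
      ring
    have hlc := congrArg Polynomial.leadingCoeff hshift
    rw [Polynomial.leadingCoeff_comp (by
      rw [Polynomial.natDegree_X_add_C]; exact one_ne_zero), Polynomial.leadingCoeff_mul,
      Polynomial.leadingCoeff_C, Polynomial.leadingCoeff_X_add_C, one_pow, mul_one] at hlc
    exact (mul_right_cancel₀ (Polynomial.leadingCoeff_ne_zero.2 hQ0) (by rw [one_mul]; exact hlc)).symm

section
variable {V : Type} [AddCommGroup V] [Module k V] [FiniteDimensional k V]

noncomputable def diagHom (n : ℕ) (k : Type) [Field k] : (Fin n → kˣ) →* GLn n k :=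
  (Units.map (Matrix.diagonalRingHom (Fin n) k).toMonoidHom).comp MulEquiv.piUnits.symm.toMonoidHom

lemma coe_diagHom (x : Fin n → kˣ) :
    (diagHom n k x).1 = Matrix.diagonal fun i => (x i : k) := rfl

/-- The monomial function `x ↦ x ^ χ` on the diagonal torus. -/
def mon (χ : Fin n → ℤ) : (Fin n → kˣ) →* k where
  toFun x := ((∏ i, x i ^ χ i : kˣ) : k)
  map_one' := by simp
  map_mul' x y := by simp [mul_zpow, Finset.prod_mul_distrib]

lemma mon_apply (χ : Fin n → ℤ) (x : Fin n → kˣ) : mon χ x = ((∏ i, x i ^ χ i : kˣ) : k) := rfl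

lemma mon_add (χ χ' : Fin n → ℤ) (x : Fin n → kˣ) :
    mon (χ + χ') x = mon χ x * mon χ' x := by
  simp [mon_apply, zpow_add, Finset.prod_mul_distrib]

lemma mon_ne_zero (χ : Fin n → ℤ) (x : Fin n → kˣ) : mon χ x ≠ 0 := Units.ne_zero _

lemma mon_curve (χ a : Fin n → ℤ) (t : kˣ) :
    mon χ (fun i => t ^ a i) = zpowFun k (∑ i, a i * χ i) t := by
  simp only [mon_apply, ← zpow_mul, zpowFun]
  congr 1
  exact (map_sum (AddMonoidHom.mk' (M := ℤ) (fun i => Additive.ofMul (t ^ i))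
    fun i j => zpow_add t i j) _ _).symm

def monSpan (S : Set (Fin n → ℤ)) : Submodule k ((Fin n → kˣ) → k) :=
  Submodule.span k ((fun χ => ⇑(mon (k := k) χ)) '' S)

lemma monSpan_mono {S S' : Set (Fin n → ℤ)} (h : S ⊆ S') :
    monSpan (k := k) S ≤ monSpan S' := Submodule.span_mono (Set.image_mono h)

def toricBounded (n : ℕ) (k : Type) [Field k] [IsAlgClosed k] : Subalgebra k (GLn n k → k) where
  carrier := {f | ∃ S : Finset (Fin n → ℤ), ∀ g : GLn n k,
    (fun x => f (g * diagHom n k x * g⁻¹)) ∈ monSpan (S : Set (Fin n → ℤ))}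
  mul_mem' := by
    classical
    rintro f f' ⟨S, hS⟩ ⟨S', hS'⟩
    refine ⟨S + S', fun g => ?_⟩
    have h := Submodule.mul_mem_mul (hS g) (hS' g)
    refine SetLike.le_def.1 ?_ h
    rw [monSpan, monSpan, Submodule.span_mul_span]
    refine Submodule.span_mono ?_
    rintro _ ⟨_, ⟨χ, hχ, rfl⟩, _, ⟨χ', hχ', rfl⟩, rfl⟩
    refine ⟨χ + χ', ?_, ?_⟩
    · rw [Finset.coe_add]; exact Set.add_mem_add hχ hχ'
    · ext x; simp [mon_add]
  add_mem' := by
    classical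
    rintro f f' ⟨S, hS⟩ ⟨S', hS'⟩
    refine ⟨S ∪ S', fun g => add_mem (monSpan_mono ?_ (hS g)) (monSpan_mono ?_ (hS' g))⟩ <;>
      simp
  algebraMap_mem' c := by
    refine ⟨{0}, fun g => ?_⟩
    have : (fun x => (algebraMap k (GLn n k → k)) c (g * diagHom n k x * g⁻¹))
        = c • ⇑(mon (k := k) (0 : Fin n → ℤ)) := by ext x; simp [mon_apply]
    rw [this]
    exact Submodule.smul_mem _ _ (Submodule.subset_span ⟨0, by simp, rfl⟩)

lemma reg_le_toricBounded : reg k (GLn n k) ≤ toricBounded n k := by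
  classical
  refine evalHom_range_le fun ⟨i, j, b⟩ => ?_
  refine ⟨Finset.univ.image fun l => Pi.single l (if b then 1 else -1), fun g => ?_⟩
  have hm : ∀ (l : Fin n) (m : ℤ) (x : Fin n → kˣ), mon (Pi.single l m) x = ((x l ^ m : kˣ) : k) := by
    intro l m x
    rw [mon_apply, Finset.prod_eq_single l]
    · simp
    · intro i _ hi; simp [hi]
    · simp
  have : (fun x => coordFun n k (i, j, b) (g * diagHom n k x * g⁻¹)) =
      ∑ l, (g.1 i l * g⁻¹.1 l j) • ⇑(mon (k := k) (Pi.single l (if b then 1 else -1))) := by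
    ext x
    simp only [Finset.sum_apply, Pi.smul_apply, hm, smul_eq_mul]
    cases b
    · have : (g * diagHom n k x * g⁻¹)⁻¹ = g * diagHom n k x⁻¹ * g⁻¹ := by
        rw [map_inv]; group
      simp only [coordFun, this, Bool.false_eq_true, if_false]
      simp only [Units.val_mul, coe_diagHom]
      rw [Matrix.mul_apply]
      simp only [Matrix.mul_diagonal]
      refine Finset.sum_congr rfl fun l _ => ?_
      simp; ring
    · simp only [coordFun, if_true, Units.val_mul, coe_diagHom]
      rw [Matrix.mul_apply]
      simp only [Matrix.mul_diagonal]
      refine Finset.sum_congr rfl fun l _ => ?_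
      simp; ring
  rw [this]
  refine Submodule.sum_mem _ fun l _ => Submodule.smul_mem _ _ (Submodule.subset_span ?_)
  exact ⟨_, by simp, rfl⟩

lemma exists_monSpan (F : Finset (GLn n k → k)) (hF : ∀ f ∈ F, f ∈ reg k (GLn n k)) :
    ∃ S : Finset (Fin n → ℤ), ∀ f ∈ F, ∀ g : GLn n k,
      (fun x => f (g * diagHom n k x * g⁻¹)) ∈ monSpan (S : Set (Fin n → ℤ)) := by
  classical
  choose! S hS using fun f hf => reg_le_toricBounded (hF f hf)
  exact ⟨F.biUnion S, fun f hf g => monSpan_mono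
    (by exact_mod_cast Finset.subset_biUnion_of_mem S hf) (hS f hf g)⟩

lemma pow_independent {s : Finset k} {c : k → k} (h : ∀ j : ℕ, ∑ ξ ∈ s, c ξ * ξ ^ j = 0) :
    ∀ ξ ∈ s, c ξ = 0 := by
  have hi := (linearIndependent_monoidHom (Multiplicative ℕ) k).comp (powersHom k)
    (powersHom k).injective
  refine linearIndependent_iff'.1 hi s c ?_
  ext j
  simpa using h j.toAdd

lemma eval_curve {S : Finset (Fin n → ℤ)} {φ : (Fin n → kˣ) → k}
    (hφ : φ ∈ monSpan (S : Set (Fin n → ℤ))) {e : Fin n → kˣ} {f b : k}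
    (h : ∀ j : ℕ, φ (e ^ j) = f ^ j * b) {a : Fin n → ℤ} {A : k → ℤ}
    (hA : ∀ χ ∈ S, ∑ i, a i * χ i = A (mon χ e)) :
    (∀ t : kˣ, φ (fun i => t ^ a i) = zpowFun k (A f) t * b) ∧
      (b ≠ 0 → ∃ χ ∈ S, mon χ e = f) := by
  classical
  obtain ⟨c, hc⟩ : ∃ c : (Fin n → ℤ) → k, φ = ∑ χ ∈ S, c χ • ⇑(mon (k := k) χ) := by
    rw [monSpan, Submodule.mem_span_image_finset_iff_exists_fun] at hφ
    obtain ⟨c, hc⟩ := hφ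
    exact ⟨fun χ => if h : χ ∈ S then c ⟨χ, h⟩ else 0, by
      rw [← hc, ← Finset.sum_attach S]
      exact Finset.sum_congr rfl fun χ _ => by simp⟩
  have hval : ∀ x, φ x = ∑ χ ∈ S, c χ * mon χ x := fun x => by simp [hc]
  set I := insert f (S.image fun χ => mon χ e) with hI
  let d : k → k := fun ξ => ∑ χ ∈ S with mon χ e = ξ, c χ
  have hmaps : ∀ χ ∈ S, mon χ e ∈ I := fun χ hχ =>
    Finset.mem_insert_of_mem (Finset.mem_image_of_mem _ hχ)
  have hd : ∀ ξ ∈ I, d ξ - (if ξ = f then b else 0) = 0 := by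
    refine pow_independent fun j => ?_
    have h1 : ∑ ξ ∈ I, d ξ * ξ ^ j = φ (e ^ j) := by
      rw [hval, ← Finset.sum_fiberwise_of_maps_to hmaps]
      refine Finset.sum_congr rfl fun ξ _ => ?_
      rw [Finset.sum_mul]
      refine Finset.sum_congr rfl fun χ hχ => ?_
      rw [map_pow, (Finset.mem_filter.1 hχ).2]
    simp only [sub_mul, Finset.sum_sub_distrib, h1, h, ite_mul, zero_mul]
    rw [Finset.sum_ite_eq' I f, if_pos (Finset.mem_insert_self _ _)]
    ring
  constructor
  · intro t
    rw [hval, ← Finset.sum_fiberwise_of_maps_to hmaps]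
    have : ∀ ξ ∈ I, ∑ χ ∈ S with mon χ e = ξ, c χ * mon χ (fun i => t ^ a i) =
        if ξ = f then zpowFun k (A f) t * b else 0 := by
      intro ξ hξ
      rw [Finset.sum_congr rfl (g := fun χ => c χ * zpowFun k (A ξ) t) fun χ hχ => ?_,
        ← Finset.sum_mul]
      · rw [show ∑ χ ∈ S with mon χ e = ξ, c χ = d ξ from rfl, sub_eq_zero.1 (hd ξ hξ)]
        split_ifs with hf
        · rw [hf, mul_comm]
        · simp
      · obtain ⟨h1, h2⟩ := Finset.mem_filter.1 hχ
        rw [mon_curve, hA χ h1, h2]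
    rw [Finset.sum_congr rfl this, Finset.sum_ite_eq' I f, if_pos (Finset.mem_insert_self _ _)]
  · intro hb
    by_contra! hne
    refine hb ?_
    have := hd f (Finset.mem_insert_self _ _)
    rw [if_pos rfl, sub_eq_zero] at this
    rw [← this]
    exact Finset.sum_eq_zero fun χ hχ => absurd (Finset.mem_filter.1 hχ).2
      (hne χ (Finset.mem_filter.1 hχ).1)

lemma eval_aeval {S : Finset (Fin n → ℤ)} {φ : (Fin n → kˣ) → k}
    (hφ : φ ∈ monSpan (S : Set (Fin n → ℤ))) (e : Fin n → kˣ) (p : Polynomial k)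
    (hp : ∀ χ ∈ S, p.eval (mon χ e) = 0) : p.sum (fun j c => c * φ (e ^ j)) = 0 := by
  induction hφ using Submodule.span_induction with
  | mem x hx =>
    obtain ⟨χ, hχ, rfl⟩ := hx
    simpa [Polynomial.eval_eq_sum] using hp χ hχ
  | zero => simp [Polynomial.sum]
  | add x y _ _ hx hy =>
    simp only [Polynomial.sum, Pi.add_apply, mul_add, Finset.sum_add_distrib] at *
    rw [hx, hy, add_zero]
  | smul c x _ hx =>
    simp only [Polynomial.sum, Pi.smul_apply, smul_eq_mul] at *
    rw [Finset.sum_congr rfl (g := fun j => c * (p.coeff j * x (e ^ j))) fun j _ => by ring,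
      ← Finset.mul_sum, hx, mul_zero]

namespace RatRep
variable {G : Subgroup (GLn n k)} (ρ : RatRep G V)

lemma exists_matrix {d : ℕ} (b : Module.Basis (Fin d) k V) :
    ∃ M : GLn n k → Matrix (Fin d) (Fin d) k, (∀ i j, (fun g => M g i j) ∈ reg k (GLn n k)) ∧
      ∀ g ∈ G, LinearMap.toMatrix b b (ρ g) = M g := by
  choose f hf hf' using fun i j => ρ.regular (b j) (b.coord i)
  exact ⟨fun g => Matrix.of fun i j => f i j g, hf, fun g hg => by
    ext i j
    simp [LinearMap.toMatrix_apply, ← hf' i j g hg]⟩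

lemma exists_monSpan : ∃ S : Finset (Fin n → ℤ), ∀ (g : GLn n k) (v : V) (l : Module.Dual k V),
    ∃ φ ∈ monSpan (k := k) (S : Set (Fin n → ℤ)), ∀ x, g * diagHom n k x * g⁻¹ ∈ G →
      l (ρ (g * diagHom n k x * g⁻¹) v) = φ x := by
  classical
  let b := Module.finBasis k V
  obtain ⟨M, hM, hM'⟩ := ρ.exists_matrix b
  obtain ⟨S, hS⟩ := Stmt17.exists_monSpan
    (Finset.univ.image fun p : Fin (Module.finrank k V) × Fin (Module.finrank k V) =>
      fun g => M g p.1 p.2) (by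
        intro f hf
        obtain ⟨p, -, rfl⟩ := Finset.mem_image.1 hf
        exact hM _ _)
  refine ⟨S, fun g v l => ⟨∑ i, ∑ j, (l (b i) * b.repr v j) •
    fun x => M (g * diagHom n k x * g⁻¹) i j, ?_, fun x hx => ?_⟩⟩
  · exact Submodule.sum_mem _ fun i _ => Submodule.sum_mem _ fun j _ => Submodule.smul_mem _ _
      (hS _ (Finset.mem_image.2 ⟨(i, j), Finset.mem_univ _, rfl⟩) g)
  · rw [← hM' _ hx |> fun h => b.sum_repr (ρ (g * diagHom n k x * g⁻¹) v), map_sum]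
    simp only [Finset.sum_apply, Pi.smul_apply, smul_eq_mul, map_smul, ← hM' _ hx]
    refine Finset.sum_congr rfl fun i _ => ?_
    have := congrFun (LinearMap.toMatrix_mulVec_repr b b (ρ (g * diagHom n k x * g⁻¹)) v) i
    rw [← this, Matrix.mulVec, dotProduct, Finset.sum_mul]
    exact Finset.sum_congr rfl fun j _ => by ring

/-- The toral factor of a commuting toral–unipotent factorisation has the same eigenvectors. -/
lemma eigen_of_jordan {g u : GLn n k} {e : Fin n → kˣ} (hs : g * diagHom n k e * g⁻¹ ∈ G)
    (hu : u ∈ G) (huu : IsUnip u)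
    (hc : g * diagHom n k e * g⁻¹ * u = u * (g * diagHom n k e * g⁻¹)) {c : k} {v : V}
    (hv : ρ (g * diagHom n k e * g⁻¹ * u) v = c • v) :
    ρ (g * diagHom n k e * g⁻¹) v = c • v := by
  classical
  obtain ⟨S, hS⟩ := ρ.exists_monSpan
  set s := g * diagHom n k e * g⁻¹ with hsdef
  have hpow : ∀ j, s ^ j = g * diagHom n k (e ^ j) * g⁻¹ := fun j => by
    rw [map_pow, hsdef, conj_pow]
  let A : Module.End k V := ρ s
  let B : Module.End k V := ρ u
  have hAB : A * B = B * A := by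
    rw [← ρ.map_mul _ hs _ hu, ← ρ.map_mul _ hu _ hs, hc]
  let I := S.image fun χ => mon (k := k) χ e
  let p : Polynomial k := ∏ ξ ∈ I, (Polynomial.X - Polynomial.C ξ)
  have hp : Polynomial.aeval A p = 0 := by
    ext w
    refine (Module.forall_dual_apply_eq_zero_iff k _).1 fun l => ?_
    obtain ⟨φ, hφ, hφ'⟩ := hS g w l
    rw [← eval_aeval hφ e p fun χ hχ => ?_]
    · rw [Polynomial.aeval_eq_sum_range, LinearMap.sum_apply, map_sum, Polynomial.sum_over_range]
      · refine Finset.sum_congr rfl fun j _ => ?_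
        rw [← hφ' _ (by rw [← hpow]; exact G.pow_mem hs j), ← hpow, ρ.pow_apply hs]
        simp [A]
      · simp
    · rw [Polynomial.eval_prod]
      exact Finset.prod_eq_zero (Finset.mem_image_of_mem _ hχ) (by simp)
  have hsq : Squarefree p := by
    refine Polynomial.Separable.squarefree ?_
    exact Polynomial.separable_prod_X_sub_C_iff'.2 fun x _ y _ h => h
  have hA := Module.End.isSemisimple_of_squarefree_aeval_eq_zero hsq hp
  have hN := ρ.nilp_of_isUnip hu huu
  have hN' : IsNilpotent (A * (B - 1)) :=
    Commute.isNilpotent_mul_left (show A * (B - 1) = (B - 1) * A by rw [mul_sub, sub_mul, hAB]; simp) hN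
  obtain ⟨N, hN'⟩ := hN'
  have key : ∀ j : ℕ, ((A - algebraMap k _ c) ^ j : Module.End k V) v =
      ((-(A * (B - 1))) ^ j : Module.End k V) v := by
    have hcomm : Commute (A - algebraMap k _ c) (-(A * (B - 1))) :=
      Commute.neg_right (Commute.sub_left ((Commute.refl A).mul_right
        (Commute.sub_right hAB (Commute.one_right A))) (Algebra.commutes c _))
    intro j
    induction j with
    | zero => rfl
    | succ j ih =>
      rw [pow_succ', Module.End.mul_apply, ih, ← Module.End.mul_apply,
        (hcomm.pow_right j).eq, pow_succ, Module.End.mul_apply,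
        Module.End.mul_apply]
      congr 1
      rw [ρ.map_mul _ hs _ hu] at hv
      have hv' : A (B v) = c • v := hv
      simp [mul_sub, hv', Algebra.algebraMap_eq_smul_one]
  have hmem : v ∈ Module.End.maxGenEigenspace A c := by
    rw [Module.End.mem_maxGenEigenspace]
    refine ⟨N, ?_⟩
    have := key N
    rw [neg_pow, hN', mul_zero] at this
    simpa [Algebra.algebraMap_eq_smul_one] using this
  rw [hA.isFinitelySemisimple.maxGenEigenspace_eq_eigenspace] at hmem
  exact Module.End.mem_eigenspace_iff.1 hmem

end RatRep

theorem exists_jordan (h : GLn n k) : ∃ (g u : GLn n k) (e : Fin n → kˣ), IsUnip u ∧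
    h = g * diagHom n k e * g⁻¹ * u ∧
    g * diagHom n k e * g⁻¹ * u = u * (g * diagHom n k e * g⁻¹) := by
  classical
  obtain ⟨N, hN, S, hS, hnil, hss, hf⟩ :=
    Module.End.exists_isNilpotent_isSemisimple (f := Matrix.toLin' h.1)
  have hcomm : ∀ x ∈ Algebra.adjoin k {Matrix.toLin' h.1}, Commute x (Matrix.toLin' h.1) :=
    fun x hx => (Algebra.commute_of_mem_adjoin_self hx).symm
  have hSN : Commute N S := by
    have := hcomm N hN
    rw [hf] at this
    have h2 := this.sub_right (Commute.refl N)
    simpa using h2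
  set E : Set (Fin n → k) := {v | ∃ c : k, S v = c • v}
  have hE : ⊤ ≤ Submodule.span k E := by
    rw [← hss.iSup_eigenspace_eq_top, iSup_le_iff]
    exact fun c v hv => Submodule.subset_span ⟨c, Module.End.mem_eigenspace_iff.1 hv⟩
  obtain ⟨b, hb⟩ : ∃ b : Module.Basis (Fin n) k (Fin n → k), ∀ i, b i ∈ E := by
    let b := Module.Basis.ofSpan hE
    refine ⟨b.reindex (b.indexEquiv (Pi.basisFun k (Fin n))), fun i => ?_⟩
    rw [Module.Basis.reindex_apply]
    exact Module.Basis.ofSpan_subset hE ⟨_, rfl⟩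
  choose e he using hb
  have hhu : IsUnit (Matrix.toLin' h.1) :=
    ⟨Units.map (Matrix.toLinAlgEquiv' (R := k)).toRingHom.toMonoidHom h, rfl⟩
  have hSu : IsUnit S := by
    have h1 : S = Matrix.toLin' h.1 + -N := by rw [hf]; abel
    rw [h1]
    exact hnil.neg.isUnit_add_left_of_commute hhu ((hcomm N hN).neg_left)
  have he0 : ∀ i, e i ≠ 0 := by
    intro i h0
    have h1 := he i
    rw [h0, zero_smul] at h1
    obtain ⟨S', hS'⟩ := hSu
    have : (S'⁻¹.1 * S'.1) (b i) = 0 := by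
      rw [Module.End.mul_apply, hS', h1, _root_.map_zero]
    rw [S'.inv_mul] at this
    exact b.ne_zero i this
  let A : Matrix (Fin n) (Fin n) k := LinearMap.toMatrix' S
  have hB : IsUnit ((Pi.basisFun k (Fin n)).toMatrix b) :=
    @isUnit_of_invertible _ _ _ ((Pi.basisFun k (Fin n)).invertibleToMatrix b)
  obtain ⟨g, hg⟩ := hB
  let ε : Fin n → kˣ := fun i => Units.mk0 (e i) (he0 i)
  have hAg : A * g.1 = g.1 * (diagHom n k ε).1 := by
    rw [coe_diagHom]
    ext i j
    rw [Matrix.mul_diagonal, hg]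
    have h1 := congrFun (he j) i
    rw [← Matrix.toLin'_toMatrix' S, Matrix.toLin'_apply] at h1
    simp only [Matrix.mul_apply, Module.Basis.toMatrix_apply, Pi.basisFun_repr]
    simp only [Matrix.mulVec, dotProduct, Pi.smul_apply, smul_eq_mul] at h1
    rw [h1, mul_comm]; rfl
  set s := g * diagHom n k ε * g⁻¹ with hs
  have hsA : s.1 = A := by
    rw [hs, Units.val_mul, Units.val_mul, ← hAg, mul_assoc, ← Units.val_mul, mul_inv_cancel,
      Units.val_one, mul_one]
  have hA : h.1 = LinearMap.toMatrix' N + A := by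
    rw [← map_add, ← hf, LinearMap.toMatrix'_toLin']
  have hAN : Commute A (LinearMap.toMatrix' N) := by
    have := congrArg LinearMap.toMatrix' hSN.eq
    rw [LinearMap.toMatrix'_mul, LinearMap.toMatrix'_mul] at this
    exact this.symm
  have hsh : Commute s h := by
    refine Units.ext ?_
    change s.1 * h.1 = h.1 * s.1
    rw [hsA, hA]
    exact (hAN.add_right (Commute.refl A)).eq
  refine ⟨g, s⁻¹ * h, ε, ?_, ?_, ?_⟩
  · have h1 : (s⁻¹ * h).1 - 1 = (s⁻¹).1 * LinearMap.toMatrix' N := by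
      rw [Units.val_mul, hA, mul_add, ← hsA, ← Units.val_mul, inv_mul_cancel, Units.val_one]
      abel
    rw [IsUnip, h1]
    refine Commute.isNilpotent_mul_left ?_ (hnil.map (LinearMap.toMatrixAlgEquiv' (R := k)))
    have : Commute s.1 (LinearMap.toMatrix' N) := hsA ▸ hAN
    exact this.units_inv_left
  · rw [← hs, mul_inv_cancel_left]
  · rw [← hs, mul_inv_cancel_left, mul_assoc, ← hsh.eq, inv_mul_cancel_left]

lemma toral_mem {H : Subgroup (GLn n k)} (hH : IsClo H) {g u : GLn n k}
    {e : Fin n → kˣ} (hu : IsUnip u)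
    (hc : g * diagHom n k e * g⁻¹ * u = u * (g * diagHom n k e * g⁻¹))
    (h : g * diagHom n k e * g⁻¹ * u ∈ H) : g * diagHom n k e * g⁻¹ ∈ H := by
  obtain ⟨V, _, _, _, σ, v, -, hv⟩ := exists_line hH
  obtain ⟨c, hc'⟩ := (hv _).1 h
  exact (hv _).2 ⟨c, σ.eigen_of_jordan trivial trivial hu hc hc'⟩

lemma exists_functional {M : Type} [AddCommGroup M] [Module.Finite ℤ M] (R : Submodule ℤ M) (c : M) :
    (∃ a : M →ₗ[ℤ] ℤ, (∀ r ∈ R, a r = 0) ∧ a c ≠ 0) ∨ ∃ m : ℕ, m ≠ 0 ∧ (m : ℤ) • c ∈ R := by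
  by_cases hc : R.mkQ c ∈ Submodule.torsion ℤ (M ⧸ R)
  · right
    obtain ⟨⟨m, hm⟩, h⟩ := (Submodule.mem_torsion_iff _).1 hc
    refine ⟨m.natAbs, by simpa using nonZeroDivisors.ne_zero hm, ?_⟩
    have h2 : m • c ∈ R := by
      rw [← R.ker_mkQ, LinearMap.mem_ker, _root_.map_smul]
      exact h
    rcases Int.natAbs_eq m with h | h
    · rwa [← h]
    · rw [h, neg_smul] at h2; simpa using h2
  · left
    let Q := (M ⧸ R) ⧸ Submodule.torsion ℤ (M ⧸ R)
    have hne : (Submodule.torsion ℤ (M ⧸ R)).mkQ (R.mkQ c) ≠ 0 := by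
      intro h
      rw [← LinearMap.mem_ker, Submodule.ker_mkQ] at h
      exact hc h
    obtain ⟨a, ha⟩ : ∃ a : Module.Dual ℤ Q, a ((Submodule.torsion ℤ (M ⧸ R)).mkQ (R.mkQ c)) ≠ 0 := by
      by_contra! h
      exact hne ((Module.forall_dual_apply_eq_zero_iff ℤ _).1 h)
    refine ⟨a ∘ₗ (Submodule.torsion ℤ (M ⧸ R)).mkQ ∘ₗ R.mkQ, fun r hr => ?_, ha⟩
    have : R.mkQ r = 0 := by rwa [← LinearMap.mem_ker, Submodule.ker_mkQ]
    simp [this]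

lemma exists_finset_ideal {X : Type} [Aff k X] {C : Set X} (hC : Clo k C) :
    ∃ F : Finset (X → k), (∀ f ∈ F, f ∈ reg k X) ∧ ∀ x, x ∈ C ↔ ∀ f ∈ F, f x = 0 := by
  classical
  obtain ⟨S, hS, rfl⟩ := clo_iff.1 hC
  let I : Ideal (reg k X) := Ideal.span {f | f.1 ∈ S}
  obtain ⟨F, hF⟩ := (isNoetherianRing_iff_ideal_fg _).1 (inferInstance : IsNoetherianRing (reg k X)) I
  refine ⟨F.image Subtype.val, fun f hf => ?_, fun x => ?_⟩
  · obtain ⟨f, -, rfl⟩ := Finset.mem_image.1 hf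
    exact f.2
  · let ev : reg k X →+* k := (Pi.evalRingHom (fun _ : X => k) x).comp (reg k X).val.toRingHom
    have h1 : (∀ f ∈ S, f x = 0) ↔ I ≤ RingHom.ker ev := by
      rw [Ideal.span_le]
      exact ⟨fun h f hf => h f.1 hf, fun h f hf => h (a := ⟨f, hS hf⟩) hf⟩
    rw [Set.mem_ofPred_eq, h1, ← hF, Ideal.span_le]
    exact ⟨fun h f hf => by
      obtain ⟨f, hf', rfl⟩ := Finset.mem_image.1 hf
      exact h hf', fun h f hf => h f.1 (Finset.mem_image_of_mem _ hf)⟩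

noncomputable def diagCochar (g : GLn n k) (a : Fin n → ℤ) : Cochar n k :=
  Cochar.conj ⟨(diagHom n k).comp (Pi.monoidHom fun i => zpowGroupHom (a i)), by
    have h : ∀ (b : Fin n → ℤ) (i j : Fin n), (fun t : kˣ =>
        (Matrix.diagonal fun i => ((t ^ b i : kˣ) : k) : Matrix (Fin n) (Fin n) k) i j) ∈ reg k kˣ := by
      intro b i j
      rcases eq_or_ne i j with rfl | hij
      · simp only [Matrix.diagonal_apply_eq]
        exact zpowFun_mem (b i)
      · simp only [Matrix.diagonal_apply_ne _ hij]
        exact (reg k kˣ).zero_mem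
    refine mor_GLn (h a) fun i j => ?_
    have h2 := h (fun i => -a i) i j
    have : ∀ t : kˣ, ((diagHom n k) fun i => t ^ a i)⁻¹ = diagHom n k fun i => t ^ (- a i) := by
      intro t
      rw [← map_inv]
      congr 1
      ext i
      simp
    convert h2 using 2 with t
    exact congrArg (fun A : GLn n k => A.1 i j) (this t)⟩ g

lemma diagCochar_apply (g : GLn n k) (a : Fin n → ℤ) (t : kˣ) :
    diagCochar g a t = g * diagHom n k (fun i => t ^ a i) * g⁻¹ := rfl

lemma RatRep.nilp_of_finite_eigenvalues {H : Subgroup (GLn n k)} (hI : IsIrr H)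
    (ρ : RatRep H V) {M : ℕ} (hM : M ≠ 0)
    (h : ∀ h ∈ H, ∀ (f : k) (v : V), v ≠ 0 → ρ h v = f • v → f ^ M = 1) {h₀ : GLn n k}
    (hh₀ : h₀ ∈ H) : IsNilpotent (ρ h₀ - 1) := by
  classical
  refine nilp_of_eigenvalues fun e v hv he => ?_
  let b := Module.finBasis k V
  obtain ⟨Ma, hMa, hMa'⟩ := ρ.exists_matrix b
  let F : GLn n k → k := fun g => (Matrix.scalar _ e - Ma g).det
  have hF : F ∈ reg k (GLn n k) := by
    refine det_mem fun i j => ?_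
    simp only [Matrix.sub_apply]
    exact sub_mem (matrix_const_mem _ i j) (hMa i j)
  have hFe : ∀ g ∈ H, F g = Polynomial.eval e (ρ g).charpoly := by
    intro g hg
    simp only [F]
    rw [← hMa' g hg, ← LinearMap.charpoly_toMatrix (ρ g) b, Matrix.eval_charpoly]
  let μ : Multiset k := Module.finrank k V • (Polynomial.X ^ M - 1 : Polynomial k).roots.toFinset.val
  have hfin : (F '' (H : Set (GLn n k))).Finite := by
    refine ((Set.finite_Iic μ).image fun m => (m.map fun a => e - a).prod).subset ?_
    rintro _ ⟨g, hg, rfl⟩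
    have hs : (ρ g).charpoly.Splits := IsAlgClosed.splits _
    refine ⟨(ρ g).charpoly.roots, ?_, ?_⟩
    · refine Multiset.le_iff_count.2 fun a => ?_
      by_cases ha : a ∈ (ρ g).charpoly.roots
      · have hr := (Polynomial.mem_roots'.1 ha).2
        obtain ⟨w, hw⟩ := (Module.End.hasEigenvalue_iff_isRoot_charpoly _ _).2 hr |>.exists_hasEigenvector
        have ha1 := h g hg a w hw.2 hw.apply_eq_smul
        have hmem : a ∈ (Polynomial.X ^ M - 1 : Polynomial k).roots.toFinset := by
          rw [Multiset.mem_toFinset, Polynomial.mem_roots (by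
            simpa using Polynomial.X_pow_sub_C_ne_zero (Nat.pos_of_ne_zero hM) (1 : k))]
          simp [ha1]
        rw [Multiset.count_nsmul, Multiset.count_eq_one_of_mem (Finset.nodup _) hmem, mul_one]
        refine (Multiset.count_le_card _ _).trans ((Polynomial.card_roots' _).trans ?_)
        rw [LinearMap.charpoly_natDegree]
      · rw [Multiset.count_eq_zero_of_notMem ha]; exact Nat.zero_le _
    · rw [hFe g hg]
      conv_rhs => rw [hs.eq_prod_roots_of_monic (LinearMap.charpoly_monic _)]
      rw [Polynomial.eval_multiset_prod, Multiset.map_map]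
      simp
  have h1 := hI.const_of_finite hF hfin hh₀ H.one_mem
  rw [hFe _ hh₀, hFe _ H.one_mem, ρ.map_one] at h1
  have h2 : Polynomial.IsRoot (ρ h₀).charpoly e :=
    (Module.End.hasEigenvalue_iff_isRoot_charpoly _ _).1
      (Module.End.hasEigenvalue_of_hasEigenvector ⟨Module.End.mem_eigenspace_iff.2 he, hv⟩)
  rw [h2.eq_zero] at h1
  have h3 := (Module.End.hasEigenvalue_iff_isRoot_charpoly (1 : Module.End k V) e).2 h1.symm
  obtain ⟨w, hw⟩ := h3.exists_hasEigenvector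
  have := hw.apply_eq_smul
  rw [Module.End.one_apply] at this
  have h4 : (e - 1) • w = 0 := by rw [sub_smul, ← this, one_smul, sub_self]
  exact sub_eq_zero.1 ((smul_eq_zero.1 h4).resolve_right hw.2)

/-- A non-unipotent rational representation of a connected group is nontrivial on a cocharacter. -/
theorem RatRep.exists_cochar {H : Subgroup (GLn n k)} (hH : IsClo H)
    (hI : IsIrr H) (ρ : RatRep H V) {h₀ : GLn n k} (hh₀ : h₀ ∈ H)
    (hn : ¬ IsNilpotent (ρ h₀ - 1)) : ∃ κ : Cochar n k, κ.In H ∧ ∃ t, ρ (κ t) ≠ 1 := by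
  classical
  by_contra! hcon
  obtain ⟨F, hF, hFH⟩ := exists_finset_ideal hH
  obtain ⟨S₁, hS₁⟩ := Stmt17.exists_monSpan F hF
  obtain ⟨S₂, hS₂⟩ := ρ.exists_monSpan
  let S := S₁ ∪ S₂
  have hl : (S₁ : Set (Fin n → ℤ)) ⊆ S := by simp [S]
  have hr : (S₂ : Set (Fin n → ℤ)) ⊆ S := by simp [S]
  let Rel : Finset ((Fin n → ℤ) × (Fin n → ℤ)) → Submodule ℤ (Fin n → ℤ) := fun R =>
    Submodule.span ℤ ((fun p => p.1 - p.2) '' (R : Set ((Fin n → ℤ) × (Fin n → ℤ))))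
  let m : Finset ((Fin n → ℤ) × (Fin n → ℤ)) × (Fin n → ℤ) → ℕ := fun q =>
    if h : ∃ m : ℕ, m ≠ 0 ∧ (m : ℤ) • q.2 ∈ Rel q.1 then h.choose else 1
  have hm0 : ∀ q, m q ≠ 0 := fun q => by
    simp only [m]; split_ifs with h
    · exact h.choose_spec.1
    · exact one_ne_zero
  refine hn (ρ.nilp_of_finite_eigenvalues hI (M := ∏ q ∈ (S ×ˢ S).powerset ×ˢ S, m q)
    (Finset.prod_ne_zero_iff.2 fun q _ => hm0 q) ?_ hh₀)
  intro h hh f v hv hf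
  obtain ⟨g, u, e, hu, rfl, hc⟩ := exists_jordan h
  have hsH := toral_mem hH hu hc hh
  have huH : u ∈ H := (H.mul_mem_cancel_left hsH).1 hh
  have hsv := ρ.eigen_of_jordan hsH huH hu hc hf
  set s := g * diagHom n k e * g⁻¹ with hs
  have hpow : ∀ j, s ^ j = g * diagHom n k (e ^ j) * g⁻¹ := fun j => by
    rw [map_pow, hs, conj_pow]
  obtain ⟨l, hlv⟩ : ∃ l : Module.Dual k V, l v ≠ 0 := by
    by_contra! h
    exact hv ((Module.forall_dual_apply_eq_zero_iff k _).1 h)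
  obtain ⟨φ, hφ, hφ'⟩ := hS₂ g v l
  have hφj : ∀ j : ℕ, φ (e ^ j) = f ^ j * l v := by
    intro j
    rw [← hφ' _ (by rw [← hpow]; exact H.pow_mem hsH j), ← hpow, ρ.pow_apply hsH]
    have : ((ρ s : Module.End k V) ^ j) v = f ^ j • v := by
      induction j with
      | zero => simp
      | succ j ih => rw [pow_succ, Module.End.mul_apply, hsv, _root_.map_smul, ih, smul_smul,
          pow_succ, mul_comm]
    rw [this, _root_.map_smul, smul_eq_mul]
  obtain ⟨c, hcS, hcf⟩ := (eval_curve (monSpan_mono hr hφ) hφj (a := 0) (A := 0) (by simp)).2 hlv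
  let R := (S ×ˢ S).filter fun p => mon (k := k) p.1 e = mon p.2 e
  rcases exists_functional (Rel R) c with ⟨a, haR, hac⟩ | hex
  · exfalso
    let a' : Fin n → ℤ := fun i => a (Pi.single i 1)
    have ha' : ∀ χ, ∑ i, a' i * χ i = a χ := by
      intro χ
      conv_rhs => rw [← Finset.univ_sum_single χ, map_sum]
      refine Finset.sum_congr rfl fun i _ => ?_
      rw [show (Pi.single i (χ i) : Fin n → ℤ) = χ i • Pi.single i 1 by
        rw [← Pi.single_smul]; simp, _root_.map_smul, smul_eq_mul, mul_comm]
    let A : k → ℤ := fun ξ => if h : ∃ χ ∈ S, mon χ e = ξ then a h.choose else 0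
    have hA : ∀ χ ∈ S, a χ = A (mon χ e) := by
      intro χ hχ
      have hex : ∃ χ' ∈ S, mon (k := k) χ' e = mon χ e := ⟨χ, hχ, rfl⟩
      simp only [A, dif_pos hex]
      rw [← sub_eq_zero, ← map_sub]
      refine haR _ (Submodule.subset_span ⟨(χ, hex.choose), ?_, rfl⟩)
      simp only [R, Finset.coe_filter, Finset.mem_product, Set.mem_ofPred_eq]
      exact ⟨⟨hχ, hex.choose_spec.1⟩, hex.choose_spec.2.symm⟩
    have hA' : ∀ χ ∈ S, ∑ i, a' i * χ i = A (mon χ e) := fun χ hχ => by rw [ha', hA χ hχ]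
    have hκ : (diagCochar g a').In H := by
      intro t
      refine (hFH _).2 fun q hq => ?_
      have := (eval_curve (monSpan_mono hl (hS₁ q hq g)) (f := 0) (b := 0) (fun j => ?_) hA').1 t
      · rw [mul_zero] at this; exact this
      · rw [mul_zero, ← hpow]
        exact (hFH _).1 (H.pow_mem hsH j) q hq
    have h1 : ∀ t, φ (fun i => t ^ a' i) = l v := by
      intro t
      rw [← hφ' (fun i => t ^ a' i) (hκ t), ← diagCochar_apply, hcon _ hκ t]; rfl
    have h2 : ∀ t : kˣ, zpowFun k (a c) t = 1 := by
      intro t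
      have := (eval_curve (monSpan_mono hr hφ) hφj hA').1 t
      rw [h1, ← hcf, ← hA c hcS] at this
      exact mul_right_cancel₀ hlv (by rw [← this, one_mul])
    obtain ⟨t, ht⟩ := exists_zpowFun_ne (k := k) hac
    exact ht (by rw [h2, zpowFun_zero])
  · have hmq : (m (R, c) : ℤ) • c ∈ Rel R := by
      simp only [m]
      rw [dif_pos hex]
      exact hex.choose_spec.2
    have hdvd : m (R, c) ∣ ∏ q ∈ (S ×ˢ S).powerset ×ˢ S, m q :=
      Finset.dvd_prod_of_mem m (Finset.mem_product.2
        ⟨Finset.mem_powerset.2 (Finset.filter_subset _ _), hcS⟩)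
    have h1 : ∀ χ ∈ Rel R, mon (k := k) χ e = 1 := by
      intro χ hχ
      induction hχ using Submodule.span_induction with
      | mem χ hχ =>
        obtain ⟨p, hp, rfl⟩ := hχ
        have h2 := (Finset.mem_filter.1 hp).2
        rw [show p.1 = (p.1 - p.2) + p.2 by simp, mon_add] at h2
        exact mul_right_cancel₀ (mon_ne_zero p.2 e) (by rw [h2, one_mul])
      | zero => simp [mon_apply]
      | add x y _ _ hx hy => rw [mon_add, hx, hy, one_mul]
      | smul c x _ hx =>
        rw [mon_apply, Units.val_eq_one] at hx ⊢
        have : ∀ i, e i ^ (c • x) i = (e i ^ x i) ^ c := fun i => by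
          rw [← zpow_mul, mul_comm]; rfl
        simp only [this, Finset.prod_zpow, hx, one_zpow]
    obtain ⟨d, hd⟩ := hdvd
    rw [hd, pow_mul, ← hcf]
    have h3 := h1 _ hmq
    have : mon (k := k) c e ^ m (R, c) = 1 := by
      rw [← h3, mon_apply, mon_apply, ← Units.val_pow_eq_pow_val, ← Finset.prod_pow]
      congr 1
      refine Finset.prod_congr rfl fun i _ => ?_
      rw [← zpow_natCast, ← zpow_mul, mul_comm]; rfl
    rw [this, one_pow]

namespace RatRep
variable {G : Subgroup (GLn n k)} (ρ : RatRep G V)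

lemma mul_inv {g : GLn n k} (hg : g ∈ G) : (ρ g : Module.End k V) * ρ g⁻¹ = 1 := by
  rw [← ρ.map_mul _ hg _ (G.inv_mem hg), mul_inv_cancel, ρ.map_one]

noncomputable def endRep : RatRep G (Module.End k V) where
  toFun g := LinearMap.mulLeft k (ρ g : Module.End k V) ∘ₗ LinearMap.mulRight k (ρ g⁻¹ : Module.End k V)
  map_one := by ext X : 1; simp [ρ.map_one]
  map_mul g hg h hh := by
    ext X : 1
    simp [ρ.map_mul g hg h hh, ρ.map_mul _ (G.inv_mem hh) _ (G.inv_mem hg), mul_assoc]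
  regular := by
    obtain ⟨M, hM, hM'⟩ := ρ.exists_matrix (Module.finBasis k V)
    set b := Module.finBasis k V
    let S' : Set (Module.Dual k (Module.End k V)) :=
      {l | ∃ i j, ∀ X, l X = LinearMap.toMatrix b b X i j}
    refine regular_of_span (S := Set.univ) Submodule.span_univ (S' := S')
      (span_dual_eq_top fun X hX => ?_) ?_
    · refine (LinearMap.toMatrix b b).injective ?_
      ext i j
      have := hX (Matrix.entryLinearMap k k i j ∘ₗ (LinearMap.toMatrix b b).toLinearMap)
        ⟨i, j, fun _ => rfl⟩
      simpa using this
    · rintro X - l ⟨i, j, hl⟩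
      have h2 : ∀ i j, (fun g => M g⁻¹ i j) ∈ reg k (GLn n k) := fun i j =>
        Mor.inv Mor.id _ (hM i j)
      refine ⟨_, matrix_mul_mem (matrix_mul_mem hM (matrix_const_mem (LinearMap.toMatrix b b X))) h2 i j,
        fun g hg => ?_⟩
      rw [hl, ← hM' g hg, ← hM' _ (G.inv_mem hg), ← LinearMap.toMatrix_mul, ← LinearMap.toMatrix_mul]
      rfl

lemma endRep_apply (g : GLn n k) (X : Module.End k V) : ρ.endRep g X = ρ g * (X * ρ g⁻¹) := rfl

lemma sum_roots_of_unity {ν : Cochar n k} (hν : ν.In G) {N : ℕ} {ζ : kˣ}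
    (hζ : IsPrimitiveRoot (ζ : k) N) (hN : ∀ i ∈ (ρ.pr ν).support, i.natAbs < N) (v : V) :
    ∑ j ∈ Finset.range N, ρ (ν (ζ ^ j)) v = (N : k) • ρ.pr ν 0 v := by
  classical
  simp only [ρ.pr_eq_sum hν]
  rw [Finset.sum_comm]
  have : ∀ i ∈ (ρ.pr ν).support, ∑ j ∈ Finset.range N, zpowFun k i (ζ ^ j) • ρ.pr ν i v =
      if i = 0 then (N : k) • ρ.pr ν 0 v else 0 := by
    intro i hi
    rw [← Finset.sum_smul]
    split_ifs with h0
    · subst h0; simp [zpowFun_zero]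
    · have hz : ∀ j : ℕ, zpowFun k i (ζ ^ j) = ((ζ : k) ^ i) ^ j := fun j => by
        simp only [zpowFun]
        rw [← zpow_natCast, ← zpow_mul, mul_comm, zpow_mul]; simp
      simp only [hz]
      have hne : (ζ : k) ^ i ≠ 1 := fun h => by
        have := (hζ.zpow_eq_one_iff_dvd i).1 h
        have := Int.natAbs_dvd_natAbs.2 this
        rw [Int.natAbs_natCast] at this
        exact absurd (Nat.le_of_dvd (Int.natAbs_pos.2 h0) this) (not_le.2 (hN i hi))
      have h1 := geom_sum_mul ((ζ : k) ^ i) N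
      rw [show ((ζ : k) ^ i) ^ N = 1 by
        rw [← zpow_natCast, ← zpow_mul, mul_comm, zpow_mul, zpow_natCast, hζ.pow_eq_one, one_zpow],
        sub_self] at h1
      rw [(mul_eq_zero.1 h1).resolve_right (sub_ne_zero.2 hne), zero_smul]
  rw [Finset.sum_congr rfl this, Finset.sum_ite_eq']
  split_ifs with h
  · rfl
  · rw [Finsupp.notMem_support_iff.1 h]; simp

lemma additive_eq_zero {φ : kˣ → V} (hφ : Mor k φ) (h : ∀ s t, φ (s * t) = φ s + φ t) (s : kˣ) :
    φ s = 0 := by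
  obtain ⟨c, hc⟩ := exists_lsum hφ
  have h1 : ∀ s : kˣ, ∀ i, zpowFun k i s • c i = c i + if i = 0 then φ s else 0 := by
    classical
    intro s i
    have := sum_lsum_injective (k := k) (s := insert 0 (insert i c.support)) (c := fun i => zpowFun k i s • c i)
      (d := fun i => c i + if i = 0 then φ s else 0) (fun t => ?_) i (by simp)
    · exact this
    · have h2 : ∀ t, φ t = ∑ j ∈ insert 0 (insert i c.support), zpowFun k j t • c j := fun t => by
        rw [hc, lsum_eq (s := insert 0 (insert i c.support)) fun j hj => by simp [Finsupp.mem_support_iff.1 hj]]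
      simp only [smul_add, smul_ite, smul_zero, Finset.sum_add_distrib]
      rw [← h2, Finset.sum_ite_eq' _ 0, if_pos (by simp), zpowFun_zero, one_smul, add_comm, ← h,
        mul_comm, h2]
      exact Finset.sum_congr rfl fun j _ => by rw [smul_smul, zpowFun_mul]
  have := h1 s 0
  rw [zpowFun_zero, one_smul, if_pos rfl] at this
  exact left_eq_add.1 this

lemma exists_primitive (M : ℕ) : ∃ N N' : ℕ, M < N ∧ M < N' ∧ N.Coprime N' ∧
    (∃ ζ : kˣ, IsPrimitiveRoot (ζ : k) N) ∧ ∃ ζ : kˣ, IsPrimitiveRoot (ζ : k) N' := by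
  have key : ∀ M : ℕ, ∃ N, M < N ∧ N.Prime ∧ ∃ ζ : kˣ, IsPrimitiveRoot (ζ : k) N := by
    intro M
    obtain ⟨N, hN, hp⟩ := Nat.exists_infinite_primes (max (M + 1) (ringChar k + 1))
    have h0 : (N : k) ≠ 0 := fun h => by
      have h1 := (ringChar.spec k N).1 h
      rcases (Nat.dvd_prime hp).1 h1 with h2 | h2
      · exact (CharP.ringChar_ne_one (R := k)) h2
      · have := le_of_max_le_right hN; omega
    haveI : NeZero (N : k) := ⟨h0⟩
    obtain ⟨ζ, hζ⟩ := HasEnoughRootsOfUnity.exists_primitiveRoot k N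
    exact ⟨N, by have := le_of_max_le_left hN; omega, hp, (hζ.isUnit hp.ne_zero).unit, hζ⟩
  obtain ⟨N, h1, h2, h3⟩ := key M
  obtain ⟨N', h1', h2', h3'⟩ := key N
  exact ⟨N, N', h1, h1.trans h1', (Nat.coprime_primes h2 h2').2 h1'.ne, h3, h3'⟩

lemma cocycle_trivial {ν : Cochar n k} (hν : ν.In G) (A : AddSubgroup V) {c : kˣ → V} (hc : Mor k c)
    (hA : ∀ t, c t ∈ A) (h : ∀ s t, c (s * t) = c s + ρ (ν s) (c t)) :
    ∃ a ∈ A, ∀ t, c t = ρ (ν t) a - a := by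
  have h0 : ∀ t, ρ.pr ν 0 (c t) = 0 := by
    refine additive_eq_zero ((LinearMap.mor (ρ.pr ν 0)).comp hc) fun s t => ?_
    simp only [h, map_add]
    congr 1
    have := ρ.pr_map ρ hν hν (ρ (ν s)) (c t) (fun r => by
      rw [← ρ.mul_apply (hν s) (hν r), ν.comm, ρ.mul_apply (hν r) (hν s)]) 0
    rw [← this, ρ.apply_pr hν, zpowFun_zero, one_smul]
  obtain ⟨N, N', hN, hN', hcop, ⟨ζ, hζ⟩, ζ', hζ'⟩ := exists_primitive (k := k)
    ((ρ.pr ν).support.sup Int.natAbs)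
  have key : ∀ (N : ℕ) (ζ : kˣ), (ρ.pr ν).support.sup Int.natAbs < N → IsPrimitiveRoot (ζ : k) N →
      ∃ a ∈ A, ∀ t, (N : ℤ) • c t = ρ (ν t) a - a := by
    intro N ζ hN hζ
    refine ⟨-∑ j ∈ Finset.range N, c (ζ ^ j), A.neg_mem (A.sum_mem fun j _ => hA _), fun t => ?_⟩
    have h1 : ∑ j ∈ Finset.range N, c (t * ζ ^ j) = (N : ℤ) • c t +
        ρ (ν t) (∑ j ∈ Finset.range N, c (ζ ^ j)) := by
      simp [h, Finset.sum_add_distrib]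
    have h2 : ∑ j ∈ Finset.range N, c (t * ζ ^ j) = ∑ j ∈ Finset.range N, c (ζ ^ j) := by
      simp only [mul_comm t, h, Finset.sum_add_distrib]
      rw [ρ.sum_roots_of_unity hν hζ (fun i hi => (Finset.le_sup (f := Int.natAbs) hi).trans_lt hN), h0]
      simp
    rw [h2] at h1
    rw [_root_.map_neg, sub_neg_eq_add, eq_neg_add_iff_add_eq, add_comm, ← h1]
  obtain ⟨a, ha, hac⟩ := key N ζ hN hζ
  obtain ⟨a', ha', hac'⟩ := key N' ζ' hN' hζ'
  obtain ⟨u, v, huv⟩ := (Nat.isCoprime_iff_coprime.2 hcop)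
  refine ⟨u • a + v • a', A.add_mem (A.zsmul_mem ha u) (A.zsmul_mem ha' v), fun t => ?_⟩
  rw [map_add, map_zsmul, map_zsmul, add_sub_add_comm, ← smul_sub, ← smul_sub, ← hac, ← hac',
    smul_smul, smul_smul, ← add_smul, huv, one_smul]

end RatRep

lemma exists_conj_trivial (J : Subgroup (GLn n k)) (ν : Cochar n k) {H : Subgroup (GLn n k)}
    (hJH : J ≤ H) (hH : ∀ h ∈ H, ∀ j ∈ J, h * j * h⁻¹ ∈ J) (hν : ν.In H) (d : ℕ) :
    ∀ (V : Type) [AddCommGroup V] [Module k V] [FiniteDimensional k V] (ρ : RatRep H V)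
      (ν' : Cochar n k), Module.finrank k V = d → (∀ j ∈ J, IsNilpotent (ρ j - 1)) →
      (∀ t, ν' t * (ν t)⁻¹ ∈ J) → ∃ j ∈ J, ∀ t, ρ (j * ν' t * j⁻¹ * (ν t)⁻¹) = 1 := by
  induction d using Nat.strong_induction_on with
  | _ d ih =>
  intro V _ _ _ ρ ν' hd hJ hν'
  rcases subsingleton_or_nontrivial V with hV | hV
  · exact ⟨1, J.one_mem, fun t => Subsingleton.elim _ _⟩
  let F : Submodule k V :=
    { carrier := {v | ∀ j ∈ J, ρ j v = v}
      add_mem' := fun {a b} ha hb j hj => by rw [map_add, ha j hj, hb j hj]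
      zero_mem' := fun j _ => _root_.map_zero _
      smul_mem' := fun c a ha j hj => by rw [_root_.map_smul, ha j hj] }
  have hF : ρ.Stable F := by
    intro h hh v hv j hj
    have h1 : j * h = h * (h⁻¹ * j * h⁻¹⁻¹) := by group
    have h2 := hH _ (H.inv_mem hh) j hj
    rw [← ρ.mul_apply (hJH hj) hh, h1, ρ.mul_apply hh (hJH h2), hv _ h2]
  obtain ⟨v, hv, hvJ⟩ := (ρ.mono hJH).kolchin hJ
  have hlt : Module.finrank k (V ⧸ F) < d := by
    have h1 := F.finrank_quotient_add_finrank
    have h2 : 0 < Module.finrank k F := Module.finrank_pos_iff_exists_ne_zero.2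
      ⟨⟨v, hvJ⟩, fun h => hv (congrArg Subtype.val h)⟩
    omega
  obtain ⟨j, hj, hjt⟩ := ih _ hlt (V ⧸ F) (ρ.quot F hF) ν' rfl
    (fun j hj => ρ.nilp_quot hF (hJH hj) (hJ j hj)) hν'
  have hν'' : ∀ t, (ν'.conj j) t * (ν t)⁻¹ ∈ J := fun t => by
    rw [Cochar.conj_apply, show j * ν' t * j⁻¹ * (ν t)⁻¹ =
      j * (ν' t * (ν t)⁻¹) * (ν t * j⁻¹ * (ν t)⁻¹) by group]
    exact J.mul_mem (J.mul_mem hj (hν' t)) (hH _ (hν t) _ (J.inv_mem hj))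
  have hquot : ∀ h ∈ H, (ρ.quot F hF h = 1 ↔ ∀ v, ρ h v - v ∈ F) := by
    intro h hh
    constructor
    · intro h1 v
      rw [← F.ker_mkQ, LinearMap.mem_ker, map_sub, ← ρ.quot_apply hF hh, h1]
      simp
    · intro h1
      ext v
      have := h1 v
      rw [← F.ker_mkQ, LinearMap.mem_ker, map_sub, ← ρ.quot_apply hF hh, sub_eq_zero] at this
      simpa using this
  have hmul : ∀ x ∈ J, ∀ y ∈ J, (∀ v, ρ y v - v ∈ F) →
      (ρ (x * y) - 1 : Module.End k V) = (ρ x - 1) + (ρ y - 1) := by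
    intro x hx y hy h
    ext v
    have := h v x hx
    rw [map_sub, ← ρ.mul_apply (hJH hx) (hJH hy)] at this
    simp only [LinearMap.sub_apply, LinearMap.add_apply, Module.End.one_apply]
    rw [eq_add_of_sub_eq this]
    abel
  have htriv : ∀ x ∈ J, ∀ y ∈ J, (∀ v, ρ x v - v ∈ F) → (∀ v, ρ y v - v ∈ F) →
      ∀ v, ρ (x * y) v - v ∈ F := by
    intro x hx y hy h1 h2 v
    rw [ρ.mul_apply (hJH hx) (hJH hy)]
    simpa using F.add_mem (h1 (ρ y v)) (h2 v)
  let A : AddSubgroup (Module.End k V) :=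
    { carrier := {a | ∃ x ∈ J, (∀ v, ρ x v - v ∈ F) ∧ a = ρ x - 1}
      add_mem' := by
        rintro _ _ ⟨x, hx, h, rfl⟩ ⟨y, hy, h', rfl⟩
        exact ⟨x * y, J.mul_mem hx hy, htriv x hx y hy h h', (hmul x hx y hy h').symm⟩
      zero_mem' := ⟨1, J.one_mem, by simp [ρ.map_one], by simp [ρ.map_one]⟩
      neg_mem' := by
        rintro _ ⟨x, hx, h, rfl⟩
        have h' : ∀ v, ρ x⁻¹ v - v ∈ F := fun v => by
          have := hF _ (H.inv_mem (hJH hx)) _ (h v)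
          rw [map_sub, ρ.inv_apply_self (hJH hx)] at this
          simpa using F.neg_mem this
        refine ⟨x⁻¹, J.inv_mem hx, h', neg_eq_of_add_eq_zero_right ?_⟩
        rw [← hmul x hx _ (J.inv_mem hx) h', mul_inv_cancel, ρ.map_one, sub_self] }
  have hcJ : ∀ t, ∀ v, ρ ((ν'.conj j) t * (ν t)⁻¹) v - v ∈ F := fun t =>
    (hquot _ (hJH (hν'' t))).1 (hjt t)
  let c : kˣ → Module.End k V := fun t => ρ ((ν'.conj j) t * (ν t)⁻¹) - 1
  have hconj : ∀ t, ∀ x ∈ J, (ρ.endRep (ν t)) (ρ x - 1 : Module.End k V) =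
      ρ (ν t * x * (ν t)⁻¹) - 1 := by
    intro t x hx
    rw [ρ.endRep_apply, sub_mul, mul_sub, one_mul, ρ.mul_inv (hν t), mul_assoc,
      ρ.map_mul _ (hν t) _ (H.mul_mem (hJH hx) (H.inv_mem (hν t))),
      ρ.map_mul _ (hJH hx) _ (H.inv_mem (hν t))]
  have hAν : ∀ t, ∀ x ∈ J, (∀ v, ρ x v - v ∈ F) → ∀ v, ρ (ν t * x * (ν t)⁻¹) v - v ∈ F := by
    intro t x hx h v
    have := hF _ (hν t) _ (h (ρ (ν t)⁻¹ v))
    rwa [map_sub, ρ.apply_inv_self (hν t), ← ρ.mul_apply (hJH hx) (H.inv_mem (hν t)),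
      ← ρ.mul_apply (hν t) (H.mul_mem (hJH hx) (H.inv_mem (hν t))), ← mul_assoc] at this
  obtain ⟨a, ⟨x, hx, hxF, rfl⟩, hac⟩ := ρ.endRep.cocycle_trivial hν A (c := c)
    (RatRep.mor_end fun v l => by
      obtain ⟨f, hf, hf'⟩ := ρ.regular v l
      have h1 : (fun t => f ((ν'.conj j) t * (ν t)⁻¹) - l v) ∈ reg k kˣ :=
        sub_mem (Mor.mul (ν'.conj j).mor (Mor.inv ν.mor) f hf) ((reg k kˣ).algebraMap_mem (l v))
      convert h1 using 2 with t
      rw [← hf' _ (hJH (hν'' t))]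
      simp [c])
    (fun t => ⟨_, hν'' t, hcJ t, rfl⟩)
    (by
      intro s t
      simp only [c]
      rw [hconj s _ (hν'' t), ← hmul _ (hν'' s) _ (hH _ (hν s) _ (hν'' t)) (hAν s _ (hν'' t) (hcJ t)),
        Cochar.map_mul, Cochar.map_mul]
      congr 2
      group)
  refine ⟨x * j, J.mul_mem hx hj, fun t => ?_⟩
  have h1 := hac t
  rw [hconj t x hx] at h1
  have hxi : ∀ v, ρ x⁻¹ v - v ∈ F := fun v => by
    have := hF _ (H.inv_mem (hJH hx)) _ (hxF v)
    rw [map_sub, ρ.inv_apply_self (hJH hx)] at this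
    simpa using F.neg_mem this
  rw [show x * j * ν' t * (x * j)⁻¹ * (ν t)⁻¹ = x * ((ν'.conj j t * (ν t)⁻¹) *
    (ν t * x⁻¹ * (ν t)⁻¹)) by rw [Cochar.conj_apply]; group, ← sub_eq_zero]
  have h2 := hH _ (hν t) _ (J.inv_mem hx)
  rw [hmul _ hx _ (J.mul_mem (hν'' t) h2) (htriv _ (hν'' t) _ h2 (hcJ t) (hAν t _ (J.inv_mem hx) hxi)),
    hmul _ (hν'' t) _ h2 (hAν t _ (J.inv_mem hx) hxi), ← hconj t _ (J.inv_mem hx)]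
  have h3 := hmul x hx _ (J.inv_mem hx) hxi
  rw [mul_inv_cancel, ρ.map_one, sub_self] at h3
  rw [eq_neg_of_add_eq_zero_right h3.symm, _root_.map_neg, hconj t x hx]
  simp only [c] at h1
  rw [h1]
  abel

/-- Cocharacters congruent modulo a unipotent group are conjugate by an element of it. -/
theorem Cochar.exists_conj_eq {J : Subgroup (GLn n k)} (hJ : ∀ j ∈ J, IsUnip j) {ν ν' : Cochar n k}
    (hν : ∀ t, ∀ j ∈ J, ν t * j * (ν t)⁻¹ ∈ J) (h : ∀ t, ν' t * (ν t)⁻¹ ∈ J) :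
    ∃ j ∈ J, ν'.conj j = ν := by
  have hN : ∀ t, ν t ∈ Subgroup.normalizer (J : Set (GLn n k)) := fun t =>
    Subgroup.mem_normalizer_iff.2 fun x => ⟨fun hx => hν t x hx, fun hx => by
      have := hν t⁻¹ _ hx
      rw [map_inv] at this
      simpa [mul_assoc] using this⟩
  obtain ⟨j, hj, hjt⟩ := exists_conj_trivial J ν (Subgroup.le_normalizer (H := J))
    (fun h hh j hj => (Subgroup.mem_normalizer_iff.1 hh j).1 hj) hN _ _ (stdRep _) ν' rfl
    (fun j hj => nilp_of_isUnip (hJ j hj)) h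
  refine ⟨j, hj, ?_⟩
  ext t : 1
  have h1 := hjt t
  have h2 : (j * ν' t * j⁻¹ * (ν t)⁻¹).1 = (1 : GLn n k).1 :=
    Cochar.mulVec_injective fun v => by
      have := LinearMap.congr_fun h1 v
      simpa [stdRep, mul_assoc] using this
  exact eq_of_mul_inv_eq_one (Units.ext h2)

end

namespace Cochar
variable {ν μ : Cochar n k} {G : Subgroup (GLn n k)}

lemma In.symm (h : μ.In ν.C) : ν.In μ.C := fun t => mem_C.2 fun s => (mem_C.1 (h s) t).symm

/-- The product `ν ^ N * μ` of commuting cocharacters. -/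
noncomputable def join (h : μ.In ν.C) (N : ℤ) : Cochar n k :=
  (ν.pow N).mul μ fun s t => mem_C.1 (h t) (s ^ N)

lemma join_apply (h : μ.In ν.C) (N : ℤ) (t : kˣ) : join h N t = ν t ^ N * μ t := by
  change ν (t ^ N) * μ t = _
  rw [show ν (t ^ N) = ν t ^ N from _root_.map_zpow ν.toHom t N]

lemma In.join (hν : ν.In G) (hμ : μ.In G) (h : μ.In ν.C) (N : ℤ) : (join h N).In G := fun t => by
  rw [join_apply]; exact G.mul_mem (G.zpow_mem (hν t) N) (hμ t)

end Cochar

open Cochar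

section
variable {V : Type} [AddCommGroup V] [Module k V] [FiniteDimensional k V] {H : Subgroup (GLn n k)}
  (ρ : RatRep H V) {ν μ : Cochar n k}

namespace RatRep

lemma pr_comm (hν : ν.In H) {T : V →ₗ[k] V} (hT : ∀ t v, T (ρ (ν t) v) = ρ (ν t) (T v)) (i : ℤ)
    (v : V) : T (ρ.pr ν i v) = ρ.pr ν i (T v) :=
  ρ.pr_map ρ hν hν T v (fun t => hT t v) i

lemma apply_comm {g h : GLn n k} (hg : g ∈ H) (hh : h ∈ H) (e : g * h = h * g) (v : V) :
    ρ g (ρ h v) = ρ h (ρ g v) := by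
  rw [← ρ.mul_apply hg hh, e, ρ.mul_apply hh hg]

lemma apply_zpow_of_mem_wt {i : ℤ} {v : V} (hv : v ∈ ρ.wt ν i) (N : ℤ) (t : kˣ) :
    ρ (ν t ^ N) v = zpowFun k (N * i) t • v := by
  rw [show ν t ^ N = ν (t ^ N) from (_root_.map_zpow ν.toHom t N).symm, (ρ.mem_wt.1 hv)]
  simp [zpowFun, zpow_mul]

lemma wt_join (hν : ν.In H) (hμ : μ.In H) (h : μ.In ν.C) (N : ℤ) {i j : ℤ} {v : V}
    (hi : v ∈ ρ.wt ν i) (hj : v ∈ ρ.wt μ j) : v ∈ ρ.wt (join h N) (N * i + j) :=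
  ρ.mem_wt.2 fun t => by
    rw [join_apply, ρ.mul_apply (H.zpow_mem (hν t) N) (hμ t), ρ.mem_wt.1 hj,
      _root_.map_smul, ρ.apply_zpow_of_mem_wt hi, smul_smul, zpowFun_add, mul_comm]

lemma pr_mem_wt_of_comm (hν : ν.In H) (hμ : μ.In H) (h : μ.In ν.C) {j : ℤ} {v : V}
    (hv : v ∈ ρ.wt μ j) (i : ℤ) : ρ.pr ν i v ∈ ρ.wt μ j :=
  ρ.mem_wt.2 fun t => by
    rw [ρ.pr_comm hν (fun s w => ρ.apply_comm (hμ t) (hν s) (mem_C.1 (h t) s).symm w),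
      ρ.mem_wt.1 hv, _root_.map_smul]

lemma pr_join (hν : ν.In H) (hμ : μ.In H) (h : μ.In ν.C) (N m : ℤ) (v : V) :
    ρ.pr (join h N) m v = ∑ i ∈ (ρ.pr ν).support, ∑ j ∈ (ρ.pr μ).support,
      if N * i + j = m then ρ.pr ν i (ρ.pr μ j v) else 0 := by
  conv_lhs => rw [← ρ.sum_pr hμ v, ← ρ.sum_pr hν (∑ j ∈ _, _)]
  simp only [_root_.map_sum]
  refine Finset.sum_congr rfl fun i _ => Finset.sum_congr rfl fun j _ => ?_
  exact ρ.pr_of_weight (hν.join hμ h N) (ρ.mem_wt.1 (ρ.wt_join hν hμ h N (ρ.pr_mem_wt hν i _)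
    (ρ.pr_mem_wt_of_comm hν hμ h (ρ.pr_mem_wt hμ j v) i))) m

lemma exists_pr_join (hν : ν.In H) (hμ : μ.In H) (h : μ.In ν.C) : ∃ N₀ : ℤ, 0 < N₀ ∧ ∀ N ≥ N₀,
    ∀ i ∈ (ρ.pr ν).support, ∀ j ∈ (ρ.pr μ).support, ∀ v,
      ρ.pr (join h N) (N * i + j) v = ρ.pr ν i (ρ.pr μ j v) := by
  obtain ⟨M, hM⟩ : ∃ M : ℕ, ∀ j ∈ (ρ.pr μ).support, j.natAbs ≤ M :=
    ⟨_, fun j hj => Finset.le_sup (f := Int.natAbs) hj⟩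
  refine ⟨2 * M + 1, by positivity, fun N hN i hi j hj v => ?_⟩
  rw [ρ.pr_join hν hμ h, Finset.sum_eq_single i, Finset.sum_eq_single j, if_pos rfl]
  · exact fun j' _ hj' => if_neg fun e => hj' (by linarith)
  · exact fun h' => absurd hj h'
  · refine fun i' _ hi' => Finset.sum_eq_zero fun j' hj' => if_neg fun e => hi' ?_
    have h1 := hM j hj
    have h2 := hM j' hj'
    by_contra hne
    have h3 : N * (i' - i) = j - j' := by linarith
    have h4 : |N * (i' - i)| ≥ N := by
      rw [abs_mul]
      have := Int.one_le_abs (sub_ne_zero.2 hne)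
      have := le_abs_self N
      nlinarith [abs_nonneg N]
    rw [h3] at h4
    have := abs_le.2 (⟨by omega, by omega⟩ : -(2 * M : ℤ) ≤ j - j' ∧ j - j' ≤ 2 * M)
    omega
  · exact absurd hi

/-- For large `N`, an operator commuting with `ν ^ N * μ` commutes with `ν` and `μ`. -/
lemma exists_join_comm (hν : ν.In H) (hμ : μ.In H) (h : μ.In ν.C) : ∃ N₀ : ℤ, 0 < N₀ ∧ ∀ N ≥ N₀,
    ∀ T : V →ₗ[k] V, (∀ t v, T (ρ (join h N t) v) = ρ (join h N t) (T v)) →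
      (∀ t v, T (ρ (ν t) v) = ρ (ν t) (T v)) ∧ ∀ t v, T (ρ (μ t) v) = ρ (μ t) (T v) := by
  obtain ⟨N₀, h0, hN₀⟩ := ρ.exists_pr_join hν hμ h
  refine ⟨N₀, h0, fun N hN T hT => ?_⟩
  have key : ∀ i ∈ (ρ.pr ν).support, ∀ j ∈ (ρ.pr μ).support, ∀ v,
      T (ρ.pr ν i (ρ.pr μ j v)) = ρ.pr ν i (ρ.pr μ j (T v)) := fun i hi j hj v => by
    rw [← hN₀ N hN i hi j hj, ← hN₀ N hN i hi j hj, ρ.pr_comm (hν.join hμ h N) hT]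
  have hc : ∀ i v j, ρ.pr ν i (ρ.pr μ j v) = ρ.pr μ j (ρ.pr ν i v) := fun i v j =>
    ρ.pr_comm hμ (fun t w => ((ρ.pr_comm hν (fun s w =>
      ρ.apply_comm (hμ t) (hν s) (mem_C.1 (h t) s).symm w) i w)).symm) j v
  constructor
  · intro t v
    rw [ρ.pr_eq_sum hν, ρ.pr_eq_sum hν, _root_.map_sum]
    refine Finset.sum_congr rfl fun i hi => ?_
    rw [_root_.map_smul]
    conv_lhs => rw [← ρ.sum_pr hμ v]
    conv_rhs => rw [← ρ.sum_pr hμ (T v)]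
    rw [_root_.map_sum, _root_.map_sum, _root_.map_sum, Finset.sum_congr rfl fun j hj => key i hi j hj v]
  · intro t v
    rw [ρ.pr_eq_sum hμ, ρ.pr_eq_sum hμ, _root_.map_sum]
    refine Finset.sum_congr rfl fun j hj => ?_
    rw [_root_.map_smul]
    conv_lhs => rw [← ρ.sum_pr hν v]
    conv_rhs => rw [← ρ.sum_pr hν (T v)]
    rw [_root_.map_sum, _root_.map_sum, _root_.map_sum, Finset.sum_congr rfl fun i hi => by
      rw [← hc, key i hi j hj v, hc]]

/-- The operators commuting with a cocharacter. -/
def commutant (ν : Cochar n k) : Submodule k (V →ₗ[k] V) where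
  carrier := {T | ∀ t v, T (ρ (ν t) v) = ρ (ν t) (T v)}
  add_mem' := fun ha hb t v => by simp [ha t v, hb t v]
  zero_mem' := fun t v => by simp
  smul_mem' := fun c T h t v => by simp [h t v]

/-- `κ` is generic if every cocharacter commuting with `ν` preserves all lines in the weight spaces
of `κ`. -/
lemma eigen_of_commutant_le (hν : ν.In H) (h : ρ.commutant ν ≤ ρ.commutant μ) {i : ℤ} {v : V}
    (hv : v ∈ ρ.wt ν i) (t : kˣ) : ∃ c : k, ρ (μ t) v = c • v := by
  by_cases h0 : v = 0
  · exact ⟨0, by simp [h0]⟩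
  obtain ⟨l, hl⟩ := Module.Projective.exists_dual_ne_zero k h0
  have h1 := @h ((l.comp (ρ.pr ν i)).smulRight v) (fun s w => by
    simp only [LinearMap.smulRight_apply, LinearMap.comp_apply, _root_.map_smul]
    rw [← ρ.pr_comm hν (T := ρ (ν s)) (fun t v => ρ.apply_comm (hν s) (hν t) (ν.comm _ _) v),
      ρ.apply_pr hν, _root_.map_smul, ρ.mem_wt.1 hv, smul_smul, smul_eq_mul, mul_comm]) t v
  simp only [LinearMap.smulRight_apply, LinearMap.comp_apply, _root_.map_smul,
    ρ.pr_of_mem_wt hν hv] at h1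
  exact ⟨(l v)⁻¹ * l (ρ.pr ν i (ρ (μ t) v)), by rw [mul_smul, h1, smul_smul, inv_mul_cancel₀ hl, one_smul]⟩

end RatRep
end

namespace Cochar
variable {ν μ : Cochar n k} {G : Subgroup (GLn n k)}

lemma mem_C_of_stdRep {g : GLn n k}
    (h : ∀ t v, g.1.mulVec ((ν t).1.mulVec v) = (ν t).1.mulVec (g.1.mulVec v)) : g ∈ ν.C :=
  mem_C.2 fun t => Units.ext (mulVec_injective fun v => by
    have := h t v
    simpa using this.symm)

lemma exists_join_C (h : μ.In ν.C) : ∃ N₀ : ℤ, 0 < N₀ ∧ ∀ N ≥ N₀, (join h N).C ≤ ν.C ⊓ μ.C := by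
  obtain ⟨N₀, h0, hN⟩ := (stdRep ⊤).exists_join_comm ν.in_top μ.in_top h
  refine ⟨N₀, h0, fun N hN' g hg => ?_⟩
  obtain ⟨h1, h2⟩ := hN N hN' ((stdRep ⊤ : RatRep (⊤ : Subgroup (GLn n k)) _) g) fun t v =>
    (stdRep ⊤).apply_comm (Subgroup.mem_top _) (Subgroup.mem_top _) (mem_C.1 hg t).symm v
  exact ⟨mem_C_of_stdRep h1, mem_C_of_stdRep h2⟩

lemma le_join_C (h : μ.In ν.C) (N : ℤ) : ν.C ⊓ μ.C ≤ (join h N).C := fun g hg => mem_C.2 fun t => by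
  have h1 : Commute (ν t) g := mem_C.1 hg.1 t
  have h2 : Commute (μ t) g := mem_C.1 hg.2 t
  rw [join_apply]
  exact (h1.zpow_left N).mul_left h2

lemma clo_one : Clo k ({1} : Set (GLn n k)) := by
  convert (stdRep (⊤ : Subgroup (GLn n k))).clo_coeff isClosed_univ Set.univ using 1
  ext g
  simp only [Set.mem_singleton_iff, Set.mem_ofPred_eq, Set.mem_univ, Subgroup.mem_top, true_and,
    forall_true_left, Prod.forall]
  refine ⟨fun h => by simp [h, stdRep], fun h => Units.ext (mulVec_injective fun v => ?_)⟩
  have := (Module.forall_dual_apply_eq_zero_iff k _).1 fun l => (sub_eq_zero.2 (h v l)).symm ▸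
    (_root_.map_sub l _ _)
  simpa [stdRep] using sub_eq_zero.1 this

lemma clo_C : IsClo ν.C := by
  have : (ν.C : Set (GLn n k)) = ⋂ t, (fun x => ν t * x * (ν t)⁻¹ * x⁻¹) ⁻¹' {1} := by
    ext x
    simp only [SetLike.mem_coe, mem_C, Set.mem_iInter, Set.mem_preimage, Set.mem_singleton_iff]
    refine forall_congr' fun t => ?_
    rw [mul_inv_eq_one, mul_inv_eq_iff_eq_mul]
  rw [IsClo, this]
  refine @isClosed_iInter _ _ (zar k _) _ fun t => Clo.preimage
    (Mor.mul (mor_conj _) (Mor.inv Mor.id)) ?_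
  exact clo_one

/-- Regular cocharacters of `G`: the centraliser is as small as possible. -/
def Reg (G : Subgroup (GLn n k)) (ν : Cochar n k) : Prop :=
  ν.In G ∧ ∀ κ : Cochar n k, κ.In G → κ.In ν.C → ν.C ≤ κ.C

theorem exists_reg (G : Subgroup (GLn n k)) : ∃ ν, Reg G ν := by
  obtain ⟨C, -, ⟨ν, hν, rfl⟩, hmin⟩ := exists_minimal_clo (k := k)
    (fun C : Set (GLn n k) => ∃ ν : Cochar n k, ν.In G ∧ C = ν.C)
    ⟨_, clo_C, ⟨⟨1, Mor.const 1⟩, fun _ => G.one_mem, rfl⟩⟩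
  refine ⟨ν, hν, fun κ hκ h => ?_⟩
  obtain ⟨N, -, hN⟩ := exists_join_C h
  have := hmin (join h N).C clo_C ⟨_, hν.join hκ h N, rfl⟩ ((hN N le_rfl).trans inf_le_left)
  exact fun g hg => (hN N le_rfl (this.symm ▸ hg : g ∈ ((join h N).C : Set _))).2

/-- The cocharacters of the maximal torus determined by a regular cocharacter. -/
def X (G : Subgroup (GLn n k)) (ν : Cochar n k) : Set (Cochar n k) := {κ | κ.In G ∧ κ.In ν.C}

lemma Reg.mem_X (h : Reg G ν) : ν ∈ X G ν := ⟨h.1, ν.in_C⟩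

lemma Reg.comm (h : Reg G ν) {κ κ' : Cochar n k} (hκ : κ ∈ X G ν) (hκ' : κ' ∈ X G ν) : κ'.In κ.C :=
  hκ'.2.mono (h.2 κ hκ.1 hκ.2)

lemma Reg.join_mem (h : Reg G ν) {κ κ' : Cochar n k} (hκ : κ ∈ X G ν) (hκ' : κ' ∈ X G ν)
    (N : ℤ) : join (h.comm hκ hκ') N ∈ X G ν :=
  ⟨hκ.1.join hκ'.1 _ N, hκ.2.join hκ'.2 _ N⟩

lemma Reg.of_C_eq (h : Reg G ν) {κ : Cochar n k} (hκ : κ.In G) (e : κ.C = ν.C) : Reg G κ :=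
  ⟨hκ, fun μ hμ hc => by rw [e] at hc ⊢; exact h.2 μ hμ hc⟩

lemma X_congr {κ : Cochar n k} (e : κ.C = ν.C) : X G κ = X G ν := by simp [X, e]

/-- A regular cocharacter of the same torus, generic for a given representation. -/
lemma Reg.exists_generic {V : Type} [AddCommGroup V] [Module k V] [FiniteDimensional k V]
    (h : Reg G ν) (ρ : RatRep G V) : ∃ κ : Cochar n k, κ.In G ∧ κ.C = ν.C ∧
      ∀ μ ∈ X G ν, ρ.commutant κ ≤ ρ.commutant μ := by
  obtain ⟨_, ⟨κ, hκ, hC, rfl⟩, hmin⟩ := WellFounded.has_min (wellFounded_lt (α := Submodule k (V →ₗ[k] V)))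
    {W | ∃ κ : Cochar n k, κ.In G ∧ κ.C = ν.C ∧ ρ.commutant κ = W} ⟨_, ν, h.1, rfl, rfl⟩
  refine ⟨κ, hκ, hC, fun μ hμ => ?_⟩
  have hc : μ.In κ.C := hC ▸ hμ.2
  obtain ⟨N₁, -, hN₁⟩ := ρ.exists_join_comm hκ hμ.1 hc
  obtain ⟨N₂, -, hN₂⟩ := exists_join_C hc
  set N := max N₁ N₂
  have hle : ρ.commutant (join hc N) ≤ ρ.commutant κ ⊓ ρ.commutant μ :=
    fun T hT => hN₁ N (le_max_left _ _) T hT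
  have hC' : (join hc N).C = ν.C := by
    refine le_antisymm (hC ▸ (hN₂ N (le_max_right _ _)).trans inf_le_left) ?_
    exact (le_inf hC.ge (h.2 μ hμ.1 hμ.2)).trans (le_join_C hc N)
  have := hmin _ ⟨_, hκ.join hμ.1 hc N, hC', rfl⟩
  rw [← eq_of_le_of_not_lt (hle.trans inf_le_left) this]
  exact hle.trans inf_le_right

end Cochar

section
variable {G : Subgroup (GLn n k)} {ν : Cochar n k}

lemma clo_inf {H K : Subgroup (GLn n k)} (hH : IsClo H) (hK : IsClo K) : IsClo (H ⊓ K) := by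
  rw [IsClo, Subgroup.coe_inf]; exact @IsClosed.inter _ _ _ (zar k _) hH hK

lemma dser_trivial_of_cochar {V : Type} [AddCommGroup V] [Module k V] [FiniteDimensional k V]
    (hG : IsClo G) (hI : IsIrr G) (ρ : RatRep G V)
    (h : ∀ μ : Cochar n k, μ.In G → ∀ t v, ρ (μ t) v = v) :
    ∃ m, ∀ g ∈ dser G m, ∀ v, ρ g v = v :=
  exists_unipotent_flag ρ fun g hg => by
    by_contra hn
    obtain ⟨μ, hμ, t, ht⟩ := ρ.exists_cochar hG hI hg hn
    exact ht (LinearMap.ext fun v => h μ hμ t v)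

theorem Cochar.Reg.isSolvable_C (hG : IsClo G) (hI : IsIrr G)
    (h : Reg G ν) : IsSolvable (G ⊓ ν.C : Subgroup (GLn n k)) := by
  obtain ⟨κ, hκ, hC, hgen⟩ := h.exists_generic (stdRep G)
  have hc := clo_inf hG (clo_C (ν := ν))
  have hi := irr_C hG hI h.1
  set H := G ⊓ ν.C with hH
  obtain ⟨W, hW⟩ : ∃ W : Submodule k (Module.End k (Fin n → k)),
      ∀ X, X ∈ W ↔ X ∈ (stdRep G).commutant κ := ⟨(stdRep G).commutant κ, fun _ => Iff.rfl⟩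
  have hst : (stdRep H).endRep.Stable W := fun g hg X hX => (hW _).2 fun t v => by
    replace hX := (hW X).1 hX
    rw [RatRep.endRep_apply]
    have h1 : ∀ x ∈ H, ∀ v, stdRep H x (stdRep H (κ t) v) = stdRep H (κ t) (stdRep H x v) :=
      fun x hx v => (stdRep ⊤).apply_comm trivial trivial (mem_C.1 (hC ▸ hx.2 : x ∈ κ.C) t).symm v
    change stdRep H g (X (stdRep H g⁻¹ (stdRep H (κ t) v))) = _
    rw [h1 _ (H.inv_mem hg), show X (stdRep H (κ t) _) = stdRep H (κ t) (X _) from hX t _, h1 _ hg]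
    rfl
  obtain ⟨m, hm⟩ := dser_trivial_of_cochar hc hi ((stdRep H).endRep.sub W hst) (by
    intro μ hμ t X
    refine Subtype.ext ?_
    rw [RatRep.sub_apply _ hst (hμ t), RatRep.endRep_apply]
    have h1 := hgen μ ⟨hμ.mono inf_le_left, hμ.mono inf_le_right⟩ ((hW _).1 X.2)
    refine LinearMap.ext fun v => ?_
    change stdRep G (μ t) (X.1 (stdRep G (μ t)⁻¹ v)) = X.1 v
    rw [← h1 t, RatRep.apply_inv_self _ (hμ t).1])
  refine isSolvable_iff_dser.2 ⟨m + 1, ?_⟩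
  change ⁅dser H m, dser H m⁆ = ⊥
  rw [Subgroup.commutator_eq_bot_iff_le_centralizer]
  intro g hg
  rw [Subgroup.mem_centralizer_iff]
  intro x hx
  have hxH := dser_le H m hx
  have hgH := dser_le H m hg
  have h1 := congrArg Subtype.val (hm g hg ⟨stdRep G x, (hW _).2 fun t v =>
    (stdRep ⊤).apply_comm trivial trivial (mem_C.1 (hC ▸ hxH.2 : x ∈ κ.C) t).symm v⟩)
  rw [RatRep.sub_apply _ hst hgH, RatRep.endRep_apply] at h1
  have h2 : g * (x * g⁻¹) = x := Units.ext (mulVec_injective fun v => by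
    have := LinearMap.congr_fun h1 v
    simpa [stdRep, mul_assoc] using this)
  rw [← mul_assoc, mul_inv_eq_iff_eq_mul] at h2
  exact h2.symm

theorem Cochar.Reg.isSolvable_inf_P (hG : IsClo G)
    (hI : IsIrr G) (h : Reg G ν) : IsSolvable (G ⊓ ν.P : Subgroup (GLn n k)) :=
  isSolvable_P hG h.1 (h.isSolvable_C hG hI)

end

section
variable {B : Subgroup (GLn n k)}

/-- The group of rational characters of `B`. -/
def charGroup (B : Subgroup (GLn n k)) : Subgroup (B →* kˣ) where
  carrier := {χ | ∃ f ∈ reg k (GLn n k), ∀ b : B, (χ b : k) = f b}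
  one_mem' := ⟨1, one_mem _, fun _ => rfl⟩
  mul_mem' := by
    rintro χ ψ ⟨f, hf, h⟩ ⟨g, hg, h'⟩
    exact ⟨f * g, mul_mem hf hg, fun b => by simp [h, h']⟩
  inv_mem' := by
    rintro χ ⟨f, hf, h⟩
    exact ⟨_, (Mor.inv Mor.id) f hf, fun b => by
      change ((χ b)⁻¹ : kˣ).val = f (b : GLn n k)⁻¹
      rw [← Subgroup.coe_inv, ← h, _root_.map_inv]⟩

open Classical in
/-- The one-dimensional representation attached to a character. -/
noncomputable def charRep {χ : B →* kˣ} (hχ : χ ∈ charGroup B) : RatRep B k where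
  toFun g := if h : g ∈ B then (χ ⟨g, h⟩ : k) • LinearMap.id else 0
  map_one := by
    rw [dif_pos B.one_mem, show (⟨1, B.one_mem⟩ : B) = 1 from rfl, _root_.map_one]; ext; simp
  map_mul g hg h hh := by
    rw [dif_pos hg, dif_pos hh, dif_pos (B.mul_mem hg hh),
      show (⟨g * h, B.mul_mem hg hh⟩ : B) = ⟨g, hg⟩ * ⟨h, hh⟩ from rfl, _root_.map_mul]
    ext; simp [mul_comm]
  regular v l := by
    obtain ⟨f, hf, h⟩ := hχ
    exact ⟨fun g => f g * l v, mul_mem hf ((reg k _).algebraMap_mem (l v)), fun g hg => by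
      rw [dif_pos hg, h, LinearMap.smul_apply, LinearMap.id_apply, _root_.map_smul]; rfl⟩

lemma charRep_apply {χ : B →* kˣ} (hχ : χ ∈ charGroup B) (b : B) (v : k) :
    charRep hχ b v = (χ b : k) * v := by
  simp [charRep]

lemma char_eq_one {χ : B →* kˣ} (hχ : χ ∈ charGroup B) (b : B)
    (hb : IsNilpotent (charRep hχ b - 1)) : χ b = 1 :=
  Units.ext (eq_one_of_nilp hb one_ne_zero (by rw [charRep_apply]; rfl))

lemma exists_weight {χ : B →* kˣ} (hχ : χ ∈ charGroup B) {κ : Cochar n k} (hκ : κ.In B) :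
    ∃ y : ℤ, ∀ t, χ ⟨κ t, hκ t⟩ = t ^ y := by
  obtain ⟨y, hy⟩ := (charRep hχ).exists_wt_of_eigen hκ (one_ne_zero (α := k))
    fun t => ⟨_, charRep_apply hχ ⟨κ t, hκ t⟩ 1⟩
  refine ⟨y, fun t => Units.ext ?_⟩
  have := (RatRep.mem_wt _).1 hy t
  rw [show κ t = ((⟨κ t, hκ t⟩ : B) : GLn n k) from rfl, charRep_apply] at this
  simpa [zpowFun] using this

lemma exists_flag_chars (hI : IsIrr B) (hs : IsSolvable B) (d : ℕ) :
    ∀ (V : Type) [AddCommGroup V] [Module k V] [FiniteDimensional k V] (ρ : RatRep B V),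
      Module.finrank k V = d → ∃ S : Finset (B →* kˣ), (∀ χ ∈ S, χ ∈ charGroup B) ∧
        ∀ b : B, IsNilpotent (ρ b - 1) ↔ ∀ χ ∈ S, χ b = 1 := by
  classical
  induction d with
  | zero =>
    intro V _ _ _ ρ hd
    have := Module.finrank_zero_iff.1 hd
    exact ⟨∅, by simp, fun b => by simp [Subsingleton.elim (ρ b - 1) 0]⟩
  | succ d ih =>
    intro V _ _ _ ρ hd
    have : Nontrivial V := Module.nontrivial_of_finrank_pos (R := k) (by omega)
    obtain ⟨v, hv, hc⟩ := lie_kolchin hI hs ρ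
    choose! c hc using hc
    have hcv : ∀ {a b : k}, a • v = b • v → a = b := fun h => smul_left_injective k hv h
    have hW : ρ.Stable (k ∙ v) := fun g hg w hw => by
      obtain ⟨a, rfl⟩ := Submodule.mem_span_singleton.1 hw
      rw [_root_.map_smul, hc g hg, smul_comm]
      exact Submodule.smul_mem _ _ (Submodule.mem_span_singleton.2 ⟨a, rfl⟩)
    have hc1 : c 1 = 1 := hcv (by rw [← hc 1 B.one_mem, ρ.one_apply, one_smul])
    have hcm : ∀ a b : B, c (a * b) = c a * c b := fun a b => hcv (by
      rw [← hc _ (B.mul_mem a.2 b.2), ρ.mul_apply a.2 b.2, hc b b.2, _root_.map_smul, hc a a.2, smul_smul,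
        mul_comm])
    let χ₀ : B →* kˣ := MonoidHom.toHomUnits ⟨⟨fun b : B => c b, hc1⟩, hcm⟩
    have hχ₀ : ∀ b : B, (χ₀ b : k) = c b := fun b => rfl
    obtain ⟨S, hS, hS'⟩ := ih (V ⧸ (k ∙ v)) (ρ.quot _ hW) (by
      have := (k ∙ v).finrank_quotient_add_finrank
      rw [finrank_span_singleton hv] at this; omega)
    refine ⟨insert χ₀ S, ?_, fun b => ?_⟩
    · intro χ hχ
      rcases Finset.mem_insert.1 hχ with rfl | hχ
      · obtain ⟨l, hl⟩ := Module.Projective.exists_dual_ne_zero k hv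
        obtain ⟨f, hf, h⟩ := ρ.regular v l
        refine ⟨fun g => f g * (l v)⁻¹, mul_mem hf ((reg k _).algebraMap_mem _), fun b => ?_⟩
        change c b = f b * (l v)⁻¹
        rw [← h b b.2, hc b b.2, _root_.map_smul, smul_eq_mul, mul_inv_cancel_right₀ hl]
      · exact hS χ hχ
    · rw [Finset.forall_mem_insert, ← hS']
      constructor
      · exact fun h => ⟨Units.ext (eq_one_of_nilp h hv (hc b b.2)), ρ.nilp_quot hW b.2 h⟩
      · rintro ⟨h1, h2⟩
        refine nilp_of_eigenvalues fun e w hw he => ?_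
        by_cases hwW : w ∈ (k ∙ v)
        · obtain ⟨a, rfl⟩ := Submodule.mem_span_singleton.1 hwW
          rw [_root_.map_smul, hc b b.2, ← hχ₀, h1, Units.val_one, one_smul] at he
          exact (smul_left_injective k hw (show (1 : k) • _ = e • _ by rw [one_smul]; exact he)).symm
        · exact eq_one_of_nilp h2 (v := (k ∙ v).mkQ w)
            (fun h => hwW ((Submodule.Quotient.mk_eq_zero _).1 h))
            (by rw [ρ.quot_apply hW b.2, he, _root_.map_smul])

/-- A character trivial on a maximal torus is trivial. -/
lemma char_trivial (hB : IsClo B) (hI : IsIrr B)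
    {ν : Cochar n k} (hν : ν.In B) {ψ : B →* kˣ} (hψ : ψ ∈ charGroup B)
    (h : ∀ κ ∈ X B ν, ∀ hκ : κ.In B, ∀ t, ψ ⟨κ t, hκ t⟩ = 1) (b : B) : ψ b = 1 := by
  have hu : ∀ g (hg : g ∈ B), IsUnip g → g ∈ ψ.ker.map B.subtype := fun g hg hu =>
    ⟨⟨g, hg⟩, char_eq_one hψ _ ((charRep hψ).nilp_of_isUnip hg hu), rfl⟩
  have hC : B ⊓ ν.C ≤ ψ.ker.map B.subtype := fun g hg => by
    refine ⟨⟨g, hg.1⟩, char_eq_one hψ _ ?_, rfl⟩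
    by_contra hn
    obtain ⟨κ, hκ, t, ht⟩ := RatRep.exists_cochar (clo_inf hB clo_C) (irr_C hB hI hν)
      ((charRep hψ).mono inf_le_left) hg hn
    refine ht (LinearMap.ext fun v => ?_)
    have := h κ ⟨hκ.mono inf_le_left, hκ.mono inf_le_right⟩ (hκ.mono inf_le_left) t
    exact (charRep_apply hψ ⟨κ t, (hκ t).1⟩ v).trans (by rw [this]; simp)
  obtain ⟨b', hb', e⟩ := le_of_cell hB hI hν (fun g hg => hu g hg.1 (isUnip_of_mem_U hg.2)) hC
    (fun g hg => hu g hg.1 (isUnip_of_mem_U hg.2)) b.2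
  rw [← Subtype.ext e]; exact hb'

lemma zpow_finset_sum {ι : Type*} (s : Finset ι) (f : ι → ℤ) (t : kˣ) :
    t ^ (∑ i ∈ s, f i) = ∏ i ∈ s, t ^ f i := by
  classical
  induction s using Finset.induction_on with
  | empty => simp
  | insert a s ha ih => rw [Finset.sum_insert ha, Finset.prod_insert ha, zpow_add, ih]

lemma exists_lattice (hB : IsClo B) (hI : IsIrr B)
    {ν ν' : Cochar n k} (h : Reg B ν) (h' : ν'.In B) (S : Finset (B →* kˣ))
    (hS : ∀ χ ∈ S, χ ∈ charGroup B) : ∃ m : ℕ, m ≠ 0 ∧ ∃ κ ∈ X B ν, ∃ hκ : κ.In B,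
      ∀ χ ∈ S, ∀ t, χ ⟨κ t, hκ t⟩ = χ ⟨ν' t, h' t⟩ ^ m := by
  classical
  let Y : AddSubgroup (S → ℤ) :=
    { carrier := {y | ∃ κ ∈ X B ν, ∃ hκ : κ.In B, ∀ χ : S, ∀ t, χ.1 ⟨κ t, hκ t⟩ = t ^ y χ}
      zero_mem' := ⟨ν.pow 0, ⟨h.1.pow 0, ν.in_C.pow 0⟩, h.1.pow 0, fun χ t => by
        rw [Pi.zero_apply, zpow_zero]
        rw [← _root_.map_one χ.1]
        congr 1
        exact Subtype.ext ((pow_apply _ _ _).trans (by rw [zpow_zero]; exact ν.map_one))⟩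
      add_mem' := by
        rintro y y' ⟨κ, hκ, hκB, e⟩ ⟨κ', hκ', hκB', e'⟩
        refine ⟨_, h.join_mem hκ hκ' 1, (h.join_mem hκ hκ' 1).1, fun χ t => ?_⟩
        rw [Pi.add_apply, zpow_add, ← e, ← e', ← _root_.map_mul]
        congr 1
        exact Subtype.ext ((join_apply _ 1 t).trans (by rw [zpow_one]; rfl))
      neg_mem' := by
        rintro y ⟨κ, hκ, hκB, e⟩
        refine ⟨κ.neg, ⟨hκ.1.neg, hκ.2.neg⟩, hκ.1.neg, fun χ t => ?_⟩
        rw [Pi.neg_apply, zpow_neg, ← e, ← _root_.map_inv]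
        congr 1
        exact Subtype.ext (κ.neg_apply t) }
  choose y' hy' using fun χ : S => exists_weight (hS χ χ.2) h'
  rcases exists_functional (AddSubgroup.toIntSubmodule Y) y' with ⟨a, ha, hay⟩ | ⟨m, hm, κ, hκ, hκB, e⟩
  · exfalso
    set ψ : B →* kˣ := ∏ χ : S, χ.1 ^ a (Pi.single χ 1) with hψ
    have hval : ∀ y : S → ℤ, ∀ (κ : Cochar n k) (hκ : κ.In B),
        (∀ χ : S, ∀ t, χ.1 ⟨κ t, hκ t⟩ = t ^ y χ) → ∀ t, ψ ⟨κ t, hκ t⟩ = t ^ a y := by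
      intro y κ hκ e t
      have hay : a y = ∑ χ : S, y χ * a (Pi.single χ 1) := by
        conv_lhs => rw [pi_eq_sum_univ' y]
        simp_rw [_root_.map_sum, _root_.map_smul, smul_eq_mul]
      rw [hψ, MonoidHom.finsetProd_apply, hay, zpow_finset_sum]
      exact Finset.prod_congr rfl fun χ _ => by
        rw [show (χ.1 ^ a (Pi.single χ 1)) _ = χ.1 ⟨κ t, hκ t⟩ ^ a (Pi.single χ 1) from rfl, e,
          zpow_mul]
    have h1 := char_trivial hB hI h.1 (ψ := ψ)
      (prod_mem fun χ _ => zpow_mem (hS χ χ.2) _) (fun κ hκ hκB t => by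
        choose y hy using fun χ : S => exists_weight (hS χ χ.2) hκB
        rw [hval y κ hκB hy, ha y ⟨κ, hκ, hκB, hy⟩, zpow_zero])
    obtain ⟨t, ht⟩ := exists_zpowFun_ne (k := k) hay
    apply ht
    rw [zpowFun_zero]
    have := hval y' ν' h' hy' t
    rw [h1] at this
    simpa [zpowFun] using (congrArg Units.val this).symm
  · exact ⟨m, hm, κ, hκ, hκB, fun χ hχ t => by
      rw [e ⟨χ, hχ⟩, hy' ⟨χ, hχ⟩, Pi.smul_apply, smul_eq_mul, mul_comm, zpow_mul, zpow_natCast]⟩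

lemma Cochar.C_pow (ν : Cochar n k) {m : ℕ} (hm : m ≠ 0) : (ν.pow m).C = ν.C := by
  ext g
  simp only [mem_C, pow_apply]
  refine ⟨fun h t => ?_, fun h t => h _⟩
  obtain ⟨s, hs⟩ := IsAlgClosed.exists_pow_nat_eq (t : k) (Nat.pos_of_ne_zero hm)
  have hs0 : s ≠ 0 := by rintro rfl; rw [zero_pow hm] at hs; exact t.ne_zero hs.symm
  have := h (Units.mk0 s hs0)
  rwa [zpow_natCast, show (Units.mk0 s hs0) ^ m = t from Units.ext (by simpa using hs)] at this

lemma exists_conj_C_le (hB : IsClo B) (hI : IsIrr B)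
    (hs : IsSolvable B) {ν ν' : Cochar n k} (h : Reg B ν) (h' : ν'.In B) :
    ∃ b ∈ B, ν.C ≤ cj b ν'.C := by
  obtain ⟨S, hS, hS'⟩ := exists_flag_chars hI hs _ _ (stdRep B) rfl
  obtain ⟨m, hm, κ, hκ, hκB, e⟩ := exists_lattice hB hI h h' S hS
  let J : Subgroup (GLn n k) := (⨅ χ ∈ S, χ.ker).map B.subtype
  have hJ : ∀ b : B, (b : GLn n k) ∈ J ↔ ∀ χ ∈ S, χ b = 1 := fun b => by
    refine ⟨?_, fun h => ⟨b, by simpa [Subgroup.mem_iInf] using h, rfl⟩⟩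
    rintro ⟨b', hb', e⟩
    rw [← Subtype.ext e]
    simpa [Subgroup.mem_iInf] using hb'
  have hJB : J ≤ B := by rintro _ ⟨b, -, rfl⟩; exact b.2
  have hJu : ∀ g ∈ J, IsUnip g := fun g hg => by
    obtain ⟨N, hN⟩ := (hS' ⟨g, hJB hg⟩).2 ((hJ ⟨g, hJB hg⟩).1 hg)
    refine ⟨N, Matrix.toLin'.injective ?_⟩
    rw [Matrix.toLin'_pow, _root_.map_sub, Matrix.toLin'_one, _root_.map_zero]
    exact hN
  obtain ⟨j, hj, e'⟩ := exists_conj_eq hJu (ν := κ) (ν' := ν'.pow m) (fun t g hg => by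
    have e0 : κ t * g * (κ t)⁻¹ =
        ((⟨κ t, hκB t⟩ * ⟨g, hJB hg⟩ * ⟨κ t, hκB t⟩⁻¹ : B) : GLn n k) := by
      simp only [Subgroup.coe_mul, Subgroup.coe_inv]
    rw [e0]
    refine (hJ _).2 fun χ hχ => ?_
    rw [_root_.map_mul, _root_.map_mul, _root_.map_inv, (hJ ⟨g, hJB hg⟩).1 hg χ hχ]; simp)
    (fun t => by
      have h1 : ν'.pow m t * (κ t)⁻¹ = ((⟨ν' t, h' t⟩ ^ m * ⟨κ t, hκB t⟩⁻¹ : B) : GLn n k) := by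
        rw [pow_apply, zpow_natCast, show ν' (t ^ m) = ν' t ^ m from _root_.map_pow ν'.toHom t m]
        simp only [Subgroup.coe_mul, Subgroup.coe_inv, Subgroup.coe_pow]
      rw [h1]
      refine (hJ _).2 fun χ hχ => ?_
      rw [_root_.map_mul, _root_.map_pow, _root_.map_inv, e χ hχ, mul_inv_cancel])
  refine ⟨j, hJB hj, (h.2 κ hκ.1 hκ.2).trans ?_⟩
  rw [← e', C_conj, C_pow _ hm]

/-- Maximal tori of a connected solvable group are conjugate. -/
theorem exists_conj_C_eq (hB : IsClo B) (hI : IsIrr B)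
    (hs : IsSolvable B) {ν ν' : Cochar n k} (h : Reg B ν) (h' : Reg B ν') :
    ∃ b ∈ B, ν.C = cj b ν'.C := by
  obtain ⟨b, hb, h1⟩ := exists_conj_C_le hB hI hs h h'.1
  obtain ⟨c, hc, h2⟩ := exists_conj_C_le hB hI hs h' h.1
  refine ⟨b, hb, h1.antisymm ?_⟩
  have h3 : cj b ν'.C ≤ cj (b * c) ν.C := by rw [cj_mul]; exact cj_mono h2
  have h4 : cj (b * c)⁻¹ ν.C ≤ ν.C := by rw [cj_le_iff, inv_inv]; exact h1.trans h3
  have h5 := cj_eq_of_le clo_C h4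
  have h6 : cj (b * c) ν.C = ν.C := by conv_lhs => rw [← h5, cj_cj_inv]
  rwa [h6] at h3

end

def CC (G : Subgroup (GLn n k)) : Prop := IsClo G ∧ IsIrr G

namespace RatRep
variable {V : Type} [AddCommGroup V] [Module k V] {G : Subgroup (GLn n k)} (ρ : RatRep G V)
  {ν : Cochar n k}

def Gen (v : V) : Prop := ∀ W : Submodule k V, (∀ g ∈ G, ρ g v ∈ W) → W = ⊤

lemma stable_span (v : V) : ρ.Stable (Submodule.span k {w | ∃ g ∈ G, w = ρ g v}) := by
  intro g hg w hw
  refine Submodule.span_induction (p := fun w _ => ρ g w ∈ _) ?_ (by simp) (fun a b _ _ ha hb => ?_)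
    (fun c a _ ha => ?_) hw
  · rintro _ ⟨h, hh, rfl⟩
    exact Submodule.subset_span ⟨g * h, mul_mem hg hh, (ρ.mul_apply hg hh v).symm⟩
  · rw [map_add]; exact add_mem ha hb
  · rw [_root_.map_smul]; exact Submodule.smul_mem _ _ ha

variable [FiniteDimensional k V]

lemma cell_span (hG : CC G) (hν : ν.In G) {v : V}
    (hv : ∀ p ∈ G ⊓ ν.P, ∃ c : k, ρ p v = c • v) {W : Submodule k V}
    (hW : ∀ u ∈ G ⊓ ν.neg.U, ρ u v ∈ W) {g : GLn n k} (hg : g ∈ G) : ρ g v ∈ W := by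
  by_contra h
  obtain ⟨l, hl, hl'⟩ := Submodule.exists_dual_map_eq_bot_of_notMem h inferInstance
  obtain ⟨f, hf, hfl⟩ := ρ.regular v l
  obtain ⟨x, hx, h1, h2⟩ := Irr.exists_ne hG.2 hf ν.cellFun_mem hg G.one_mem
    (by rw [← hfl g hg]; exact hl) (cellFun_ne_zero_of_mem_C (one_mem _))
  obtain ⟨u, hu, c, hc, w, hw, rfl⟩ := exists_cell_of_mem hG.1 hν hx h2
  obtain ⟨e, he⟩ := hv (c * w) ⟨mul_mem hc.1 hw.1, mul_mem (C_le_P hc.2) (U_le_P hw.2)⟩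
  apply h1
  rw [← hfl _ hx]
  change l (ρ _ v) = 0
  rw [mul_assoc, ρ.mul_apply hu.1 (mul_mem hc.1 hw.1), he, _root_.map_smul]
  have := Submodule.mem_map_of_mem (f := l) (W.smul_mem e (hW u hu))
  rwa [hl', Submodule.mem_bot] at this

def Top (ν : Cochar n k) (v : V) (c : ℤ) : Prop :=
  v ∈ ρ.wt ν c ∧ ∀ i, ∀ w ∈ ρ.wt ν i, w ≠ 0 → i < c ∨ ∃ e : k, w = e • v

variable {ρ}
lemma top_of_eigen (hG : CC G) (hν : ν.In G) {v : V} (h0 : v ≠ 0) (hgen : ρ.Gen v)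
    (hv : ∀ p ∈ G ⊓ ν.P, ∃ c : k, ρ p v = c • v) : ∃ c, ρ.Top ν v c := by
  obtain ⟨c, hc⟩ := ρ.exists_wt_of_eigen hν h0 fun t => hv _ ⟨hν t, C_le_P (ν.in_C t)⟩
  let W : Submodule k V :=
    { carrier := {w | (∀ i > c, ρ.pr ν i w = 0) ∧ ρ.pr ν c w ∈ Submodule.span k {v}}
      add_mem' := fun ha hb => ⟨fun i hi => by rw [map_add, ha.1 i hi, hb.1 i hi, add_zero],
        by rw [map_add]; exact add_mem ha.2 hb.2⟩
      zero_mem' := by simp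
      smul_mem' := fun e a ha => ⟨fun i hi => by rw [_root_.map_smul, ha.1 i hi, smul_zero],
        by rw [_root_.map_smul]; exact Submodule.smul_mem _ _ ha.2⟩ }
  have hW : W = ⊤ := hgen W fun g hg => ρ.cell_span hG hν hv (fun u hu => by
    have hc' : v ∈ ρ.wt ν.neg (-c) := by rwa [wt_neg, _root_.neg_neg]
    have h1 := ρ.pr_of_lim hG.1 hν.neg hu.1 (mem_U.1 hu.2) hc'
    refine ⟨fun i hi => ?_, ?_⟩
    · have := h1.1 (-i) (by lia)
      rwa [ρ.pr_neg hν, _root_.neg_neg] at this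
    · have := h1.2
      rw [ρ.pr_neg hν, _root_.neg_neg, one_apply] at this
      rw [this]
      exact Submodule.mem_span_singleton_self v) hg
  refine ⟨c, hc, fun i w hw h0 => ?_⟩
  have hwW : w ∈ W := hW ▸ Submodule.mem_top
  rcases lt_trichotomy i c with h | rfl | h
  · exact Or.inl h
  · have := hwW.2
    rw [ρ.pr_of_mem_wt hν hw] at this
    obtain ⟨e, he⟩ := Submodule.mem_span_singleton.1 this
    exact Or.inr ⟨e, he.symm⟩
  · exact absurd (ρ.pr_of_mem_wt hν hw ▸ hwW.1 i h) h0

lemma Top.eigen (hG : IsClo G) (hν : ν.In G) {v : V} {c : ℤ} (h : ρ.Top ν v c) {p : GLn n k}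
    (hp : p ∈ G ⊓ ν.P) : ∃ e : k, ρ p v = e • v := by
  obtain ⟨q, hq⟩ := mem_P.1 hp.2
  have h1 := ρ.pr_of_lim hG hν hp.1 hq h.1
  have h2 : ρ p v ∈ ρ.wt ν c := ρ.mem_wt_of_pr hν fun j hj => by
    rcases lt_or_gt_of_ne hj with hj | hj
    · exact h1.1 j hj
    by_contra h0
    rcases h.2 j _ (ρ.pr_mem_wt hν j _) h0 with h3 | ⟨e, he⟩
    · lia
    · apply h0
      rw [← ρ.pr_of_mem_wt hν (ρ.pr_mem_wt hν j (ρ p v)), he, _root_.map_smul,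
        ρ.pr_of_mem_wt_ne hν h.1 hj.ne, smul_zero]
  by_cases h0 : ρ p v = 0
  · exact ⟨0, by simp [h0]⟩
  · exact (h.2 c _ h2 h0).resolve_left (lt_irrefl c)

end RatRep

theorem exists_line_span {G P : Subgroup (GLn n k)} (hP : IsClo P) :
    ∃ (V : Type) (_ : AddCommGroup V) (_ : Module k V) (_ : FiniteDimensional k V) (ρ : RatRep G V)
      (v : V), v ≠ 0 ∧ ρ.Gen v ∧ ∀ g ∈ G, g ∈ P ↔ ∃ c : k, ρ g v = c • v := by
  obtain ⟨V, _, _, _, ρ₀, v, hv, h⟩ := exists_line hP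
  set ρ := ρ₀.mono (le_top : G ≤ ⊤)
  have hs := ρ.stable_span v
  have hvs : v ∈ Submodule.span k {w | ∃ g ∈ G, w = ρ g v} :=
    Submodule.subset_span ⟨1, G.one_mem, (ρ.one_apply v).symm⟩
  refine ⟨_, _, _, inferInstance, ρ.sub _ hs, ⟨v, hvs⟩, fun e => hv (congrArg Subtype.val e),
    fun W hW => ?_, fun g hg => (h g).trans ⟨fun ⟨c, hc⟩ => ⟨c, Subtype.ext ?_⟩, fun ⟨c, hc⟩ => ⟨c, ?_⟩⟩⟩
  · refine eq_top_iff.2 fun ⟨w, hw⟩ _ => ?_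
    have h1 : Submodule.span k {w | ∃ g ∈ G, w = ρ g v} ≤ W.map (Submodule.subtype _) := by
      refine Submodule.span_le.2 ?_
      rintro _ ⟨g, hg, rfl⟩
      exact ⟨_, hW g hg, ρ.sub_apply hs hg _⟩
    obtain ⟨w', hw', e⟩ := h1 hw
    rwa [show (⟨w, hw⟩ : Submodule.span k {w | ∃ g ∈ G, w = ρ g v}) = w' from Subtype.ext e.symm]
  · exact (ρ.sub_apply hs hg _).trans hc
  · exact (ρ.sub_apply hs hg _).symm.trans (congrArg Subtype.val hc)

namespace RatRep
variable {V : Type} [AddCommGroup V] [Module k V] {G : Subgroup (GLn n k)} [FiniteDimensional k V]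
  (ρ : RatRep G V) {ν μ : Cochar n k}

lemma mem_wt_conj (hν : ν.In G) {g : GLn n k} (hg : g ∈ G) {j : ℤ} {v : V} (hv : v ∈ ρ.wt ν j) :
    ρ g v ∈ ρ.wt (ν.conj g) j := ρ.mem_wt.2 fun t => by
  rw [← ρ.mul_apply (by rw [conj_apply]; exact mul_mem (mul_mem hg (hν t)) (inv_mem hg)) hg,
    conj_apply, inv_mul_cancel_right, ρ.mul_apply hg (hν t), ρ.mem_wt.1 hv, _root_.map_smul]

lemma mem_wt_of_conj (hν : ν.In G) {g : GLn n k} (hg : g ∈ G) {j : ℤ} {v : V}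
    (hv : v ∈ ρ.wt (ν.conj g) j) : ρ g⁻¹ v ∈ ρ.wt ν j := by
  have := ρ.mem_wt_conj (ν := ν.conj g) (fun t => mul_mem (mul_mem hg (hν t)) (inv_mem hg))
    (inv_mem hg) hv
  rwa [← Cochar.conj_mul, inv_mul_cancel, conj_one] at this

lemma wt_unique {i j : ℤ} {v : V} (hν : ν.In G) (hv : v ≠ 0) (h : v ∈ ρ.wt ν i)
    (h' : v ∈ ρ.wt ν j) : i = j := by
  by_contra e
  exact hv ((ρ.pr_of_mem_wt hν h').symm.trans (ρ.pr_of_mem_wt_ne hν h e))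

lemma exists_wt_le (hν : ν.In G) (hμ : μ.In G) (h : ρ.commutant ν ≤ ρ.commutant μ) (i : ℤ) :
    ∃ j, ρ.wt ν i ≤ ρ.wt μ j := by
  by_cases hb : ρ.wt ν i = ⊥
  · exact ⟨0, hb ▸ bot_le⟩
  obtain ⟨v, hv, h0⟩ := Submodule.exists_mem_ne_zero_of_ne_bot hb
  obtain ⟨j, hj⟩ := ρ.exists_wt_of_eigen hμ h0 (ρ.eigen_of_commutant_le hν h hv)
  refine ⟨j, fun w hw => ρ.mem_wt.2 fun t => ?_⟩
  obtain ⟨l, hl⟩ := Module.Projective.exists_dual_ne_zero k h0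
  have h1 := @h ((l.comp (ρ.pr ν i)).smulRight w) (fun s x => by
    simp only [LinearMap.smulRight_apply, LinearMap.comp_apply, _root_.map_smul]
    rw [← ρ.pr_comm hν (T := ρ (ν s)) (fun t v => ρ.apply_comm (hν s) (hν t) (ν.comm _ _) v),
      ρ.apply_pr hν, _root_.map_smul, ρ.mem_wt.1 hw, smul_smul, smul_eq_mul, mul_comm]) t v
  simp only [LinearMap.smulRight_apply, LinearMap.comp_apply, _root_.map_smul,
    ρ.pr_of_mem_wt hν hv, ρ.mem_wt.1 hj] at h1
  rw [smul_comm] at h1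
  exact (smul_right_injective V hl h1).symm

end RatRep

namespace Cochar
variable {G : Subgroup (GLn n k)} {ν : Cochar n k}

lemma Reg.exists_weights {V : Type} [AddCommGroup V] [Module k V] [FiniteDimensional k V]
    (h : Reg G ν) (ρ : RatRep G V) : ∃ κ ∈ X G ν, κ.C = ν.C ∧ ∃ a : ℤ → Cochar n k → ℤ,
      ∀ i, ∀ μ ∈ X G ν, ρ.wt κ i ≤ ρ.wt μ (a i μ) := by
  classical
  obtain ⟨κ, hκ, hC, hg⟩ := h.exists_generic ρ
  have : ∀ i μ, ∃ j, μ ∈ X G ν → ρ.wt κ i ≤ ρ.wt μ j := fun i μ => by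
    by_cases hμ : μ ∈ X G ν
    · obtain ⟨j, hj⟩ := ρ.exists_wt_le hκ hμ.1 (hg μ hμ) i
      exact ⟨j, fun _ => hj⟩
    · exact ⟨0, fun h => absurd h hμ⟩
  choose a ha using this
  exact ⟨κ, ⟨hκ, hC ▸ κ.in_C⟩, hC, a, ha⟩

lemma conj_mem_X {g : GLn n k} (hg : g ∈ G) (e : cj g ν.C = ν.C) {μ : Cochar n k}
    (hμ : μ ∈ X G ν) : μ.conj g ∈ X G ν :=
  ⟨fun t => mul_mem (mul_mem hg (hμ.1 t)) (inv_mem hg), e ▸ (in_cj_iff μ g).2 hμ.2⟩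

lemma Reg.finite_orbit (h : Reg G ν) :
    {μ : Cochar n k | ∃ g ∈ G, cj g ν.C = ν.C ∧ μ = ν.conj g}.Finite := by
  set ρ := stdRep G
  obtain ⟨κ, hκ, -, a, ha⟩ := h.exists_weights ρ
  refine Set.Finite.of_finite_image (f := fun μ : Cochar n k =>
    {p : ℤ × ℤ | p.1 ∈ (ρ.pr κ).support ∧ p.2 ∈ (ρ.pr ν).support ∧ ρ.wt κ p.1 ≤ ρ.wt μ p.2})
    (((ρ.pr κ).support ×ˢ (ρ.pr ν).support).finite_toSet.finite_subsets.subset ?_) ?_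
  · rintro _ ⟨μ, -, rfl⟩ ⟨i, j⟩ hp
    exact Finset.mem_coe.2 (Finset.mem_product.2 ⟨hp.1, hp.2.1⟩)
  rintro μ ⟨g, hg, hgC, rfl⟩ μ' ⟨g', hg', hgC', rfl⟩ e
  have key : ∀ t, (ν.conj g t) = ν.conj g' t := fun t => by
    have : ∀ v, ρ (ν.conj g t) v = ρ (ν.conj g' t) v := fun v => by
      rw [← ρ.sum_pr hκ.1 v, _root_.map_sum, _root_.map_sum]
      refine Finset.sum_congr rfl fun i hi => ?_
      by_cases h0 : ρ.pr κ i v = 0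
      · simp [h0]
      have hX := conj_mem_X hg hgC h.mem_X
      have h1 := ha i _ hX (ρ.pr_mem_wt hκ.1 i v)
      have h2 := ρ.mem_wt_of_conj h.1 hg h1
      have h3 : (i, a i (ν.conj g)) ∈ {p : ℤ × ℤ | p.1 ∈ (ρ.pr κ).support ∧
          p.2 ∈ (ρ.pr ν).support ∧ ρ.wt κ p.1 ≤ ρ.wt (ν.conj g) p.2} := by
        refine ⟨hi, Finsupp.mem_support_iff.2 fun e => h0 ?_, ha i _ hX⟩
        have := ρ.pr_of_mem_wt h.1 h2
        dsimp only at e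
        rw [e, LinearMap.zero_apply] at this
        rw [← ρ.apply_inv_self hg (ρ.pr κ i v), ← this, _root_.map_zero]
      have h4 := h3
      dsimp only at e
      rw [e] at h4
      rw [ρ.mem_wt.1 h1, ρ.mem_wt.1 (h4.2.2 (ρ.pr_mem_wt hκ.1 i v))]
    exact Units.ext (mulVec_injective this)
  cases hh : ν.conj g; cases hh' : ν.conj g'
  rw [hh, hh'] at key
  congr
  exact MonoidHom.ext key

lemma Reg.exists_sum (h : Reg G ν) (S : Finset (Cochar n k)) (hS : ∀ μ ∈ S, μ ∈ X G ν) :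
    ∃ l ∈ X G ν, ∀ (V : Type) [AddCommGroup V] [Module k V] [FiniteDimensional k V] (ρ : RatRep G V)
      (v : V) (f : Cochar n k → ℤ), (∀ μ ∈ S, v ∈ ρ.wt μ (f μ)) → v ∈ ρ.wt l (∑ μ ∈ S, f μ) := by
  classical
  induction S using Finset.induction_on with
  | empty =>
    refine ⟨ν.pow 0, ⟨h.1.pow 0, ν.in_C.pow 0⟩, fun V _ _ _ ρ v f _ => ρ.mem_wt.2 fun t => ?_⟩
    rw [pow_apply, zpow_zero, ν.map_one, ρ.one_apply, Finset.sum_empty, zpowFun_zero, one_smul]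
  | insert μ S hμ ih =>
    obtain ⟨l, hl, hl'⟩ := ih fun μ hμ => hS μ (Finset.mem_insert_of_mem hμ)
    have hμX := hS μ (Finset.mem_insert_self μ S)
    refine ⟨_, h.join_mem hμX hl 1, fun V _ _ _ ρ v f hf => ?_⟩
    rw [Finset.sum_insert hμ, ← one_mul (f μ)]
    exact ρ.wt_join hμX.1 hl.1 _ 1 (hf μ (Finset.mem_insert_self μ S))
      (hl' V ρ v f fun μ hμ => hf μ (Finset.mem_insert_of_mem hμ))

theorem Reg.exists_average (h : Reg G ν) {K : Subgroup (GLn n k)} (hK : K ≤ G)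
    (hKC : ∀ g ∈ K, cj g ν.C = ν.C) : ∃ l ∈ X G ν, K ≤ l.C ∧
      ∀ (V : Type) [AddCommGroup V] [Module k V] [FiniteDimensional k V] (ρ : RatRep G V) (v : V),
        (∀ g ∈ K, ∃ c, ρ.Top (ν.conj g) v c) → ∃ c, ρ.Top l v c := by
  classical
  have hfin : {μ : Cochar n k | ∃ g ∈ K, μ = ν.conj g}.Finite :=
    h.finite_orbit.subset fun μ ⟨g, hg, e⟩ => ⟨g, hK hg, hKC g hg, e⟩
  set S := hfin.toFinset with hSd
  have hS : ∀ μ, μ ∈ S ↔ ∃ g ∈ K, μ = ν.conj g := fun μ => hfin.mem_toFinset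
  have hSX : ∀ μ ∈ S, μ ∈ X G ν := fun μ hμ => by
    obtain ⟨g, hg, rfl⟩ := (hS μ).1 hμ
    exact conj_mem_X (hK hg) (hKC g hg) h.mem_X
  have hSK : ∀ g ∈ K, ∀ μ ∈ S, μ.conj g ∈ S := fun g hg μ hμ => by
    obtain ⟨g', hg', rfl⟩ := (hS μ).1 hμ
    exact (hS _).2 ⟨g * g', mul_mem hg hg', (conj_mul _ _ _).symm⟩
  obtain ⟨l, hl, hsum⟩ := h.exists_sum S hSX
  refine ⟨l, hl, fun g hg => ?_, fun V _ _ _ ρ v hv => ?_⟩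
  · rw [← inv_inv g]
    refine inv_mem (mem_C_of_stdRep fun t v => ?_)
    set ρ := stdRep G
    change ρ g⁻¹ (ρ (l t) v) = ρ (l t) (ρ g⁻¹ v)
    obtain ⟨κ, hκ, -, a, ha⟩ := h.exists_weights ρ
    rw [← ρ.sum_pr hκ.1 v]
    simp only [_root_.map_sum]
    refine Finset.sum_congr rfl fun i hi => ?_
    have h1 := ρ.pr_mem_wt hκ.1 i v
    have h2 := hsum _ ρ _ _ fun μ hμ => ha i μ (hSX μ hμ) h1
    have h3 := hsum _ ρ (ρ g⁻¹ (ρ.pr κ i v)) (fun μ => a i (μ.conj g)) fun μ hμ =>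
      ρ.mem_wt_of_conj (hSX μ hμ).1 (hK hg) (ha i _ (hSX _ (hSK g hg μ hμ)) h1)
    have h4 : ∑ μ ∈ S, a i (μ.conj g) = ∑ μ ∈ S, a i μ :=
      Finset.sum_bij' (fun μ _ => μ.conj g) (fun μ _ => μ.conj g⁻¹) (hSK g hg)
        (hSK _ (inv_mem hg)) (fun μ _ => by rw [← conj_mul, inv_mul_cancel, conj_one])
        (fun μ _ => by rw [← conj_mul, mul_inv_cancel, conj_one]) fun _ _ => rfl
    rw [ρ.mem_wt.1 h2, ρ.mem_wt.1 h3, h4, _root_.map_smul]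
  have : ∀ μ, ∃ c, μ ∈ S → ρ.Top μ v c := fun μ => by
    by_cases hμ : μ ∈ S
    · obtain ⟨g, hg, rfl⟩ := (hS μ).1 hμ
      obtain ⟨c, hc⟩ := hv g hg
      exact ⟨c, fun _ => hc⟩
    · exact ⟨0, fun h => absurd h hμ⟩
  choose c hc using this
  refine ⟨∑ μ ∈ S, c μ, hsum V ρ v c fun μ hμ => (hc μ hμ).1, fun i w hw _ => ?_⟩
  obtain ⟨κ, hκ, -, a, ha⟩ := h.exists_weights ρ
  by_cases hi : i < ∑ μ ∈ S, c μ
  · exact Or.inl hi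
  right
  rw [← ρ.sum_pr hκ.1 w]
  have : ∑ j ∈ (ρ.pr κ).support, ρ.pr κ j w ∈ Submodule.span k {v} := by
    refine Submodule.sum_mem _ fun j hj => ?_
    by_cases h0 : ρ.pr κ j w = 0
    · rw [h0]; exact zero_mem _
    have h1 := ρ.pr_mem_wt hκ.1 j w
    have h2 := hsum V ρ _ _ fun μ hμ => ha j μ (hSX μ hμ) h1
    have h3 := ρ.wt_unique hl.1 h0 h2 (ρ.pr_mem_wt_of_comm hκ.1 hl.1 (h.comm hκ hl) hw j)
    by_contra hns
    have h4 : ∀ μ ∈ S, a j μ < c μ := fun μ hμ =>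
      ((hc μ hμ).2 _ _ (ha j μ (hSX μ hμ) h1) h0).resolve_right fun ⟨e, he⟩ =>
        hns (Submodule.mem_span_singleton.2 ⟨e, he.symm⟩)
    exact hi (h3 ▸ Finset.sum_lt_sum_of_nonempty
      ⟨ν, (hS ν).2 ⟨1, K.one_mem, (conj_one ν).symm⟩⟩ h4)
  obtain ⟨e, he⟩ := Submodule.mem_span_singleton.1 this
  exact ⟨e, he.symm⟩

end Cochar

theorem exists_parabolic_average {G P K : Subgroup (GLn n k)} {ν : Cochar n k} (hG : CC G)
    (h : Reg G ν) (hP : IsClo P) (hνP : G ⊓ ν.P ≤ P) (hK : K ≤ G)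
    (hKC : ∀ g ∈ K, cj g ν.C = ν.C ∧ cj g P = P) : ∃ l ∈ X G ν, K ≤ l.C ∧ G ⊓ l.P ≤ P := by
  obtain ⟨l, hl, hl1, hl2⟩ := h.exists_average hK fun g hg => (hKC g hg).1
  refine ⟨l, hl, hl1, ?_⟩
  obtain ⟨V, _, _, _, ρ, v, h0, hgen, hst⟩ := exists_line_span (G := G) hP
  obtain ⟨c, hc⟩ := hl2 V ρ v fun g hg =>
    RatRep.top_of_eigen hG (conj_mem_X (hK hg) (hKC g hg).1 h.mem_X).1 h0 hgen fun p hp =>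
      (hst p hp.1).1 (by
        have h1 : p ∈ cj g ν.P := P_conj (ν := ν) g ▸ hp.2
        have h2 := hνP ⟨G.mul_mem (G.mul_mem (G.inv_mem (hK hg)) hp.1) (hK hg), mem_cj.1 h1⟩
        rw [← (hKC g hg).2]
        exact mem_cj.2 h2)
  exact fun p hp => (hst p hp.1).2 (hc.eigen hG.1 hl.1 hp)

lemma Cochar.Reg.mono {G H : Subgroup (GLn n k)} {ν : Cochar n k} (h : Reg G ν) (hH : H ≤ G)
    (hν : ν.In H) : Reg H ν :=
  ⟨hν, fun κ hκ => h.2 κ (hκ.mono hH)⟩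

lemma Cochar.Reg.conj {G : Subgroup (GLn n k)} {ν : Cochar n k} (h : Reg G ν) {g : GLn n k}
    (hg : g ∈ G) : Reg G (ν.conj g) := by
  have h1 : ∀ g ∈ G, ∀ μ : Cochar n k, μ.In G → (μ.conj g).In G :=
    fun g hg μ hμ t => mul_mem (mul_mem hg (hμ t)) (inv_mem hg)
  refine ⟨h1 g hg ν h.1, fun κ hκ hκ' => ?_⟩
  rw [C_conj] at hκ' ⊢
  rw [cj_le_iff, ← C_conj]
  refine h.2 _ (h1 _ (inv_mem hg) κ hκ) ?_
  rw [← cj_inv_cj (g := g) (H := ν.C)]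
  exact (in_cj_iff _ _).2 hκ'

lemma IsBorel.mono {G H B : Subgroup (GLn n k)} (hB : IsBorel G B) (hH : H ≤ G) (hBH : B ≤ H) :
    IsBorel H B :=
  ⟨hBH, hB.2.1, hB.2.2.1, hB.2.2.2.1, fun B' h => hB.2.2.2.2 B' (h.trans hH)⟩

lemma IsBorel.cc {G B : Subgroup (GLn n k)} (hB : IsBorel G B) : CC B :=
  ⟨(isBorel_iff.1 hB).2.1, (isBorel_iff.1 hB).2.2.1⟩

lemma IsBorel.solvable {G B : Subgroup (GLn n k)} (hB : IsBorel G B) : IsSolvable B :=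
  (isBorel_iff.1 hB).2.2.2.1

lemma CC.idc {P : Subgroup (GLn n k)} (hP : IsClo P) : CC (idc P) :=
  ⟨clo_idc hP, irr_idc P⟩

def cjStab (A : Subgroup (GLn n k)) : Subgroup (GLn n k) where
  carrier := {g | cj g A = A}
  one_mem' := cj_one
  mul_mem' := fun {a b} ha hb => by
    change cj _ _ = _
    rw [cj_mul, show cj b A = A from hb]
    exact ha
  inv_mem' := fun {a} (ha : cj a A = A) => by
    change cj _ _ = _
    nth_rw 1 [← ha]
    exact cj_inv_cj

section
variable {G : Subgroup (GLn n k)} {ν : Cochar n k} (hG : CC G)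

lemma Cochar.Reg.exists_borel (hG : CC G) (h : Reg G ν) : ∃ B, IsBorel G B ∧ G ⊓ ν.P ≤ B :=
  exists_isBorel_ge hG.1 hG.2 inf_le_left (irr_P hG.1 hG.2 h.1) (h.isSolvable_inf_P hG.1 hG.2)

lemma In.inf_P (h : ν.In G) : ν.In (G ⊓ ν.P) := fun t => ⟨h t, C_le_P (ν.in_C t)⟩

lemma inf_P_conj_le {B : Subgroup (GLn n k)} {g : GLn n k} (hg : g ∈ G) (h : G ⊓ ν.P ≤ B) :
    G ⊓ (ν.conj g).P ≤ cj g B := fun p hp => by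
  rw [P_conj] at hp
  exact mem_cj.2 (h ⟨G.mul_mem (G.mul_mem (G.inv_mem hg) hp.1) hg, mem_cj.1 hp.2⟩)

lemma exists_reg_P_le (hG : CC G) {B : Subgroup (GLn n k)} (hB : IsBorel G B) :
    ∃ ν, Reg G ν ∧ G ⊓ ν.P ≤ B := by
  obtain ⟨ν, hν⟩ := exists_reg G
  obtain ⟨B₁, hB₁, h⟩ := hν.exists_borel hG
  obtain ⟨g, hg, rfl⟩ := hB₁.exists_cj_eq hG.1 hG.2 hB
  exact ⟨_, hν.conj hg, inf_P_conj_le hg h⟩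

lemma Cochar.Reg.exists_norm {B : Subgroup (GLn n k)} (h : Reg G ν) (hB : IsBorel G B)
    (hν : ν.In B) {g : GLn n k} (hg : g ∈ G) (hν' : (ν.conj g).In B) :
    ∃ b ∈ B, cj (b * g) ν.C = ν.C := by
  obtain ⟨b, hb, e⟩ := exists_conj_C_eq hB.cc.1 hB.cc.2 hB.solvable (h.mono hB.1 hν)
    ((h.conj hg).mono hB.1 hν')
  exact ⟨b, hb, by rw [cj_mul, ← C_conj, ← e]⟩

lemma Cochar.Reg.exists_norm_cj (hG : CC G) {B B' : Subgroup (GLn n k)} (h : Reg G ν)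
    (hB : IsBorel G B) (hB' : IsBorel G B') (hν : ν.In B) (hν' : ν.In B') :
    ∃ g ∈ G, cj g ν.C = ν.C ∧ B' = cj g B := by
  obtain ⟨g, hg, rfl⟩ := hB.exists_cj_eq hG.1 hG.2 hB'
  obtain ⟨b, hb, e⟩ := h.exists_norm hB' hν' hg ((in_cj_iff _ _).2 hν)
  exact ⟨b * g, mul_mem (hB'.1 hb) hg, e, by rw [cj_mul, cj_eq_self hb]⟩

lemma Cochar.Reg.exists_P_le (hG : CC G) {B : Subgroup (GLn n k)} (h : Reg G ν)
    (hB : IsBorel G B) (hν : ν.In B) : ∃ μ, Reg G μ ∧ μ.C = ν.C ∧ G ⊓ μ.P ≤ B := by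
  obtain ⟨B₁, hB₁, h₁⟩ := h.exists_borel hG
  obtain ⟨g, hg, e, rfl⟩ := h.exists_norm_cj hG hB₁ hB ((In.inf_P h.1).mono h₁) hν
  exact ⟨_, h.conj hg, by rw [C_conj, e], inf_P_conj_le hg h₁⟩

theorem IsParabolic.irr (hG : CC G) {P : Subgroup (GLn n k)} (hP : IsParabolic G P) : IsIrr P := by
  obtain ⟨hPG, hPc, B, hB, hBP⟩ := isParabolic_iff.1 hP
  have hB0 : B ≤ idc P := le_idc hB.cc.2 hBP
  have hP0 : CC (idc P) := CC.idc hPc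
  obtain ⟨ν, hν, hνB⟩ := exists_reg_P_le hG hB
  have hνB' := (In.inf_P hν.1).mono hνB
  have hI : idc P ≤ G := idc_le.trans hPG
  obtain ⟨l, hl, h1, h2⟩ := exists_parabolic_average (K := G ⊓ cjStab ν.C ⊓ cjStab (idc P)) hG hν
    hP0.1 (hνB.trans hB0) (fun x hx => hx.1.1) fun g hg => ⟨hg.1.2, hg.2⟩
  suffices P ≤ idc P by rw [le_antisymm this idc_le]; exact irr_idc P
  intro p hp
  have hs : ∀ p ∈ P, cj p (idc P) ≤ idc P := fun p hp x hx => by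
    have := conj_mem_idc (fun x hx => mul_mem (mul_mem hp hx) (inv_mem hp)) (mem_cj.1 hx)
    rwa [show p * (p⁻¹ * x * p) * p⁻¹ = x by group] at this
  have hB' := hB.mono hI hB0
  obtain ⟨q, hq, e⟩ := hB'.exists_cj_eq hP0.1 hP0.2
    ((isBorel_cj hB (hPG hp)).mono hI ((cj_mono hB0).trans (hs p hp)))
  have e' : cj (q⁻¹ * p) B = B := by rw [cj_mul, e, cj_inv_cj]
  have hqp : q⁻¹ * p ∈ P := mul_mem (inv_mem (idc_le hq)) hp
  obtain ⟨b, hb, e2⟩ := hν.exists_norm (g := q⁻¹ * p) hB hνB' (hPG hqp)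
    (e' ▸ (in_cj_iff _ _).2 hνB')
  have hbP : b * (q⁻¹ * p) ∈ P := mul_mem (hBP hb) hqp
  have h3 : b * (q⁻¹ * p) ∈ G ⊓ cjStab ν.C ⊓ cjStab (idc P) :=
    ⟨⟨hPG hbP, e2⟩, cj_eq_of_le hP0.1 (hs _ hbP)⟩
  have h4 := h2 ⟨hPG hbP, C_le_P (h1 h3)⟩
  have h5 := mul_mem hq (mul_mem (inv_mem (hB0 hb)) h4)
  rwa [inv_mul_cancel_left, mul_inv_cancel_left] at h5
end

namespace RatRep
variable {V : Type} [AddCommGroup V] [Module k V] {P : Subgroup (GLn n k)} {ρ : RatRep P V}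
  {ν l : Cochar n k}

lemma Simple.gen (h : ρ.Simple) {v : V} (hv : v ≠ 0) : ρ.Gen v := fun W hW => by
  have h1 : v ∈ Submodule.span k {w | ∃ g ∈ P, w = ρ g v} :=
    Submodule.subset_span ⟨1, P.one_mem, (ρ.one_apply v).symm⟩
  have h2 := (h.2 _ (ρ.stable_span v)).resolve_left fun e => hv (by rwa [e, Submodule.mem_bot] at h1)
  refine top_le_iff.1 (h2 ▸ Submodule.span_le.2 ?_)
  rintro _ ⟨g, hg, rfl⟩
  exact hW g hg

variable [FiniteDimensional k V]

lemma mem_support_of_wt (hν : ν.In P) {v : V} (hv : v ≠ 0) {b : ℤ} (h : v ∈ ρ.wt ν b) :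
    b ∈ (ρ.pr ν).support :=
  Finsupp.mem_support_iff.2 fun e => hv (by
    have := ρ.pr_of_mem_wt hν h
    rwa [e, LinearMap.zero_apply, eq_comm] at this)

lemma Top.le_of_wt (hν : ν.In P) {v w : V} {c i : ℤ} (h : ρ.Top ν v c) (hw : w ∈ ρ.wt ν i)
    (h0 : w ≠ 0) : i ≤ c := by
  rcases h.2 i w hw h0 with h1 | ⟨e, rfl⟩
  · exact h1.le
  · exact (ρ.wt_unique hν h0 hw ((ρ.wt ν c).smul_mem e h.1)).le

theorem Simple.exists_wt (hρ : ρ.Simple) (hP : CC P) (h : Reg P ν) (hl : l ∈ X P ν)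
    (hK : P ⊓ cjStab ν.C ≤ l.C) : ∃ a, ∀ w, w ∈ ρ.wt l a := by
  haveI := hρ.1
  have hc := h.comm hl h.mem_X
  obtain ⟨N₀, -, hN₀⟩ := exists_join_C hc
  set M : ℤ := ∑ j ∈ (ρ.pr ν).support, |j|
  have hM : ∀ j ∈ (ρ.pr ν).support, |j| ≤ M := fun j hj =>
    Finset.single_le_sum (f := fun j : ℤ => |j|) (fun i _ => abs_nonneg i) hj
  obtain ⟨N, hN, hNM⟩ : ∃ N, N₀ ≤ N ∧ 2 * M < N := ⟨max N₀ (2 * M + 1), le_max_left _ _,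
    lt_of_lt_of_le (lt_add_one _) (le_max_right _ _)⟩
  have hX := h.join_mem hl h.mem_X N
  have hC : (join hc N).C = ν.C := le_antisymm ((hN₀ N hN).trans inf_le_right) (h.2 _ hX.1 hX.2)
  have hm : ∀ {w i j}, w ∈ ρ.wt l i → w ∈ ρ.wt ν j → w ∈ ρ.wt (join hc N) (N * i + j) :=
    fun hi hj => ρ.wt_join hl.1 h.1 hc N hi hj
  set ν₁ := join hc N
  have h₁ : Reg P ν₁ := h.of_C_eq hX.1 hC
  obtain ⟨B₁, hB₁, h1⟩ := h₁.exists_borel hP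
  have h₂ : Reg P ν₁.neg := h₁.of_C_eq hX.1.neg C_neg
  obtain ⟨B₂, hB₂, h2⟩ := h₂.exists_borel hP
  have hνB : ν₁.In B₁ := (In.inf_P h₁.1).mono h1
  obtain ⟨g, hg, hgC, rfl⟩ := h₁.exists_norm_cj hP hB₁ hB₂ hνB
    (by rw [← neg_neg (ν := ν₁)]; exact ((In.inf_P h₂.1).mono h2).neg)
  obtain ⟨v, hv, hve⟩ := lie_kolchin hB₁.cc.2 hB₁.solvable (ρ.mono hB₁.1)
  have hve : ∀ b ∈ B₁, ∃ c : k, ρ b v = c • v := hve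
  have hgl : g ∈ l.C := hK ⟨hg, by rw [hC] at hgC; exact hgC⟩
  have hgv : ρ g v ≠ 0 := fun e => hv (by rw [← ρ.inv_apply_self hg v, e, _root_.map_zero])
  have hge : ∀ p ∈ P ⊓ ν₁.neg.P, ∃ c : k, ρ p (ρ g v) = c • ρ g v := fun p hp => by
    obtain ⟨c, hc⟩ := hve _ (mem_cj.1 (h2 hp))
    refine ⟨c, ?_⟩
    rw [← _root_.map_smul, ← hc, ← ρ.mul_apply hp.1 hg, ← ρ.mul_apply hg
      (mul_mem (mul_mem (inv_mem hg) hp.1) hg)]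
    congr 2; group
  obtain ⟨c, hc1⟩ := top_of_eigen hP h₁.1 hv (hρ.gen hv) fun p hp => hve p (h1 hp)
  obtain ⟨c', hc2⟩ := top_of_eigen hP h₂.1 hgv (hρ.gen hgv) hge
  have hX' : ∀ μ ∈ X P ν, ∀ t, μ t ∈ B₁ := fun μ hμ t => h1 ⟨hμ.1 t, C_le_P (hC ▸ hμ.2 t)⟩
  obtain ⟨a, ha⟩ := ρ.exists_wt_of_eigen hl.1 hv fun t => hve _ (hX' l hl t)
  obtain ⟨b, hb⟩ := ρ.exists_wt_of_eigen h.1 hv fun t => hve _ (hX' ν h.mem_X t)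
  have ha' : ρ g v ∈ ρ.wt l a := ρ.mem_wt.2 fun t => by
    rw [ρ.apply_comm (hl.1 t) hg (mem_C.1 hgl t), ρ.mem_wt.1 ha, _root_.map_smul]
  obtain ⟨b', hb'⟩ := ρ.exists_wt_of_eigen h.1 hgv fun t => hge _
    ⟨h.1 t, C_le_P (by rw [C_neg, hC]; exact ν.in_C t)⟩
  have e1 := ρ.wt_unique h₁.1 hv hc1.1 (hm ha hb)
  have e2 := ρ.wt_unique h₁.1 hgv (by rw [← wt_neg]; exact hc2.1) (hm ha' hb')
  refine ⟨a, fun w => ρ.mem_wt_of_pr hl.1 fun i hi => by_contra fun h0 => hi ?_⟩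
  obtain ⟨j, hj⟩ := ρ.exists_pr_ne h.1 h0
  have hj1 := ρ.pr_mem_wt h.1 j (ρ.pr l i w)
  have hj2 := hm (ρ.pr_mem_wt_of_comm h.1 hl.1 hc.symm (ρ.pr_mem_wt hl.1 i w) j) hj1
  have i1 := hc1.le_of_wt h₁.1 hj2 hj
  have i2 := hc2.le_of_wt h₂.1 (i := -(N * i + j)) (by rwa [wt_neg, _root_.neg_neg]) hj
  have m1 := abs_le.1 (hM _ (mem_support_of_wt h.1 hv hb))
  have m2 := abs_le.1 (hM _ (mem_support_of_wt h.1 hgv hb'))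
  have m3 := abs_le.1 (hM _ (mem_support_of_wt h.1 hj hj1))
  refine le_antisymm ?_ ?_
  · by_contra hh
    nlinarith
  · by_contra hh
    nlinarith

lemma eq_self_of_wt (hP : IsClo P) (hl : l.In P) {a : ℤ} (h : ∀ w, w ∈ ρ.wt l a) {u : GLn n k}
    (hu : u ∈ P ⊓ l.U) (w : V) : ρ u w = w := by
  have := (ρ.pr_of_lim hP hl hu.1 (mem_U.1 hu.2) (h w)).2
  rwa [ρ.pr_of_mem_wt hl (h _), one_apply] at this

end RatRep

def prodSub (A N : Subgroup (GLn n k)) (h : ∀ a ∈ A, ∀ u ∈ N, a * u * a⁻¹ ∈ N) :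
    Subgroup (GLn n k) where
  carrier := (A : Set (GLn n k)) * N
  one_mem' := ⟨1, A.one_mem, 1, N.one_mem, one_mul 1⟩
  mul_mem' := by
    rintro _ _ ⟨a, ha, u, hu, rfl⟩ ⟨b, hb, v, hv, rfl⟩
    exact ⟨a * b, mul_mem ha hb, b⁻¹ * u * b * v,
      mul_mem (by have := h _ (inv_mem hb) u hu; rwa [inv_inv] at this) hv, by group⟩
  inv_mem' := by
    rintro _ ⟨a, ha, u, hu, rfl⟩
    exact ⟨a⁻¹, inv_mem ha, a * u⁻¹ * a⁻¹, h a ha _ (inv_mem hu), by group⟩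

lemma mem_prodSub {A N : Subgroup (GLn n k)} {h : ∀ a ∈ A, ∀ u ∈ N, a * u * a⁻¹ ∈ N} {x : GLn n k} :
    x ∈ prodSub A N h ↔ ∃ a ∈ A, ∃ u ∈ N, a * u = x := Iff.rfl

section
variable (H : Subgroup (GLn n k))

noncomputable def subQuot (W : Submodule k (Fin n → k)) (hW : (stdRep H).Stable W) (U : Submodule k ((Fin n → k) ⧸ W))
    (hU : ((stdRep H).quot W hW).Stable U) : RatRep H U := ((stdRep H).quot W hW).sub U hU

def nrad : Subgroup (GLn n k) where
  carrier := {h | h ∈ H ∧ ∀ W hW U hU, (subQuot H W hW U hU).Simple → ∀ u, subQuot H W hW U hU h u = u}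
  one_mem' := ⟨one_mem _, fun W hW U hU _ u => (subQuot H W hW U hU).one_apply u⟩
  mul_mem' := fun {a b} ha hb => ⟨mul_mem ha.1 hb.1, fun W hW U hU hs u => by
    rw [RatRep.mul_apply _ ha.1 hb.1, hb.2 W hW U hU hs, ha.2 W hW U hU hs]⟩
  inv_mem' := fun {a} ha => ⟨inv_mem ha.1, fun W hW U hU hs u => by
    nth_rw 1 [← ha.2 W hW U hU hs u]
    exact RatRep.inv_apply_self _ ha.1 u⟩

variable {H}
lemma clo_nrad (hH : IsClo H) : IsClo (nrad H) := by
  have : (nrad H : Set (GLn n k)) = (H : Set (GLn n k)) ∩ ⋂ (W) (hW) (U) (hU)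
      (_ : (subQuot H W hW U hU).Simple) (u), {h | h ∈ H ∧ subQuot H W hW U hU h u = u} := by
    ext x
    simp only [Set.mem_inter_iff, Set.mem_iInter]
    exact ⟨fun h => ⟨h.1, fun W hW U hU hs u => ⟨h.1, h.2 W hW U hU hs u⟩⟩,
      fun h => ⟨h.1, fun W hW U hU hs u => (h.2 W hW U hU hs u).2⟩⟩
  rw [IsClo, this]
  letI := zar k (GLn n k)
  exact IsClosed.inter hH (isClosed_iInter fun W => isClosed_iInter fun hW => isClosed_iInter fun U =>
    isClosed_iInter fun hU => isClosed_iInter fun _ => isClosed_iInter fun u =>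
      (subQuot H W hW U hU).clo_fix hH u)

lemma conj_mem_nrad {g h : GLn n k} (hg : g ∈ H) (hh : h ∈ nrad H) : g * h * g⁻¹ ∈ nrad H :=
  ⟨mul_mem (mul_mem hg hh.1) (inv_mem hg), fun W hW U hU hs u => by
    rw [RatRep.mul_apply _ (mul_mem hg hh.1) (inv_mem hg), RatRep.mul_apply _ hg hh.1,
      hh.2 W hW U hU hs, RatRep.apply_inv_self _ hg]⟩

lemma isUnip_of_mem_nrad {h : GLn n k} (hh : h ∈ nrad H) : IsUnip h := by
  set ρ := stdRep H
  have key : IsNilpotent ((ρ h : Module.End k (Fin n → k)) - 1) := nilp_of_eigenvalues fun e v hv he => by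
    obtain ⟨W, ⟨hW, hvW⟩, hmax⟩ := wellFounded_gt.has_min
      {W : Submodule k (Fin n → k) | ρ.Stable W ∧ v ∉ W} ⟨⊥, fun g _ w hw => by
        rw [Submodule.mem_bot] at hw ⊢; rw [hw, map_zero], fun h => hv ((Submodule.mem_bot k).1 h)⟩
    have hne : (⊤ : Submodule k ((Fin n → k) ⧸ W)) ≠ ⊥ := fun h => hvW (by
      have : W.mkQ v ∈ (⊤ : Submodule k ((Fin n → k) ⧸ W)) := trivial
      rw [h, Submodule.mem_bot] at this
      exact (Submodule.Quotient.mk_eq_zero W).1 this)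
    obtain ⟨U, hU, -, hs⟩ := (ρ.quot W hW).exists_simple_sub hne fun g _ w _ => trivial
    have hvU : W.mkQ v ∈ U := by
      by_contra hvU
      refine hmax (U.comap W.mkQ) ⟨fun g hg w hw => ?_, hvU⟩ (lt_of_le_of_ne (fun w hw => ?_) fun e => ?_)
      · have := hU g hg _ hw
        rwa [ρ.quot_apply hW hg] at this
      · rw [Submodule.mem_comap, show W.mkQ w = 0 from (Submodule.Quotient.mk_eq_zero W).2 hw]
        exact zero_mem _
      · haveI := hs.1
        obtain ⟨⟨x, hx⟩, hx0⟩ := exists_ne (0 : U)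
        obtain ⟨y, rfl⟩ := W.mkQ_surjective x
        exact hx0 (Subtype.ext ((Submodule.Quotient.mk_eq_zero W).2 (e ▸ hx : y ∈ W)))
    have h1 := congrArg Subtype.val (hh.2 W hW U hU hs ⟨_, hvU⟩)
    have h2 : ρ.quot W hW h (W.mkQ v) = W.mkQ v := ((ρ.quot W hW).sub_apply hU hh.1 _).symm.trans h1
    rw [ρ.quot_apply hW hh.1, he, map_smul] at h2
    have h3 : (e - 1) • W.mkQ v = 0 := by rw [sub_smul, one_smul, h2, sub_self]
    rcases smul_eq_zero.1 h3 with h3 | h3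
    · exact sub_eq_zero.1 h3
    · exact absurd ((Submodule.Quotient.mk_eq_zero W).1 h3) hvW
  have h1 : ρ h - 1 = Matrix.toLinAlgEquiv' (h.1 - 1) := by
    rw [map_sub, _root_.map_one]
    rfl
  rw [h1] at key
  have := key.map (Matrix.toLinAlgEquiv' (R := k) (n := Fin n)).symm
  rwa [AlgEquiv.symm_apply_apply] at this

lemma isUnipotentRadical_iff {U : Subgroup (GLn n k)} : IsUnipotentRadical H U ↔
    U ≤ H ∧ CC U ∧ (∀ g ∈ U, IsUnip g) ∧ (∀ h ∈ H, ∀ g ∈ U, h * g * h⁻¹ ∈ U) ∧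
      ∀ V ≤ H, CC V → (∀ g ∈ V, IsUnip g) → (∀ h ∈ H, ∀ g ∈ V, h * g * h⁻¹ ∈ V) → V ≤ U := by
  simp only [IsUnipotentRadical, IsAlgSubgroup, zclosed_iff, zconnected_iff, CC, and_assoc, and_imp]

lemma nrad_le : nrad H ≤ H := fun _ h => h.1

lemma IsUnipotentRadical.idc_nrad_le {U : Subgroup (GLn n k)} (hU : IsUnipotentRadical H U)
    (hH : IsClo H) : idc (nrad H) ≤ U :=
  (isUnipotentRadical_iff.1 hU).2.2.2.2 _ (idc_le.trans nrad_le) (CC.idc (clo_nrad hH))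
    (fun _ hg => isUnip_of_mem_nrad (idc_le hg)) fun _ hh _ hg =>
      conj_mem_idc (fun _ hx => conj_mem_nrad hh hx) hg
end

theorem exists_levi {G P U : Subgroup (GLn n k)} {ν : Cochar n k} (hG : CC G) (hP : IsParabolic G P)
    (hU : IsUnipotentRadical P U) (h : Reg G ν) (hνP : G ⊓ ν.P ≤ P) :
    ∃ l ∈ X G ν, G ⊓ l.C ≤ P ∧ ∀ p ∈ P, ∃ c ∈ G ⊓ l.C, ∃ u ∈ U, p = c * u := by
  have hP' : CC P := ⟨(isParabolic_iff.1 hP).2.1, hP.irr hG⟩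
  have hPG : P ≤ G := hP.1
  obtain ⟨l, hl, h1, h2⟩ := exists_parabolic_average (K := P ⊓ cjStab ν.C) hG h hP'.1 hνP
    (inf_le_left.trans hPG) fun g hg => ⟨hg.2, cj_eq_self hg.1⟩
  have hR : Reg P ν := h.mono hPG ((In.inf_P h.1).mono hνP)
  have hlP : l ∈ X P ν := ⟨(In.inf_P hl.1).mono h2, hl.2⟩
  have hC : G ⊓ l.C ≤ P := (inf_le_inf_left G C_le_P).trans h2
  have hUn := (isUnipotentRadical_iff.1 hU).2.2.2.1
  have hle : ∀ m : Cochar n k, m.In P → (∀ (V : Type) [AddCommGroup V] [Module k V]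
      [FiniteDimensional k V] (ρ : RatRep P V), ρ.Simple → ∃ a, ∀ w, w ∈ ρ.wt m a) → P ⊓ m.U ≤ U :=
    fun m hm hw => (le_idc (H := nrad P) (irr_G_U hP'.1 hm) fun u hu => ⟨hu.1, fun W hW U hU hs w => by
      obtain ⟨a, ha⟩ := hw _ _ hs
      exact RatRep.eq_self_of_wt hP'.1 hm ha hu w⟩).trans (hU.idc_nrad_le hP'.1)
  refine ⟨l, hl, hC, fun p hp => ?_⟩
  have h3 := le_of_cell (H := prodSub (G ⊓ l.C) U fun a ha => hUn a (hC ha)) hP'.1 hP'.2 hlP.1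
    ((hle _ hlP.1.neg fun V _ _ _ ρ hs => by
      obtain ⟨a, ha⟩ := hs.exists_wt hP' hR hlP h1
      exact ⟨-a, fun w => by rw [RatRep.wt_neg, _root_.neg_neg]; exact ha w⟩).trans
        fun u hu => ⟨1, one_mem _, u, hu, one_mul u⟩)
    (fun c hc => ⟨c, ⟨hPG hc.1, hc.2⟩, 1, U.one_mem, mul_one c⟩)
    ((hle _ hlP.1 fun V _ _ _ ρ hs => hs.exists_wt hP' hR hlP h1).trans
      fun u hu => ⟨1, one_mem _, u, hu, one_mul u⟩) hp
  obtain ⟨c, hc, u, hu, e⟩ := h3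
  exact ⟨c, hc, u, hu, e.symm⟩

section
variable {V : Type} [AddCommGroup V] [Module k V] {G J : Subgroup (GLn n k)}

/-- The functions vanishing on a set. -/
def van (k : Type) [Field k] (S : Set V) : Submodule k (V → k) where
  carrier := {f | ∀ x ∈ S, f x = 0}
  add_mem' := fun ha hb x hx => by simp [ha x hx, hb x hx]
  zero_mem' := fun x _ => rfl
  smul_mem' := fun c f hf x hx => by simp [hf x hx]

lemma RatRep.kolchin_sdiff [FiniteDimensional k V] (hu : ∀ g ∈ J, IsUnip g) (σ : RatRep J V)
    {A B : Submodule k V} (hA : σ.Stable A) (hB : σ.Stable B) {x : V} (hx : x ∈ A)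
    (hx' : x ∉ B) : ∃ f ∈ A, f ∉ B ∧ ∀ g ∈ J, σ g f - f ∈ B := by
  let τ := σ.sub A hA
  have hB' : τ.Stable (B.comap A.subtype) := fun g hg f hf => by
    change (τ g f : V) ∈ B
    rw [σ.sub_apply hA hg]
    exact hB g hg _ hf
  have : Nontrivial (A ⧸ B.comap A.subtype) := ⟨(B.comap A.subtype).mkQ ⟨x, hx⟩, 0,
    fun h => hx' ((Submodule.Quotient.mk_eq_zero (B.comap A.subtype)).1 h)⟩
  obtain ⟨f', hf0, hf⟩ := (τ.quot _ hB').kolchin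
    fun g hg => RatRep.nilp_of_isUnip _ hg (hu g hg)
  obtain ⟨f, rfl⟩ := (B.comap A.subtype).mkQ_surjective f'
  refine ⟨f, f.2, fun h => hf0 ((Submodule.Quotient.mk_eq_zero _).2 h), fun g hg => ?_⟩
  have h := hf g hg
  rw [RatRep.quot_apply _ hB' hg] at h
  have : (τ g f : V) - f ∈ B := (Submodule.Quotient.eq (B.comap A.subtype)).1 h
  rwa [σ.sub_apply hA hg] at this

/-- Orbits of unipotent groups are closed. -/
theorem RatRep.clo_orbit [FiniteDimensional k V] (hJ : CC J) (hu : ∀ g ∈ J, IsUnip g)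
    (ρ : RatRep J V) (w : V) : Clo k {z | ∃ g ∈ J, z = ρ g w} := by
  obtain ⟨F, hF, hFρ⟩ := ρ.exists_mor
  have hi : ∀ g ∈ J, ∀ x, F (g⁻¹, x) = ρ g⁻¹ x := fun g hg x => hFρ _ (inv_mem hg) x
  have hA : Mor k (fun p : V × GLn n k => F (p.2⁻¹, p.1)) :=
    hF.comp (Mor.prodMk (Mor.inv Mor.snd) Mor.fst)
  have hφ : Mor k (fun g => F (g, w)) := hF.comp (Mor.prodMk Mor.id (Mor.const w))
  have hO : (fun g => F (g, w)) '' (J : Set (GLn n k)) = {z | ∃ g ∈ J, z = ρ g w} := by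
    ext z
    constructor
    · rintro ⟨g, hg, rfl⟩
      exact ⟨g, hg, hFρ g hg w⟩
    · rintro ⟨g, hg, rfl⟩
      exact ⟨g, hg, hFρ g hg w⟩
  obtain ⟨p, hp, ⟨x, hx, hpx⟩, hpO⟩ := exists_open_image hφ hJ.1 hJ.2
  rw [hO] at hpO
  set O := {z | ∃ g ∈ J, z = ρ g w} with hOdef
  have hOs : ∀ g ∈ J, ∀ z ∈ O, ρ g z ∈ O := by
    rintro g hg _ ⟨h, hh, rfl⟩
    exact ⟨g * h, mul_mem hg hh, (ρ.mul_apply hg hh w).symm⟩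
  letI := zar k V
  have hcs : ∀ g ∈ J, ∀ z ∈ closure O, ρ g z ∈ closure O := by
    intro g hg
    have : Clo k ((fun z => F (g, z)) ⁻¹' closure O) :=
      Clo.preimage (hF.comp (Mor.prodMk (Mor.const g) Mor.id)) isClosed_closure
    intro z hz
    have hsub : O ⊆ (fun z => F (g, z)) ⁻¹' closure O := fun y hy => by
      change F (g, y) ∈ closure O
      rw [hFρ g hg]
      exact subset_closure (hOs g hg y hy)
    exact hFρ g hg z ▸ closure_sub hsub this hz
  have hmul : ∀ x, ∀ g ∈ J, ∀ h ∈ J, F ((g * h)⁻¹, x) = F (h⁻¹, F (g⁻¹, x)) := by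
    intro x g hg h hh
    rw [hi _ (mul_mem hg hh), hi g hg, hi h hh, mul_inv_rev,
      ρ.mul_apply (inv_mem hh) (inv_mem hg)]
  have h1 : ∀ x, F (1⁻¹, x) = x := fun x => by rw [hi 1 (one_mem J), inv_one, ρ.one_apply]
  obtain ⟨E, hfd, hE, hpE, hst⟩ := exists_stable_space hA hmul h1 {p} (by simpa using hp)
  let σ := fnRep hA hmul h1 E hE hst
  have hσ : ∀ g ∈ J, ∀ (f : E) x, (σ g f).1 x = f.1 (ρ g⁻¹ x) := fun g hg f x => by
    rw [fnRep_apply hA hmul h1 E hE hst hg, ← hi g hg]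
  have hW : σ.Stable ((van k (closure O \ O)).comap E.subtype) := fun g hg f hf x hx => by
    change (σ g f).1 x = 0
    rw [hσ g hg]
    refine hf _ ⟨hcs _ (inv_mem hg) _ hx.1, fun h => hx.2 ?_⟩
    simpa [ρ.apply_inv_self hg] using hOs g hg _ h
  have hW' : σ.Stable ((van k (closure O)).comap E.subtype) := fun g hg f hf x hx => by
    change (σ g f).1 x = 0
    rw [hσ g hg]
    exact hf _ (hcs _ (inv_mem hg) _ hx)
  obtain ⟨f, hfO, hf0, hf⟩ := σ.kolchin_sdiff hu hW hW' (x := ⟨p, hpE p (by simp)⟩)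
    (fun y hy => by
      by_contra h
      exact hy.2 (hpO y hy.1 h))
    (fun h => hpx (h _ (subset_closure (hO ▸ ⟨x, hx, rfl⟩))))
  have hinv : ∀ g ∈ J, ∀ x ∈ closure O, f.1 (ρ g⁻¹ x) = f.1 x := by
    intro g hg x hx
    rw [← hσ g hg]
    exact sub_eq_zero.1 (hf g hg x hx)
  have hwO : w ∈ O := ⟨1, one_mem J, (ρ.one_apply w).symm⟩
  have hconst : ∀ z ∈ closure O, f.1 z = f.1 w := by
    have hc : Clo k {z | f.1 z - f.1 w = 0} :=
      clo_zero (sub_mem (hE f.2) ((reg k V).algebraMap_mem (f.1 w)))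
    refine fun z hz => sub_eq_zero.1 (closure_sub ?_ hc hz)
    rintro _ ⟨g, hg, rfl⟩
    have := hinv g⁻¹ (inv_mem hg) w (subset_closure hwO)
    rw [inv_inv] at this
    exact sub_eq_zero.2 this
  have hne : f.1 w ≠ 0 := fun h => hf0 fun z hz => (hconst z hz).trans h
  have : closure O = O := subset_antisymm (fun z hz => by
    by_contra hzO
    exact hne ((hconst z hz).symm.trans (hfO z ⟨hz, hzO⟩))) subset_closure
  exact this ▸ isClosed_closure

lemma RatRep.mem_orbit_of_cone [FiniteDimensional k V] (hJ : CC J) (hu : ∀ g ∈ J, IsUnip g)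
    (ρ : RatRep J V) {w z : V} {l : Module.Dual k V} (hl : ∀ g ∈ J, ∀ x, l (ρ g x) = l x)
    (hz : z ∈ ρ.cone w) (hzw : l z = l w) (h0 : l w ≠ 0) : ∃ g ∈ J, z = ρ g w := by
  have hO := ρ.clo_orbit hJ hu w
  obtain ⟨S, hS, hOS⟩ := clo_iff.1 hO
  change z ∈ {z | ∃ g ∈ J, z = ρ g w}
  rw [hOS]
  intro h hh
  obtain ⟨q, hq, hqh⟩ := exists_homogeneous_components (hS hh)
  let D := q.support.sup id
  let H : V → k := ∑ d ∈ q.support, (fun _ => (l w) ^ d) * ((l : V → k) ^ (D - d) * q d)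
  have hlin : ∀ d, q d ∈ reg k V := fun d => by
    have : linFun k V ^ d ≤ Subalgebra.toSubmodule (reg k V) := by
      induction d with
      | zero => rw [pow_zero, Submodule.one_le]; exact one_mem (reg k V)
      | succ d ih =>
        rw [pow_succ]
        refine Submodule.mul_le.2 fun f hf g hg => mul_mem (S := Subalgebra k (V → k)) (ih hf) ?_
        obtain ⟨l, rfl⟩ := hg
        exact dual_mem_reg l
    exact this (hq d)
  have hH : H ∈ reg k V := sum_mem fun d _ =>
    mul_mem ((reg k V).algebraMap_mem (l w ^ d)) (mul_mem (pow_mem (dual_mem_reg l) _) (hlin d))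
  have hHt : ∀ t : k, ∀ y, l y = l w → H (t • y) = (t * l w) ^ D * h y := by
    intro t y hy
    rw [hqh]
    simp only [H, Finsupp.sum, Finset.sum_apply, Finset.mul_sum, Pi.mul_apply, Pi.pow_apply]
    refine Finset.sum_congr rfl fun d hd => ?_
    have hdD : d ≤ D := Finset.le_sup (f := id) hd
    rw [pow_linFun_smul (hq d), _root_.map_smul, smul_eq_mul, hy]
    obtain ⟨e, he⟩ := Nat.exists_eq_add_of_le hdD
    rw [he, Nat.add_sub_cancel_left]
    ring
  have hX : ρ.cone w ⊆ {y | H y = 0} := by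
    refine closure_sub ?_ (clo_zero hH)
    rintro _ ⟨t, g, hg, rfl⟩
    have : h (ρ g w) = 0 := by
      have : ρ g w ∈ {z | ∃ g ∈ J, z = ρ g w} := ⟨g, hg, rfl⟩
      rw [hOS] at this
      exact this h hh
    exact (hHt t _ (hl g hg w)).trans (by rw [this, mul_zero])
  have := hHt 1 z hzw
  rw [one_smul, hX hz, one_mul] at this
  exact (mul_eq_zero.1 this.symm).resolve_left (pow_ne_zero _ h0)

end

section
variable {V : Type} [AddCommGroup V] [Module k V] [FiniteDimensional k V]
  {G H A B N J W : Subgroup (GLn n k)} {ν μ l κ : Cochar n k} {ρ : RatRep G V} {v w z : V}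
  {φ : Module.Dual k V}

lemma Cochar.clo_U : IsClo ν.U := by
  let f : ℤ → ℤ → Fin n → Fin n → GLn n k → k :=
    fun j i a b g => (ν.idem j * g.1 * ν.idem i) a b - if i = j then ν.idem i a b else 0
  have hf : ∀ j i a b, f j i a b ∈ reg k (GLn n k) := fun j i a b => sub_mem
    (matrix_mul_mem (matrix_mul_mem (matrix_const_mem _) entry_mem) (matrix_const_mem _) a b)
    ((reg k (GLn n k)).algebraMap_mem (if i = j then ν.idem i a b else 0))
  have : (ν.U : Set (GLn n k)) = ⋂ (j) (i) (_ : j ≤ i) (a) (b), {g | f j i a b g = 0} := by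
    ext g
    simp only [Set.mem_iInter, SetLike.mem_coe, Set.mem_ofPred_eq, f, sub_eq_zero]
    constructor
    · intro hg j i hji a b
      have : ν.idem j * g.1 * ν.idem i = if i = j then ν.idem i else 0 := by
        refine mulVec_injective fun x => ?_
        have := (stdRep (⊤ : Subgroup (GLn n k))).pr_of_lim (ν := ν)
          (clo_iff.2 ⟨∅, by simp, by simp⟩) ν.in_top trivial (mem_U.1 hg)
          (RatRep.pr_mem_wt _ ν.in_top i x)
        rw [← Matrix.mulVec_mulVec, ← Matrix.mulVec_mulVec, idem_mulVec, idem_mulVec]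
        rcases hji.lt_or_eq with h | rfl
        · rw [if_neg h.ne', Matrix.zero_mulVec]
          exact this.1 j h
        · rw [if_pos rfl, idem_mulVec]
          exact this.2.trans (RatRep.one_apply _ _)
      rw [this]
      split_ifs <;> rfl
    · intro h
      obtain ⟨u, hu, e⟩ := ν.exists_mem_U (X := g.1)
        (fun i j hji => by ext a b; simpa [hji.ne'] using h j i hji.le a b)
        (fun i => by ext a b; simpa using h i i le_rfl a b)
      exact Units.ext e ▸ hu
  rw [IsClo, this]
  letI := zar k (GLn n k)
  exact isClosed_iInter fun j => isClosed_iInter fun i => isClosed_iInter fun _ =>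
    isClosed_iInter fun a => isClosed_iInter fun b => clo_zero (hf j i a b)

lemma cc_U (hG : IsClo G) (hν : ν.In G) : CC (G ⊓ ν.U) :=
  ⟨clo_inf hG clo_U, irr_G_U hG hν⟩

/-- The lowest weight component of a vector in a closed stable cone lies in the cone. -/
lemma RatRep.exists_low (hν : ν.In G) {X : Set V} (hX : Clo k X)
    (hc : ∀ (t : k), ∀ x ∈ X, t • x ∈ X) (hs : ∀ g ∈ G, ∀ x ∈ X, ρ g x ∈ X) (hw : w ∈ X)
    (h0 : w ≠ 0) : ∃ c, ρ.pr ν c w ≠ 0 ∧ ρ.pr ν c w ∈ X ∧ ∀ i < c, ρ.pr ν i w = 0 := by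
  obtain ⟨j, hj⟩ := ρ.exists_pr_ne hν h0
  have hsup : ∀ i, i ∈ (ρ.comps ν w).support ↔ ρ.pr ν i w ≠ 0 := fun i => by
    rw [Finsupp.mem_support_iff, comps_apply]
  have hne : (ρ.comps ν w).support.Nonempty := ⟨j, (hsup j).2 hj⟩
  set c := (ρ.comps ν w).support.min' hne with hcdef
  have hcm := (hsup c).1 (Finset.min'_mem _ hne)
  refine ⟨c, hcm, ?_, fun i hi => by
    by_contra h
    exact absurd (Finset.min'_le _ i ((hsup i).2 h)) (not_le.2 hi)⟩
  let ψ : k → V := fun s => ∑ i ∈ (ρ.comps ν w).support, s ^ (i - c).toNat • ρ.pr ν i w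
  have hψ : Mor k ψ := Mor.sum _ fun i _ =>
    Mor.smul (pow_mem (dual_mem_reg (LinearMap.id : k →ₗ[k] k)) _) (Mor.const _)
  have hψX : ∀ t : kˣ, ψ t ∈ X := fun t => by
    have : ψ t = zpowFun k (-c) t • ρ (ν t) w := by
      rw [ρ.apply_eq_lsum hν, lsum_eq subset_rfl, Finset.smul_sum]
      refine Finset.sum_congr rfl fun i hi => ?_
      rw [smul_smul, ← zpowFun_add, comps_apply, ← zpowFun_natCast,
        Int.toNat_of_nonneg (sub_nonneg.2 (Finset.min'_le _ i hi)), sub_eq_neg_add]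
    rw [this]
    exact hc _ _ (hs _ (hν t) _ hw)
  have h00 : ψ 0 = ρ.pr ν c w := by
    refine (Finset.sum_eq_single c (fun i hi hic => ?_) fun h => ?_).trans ?_
    · rw [zero_pow, zero_smul]
      have := Finset.min'_le _ i hi
      omega
    · exact absurd (Finset.min'_mem _ hne) h
    · simp
  obtain ⟨S, hS, rfl⟩ := clo_iff.1 hX
  intro f hf
  rw [← h00]
  exact dense_units (hψ f (hS hf)) (fun t => hψX t f hf) 0

lemma subset_of_open {X : Type} [Aff k X] {C D : Set X} (hC : Irr k C) (hD : Clo k D) {f : X → k}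
    (hf : f ∈ reg k X) {x : X} (hx : x ∈ C) (hfx : f x ≠ 0) (h : ∀ y ∈ C, f y ≠ 0 → y ∈ D) :
    C ⊆ D := by
  obtain ⟨S, hS, rfl⟩ := clo_iff.1 hD
  intro y hy g hg
  by_contra hgy
  obtain ⟨z, hz, h1, h2⟩ := hC.exists_ne hf (hS hg) hx hy hfx hgy
  exact h2 (h z hz h1 g hg)

lemma RatRep.eq_self_of_isUnip (ρ : RatRep G V) {u : GLn n k} (hu : u ∈ G) (hu' : IsUnip u)
    (h : ∃ c : k, ρ u v = c • v) : ρ u v = v := by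
  rcases eq_or_ne v 0 with rfl | h0
  · exact map_zero _
  obtain ⟨c, hc⟩ := h
  rw [hc, eq_one_of_nilp (ρ.nilp_of_isUnip hu hu') h0 hc, one_smul]

lemma RatRep.dual_eq_self_of_isUnip (ρ : RatRep G V) {u : GLn n k} (hu : u ∈ G) (hu' : IsUnip u)
    (h : ∃ c : k, ρ.dual u φ = c • φ) (x : V) : φ (ρ u x) = φ x := by
  have := congrArg (· (ρ u x)) (ρ.dual.eq_self_of_isUnip hu hu' h)
  simp only [ρ.dual_apply, ρ.inv_apply_self hu] at this
  exact this.symm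

/-- Conjugacy of maximal tori. -/
lemma exists_conj_C (hG : CC G) (h : Reg G ν) (h' : Reg G μ) : ∃ g ∈ G, μ.C = cj g ν.C := by
  obtain ⟨B, hB, hν⟩ := h.exists_borel hG
  obtain ⟨B', hB', hμ⟩ := h'.exists_borel hG
  obtain ⟨g, hg, rfl⟩ := IsBorel.exists_cj_eq hG.1 hG.2 hB hB'
  obtain ⟨b, hb, e⟩ := exists_conj_C_eq hB'.cc.1 hB'.cc.2 hB'.solvable
    (h'.mono hB'.1 ((In.inf_P h'.1).mono hμ))
    ((h.conj hg).mono hB'.1 ((in_cj_iff ν g).2 ((In.inf_P h.1).mono hν)))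
  exact ⟨b * g, mul_mem (hB'.1 hb) hg, by rw [e, C_conj, cj_mul]⟩

lemma irr_units : Irr k (Set.univ : Set kˣ) := by
  refine irr_iff.2 ⟨⟨1, trivial⟩, fun f hf g hg h => ?_⟩
  obtain ⟨a, rfl⟩ := hf
  obtain ⟨b, rfl⟩ := hg
  have hab : a * b = 0 := by
    refine AddMonoidAlgebra.coeff_injective (lsum_injective (k := k) fun t => ?_)
    have := h t trivial
    rw [← Pi.mul_apply, ← _root_.map_mul] at this
    simpa [laurentEval_apply, lsum, mul_comm] using this
  rcases mul_eq_zero.1 hab with rfl | rfl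
  · exact Or.inl fun t _ => by simp
  · exact Or.inr fun t _ => by simp

lemma Cochar.In.idc {H : Subgroup (GLn n k)} (h : ν.In H) : ν.In (idc H) := fun t =>
  subset_idc (irr_units.image ν.mor) ⟨1, trivial, ν.map_one⟩
    (by rintro _ ⟨t, -, rfl⟩; exact h t) ⟨t, trivial, rfl⟩

/-- Highest weight data: an eigenvector and a nondegenerate opposite eigenfunctional. -/
structure RatRep.HW (ρ : RatRep G V) (ν : Cochar n k) (v : V) (φ : Module.Dual k V) : Prop where
  reg : Reg G ν
  eig : ∀ p ∈ G ⊓ ν.P, ∃ c : k, ρ p v = c • v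
  coeig : ∀ p ∈ G ⊓ ν.neg.P, ∃ c : k, ρ.dual p φ = c • φ
  ne : φ v ≠ 0
  nd : ∀ w ≠ 0, ∃ g ∈ G, φ (ρ g w) ≠ 0

/-- An eigenfunctional only sees one weight component. -/
lemma RatRep.exists_dual_pr (ρ : RatRep G V) (hμ : μ.In G)
    (h : ∀ t, ∃ c : k, ρ.dual (μ t) φ = c • φ) : ∃ i, ∀ z, φ z = φ (ρ.pr μ i z) := by
  rcases eq_or_ne φ 0 with rfl | h0
  · exact ⟨0, fun z => rfl⟩
  obtain ⟨d, hd⟩ := ρ.dual.exists_wt_of_eigen hμ h0 h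
  have key : ∀ j ≠ -d, ∀ z, φ (ρ.pr μ j z) = 0 := fun j hj z => by
    obtain ⟨s, hs⟩ := exists_zpowFun_ne (k := k) hj
    have := congrArg (· (ρ.pr μ j z)) ((mem_wt _).1 hd s⁻¹)
    simp only [dual_apply, Cochar.map_inv, inv_inv, apply_pr _ hμ, _root_.map_smul,
      LinearMap.smul_apply, smul_eq_mul] at this
    rw [show zpowFun k d s⁻¹ = zpowFun k (-d) s by simp [zpowFun]] at this
    by_contra h1
    exact hs (mul_right_cancel₀ h1 this)
  refine ⟨-d, fun z => ?_⟩
  conv_lhs => rw [← ρ.sum_pr hμ z, _root_.map_sum]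
  refine (Finset.sum_eq_single (-d) (fun j _ hj => key j hj z) fun h => ?_)
  rw [Finsupp.notMem_support_iff.1 h]
  simp

namespace RatRep.HW

lemma ne_zero (h : ρ.HW ν v φ) : v ≠ 0 := fun e => h.ne (by rw [e, _root_.map_zero])

lemma inv (h : ρ.HW ν v φ) {u : GLn n k} (hu : u ∈ G ⊓ ν.neg.U) (x : V) : φ (ρ u x) = φ x :=
  ρ.dual_eq_self_of_isUnip hu.1 (isUnip_of_mem_U hu.2) (h.coeig u ⟨hu.1, U_le_P hu.2⟩) x

lemma cell (hG : CC G) (h : ρ.HW ν v φ) (hw : w ∈ ρ.cone v) (h0 : φ w ≠ 0) :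
    ∃ u ∈ G ⊓ ν.neg.U, w = (φ w / φ v) • ρ u v := by
  let σ : RatRep (G ⊓ ν.neg.U : Subgroup (GLn n k)) V := ρ.mono inf_le_left
  obtain ⟨F, hF, hFv⟩ := ρ.exists_orbit_mor v
  have h1 : (G : Set (GLn n k)) ⊆ F ⁻¹' σ.cone v := by
    refine subset_of_open hG.2 ((clo_cone σ v).preimage hF) ν.cellFun_mem (one_mem G)
      (cellFun_ne_zero_of_mem_C (one_mem ν.C)) fun g hg hgc => ?_
    obtain ⟨u, hu, c, hc, p, hp, rfl⟩ := exists_cell_of_mem hG.1 h.reg.1 hg hgc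
    obtain ⟨e, he⟩ := h.eig (c * p) (mul_mem ⟨hc.1, C_le_P hc.2⟩ ⟨hp.1, U_le_P hp.2⟩)
    rw [Set.mem_preimage, hFv _ hg, mul_assoc, ρ.mul_apply hu.1 (mul_mem hc.1 hp.1), he,
      _root_.map_smul]
    exact σ.mem_cone v e hu
  have h2 : w ∈ σ.cone v := by
    refine closure_sub ?_ (clo_cone σ v) hw
    rintro _ ⟨t, g, hg, rfl⟩
    rw [← hFv g hg]
    exact σ.cone_smul v t (h1 hg)
  obtain ⟨u, hu, e⟩ := mem_orbit_of_cone (cc_U hG.1 h.reg.1.neg)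
    (fun g hg => isUnip_of_mem_U hg.2) σ (l := φ) (fun g hg x => h.inv hg x)
    (σ.cone_smul v (φ v / φ w) h2) (by simp [h0]) h.ne
  refine ⟨u, hu, ?_⟩
  change _ = ρ u v at e
  rw [← e, smul_smul, div_mul_div_cancel₀ h.ne, div_self h0, one_smul]

lemma conj (h : ρ.HW ν v φ) {g : GLn n k} (hg : g ∈ G) {c : k} (hc : c ≠ 0) :
    ρ.HW (ν.conj g) (c • ρ g v) (ρ.dual g φ) where
  reg := h.reg.conj hg
  eig p hp := by
    have hp' : g⁻¹ * p * g ∈ G ⊓ ν.P :=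
      Subgroup.mem_inf.2 ⟨G.mul_mem (G.mul_mem (G.inv_mem hg) hp.1) hg, by
        rw [← mem_cj, ← P_conj]; exact hp.2⟩
    obtain ⟨e, he⟩ := h.eig _ hp'
    refine ⟨e, ?_⟩
    rw [_root_.map_smul, ← ρ.mul_apply hp.1 hg, show p * g = g * (g⁻¹ * p * g) by group,
      ρ.mul_apply hg hp'.1, he, _root_.map_smul, smul_comm]
  coeig p hp := by
    have hp' : g⁻¹ * p * g ∈ G ⊓ ν.neg.P :=
      Subgroup.mem_inf.2 ⟨G.mul_mem (G.mul_mem (G.inv_mem hg) hp.1) hg, by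
        rw [← mem_cj, ← P_conj]; exact hp.2⟩
    obtain ⟨e, he⟩ := h.coeig _ hp'
    refine ⟨e, ?_⟩
    rw [← ρ.dual.mul_apply hp.1 hg, show p * g = g * (g⁻¹ * p * g) by group,
      ρ.dual.mul_apply hg hp'.1, he, _root_.map_smul]
  ne := by
    rw [dual_apply, _root_.map_smul, ρ.inv_apply_self hg, _root_.map_smul]
    exact smul_ne_zero hc h.ne
  nd w hw := by
    obtain ⟨x, hx, e⟩ := h.nd w hw
    refine ⟨g * x, mul_mem hg hx, ?_⟩
    rwa [dual_apply, ρ.mul_apply hg hx, ρ.inv_apply_self hg]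

lemma eigen (hG : CC G) (h : ρ.HW ν v φ) (hμ : Reg G μ) (hw : w ∈ ρ.cone v) (h0 : w ≠ 0)
    (hwt : ∀ t, ∃ c : k, ρ (μ t) w = c • w) :
    ∃ g ∈ G, ∃ c : k, c ≠ 0 ∧ w = c • ρ g v ∧ (ν.conj g).C = μ.C := by
  obtain ⟨x, hx, hne⟩ := h.nd w h0
  obtain ⟨u, hu, e⟩ := h.cell hG (ρ.cone_stable v hx hw) hne
  have hgG : x⁻¹ * u ∈ G := mul_mem (inv_mem hx) hu.1
  set g := x⁻¹ * u
  set c := φ (ρ x w) / φ v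
  have hc : c ≠ 0 := div_ne_zero hne h.ne
  have hwg : w = c • ρ g v := by
    rw [ρ.mul_apply (inv_mem hx) hu.1, ← _root_.map_smul, ← e, ρ.inv_apply_self hx]
  have hwg' : ρ g⁻¹ w = c • v := by rw [hwg, _root_.map_smul, ρ.inv_apply_self hgG]
  have hS : CC (idc (ρ.lineStab v)) := CC.idc (clo_lineStab ρ hG.1 v)
  have hSG : idc (ρ.lineStab v) ≤ G := idc_le.trans fun y hy => (mem_lineStab.1 hy).1
  have h1 : Reg (idc (ρ.lineStab v)) ν := h.reg.mono hSG (In.idc fun t =>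
    mem_lineStab.2 ⟨h.reg.1 t, h.eig _ (In.inf_P h.reg.1 t)⟩)
  have h2 : Reg (idc (ρ.lineStab v)) (μ.conj g⁻¹) :=
    (hμ.conj (inv_mem hgG)).mono hSG (In.idc fun t => mem_lineStab.2 ⟨by
      simpa [conj_apply] using mul_mem (mul_mem (inv_mem hgG) (hμ.1 t)) hgG, by
      obtain ⟨e, he⟩ := hwt t
      refine ⟨e, smul_right_injective V hc ?_⟩
      simp only
      rw [conj_apply, inv_inv, ρ.mul_apply (mul_mem (inv_mem hgG) (hμ.1 t)) hgG,
        ρ.mul_apply (inv_mem hgG) (hμ.1 t), ← _root_.map_smul, ← _root_.map_smul, ← hwg, he,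
        _root_.map_smul, hwg', smul_comm]⟩)
  obtain ⟨s, hs, hC⟩ := exists_conj_C hS h1 h2
  obtain ⟨hsG, e, he⟩ := mem_lineStab.1 (idc_le hs)
  have he0 : e ≠ 0 := by
    rintro rfl
    rw [zero_smul] at he
    exact h.ne_zero (by rw [← ρ.inv_apply_self hsG v, he, _root_.map_zero])
  refine ⟨g * s, mul_mem hgG hsG, c / e, div_ne_zero hc he0, ?_, ?_⟩
  · rw [ρ.mul_apply hgG hsG, he, _root_.map_smul, smul_smul, div_mul_cancel₀ _ he0, hwg]
  · rw [C_conj, cj_mul, ← hC, C_conj, cj_cj_inv]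

/-- The lowest component of a nonzero vector of the cone is an extremal weight vector, and is
detected by the corresponding functional. -/
lemma low (hG : CC G) (h : ρ.HW ν v φ) (hμ : Reg G μ) (hz : z ∈ ρ.cone v) (h0 : z ≠ 0) :
    ∃ g ∈ G, ∃ c : k, c ≠ 0 ∧ ∃ i, (ν.conj g).C = μ.C ∧ ρ.pr μ i z = c • ρ g v ∧
      (∀ j < i, ρ.pr μ j z = 0) ∧ ρ.dual g φ z ≠ 0 := by
  obtain ⟨i, hi0, hi, hlt⟩ := exists_low hμ.1 (ρ.clo_cone v) (fun t x => ρ.cone_smul v t)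
    (fun g hg x => ρ.cone_stable v hg) hz h0
  obtain ⟨g, hg, c, hc, e, hC⟩ := h.eigen hG hμ hi hi0 fun t => ⟨_, ρ.apply_pr hμ.1 t i z⟩
  refine ⟨g, hg, c, hc, i, hC, e, hlt, ?_⟩
  have h' := h.conj hg hc
  obtain ⟨j, hj⟩ := ρ.exists_dual_pr (φ := ρ.dual g φ) hμ.1 fun t =>
    h'.coeig _ ⟨hμ.1 t, C_le_P (by rw [C_neg, hC]; exact in_C t)⟩
  have hne := h'.ne
  rw [← e, hj] at hne
  have hij : i = j := by
    by_contra hij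
    exact hne (by rw [pr_of_mem_wt_ne ρ hμ.1 (ρ.pr_mem_wt hμ.1 i z) hij, _root_.map_zero])
  subst hij
  rwa [pr_of_mem_wt ρ hμ.1 (ρ.pr_mem_wt hμ.1 i z), ← hj] at hne

end RatRep.HW

lemma Cochar.Reg.neg (h : Reg G ν) : Reg G ν.neg := h.of_C_eq h.1.neg C_neg

lemma RatRep.exists_coeig (hG : CC G) (h : Reg G ν) (h0 : v ≠ 0) (hgen : ρ.Gen v)
    (hv : ∀ p ∈ G ⊓ ν.P, ∃ c : k, ρ p v = c • v) : ∃ C, IsBorel G C ∧ G ⊓ ν.neg.P ≤ C ∧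
      ∃ φ : Module.Dual k V, (∀ p ∈ C, ∃ c : k, ρ.dual p φ = c • φ) ∧ φ v ≠ 0 := by
  obtain ⟨ψ, hψ⟩ := Module.Projective.exists_dual_ne_zero k h0
  have : Nontrivial (Module.Dual k V) := ⟨ψ, 0, fun e => hψ (by rw [e]; rfl)⟩
  obtain ⟨C, hC, hνC⟩ := h.neg.exists_borel hG
  obtain ⟨φ, hφ0, hφ⟩ := lie_kolchin hC.cc.2 hC.solvable (ρ.dual.mono hC.1)
  refine ⟨C, hC, hνC, φ, hφ, fun e => hφ0 (LinearMap.ker_eq_top.1 (hgen _ fun g hg =>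
    ρ.cell_span hG h.1 hv (fun u hu => ?_) hg))⟩
  rw [LinearMap.mem_ker, ρ.dual_eq_self_of_isUnip hu.1 (isUnip_of_mem_U hu.2)
    (hφ u (hνC ⟨hu.1, U_le_P hu.2⟩)), e]

/-- The vectors killed by all translates of a functional. -/
def RatRep.annih (ρ : RatRep G V) (φ : Module.Dual k V) : Submodule k V where
  carrier := {w | ∀ g ∈ G, φ (ρ g w) = 0}
  add_mem' ha hb g hg := by rw [map_add, map_add, ha g hg, hb g hg, add_zero]
  zero_mem' g hg := by simp
  smul_mem' c a ha g hg := by rw [_root_.map_smul, _root_.map_smul, ha g hg, smul_zero]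

lemma RatRep.stable_annih : ρ.Stable (ρ.annih φ) := fun g hg w hw x hx => by
  rw [← ρ.mul_apply hx hg]; exact hw _ (mul_mem hx hg)

lemma RatRep.annih_le : ρ.annih φ ≤ LinearMap.ker φ := fun w hw => by
  simpa [ρ.one_apply] using hw 1 (one_mem G)

/-- Highest weight data on the quotient by the annihilator. -/
lemma RatRep.HW.of_quot (h : Reg G ν) (hv : ∀ p ∈ G ⊓ ν.P, ∃ c : k, ρ p v = c • v)
    (hφ : ∀ p ∈ G ⊓ ν.neg.P, ∃ c : k, ρ.dual p φ = c • φ) (hne : φ v ≠ 0) :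
    (ρ.quot (ρ.annih φ) stable_annih).HW ν ((ρ.annih φ).mkQ v)
      ((ρ.annih φ).liftQ φ annih_le) where
  reg := h
  eig p hp := by
    obtain ⟨c, hc⟩ := hv p hp
    exact ⟨c, by rw [quot_apply _ _ hp.1, hc, _root_.map_smul]⟩
  coeig p hp := by
    obtain ⟨c, hc⟩ := hφ p hp
    refine ⟨c, ?_⟩
    refine LinearMap.ext fun y => ?_
    obtain ⟨x, rfl⟩ := (ρ.annih φ).mkQ_surjective y
    have := congrArg (· x) hc
    simp only [dual_apply] at this
    rw [dual_apply, quot_apply _ _ (G.inv_mem hp.1)]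
    exact this
  ne := hne
  nd w hw := by
    obtain ⟨x, rfl⟩ := (ρ.annih φ).mkQ_surjective w
    by_contra! hx
    refine hw ((Submodule.Quotient.mk_eq_zero _).2 fun g hg => ?_)
    have := hx g hg
    rwa [quot_apply _ _ hg] at this

theorem exists_HW_borel (hG : CC G) (h : Reg G ν) (hB : IsBorel G B) (hνB : G ⊓ ν.P ≤ B) :
    ∃ (V : Type) (_ : AddCommGroup V) (_ : Module k V) (_ : FiniteDimensional k V)
      (ρ : RatRep G V) (v : V) (φ : Module.Dual k V), ρ.HW ν v φ ∧ idc (ρ.lineStab v) = B := by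
  obtain ⟨V, _, _, _, ρ, v, h0, hgen, hst⟩ := exists_line_span (G := G) hB.cc.1
  have hv : ∀ p ∈ G ⊓ ν.P, ∃ c : k, ρ p v = c • v := fun p hp => (hst p hp.1).1 (hνB hp)
  obtain ⟨C, -, hC, φ, hφC, hne⟩ := RatRep.exists_coeig hG h h0 hgen hv
  have hφ := fun p (hp : p ∈ G ⊓ ν.neg.P) => hφC p (hC hp)
  have hw := RatRep.HW.of_quot h hv hφ hne
  refine ⟨_, _, _, inferInstance, _, _, _, hw, ?_⟩
  set σ := ρ.quot (ρ.annih φ) RatRep.stable_annih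
  set v' := (ρ.annih φ).mkQ v
  set S := idc (σ.lineStab v')
  have hS : CC S := CC.idc (σ.clo_lineStab hG.1 v')
  have hSG : S ≤ G := idc_le.trans fun y hy => (RatRep.mem_lineStab.1 hy).1
  have hBS : B ≤ S := le_idc hB.cc.2 fun b hb => RatRep.mem_lineStab.2 ⟨hB.1 hb, by
    obtain ⟨c, hc⟩ := (hst b (hB.1 hb)).1 hb
    exact ⟨c, by rw [RatRep.quot_apply _ _ (hB.1 hb), hc, _root_.map_smul]⟩⟩
  have hνB' : ν.In B := (In.inf_P h.1).mono hνB
  have hSr : Reg S ν := h.mono hSG (hνB'.mono hBS)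
  obtain ⟨B', hB', hνB''⟩ := hSr.neg.exists_borel hS
  obtain ⟨s, hs, hsC, rfl⟩ := hSr.exists_norm_cj hS (hB.mono hSG hBS) hB' hνB'
    (by rw [← neg_neg (ν := ν)]; exact ((In.inf_P hSr.neg.1).mono hνB'').neg)
  obtain ⟨hsG, e, he⟩ := RatRep.mem_lineStab.1 (idc_le hs)
  have hφs : φ (ρ s v) = e * φ v := by
    have := congrArg ((ρ.annih φ).liftQ φ RatRep.annih_le) he
    rwa [RatRep.quot_apply _ _ hsG, _root_.map_smul] at this
  have he0 : e ≠ 0 := by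
    rintro rfl
    rw [zero_smul] at he
    exact hw.ne_zero (by rw [← σ.inv_apply_self hsG v', he, _root_.map_zero])
  have hsv : ρ s v ≠ 0 := fun h => by
    rw [h, _root_.map_zero] at hφs
    exact mul_ne_zero he0 hne hφs.symm
  obtain ⟨i, hi⟩ := ρ.exists_wt_of_eigen h.1 hsv fun t => by
    have h1 : s⁻¹ * ν t * s ∈ G ⊓ ν.P := Subgroup.mem_inf.2
      ⟨G.mul_mem (G.mul_mem (G.inv_mem hsG) (h.1 t)) hsG, C_le_P (by
        rw [← mem_cj, hsC]; exact in_C t)⟩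
    obtain ⟨c, hc⟩ := hv _ h1
    exact ⟨c, by rw [← ρ.mul_apply (h.1 t) hsG, show ν t * s = s * (s⁻¹ * ν t * s) by group,
      ρ.mul_apply hsG h1.1, hc, _root_.map_smul]⟩
  obtain ⟨c, hc⟩ := RatRep.top_of_eigen hG h.1 h0 hgen hv
  obtain ⟨j, hj⟩ := ρ.exists_dual_pr (φ := φ) h.1 fun t => hφ _ (Subgroup.mem_inf.2
    ⟨h.1 t, C_le_P (by rw [C_neg]; exact in_C t)⟩)
  have key : ∀ {l w}, w ∈ ρ.wt ν l → φ w ≠ 0 → l = j := fun {l w} hw hφw => by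
    by_contra hlj
    exact hφw (by rw [hj, ρ.pr_of_mem_wt_ne h.1 hw hlj, _root_.map_zero])
  have hic : i = c := (key hi (hφs ▸ mul_ne_zero he0 hne)).trans (key hc.1 hne).symm
  have hsB : s ∈ B := (hst s hsG).2
    ((hc.2 i _ hi hsv).resolve_left fun h => h.ne hic)
  rw [cj_eq_self hsB] at hνB''
  refine le_antisymm (le_of_cell hS.1 hS.2 hSr.1 ?_ ?_ ?_) hBS
  · exact (inf_le_inf_left _ U_le_P).trans hνB''
  · exact (inf_le_inf hSG C_le_P).trans hνB
  · exact (inf_le_inf hSG U_le_P).trans hνB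

lemma RatRep.lineStab_smul (ρ : RatRep G V) {g : GLn n k} (hg : g ∈ G) {c : k} (hc : c ≠ 0) (v : V) :
    ρ.lineStab (c • ρ g v) = cj g (ρ.lineStab v) := by
  ext x
  have key : ∀ hx : x ∈ G, ρ (g⁻¹ * x * g) v = ρ g⁻¹ (c⁻¹ • ρ x (c • ρ g v)) := fun hx => by
    rw [_root_.map_smul (ρ x), inv_smul_smul₀ hc, ρ.mul_apply (mul_mem (inv_mem hg) hx) hg,
      ρ.mul_apply (inv_mem hg) hx]
  rw [mem_cj, mem_lineStab, mem_lineStab]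
  constructor
  · rintro ⟨hx, e, he⟩
    refine ⟨mul_mem (mul_mem (inv_mem hg) hx) hg, e, ?_⟩
    rw [key hx, he, smul_comm e, inv_smul_smul₀ hc, _root_.map_smul, ρ.inv_apply_self hg]
  · rintro ⟨hx, e, he⟩
    have hx' : x ∈ G := by
      have := mul_mem (mul_mem hg hx) (inv_mem hg)
      rwa [show g * (g⁻¹ * x * g) * g⁻¹ = x by group] at this
    refine ⟨hx', e, ?_⟩
    rw [key hx'] at he
    have := congrArg (fun y => c • ρ g y) he
    simp only [ρ.apply_inv_self hg, smul_inv_smul₀ hc, _root_.map_smul] at this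
    rw [_root_.map_smul, this, smul_comm]

lemma cc_C (hG : CC G) (hl : l.In G) : CC (G ⊓ l.C) :=
  ⟨clo_inf hG.1 clo_C, irr_C hG.1 hG.2 hl⟩

/-- A Borel subgroup containing a maximal torus meets the centralizer of a subtorus in a Borel
subgroup. -/
theorem exists_borel_C (hG : CC G) (h : Reg G ν) (hB : IsBorel G B) (hνB : G ⊓ ν.P ≤ B)
    (hl : l ∈ X G ν) : ∃ B', IsBorel (G ⊓ l.C) B' ∧ B' ≤ B := by
  obtain ⟨V, _, _, _, ρ, v, φ, hw, hBv⟩ := exists_HW_borel hG h hB hνB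
  have hL := cc_C hG hl.1
  have hLr : Reg (G ⊓ l.C) ν := h.mono inf_le_left fun t => ⟨h.1 t, hl.2.symm t⟩
  obtain ⟨B', hB', hνB'⟩ := hLr.exists_borel hL
  have hB'G : B' ≤ G := hB'.1.trans inf_le_left
  let σ : RatRep (G ⊓ l.C : Subgroup (GLn n k)) V := ρ.mono inf_le_left
  obtain ⟨y, hy, hy0, hyB⟩ := exists_fixed_line hB'.cc.2 hB'.solvable (ρ.mono hB'G)
    (σ.clo_cone v) (fun t x => σ.cone_smul v t) (fun g hg x => σ.cone_stable v (hB'.1 hg))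
    ⟨v, σ.self_mem_cone v, hw.ne_zero⟩
  obtain ⟨g, hg, c, hc, rfl, hC⟩ := hw.eigen hG h (σ.cone_subset v (ρ.clo_cone v)
    (fun t x => ρ.cone_smul v t) (fun g hg x => ρ.cone_stable v hg.1) (ρ.self_mem_cone v) hy) hy0
    fun t => hyB _ (hνB' (In.inf_P hLr.1 t))
  have hw' := hw.conj hg hc
  set y := c • ρ g v with hydef
  obtain ⟨t, m, hm, hne⟩ : ∃ t, ∃ m ∈ G ⊓ l.C, ρ.dual g φ (t • ρ m v) ≠ 0 := by
    by_contra! hcon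
    refine hw'.ne (closure_sub (D := {x | ρ.dual g φ x = 0}) ?_ (clo_zero (dual_mem_reg _)) hy)
    rintro _ ⟨t, m, hm, rfl⟩
    exact hcon t m hm
  have ht : t ≠ 0 := fun e => hne (by simp [e])
  have hxy : t • ρ m v ∈ ρ.cone y := by
    have := ρ.mem_cone y (t * c⁻¹) (mul_mem hm.1 (inv_mem hg))
    rwa [ρ.mul_apply hm.1 (inv_mem hg), hydef, _root_.map_smul, ρ.inv_apply_self hg,
      _root_.map_smul, smul_smul, inv_mul_cancel_right₀ hc] at this
  obtain ⟨u, hu, e⟩ := hw'.cell hG hxy hne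
  have hS : cj m (ρ.lineStab v) = cj u (ρ.lineStab y) := by
    rw [← ρ.lineStab_smul hm.1 ht, e, ρ.lineStab_smul hu.1 (div_ne_zero hne hw'.ne)]
  have hlv : ∀ s, l s ∈ ρ.lineStab v := fun s =>
    RatRep.mem_lineStab.2 ⟨hl.1 s, hw.eig _ (Subgroup.mem_inf.2 ⟨hl.1 s, C_le_P (hl.2 s)⟩)⟩
  have hly : ∀ s, l s ∈ ρ.lineStab y := fun s => RatRep.mem_lineStab.2
    ⟨hl.1 s, hw'.eig _ (Subgroup.mem_inf.2 ⟨hl.1 s, C_le_P (by rw [hC]; exact hl.2 s)⟩)⟩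
  have hlP : ∀ s, l s ∈ (ν.conj g).neg.P := fun s => C_le_P (by rw [C_neg, hC]; exact hl.2 s)
  have hlu : ∀ s, u⁻¹ * l s * u ∈ ρ.lineStab y := fun s => by
    rw [← mem_cj, ← hS, mem_cj, mul_assoc, mem_C.1 hm.2 s, inv_mul_cancel_left]
    exact hlv s
  obtain ⟨j, hj, hjl⟩ := Cochar.exists_conj_eq (J := G ⊓ (ν.conj g).neg.U ⊓ ρ.lineStab y)
    (ν := l) (ν' := l.conj u⁻¹) (fun j hj => isUnip_of_mem_U hj.1.2)
    (fun s j hj => ⟨⟨G.mul_mem (G.mul_mem (hl.1 s) hj.1.1) (G.inv_mem (hl.1 s)),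
      conj_mem_U (hlP s) hj.1.2⟩, Subgroup.mul_mem _ (Subgroup.mul_mem _ (hly s) hj.2)
        (Subgroup.inv_mem _ (hly s))⟩)
    fun s => by
      have e1 : l.conj u⁻¹ s * (l s)⁻¹ = u⁻¹ * (l s * u * (l s)⁻¹) := by rw [conj_apply]; group
      refine ⟨?_, ?_⟩
      · rw [e1]
        exact Subgroup.mul_mem _ (Subgroup.inv_mem _ hu)
          ⟨G.mul_mem (G.mul_mem (hl.1 s) hu.1) (G.inv_mem (hl.1 s)), conj_mem_U (hlP s) hu.2⟩
      · rw [conj_apply, inv_inv]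
        exact Subgroup.mul_mem _ (hlu s) (Subgroup.inv_mem _ (hly s))
  rw [← Cochar.conj_mul] at hjl
  have hju : j * u⁻¹ ∈ G ⊓ l.C := Subgroup.mem_inf.2
    ⟨G.mul_mem hj.1.1 (G.inv_mem hu.1), mem_C.2 fun s => by
      have : j * u⁻¹ * l s * (j * u⁻¹)⁻¹ = l s := by rw [← conj_apply, hjl]
      nth_rw 1 [← this]
      group⟩
  have hd : m⁻¹ * (j * u⁻¹)⁻¹ ∈ G ⊓ l.C := mul_mem (inv_mem hm) (inv_mem hju)
  refine ⟨_, isBorel_cj hB' hd, ?_⟩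
  rw [← hBv]
  refine le_idc (irr_cj hB'.cc.2) ?_
  rw [cj_mul, ← cj_inv_cj (g := m) (H := ρ.lineStab v), hS]
  refine cj_mono ?_
  rw [mul_inv_rev, inv_inv, cj_mul]
  refine cj_mono ?_
  rw [cj_le_iff, inv_inv, cj_eq_self hj.2]
  exact fun b hb => RatRep.mem_lineStab.2 ⟨hB'G hb, hyB b hb⟩

/-- Two Borel subgroups have a common maximal torus. -/
theorem exists_reg_common (hG : CC G) {B₁ B₂ : Subgroup (GLn n k)} (h₁ : IsBorel G B₁)
    (h₂ : IsBorel G B₂) : ∃ ν, Reg G ν ∧ ν.In B₁ ∧ ν.In B₂ := by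
  obtain ⟨ν, hν, hνB⟩ := exists_reg_P_le hG h₁
  obtain ⟨μ, hμ, hμB⟩ := exists_reg_P_le hG h₂
  obtain ⟨V, _, _, _, ρ, v, φ, hw, hBv⟩ := exists_HW_borel hG hν h₁ hνB
  obtain ⟨g, hg, c, hc, i, hC, hi, hlt, hne⟩ := hw.low hG hμ (ρ.self_mem_cone v) hw.ne_zero
  have hw' := hw.conj hg hc
  have hvy : v ∈ ρ.cone (c • ρ g v) := by
    have := ρ.mem_cone (c • ρ g v) c⁻¹ (inv_mem hg)
    rwa [_root_.map_smul, ρ.inv_apply_self hg, inv_smul_smul₀ hc] at this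
  obtain ⟨u, hu, e⟩ := hw'.cell hG hvy hne
  rw [← hi] at e hw'
  set y := ρ.pr μ i v
  have hy : y ∈ ρ.wt μ i := ρ.pr_mem_wt hμ.1 i v
  set κ := ν.conj g
  obtain ⟨ψ, hψ, hψt, hψ0⟩ := mem_U.1 hu.2
  obtain ⟨t, ht⟩ : ∃ t : kˣ, μ.neg.cellFun (ψ t) ≠ 0 := by
    by_contra! hcon
    have := dense_units (hψ _ μ.neg.cellFun_mem) hcon 0
    rw [Function.comp_apply, hψ0] at this
    exact cellFun_ne_zero_of_mem_C (one_mem _) this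
  rw [hψt] at ht
  obtain ⟨a, ha, d, hd, b, hb, hab⟩ := exists_cell_of_mem hG.1 hμ.1.neg
    (G.mul_mem (G.mul_mem (hw'.reg.1.neg t) hu.1) (G.inv_mem (hw'.reg.1.neg t))) ht
  rw [Cochar.neg_neg] at ha
  rw [C_neg] at hd
  have hq : κ.neg t ∈ G ⊓ μ.C := Subgroup.mem_inf.2
    ⟨hw'.reg.1.neg t, by rw [← hC, ← C_neg]; exact in_C t⟩
  set q := κ.neg t
  have ha' : q⁻¹ * a * q ∈ G ⊓ μ.U := Subgroup.mem_inf.2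
    ⟨G.mul_mem (G.mul_mem (G.inv_mem hq.1) ha.1) hq.1, by
      simpa using conj_mem_U (C_le_P (inv_mem hq.2)) ha.2⟩
  set a' := q⁻¹ * a * q
  have hr : q⁻¹ * d * q ∈ G ⊓ μ.C := mul_mem (mul_mem (inv_mem hq) hd) hq
  set r := q⁻¹ * d * q
  have hb' : r * (q⁻¹ * b * q) * r⁻¹ ∈ G ⊓ μ.neg.U := by
    have hqb : d * b * d⁻¹ ∈ μ.neg.U := conj_mem_U (C_le_P (by rw [C_neg]; exact hd.2)) hb.2
    have hx : r * (q⁻¹ * b * q) * r⁻¹ = q⁻¹ * (d * b * d⁻¹) * q := by simp only [r]; group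
    rw [hx]
    exact Subgroup.mem_inf.2 ⟨G.mul_mem (G.mul_mem (G.inv_mem hq.1)
      (G.mul_mem (G.mul_mem hd.1 hb.1) (G.inv_mem hd.1))) hq.1, by
      have := conj_mem_U (C_le_P (by rw [C_neg]; exact inv_mem hq.2)) hqb
      rwa [inv_inv] at this⟩
  set b' := r * (q⁻¹ * b * q) * r⁻¹
  have hu' : u = a' * (b' * r) := by
    have : u = q⁻¹ * (q * u * q⁻¹) * q := by group
    rw [this, hab]
    simp only [a', b', r]
    group
  obtain ⟨f, hf⟩ := hw'.eig r (Subgroup.mem_inf.2 ⟨hr.1, C_le_P (by rw [hC]; exact hr.2)⟩)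
  have hva : ρ a'⁻¹ v = ((ρ.dual g φ v / ρ.dual g φ y) * f) • ρ b' y := by
    nth_rw 1 [e]
    rw [hu', ρ.mul_apply ha'.1 (G.mul_mem hb'.1 hr.1), ρ.mul_apply hb'.1 hr.1, hf, _root_.map_smul,
      _root_.map_smul, _root_.map_smul, _root_.map_smul, ρ.inv_apply_self ha'.1, smul_smul]
  set s := (ρ.dual g φ v / ρ.dual g φ y) * f
  have hs0 : s ≠ 0 := by
    intro h0
    rw [h0, zero_smul] at hva
    exact hw.ne_zero (by rw [← ρ.apply_inv_self ha'.1 v, hva, _root_.map_zero])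
  have hlow : ∀ j < i, ρ.pr μ j (ρ a'⁻¹ v) = 0 := fun j hj => by
    conv_lhs => rw [← ρ.sum_pr hμ.1 v]
    rw [_root_.map_sum, _root_.map_sum]
    refine Finset.sum_eq_zero fun m _ => ?_
    rcases lt_or_ge m i with hm | hm
    · rw [hlt m hm, _root_.map_zero, _root_.map_zero]
    · exact (ρ.pr_of_lim hG.1 hμ.1 (G.inv_mem ha'.1) (mem_U.1 (inv_mem ha'.2))
        (ρ.pr_mem_wt hμ.1 m v)).1 j (hj.trans_le hm)
  obtain ⟨hb1, hb2⟩ := ρ.pr_of_lim hG.1 hμ.1.neg hb'.1 (mem_U.1 hb'.2) (c := -i) (v := y)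
    (by rw [RatRep.wt_neg, _root_.neg_neg]; exact hy)
  have hby : ρ b' y = y := by
    rw [ρ.pr_neg hμ.1, _root_.neg_neg, ρ.one_apply] at hb2
    rwa [ρ.pr_of_mem_wt hμ.1] at hb2
    refine ρ.mem_wt_of_pr hμ.1 fun j hj => ?_
    rcases hj.lt_or_gt with hj | hj
    · have := hlow j hj
      rw [hva, _root_.map_smul] at this
      exact (smul_eq_zero.1 this).resolve_left hs0
    · have := hb1 (-j) (by omega)
      rwa [ρ.pr_neg hμ.1, _root_.neg_neg] at this
  refine ⟨μ.conj a', hμ.conj ha'.1, ?_, ?_⟩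
  · rw [← hBv]
    refine In.idc ?_
    have : v = s • ρ a' y := by rw [← ρ.apply_inv_self ha'.1 v, hva, hby, _root_.map_smul]
    rw [this, ρ.lineStab_smul ha'.1 hs0, in_cj_iff]
    exact fun t => RatRep.mem_lineStab.2 ⟨hμ.1 t, _, ρ.apply_pr hμ.1 t i v⟩
  · have haB : a' ∈ B₂ := hμB (Subgroup.mem_inf.2 ⟨ha'.1, U_le_P ha'.2⟩)
    rw [← cj_eq_self haB, in_cj_iff]
    exact (In.inf_P hμ.1).mono hμB

/-- A connected unipotent group contained in every Borel subgroup through a fixed maximal torus acts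
trivially on simple modules. -/
theorem RatRep.Simple.eq_self_of_le_borel (hG : CC G) (h : Reg G ν) (hJ : CC J)
    (hu : ∀ g ∈ J, IsUnip g) (hJB : ∀ B, IsBorel G B → ν.In B → J ≤ B) {ρ : RatRep G V}
    (hρ : ρ.Simple) {j : GLn n k} (hj : j ∈ J) (x : V) : ρ j x = x := by
  obtain ⟨B, hB, hνB⟩ := h.exists_borel hG
  have hJG : J ≤ G := (hJB B hB ((In.inf_P h.1).mono hνB)).trans hB.1
  haveI := hρ.1
  obtain ⟨v, h0, hv⟩ := lie_kolchin hB.cc.2 hB.solvable (ρ.mono hB.1)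
  have hgen : ρ.Gen v := hρ.gen h0
  obtain ⟨C, hC, hνC, φ, hφ, hne⟩ := RatRep.exists_coeig hG h h0 hgen fun p hp => hv p (hνB hp)
  have hw : ρ.HW ν v φ := ⟨h, fun p hp => hv p (hνB hp), fun p hp => hφ p (hνC hp), hne,
    fun w hw => by
      by_contra! hcon
      rcases hρ.2 _ (RatRep.stable_annih (φ := φ)) with e | e
      · exact hw ((Submodule.mem_bot k).1 (e ▸ (hcon : w ∈ ρ.annih φ)))
      · exact hne (RatRep.annih_le (e ▸ Submodule.mem_top : v ∈ ρ.annih φ))⟩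
  suffices key : ∀ x ∈ G, ρ j (ρ x v) = ρ x v from
    LinearMap.congr_fun (f := ρ j) (g := 1)
      (LinearMap.eqLocus_eq_top.1 (hgen (LinearMap.eqLocus (ρ j) 1) key)) x
  intro x hx
  set w := ρ x v
  have hw0 : w ≠ 0 := fun e => h0 (by rw [← ρ.inv_apply_self hx v, show ρ x v = 0 from e, _root_.map_zero])
  have hwv : w ∈ ρ.cone v := by simpa using ρ.mem_cone v 1 hx
  let σ : RatRep J V := ρ.mono hJG
  obtain ⟨z, hz, hz0, hzJ⟩ := exists_fixed_line hJ.2 (isSolvable_of_isUnip hu) σ (σ.clo_cone w)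
    (fun t y => σ.cone_smul w t) (fun g hg y => σ.cone_stable w hg) ⟨w, σ.self_mem_cone w, hw0⟩
  obtain ⟨g, hg, c, -, i, hCg, -, -, hφz⟩ := hw.low hG h (σ.cone_subset w (ρ.clo_cone v)
    (fun t y => ρ.cone_smul v t) (fun g hg y => ρ.cone_stable v (hJG hg)) hwv hz) hz0
  have hJC : J ≤ cj g C := hJB _ (isBorel_cj hC hg) fun t => mem_cj.2 (hνC (Subgroup.mem_inf.2
    ⟨G.mul_mem (G.mul_mem (G.inv_mem hg) (h.1 t)) hg, C_le_P (by
      rw [C_neg, ← mem_cj, ← C_conj, hCg]; exact in_C t)⟩))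
  set φ' := ρ.dual g φ
  have hinv : ∀ a ∈ J, ∀ y, φ' (ρ a y) = φ' y := fun a ha =>
    ρ.dual_eq_self_of_isUnip (hJG ha) (hu a ha) (by
      obtain ⟨c, hc⟩ := hφ _ (mem_cj.1 (hJC ha))
      exact ⟨c, by rw [← ρ.dual.mul_apply (hJG ha) hg, show a * g = g * (g⁻¹ * a * g) by group,
        ρ.dual.mul_apply hg (hC.1 (mem_cj.1 (hJC ha))), hc, _root_.map_smul]⟩)
  have hφw : φ' w ≠ 0 := fun e => hφz (closure_sub (D := {y | φ' y = 0}) (by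
    rintro _ ⟨t, m, hm, rfl⟩
    show φ' (t • ρ m w) = 0
    rw [_root_.map_smul, hinv m hm, e, smul_zero]) (clo_zero (dual_mem_reg _)) hz)
  obtain ⟨a, ha, hae⟩ := RatRep.mem_orbit_of_cone hJ hu σ (l := φ') hinv
    (σ.cone_smul w (φ' w / φ' z) hz) (by
      rw [_root_.map_smul, smul_eq_mul, div_mul_cancel₀ _ hφz]) hφw
  have hfix : ∀ b ∈ J, ρ b ((φ' w / φ' z) • z) = (φ' w / φ' z) • z := fun b hb => by
    rw [_root_.map_smul, ρ.eq_self_of_isUnip (hJG hb) (hu b hb) (hzJ b hb)]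
  have hwz : w = (φ' w / φ' z) • z := by
    rw [← hfix a⁻¹ (inv_mem ha), hae]
    exact (ρ.inv_apply_self (hJG ha) w).symm
  rw [hwz]
  exact hfix j hj

lemma CC.prodSub (hA : CC A) (hN : CC N) {h : ∀ a ∈ A, ∀ u ∈ N, a * u * a⁻¹ ∈ N} :
    CC (prodSub A N h) := by
  have hC : Clo k ((A : Set (GLn n k)) ×ˢ (N : Set (GLn n k))) :=
    @IsClosed.inter _ _ _ (zar k _) (Clo.preimage Mor.fst hA.1) (Clo.preimage Mor.snd hN.1)
  exact ⟨clo_of_image (Mor.fst.mul Mor.snd) hC (hA.2.prod hN.2) (by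
    rw [Set.image_prod, Set.image2_mul]; rfl), hA.2.mul hN.2⟩

lemma left_le_prodSub {h : ∀ a ∈ A, ∀ u ∈ N, a * u * a⁻¹ ∈ N} : A ≤ prodSub A N h :=
  fun a ha => mem_prodSub.2 ⟨a, ha, 1, one_mem N, mul_one a⟩

lemma right_le_prodSub {h : ∀ a ∈ A, ∀ u ∈ N, a * u * a⁻¹ ∈ N} : N ≤ prodSub A N h :=
  fun u hu => mem_prodSub.2 ⟨1, one_mem A, u, hu, one_mul u⟩

lemma conj_mem_prodSub {h : ∀ a ∈ A, ∀ u ∈ N, a * u * a⁻¹ ∈ N} {g : GLn n k}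
    (hA : ∀ a ∈ A, g * a * g⁻¹ ∈ A) (hN : ∀ u ∈ N, g * u * g⁻¹ ∈ N) {x : GLn n k}
    (hx : x ∈ prodSub A N h) : g * x * g⁻¹ ∈ prodSub A N h := by
  obtain ⟨a, ha, u, hu, rfl⟩ := mem_prodSub.1 hx
  exact mem_prodSub.2 ⟨_, hA a ha, _, hN u hu, by group⟩

lemma Cochar.cc_range (κ : Cochar n k) : CC κ.toHom.range := by
  have e : κ '' Set.univ = (κ.toHom.range : Set (GLn n k)) := by rw [Set.image_univ]; rfl
  exact ⟨clo_of_image κ.mor (@isClosed_univ _ (zar k _)) irr_units e,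
    by rw [IsIrr, ← e]; exact Irr.image κ.mor irr_units⟩

/-- The fixed points of a one-dimensional torus in a connected group normalized by it. -/
lemma cc_C_of_norm (hW : CC W) (hκ : ∀ t, ∀ w ∈ W, κ t * w * (κ t)⁻¹ ∈ W) : CC (W ⊓ κ.C) := by
  refine ⟨clo_inf hW.1 clo_C, irr_C_of hW.2 fun {u p q} hu hpq h => ?_⟩
  have hn : ∀ a ∈ κ.toHom.range, ∀ w ∈ W, a * w * a⁻¹ ∈ W := by
    rintro _ ⟨t, rfl⟩; exact hκ t
  have hD : CC (prodSub _ W hn) := κ.cc_range.prodSub hW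
  obtain ⟨a, ⟨s, rfl⟩, w, hw, e⟩ := mem_prodSub.1 (cell_mem hD.1
    (fun t => left_le_prodSub ⟨t, rfl⟩) hu ⟨q, hpq⟩ (right_le_prodSub h)).1
  have huW : u ∈ W := by
    obtain ⟨φ, hφ, hφt, hφ0⟩ := mem_U.1 hu
    have := Lim.curve_mem (φ := fun s => φ s * u⁻¹) hW.1 (hφ.mul (Mor.const _)) (fun t => by
      have h1 := hκ s _ (mul_mem (hκ t⁻¹ w hw) (inv_mem hw))
      have h2 : (κ t)⁻¹ * κ s = κ s * (κ t)⁻¹ := by rw [← κ.map_inv, κ.comm]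
      rw [κ.map_inv] at h1
      rw [hφt, Cochar.neg_apply, ← e]
      convert h1 using 1
      rw [← mul_assoc, h2]
      group
      rfl) 0
    rw [hφ0, one_mul] at this
    exact inv_mem_iff.1 this
  have hpW : p ∈ W := by simpa using mul_mem (inv_mem huW) h
  obtain ⟨φ, hφ, hφt, rfl⟩ := hpq
  exact Lim.curve_mem hW.1 hφ (fun t => by rw [hφt]; exact hκ t p hpW) 0

lemma RatRep.exists_fixed {ρ : RatRep H V} [Nontrivial V] (hN : N ≤ H) (hu : ∀ g ∈ N, IsUnip g) :
    ∃ v ≠ 0, ∀ g ∈ N, ρ g v = v :=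
  (ρ.mono hN).kolchin fun g hg => ρ.nilp_of_isUnip (hN hg) (hu g hg)

lemma RatRep.Simple.eq_self_of_gen {ρ : RatRep H V} (hρ : ρ.Simple) {v : V} (hv : v ≠ 0)
    {g : GLn n k} (h : ∀ x ∈ H, ρ g (ρ x v) = ρ x v) (w : V) : ρ g w = w :=
  LinearMap.congr_fun (f := ρ g) (g := 1)
    (LinearMap.eqLocus_eq_top.1 (hρ.gen hv (LinearMap.eqLocus (ρ g) 1) h)) w

lemma RatRep.Simple.eq_self_of_normal {ρ : RatRep H V} (hρ : ρ.Simple) (hN : N ≤ H)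
    (hu : ∀ g ∈ N, IsUnip g) (hn : ∀ h ∈ H, ∀ g ∈ N, h * g * h⁻¹ ∈ N) {g : GLn n k} (hg : g ∈ N)
    (w : V) : ρ g w = w := by
  haveI := hρ.1
  obtain ⟨v, hv, h⟩ := RatRep.exists_fixed (ρ := ρ) hN hu
  refine hρ.eq_self_of_gen hv (fun x hx => ?_) w
  have hx' := hn _ (inv_mem hx) g hg
  rw [inv_inv] at hx'
  rw [← ρ.mul_apply (hN hg) hx, show g * x = x * (x⁻¹ * g * x) by group,
    ρ.mul_apply hx (hN hx'), h _ hx']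

lemma isUnip_of_mem_prodSub (hA : ∀ g ∈ A, IsUnip g) (hN : ∀ g ∈ N, IsUnip g)
    {h : ∀ a ∈ A, ∀ u ∈ N, a * u * a⁻¹ ∈ N} {g : GLn n k} (hg : g ∈ prodSub A N h) : IsUnip g := by
  refine isUnip_of_mem_nrad (H := prodSub A N h) ⟨hg, fun W hW U hU hs => ?_⟩
  haveI := hs.1
  obtain ⟨v, hv, hfix⟩ := RatRep.exists_fixed (ρ := subQuot _ W hW U hU) (N := A) left_le_prodSub hA
  have hall : ∀ x ∈ prodSub A N h, subQuot _ W hW U hU x v = v := fun x hx => by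
    obtain ⟨a, ha, u, hu, rfl⟩ := mem_prodSub.1 hx
    rw [RatRep.mul_apply _ (left_le_prodSub ha) (right_le_prodSub hu),
      hs.eq_self_of_normal right_le_prodSub hN (fun x hx u hu => ?_) hu, hfix a ha]
    obtain ⟨a, ha, w, hw, rfl⟩ := mem_prodSub.1 hx
    simpa [mul_assoc] using h a ha _ (mul_mem (mul_mem hw hu) (inv_mem hw))
  exact hs.eq_self_of_gen hv fun x hx => by rw [hall x hx, hall g hg]

lemma isUnipotentRadical_idc_nrad (hH : IsClo H) : IsUnipotentRadical H (idc (nrad H)) :=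
  isUnipotentRadical_iff.2 ⟨idc_le.trans nrad_le, CC.idc (clo_nrad hH),
    fun _ hg => isUnip_of_mem_nrad (idc_le hg),
    fun _ hh _ hg => conj_mem_idc (fun _ hx => conj_mem_nrad hh hx) hg,
    fun _ hV hc hu hn => le_idc hc.2 fun _ hg =>
      ⟨hV hg, fun _ _ _ _ hs => hs.eq_self_of_normal hV hu hn hg⟩⟩

lemma eq_bot_of_le_borel (hG : IsConnectedReductive G) (h : Reg G ν) (hJ : CC J)
    (hu : ∀ g ∈ J, IsUnip g) (hJG : J ≤ G) (hJB : ∀ B, IsBorel G B → ν.In B → J ≤ B) : J = ⊥ := by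
  have hGc : CC G := ⟨zclosed_iff.1 hG.1, zconnected_iff.1 hG.2.1⟩
  rw [eq_bot_iff, ← hG.2.2 _ (isUnipotentRadical_idc_nrad hGc.1)]
  exact le_idc hJ.2 fun _ hg => ⟨hJG hg, fun _ _ _ _ hs =>
    hs.eq_self_of_le_borel hGc h hJ hu hJB hg⟩

lemma IsBorel.le_of_normal (hB : IsBorel H B) (hH : CC H) (hJ : IsIrr J)
    (hJH : J ≤ H) (hu : ∀ g ∈ J, IsUnip g) (hn : ∀ h ∈ H, ∀ g ∈ J, h * g * h⁻¹ ∈ J) : J ≤ B := by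
  obtain ⟨g, hg, h⟩ := hB.exists_cj_le hH.1 hH.2 hJH hJ (isSolvable_of_isUnip hu)
  refine le_trans (fun x hx => mem_cj.2 ?_) h
  simpa using hn _ (inv_mem hg) x hx

lemma Cochar.exists_mul_mem_C (hN : ∀ g ∈ N, IsUnip g) (hκ : ∀ t, ∀ g ∈ N, κ t * g * (κ t)⁻¹ ∈ N)
    {x : GLn n k} (h : ∀ t, x * κ t * x⁻¹ * (κ t)⁻¹ ∈ N) : ∃ j ∈ N, j * x ∈ κ.C := by
  obtain ⟨j, hj, e⟩ := Cochar.exists_conj_eq (ν' := κ.conj x) hN hκ h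
  rw [← Cochar.conj_mul] at e
  refine ⟨j, hj, mem_C.2 fun t => ?_⟩
  have : j * x * κ t * (j * x)⁻¹ = κ t := by rw [← conj_apply, e]
  nth_rw 1 [← this]
  group

end

lemma Cochar.comm_mem {κ : Cochar n k} {P U : Subgroup (GLn n k)} (hκ : κ.In P)
    (hn : ∀ p ∈ P, ∀ u ∈ U, p * u * p⁻¹ ∈ U)
    {c u : GLn n k} (hc : c ∈ κ.C) (hcP : c ∈ P) (hu : u ∈ U) (t : kˣ) :
    c * u * κ t * (c * u)⁻¹ * (κ t)⁻¹ ∈ U := by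
  have h := hn c hcP _ (mul_mem hu (hn _ (hκ t) _ (inv_mem hu)))
  have e : κ t * c⁻¹ = c⁻¹ * κ t := mem_C.1 (inv_mem hc) t
  have e' : c⁻¹ * (κ t)⁻¹ = (κ t)⁻¹ * c⁻¹ := by
    rw [← mul_inv_rev, ← mul_inv_rev, mem_C.1 hc t]
  simpa only [mul_inv_rev, mul_assoc, e'] using h

/-- Lusztig 1.1: `P^Q = (P ∩ Q) U_P` is a parabolic subgroup of `G`, with
unipotent radical `U_{P^Q} = U_P (P ∩ U_Q)`. -/
theorem statement17 (G P Q UP UQ : Subgroup (GLn n k))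
    (hG : IsConnectedReductive G)
    (hP : IsParabolic G P) (hQ : IsParabolic G Q)
    (hUP : IsUnipotentRadical P UP) (hUQ : IsUnipotentRadical Q UQ) :
    ∃ R : Subgroup (GLn n k),
      (R : Set (GLn n k)) = ((P ⊓ Q : Subgroup (GLn n k)) : Set (GLn n k)) *
        (UP : Set (GLn n k)) ∧
      IsParabolic G R ∧
      ∃ UR : Subgroup (GLn n k), IsUnipotentRadical R UR ∧
        (UR : Set (GLn n k)) = (UP : Set (GLn n k)) *
          ((P : Set (GLn n k)) ∩ (UQ : Set (GLn n k))) := by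
  have hGc : CC G := ⟨zclosed_iff.1 hG.1, zconnected_iff.1 hG.2.1⟩
  obtain ⟨hPG, hPc, B, hB, hBP⟩ := isParabolic_iff.1 hP
  obtain ⟨hQG, -, C, hC, hCQ⟩ := isParabolic_iff.1 hQ
  obtain ⟨hUPP, hUPc, hUPu, hUPn, -⟩ := isUnipotentRadical_iff.1 hUP
  obtain ⟨hUQQ, hUQc, hUQu, hUQn, -⟩ := isUnipotentRadical_iff.1 hUQ
  -- Levi subgroups containing a common maximal torus
  obtain ⟨ν, hν, hνB, hνC⟩ := exists_reg_common hGc hB hC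
  obtain ⟨ν₁, h₁, e₁, hB₁⟩ := hν.exists_P_le hGc hB hνB
  obtain ⟨ν₂, h₂, e₂, hC₂⟩ := hν.exists_P_le hGc hC hνC
  obtain ⟨l, hl, hLP, hPl⟩ := exists_levi hGc hP hUP h₁ (hB₁.trans hBP)
  obtain ⟨m, hm, hMQ, hQm⟩ := exists_levi hGc hQ hUQ h₂ (hC₂.trans hCQ)
  rw [X_congr e₁] at hl
  rw [X_congr e₂] at hm
  have hTB : G ⊓ ν.C ≤ B := by rw [← e₁]; exact (inf_le_inf_left _ C_le_P).trans hB₁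
  have hTC : G ⊓ ν.C ≤ C := by rw [← e₂]; exact (inf_le_inf_left _ C_le_P).trans hC₂
  have hlB : l.In B := fun t => hTB ⟨hl.1 t, hl.2 t⟩
  have hlP : l.In P := hlB.mono hBP
  have hlQ : l.In Q := fun t => hCQ (hTC ⟨hl.1 t, hl.2 t⟩)
  have hmQ : m.In Q := fun t => hCQ (hTC ⟨hm.1 t, hm.2 t⟩)
  have hml := hν.comm hl hm
  obtain ⟨N₀, -, hN₀⟩ := exists_join_C hml
  have hκl := (hN₀ N₀ le_rfl).trans inf_le_left
  have hκm := (hN₀ N₀ le_rfl).trans inf_le_right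
  have hlmκ := le_join_C hml N₀
  have hκ : join hml N₀ ∈ X G ν := hν.join_mem hl hm N₀
  set κ := join hml N₀
  have hK : CC (G ⊓ κ.C) := cc_C hGc hκ.1
  have hKP : G ⊓ κ.C ≤ P := (inf_le_inf_left _ hκl).trans hLP
  have hKQ : G ⊓ κ.C ≤ Q := (inf_le_inf_left _ hκm).trans hMQ
  have hA : CC (UQ ⊓ l.C) := cc_C_of_norm hUQc fun t => hUQn _ (hlQ t)
  have hAP : UQ ⊓ l.C ≤ P := fun a ha => hLP ⟨hQG (hUQQ ha.1), ha.2⟩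
  have hUn : ∀ a ∈ UQ ⊓ l.C, ∀ u ∈ UP, a * u * a⁻¹ ∈ UP := fun a ha => hUPn a (hAP ha)
  have hUc : CC (prodSub _ UP hUn) := hA.prodSub hUPc
  have hUu : ∀ g ∈ prodSub _ UP hUn, IsUnip g := fun g =>
    isUnip_of_mem_prodSub (A := UQ ⊓ l.C) (fun a ha => hUQu a ha.1) hUPu
  have hcl : ∀ x ∈ P, ∀ t, x * l t * x⁻¹ * (l t)⁻¹ ∈ UP := fun x hx t => by
    obtain ⟨c, hc, u, hu, rfl⟩ := hPl x hx
    exact comm_mem hlP hUPn hc.2 (hLP hc) hu t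
  have hcm : ∀ x ∈ Q, ∀ t, x * m t * x⁻¹ * (m t)⁻¹ ∈ UQ := fun x hx t => by
    obtain ⟨c, hc, u, hu, rfl⟩ := hQm x hx
    exact comm_mem hmQ hUQn hc.2 (hMQ hc) hu t
  have hUPU : UP ≤ prodSub _ UP hUn := right_le_prodSub
  have hAU : UQ ⊓ l.C ≤ prodSub _ UP hUn := left_le_prodSub
  have hUeq : (prodSub _ UP hUn : Set (GLn n k)) = (UP : Set (GLn n k)) * ((P : Set (GLn n k)) ∩ UQ) := by
    ext x
    constructor
    · rintro ⟨a, ha, u, hu, rfl⟩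
      exact ⟨a * u * a⁻¹, hUn a ha u hu, a, ⟨hAP ha, ha.1⟩, by simp⟩
    · rintro ⟨u, hu, x, ⟨hxP, hxQ⟩, rfl⟩
      obtain ⟨j, hj, hjx⟩ := exists_mul_mem_C (N := UP ⊓ UQ) (κ := l) (x := x)
        (fun g hg => hUPu g hg.1) (fun t g hg => ⟨hUPn _ (hlP t) g hg.1, hUQn _ (hlQ t) g hg.2⟩)
        fun t => ⟨hcl x hxP t, by
          simpa [mul_assoc] using mul_mem hxQ (hUQn _ (hlQ t) _ (inv_mem hxQ))⟩
      have := mul_mem (mul_mem (hUPU hu) (inv_mem (hUPU hj.1))) (hAU ⟨mul_mem hj.2 hxQ, hjx⟩)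
      simpa [mul_assoc] using this
  set U := prodSub _ UP hUn
  have hKU : ∀ c ∈ G ⊓ κ.C, ∀ u ∈ U, c * u * c⁻¹ ∈ U := fun c hc u hu =>
    conj_mem_prodSub (fun a ha => Subgroup.mem_inf.2 ⟨hUQn c (hKQ hc) a ha.1,
      mul_mem (mul_mem (hκl hc.2) ha.2) (inv_mem (hκl hc.2))⟩) (hUPn c (hKP hc)) hu
  have hRc : CC (prodSub _ U hKU) := hK.prodSub hUc
  have hUR : U ≤ prodSub _ U hKU := right_le_prodSub
  have hKR : G ⊓ κ.C ≤ prodSub _ U hKU := left_le_prodSub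
  have hRU : ∀ r ∈ prodSub _ U hKU, ∀ u ∈ U, r * u * r⁻¹ ∈ U := fun r hr u hu => by
    obtain ⟨c, hc, w, hw, rfl⟩ := mem_prodSub.1 hr
    simpa [mul_assoc] using hKU c hc _ (mul_mem (mul_mem hw hu) (inv_mem hw))
  have hPQR : P ⊓ Q ≤ prodSub _ U hKU := fun x hx => by
    obtain ⟨j, hj, hjx⟩ := exists_mul_mem_C (N := UP ⊓ Q) (κ := l) (x := x)
      (fun g hg => hUPu g hg.1)
      (fun t g hg => Subgroup.mem_inf.2 ⟨hUPn _ (hlP t) g hg.1,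
        mul_mem (mul_mem (hlQ t) hg.2) (inv_mem (hlQ t))⟩)
      fun t => Subgroup.mem_inf.2 ⟨hcl x hx.1 t,
        mul_mem (mul_mem (mul_mem hx.2 (hlQ t)) (inv_mem hx.2)) (inv_mem (hlQ t))⟩
    have hyQ : j * x ∈ Q := mul_mem hj.2 hx.2
    obtain ⟨i, hi, hiy⟩ := exists_mul_mem_C (N := UQ ⊓ l.C) (κ := m) (x := j * x)
      (fun g hg => hUQu g hg.1)
      (fun t g hg => Subgroup.mem_inf.2 ⟨hUQn _ (hmQ t) g hg.1,
        mul_mem (mul_mem (hml t) hg.2) (inv_mem (hml t))⟩)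
      fun t => Subgroup.mem_inf.2 ⟨hcm _ hyQ t,
        mul_mem (mul_mem (mul_mem hjx (hml t)) (inv_mem hjx)) (inv_mem (hml t))⟩
    have hz : i * (j * x) ∈ G ⊓ κ.C :=
      ⟨hQG (mul_mem (hUQQ hi.1) hyQ), hlmκ ⟨mul_mem hi.2 hjx, hiy⟩⟩
    have := mul_mem (hUR (hUPU (inv_mem hj.1))) (mul_mem (hUR (hAU (inv_mem hi))) (hKR hz))
    simpa [mul_assoc] using this
  set R := prodSub _ U hKU
  have hRG : R ≤ G := by
    rintro _ ⟨c, hc, _, ⟨a, ha, u, hu, rfl⟩, rfl⟩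
    exact mul_mem hc.1 (mul_mem (hPG (hAP ha)) (hPG (hUPP hu)))
  refine ⟨R, ?_, isParabolic_iff.2 ⟨hRG, hRc.1, ?_⟩, U, isUnipotentRadical_iff.2
    ⟨hUR, hUc, hUu, hRU, fun V hVR hVc hVu hVn v hv => ?_⟩, hUeq⟩
  · ext x
    constructor
    · rintro ⟨c, hc, _, ⟨a, ha, u, hu, rfl⟩, rfl⟩
      exact ⟨c * a, mul_mem (Subgroup.mem_inf.2 ⟨hKP hc, hKQ hc⟩) ⟨hAP ha, hUQQ ha.1⟩, u, hu,
        mul_assoc c a u⟩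
    · rintro ⟨x, hx, u, hu, rfl⟩
      exact mul_mem (hPQR hx) (hUR (hUPU hu))
  · obtain ⟨C', hC', hCC'⟩ := exists_borel_C hGc h₂ hC hC₂ (l := l) (by rwa [X_congr e₂])
    have hBl := cc_C hB.cc hlB
    have hGl := cc_C hGc hl.1
    obtain ⟨g, hg, hgB⟩ := hC'.exists_cj_le hGl.1 hGl.2 (inf_le_inf_right _ hB.1) hBl.2
      (solvable_mono inf_le_left hB.solvable)
    have hUB : UP ≤ B :=
      (hB.mono hPG hBP).le_of_normal ⟨hPc, hP.irr hGc⟩ hUPc.2 hUPP hUPu hUPn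
    refine ⟨cj g B, isBorel_cj hB hg.1, fun x hx => ?_⟩
    have hb := mem_cj.1 hx
    obtain ⟨c, hc, u, hu, e⟩ := hPl _ (hBP hb)
    have hcB : c ∈ B ⊓ l.C := ⟨by
      have := mul_mem hb (inv_mem (hUB hu))
      rwa [e, mul_inv_cancel_right] at this, hc.2⟩
    have h1 : g * c * g⁻¹ ∈ C' := hgB (conj_mem_cj hcB)
    have h2 : g * c * g⁻¹ ∈ P ⊓ Q := ⟨hLP (hC'.1 h1), hCQ (hCC' h1)⟩
    have := mul_mem (hPQR h2) (hUR (hUPU (hUPn g (hLP hg) u hu)))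
    have e2 : x = g * (c * u) * g⁻¹ := by rw [← e]; simp [mul_assoc]
    rw [e2]
    simpa [mul_assoc] using this
  · have hVU : ∀ a ∈ V, ∀ u ∈ U, a * u * a⁻¹ ∈ U := fun a ha => hRU a (hVR ha)
    have hWc : CC (prodSub V U hVU) := hVc.prodSub hUc
    have hVW : V ≤ prodSub V U hVU := left_le_prodSub
    have hUW : U ≤ prodSub V U hVU := right_le_prodSub
    have hWn : ∀ r ∈ R, ∀ w ∈ prodSub V U hVU, r * w * r⁻¹ ∈ prodSub V U hVU :=
      fun r hr w hw => conj_mem_prodSub (hVn r hr) (hRU r hr) hw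
    have hWu : ∀ g ∈ prodSub V U hVU, IsUnip g := fun g => isUnip_of_mem_prodSub hVu hUu
    have hWR : prodSub V U hVU ≤ R := by
      rintro _ ⟨a, ha, u, hu, rfl⟩
      exact mul_mem (hVR ha) (hUR hu)
    set W := prodSub V U hVU
    have hκR : κ.In R := fun t => hKR ⟨hκ.1 t, κ.in_C t⟩
    have hN : CC (W ⊓ κ.C) := cc_C_of_norm hWc fun t => hWn _ (hκR t)
    have hbot : W ⊓ κ.C = ⊥ := by
      refine eq_bot_of_le_borel hG hν hN (fun g hg => hWu g hg.1)
        (inf_le_left.trans (hWR.trans hRG)) fun B₀ hB₀ hνB₀ => ?_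
      obtain ⟨ν₃, h₃, e₃, hB₃⟩ := hν.exists_P_le hGc hB₀ hνB₀
      obtain ⟨B', hB', hBB'⟩ := exists_borel_C hGc h₃ hB₀ hB₃ (l := κ) (by rwa [X_congr e₃])
      exact (hB'.le_of_normal hK hN.2 (inf_le_inf_right _ (hWR.trans hRG))
        (fun g hg => hWu g hg.1) fun h hh g hg => Subgroup.mem_inf.2 ⟨hWn h (hKR hh) g hg.1,
          mul_mem (mul_mem hh.2 hg.2) (inv_mem hh.2)⟩).trans hBB'
    obtain ⟨c, hc, u, hu, rfl⟩ := mem_prodSub.1 (hVR hv)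
    have hcW : c ∈ W ⊓ κ.C := ⟨by
      have := mul_mem (hVW hv) (inv_mem (hUW hu))
      rwa [mul_inv_cancel_right] at this, hc.2⟩
    rw [hbot, Subgroup.mem_bot] at hcW
    rwa [hcW, one_mul]

end Stmt17
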